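/- Assume 0 ∈ Σf. Then the following two conditions are equivalent. (I) f satisfies central isolation (0 is an isolated point of {z ∈ U : z_0 = ⋯ = z_{s−1} = 0 and ∂f/∂z_j(z) = 0 for all s ≤ j ≤ n}) and f satisfies the Jacobian set equality near 0 (there is an open neighborhood W₀ ⊆ U of 0 with Σf ∩ W₀ = {z ∈ W₀ : ∂f/∂z_j(z) = 0 for all s ≤ j ≤ n}). (II) Σf is a graph over ℂ^s near 0 (there exist an open neighborhood W ⊆ U of 0, a connected open set V' ⊆ ℂ^s containing 0, and a complex analytic map φ : V' → ℂ^{n+1−s} with φ(0) = 0 such that Σf ∩ W = {(a, φ(a)) : a ∈ V'}) and f satisfies the a_f condition near 0 (there is an open neighborhood W₁ ⊆ U of 0 such that for every p ∈ Σf ∩ W₁, every sequence (q_k) in W₁ ∖ Σf with q_k → p, and every continuous ℂ-linear functional η on ℂ^{n+1} with Df(q_k)/‖Df(q_k)‖ → η in operator norm, η vanishes on the tangent cone over ℝ of Σf at p). -/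

import Mathlib

/-- ℂ^{n+1} identified with ℂ^s × ℂ^{n+1-s}. -/
abbrev Csp (n s : ℕ) : Type := (Fin s → ℂ) × (Fin (n + 1 - s) → ℂ)

/-- The critical locus Σf = {z ∈ U : Df(z) = 0}. -/
def SigmaF (n s : ℕ) (f : Csp n s → ℂ) (U : Set (Csp n s)) : Set (Csp n s) :=
  {z ∈ U | fderiv ℂ f z = 0}

/-- The partial derivatives ∂f/∂z_j for s ≤ j ≤ n all vanish at z. -/
def PartialsVanish (n s : ℕ) (f : Csp n s → ℂ) (z : Csp n s) : Prop :=
  ∀ j : Fin (n + 1 - s), fderiv ℂ f z (0, Pi.single j 1) = 0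

/-- Central isolation: 0 is an isolated point of
{z ∈ U : z' = 0 and ∂f/∂z_j(z) = 0 for all s ≤ j ≤ n}. -/
def CentralIsolation (n s : ℕ) (f : Csp n s → ℂ) (U : Set (Csp n s)) : Prop :=
  ∃ W : Set (Csp n s), IsOpen W ∧ (0 : Csp n s) ∈ W ∧
    ∀ z ∈ U ∩ W, z.1 = 0 → PartialsVanish n s f z → z = 0

/-- Jacobian set equality near 0: on some open neighborhood W' ⊆ U of 0,
Σf ∩ W' = {z ∈ W' : ∂f/∂z_j(z) = 0 for all s ≤ j ≤ n}. -/
def JacobianEq (n s : ℕ) (f : Csp n s → ℂ) (U : Set (Csp n s)) : Prop :=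
  ∃ W' : Set (Csp n s), IsOpen W' ∧ (0 : Csp n s) ∈ W' ∧ W' ⊆ U ∧
    SigmaF n s f U ∩ W' = {z ∈ W' | PartialsVanish n s f z}

/-- Σf is, near 0, a graph over a connected open subset of ℂ^s via an analytic map
φ with φ(0) = 0. -/
def GraphForm (n s : ℕ) (f : Csp n s → ℂ) (U : Set (Csp n s)) : Prop :=
  ∃ (W : Set (Csp n s)) (V' : Set (Fin s → ℂ))
    (φ : (Fin s → ℂ) → (Fin (n + 1 - s) → ℂ)),
    IsOpen W ∧ (0 : Csp n s) ∈ W ∧ W ⊆ U ∧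
    IsOpen V' ∧ IsConnected V' ∧ (0 : Fin s → ℂ) ∈ V' ∧
    AnalyticOnNhd ℂ φ V' ∧ φ 0 = 0 ∧
    SigmaF n s f U ∩ W = (fun a => (a, φ a)) '' V'

/-- The a_f (Thom) condition near 0: on an open neighborhood W₁ ⊆ U of 0, every
limit η of normalized differentials Df(q_k)/‖Df(q_k)‖ along non-critical points
q_k → p ∈ Σf kills the tangent cone (over ℝ) of Σf at p. -/
def AfCondition (n s : ℕ) (f : Csp n s → ℂ) (U : Set (Csp n s)) : Prop :=
  ∃ W₁ : Set (Csp n s), IsOpen W₁ ∧ (0 : Csp n s) ∈ W₁ ∧ W₁ ⊆ U ∧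
    ∀ p ∈ SigmaF n s f U ∩ W₁, ∀ q : ℕ → Csp n s,
      (∀ k, q k ∈ W₁ ∧ q k ∉ SigmaF n s f U) →
      Filter.Tendsto q Filter.atTop (nhds p) →
      ∀ η : Csp n s →L[ℂ] ℂ,
        Filter.Tendsto (fun k => (‖fderiv ℂ f (q k)‖)⁻¹ • fderiv ℂ f (q k))
          Filter.atTop (nhds η) →
        ∀ v ∈ tangentConeAt ℝ (SigmaF n s f U) p, η v = 0

open MeasureTheory Filter Topology Set
open Metric hiding tendsto_nhds eventually_nhds_iff mem_nhds_iff
open scoped ContDiff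
open ContinuousLinearMap (fst snd inl inr inr_apply comp_apply coe_restrictScalars')
open Complex (I normSq ofRealCLM conjCLE reCLM imCLM norm_real normSq_eq_norm_sq ofReal_mul real_smul
  continuous_ofReal ofReal_re normSq_apply ofReal_pow normSq_nonneg continuous_normSq I_mul_I)
open Real (smoothTransition)
open Function (uncurry)

/-- The complex coordinate space `ℂ ^ m`. -/
local notation:max "Vec" m:max => Fin m → ℂ

/-- The coordinate functional `x ↦ x k` on `ℂ ^ m`, linear over `R`. -/
local notation:max "coordL" R:max k:max => (ContinuousLinearMap.proj k : (Fin _ → ℂ) →L[R] ℂ)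

open scoped Matrix

section Determinants

variable {ι : Type*} [Fintype ι] [DecidableEq ι]

theorem det_updateCol_updateCol_swap {R : Type*} [CommRing R] (A : Matrix ι ι R)
    (u d : ι → R) {k l : ι} (h : k ≠ l) :
    ((A.updateCol l u).updateCol k d).det = -((A.updateCol k u).updateCol l d).det := by
  have := Matrix.det_permute' (Equiv.swap k l) ((A.updateCol k u).updateCol l d)
  rw [Equiv.Perm.sign_swap h] at this
  simp only [Units.val_neg, Units.val_one, Int.cast_neg, Int.cast_one, neg_mul, one_mul] at this
  rw [← this]
  congr 1
  ext i j
  simp only [Matrix.submatrix_apply, id, Matrix.updateCol_apply, Equiv.swap_apply_def]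
  by_cases h1 : j = k
  · simp [h1]
  · by_cases h2 : j = l
    · simp [h2, h, h.symm]
    · simp [h1, h2]

theorem sum_det_updateCol_updateCol_eq_zero {R : Type*} [CommRing R] (A : Matrix ι ι R)
    (u : ι → R) (D : ι → ι → ι → R) (hD : ∀ l k, D l k = D k l) :
    ∑ l, ∑ k, (if k = l then 0 else ((A.updateCol l u).updateCol k (D l k)).det) = 0 := by
  rw [← Finset.sum_product']
  refine Finset.sum_involution (fun a _ => (a.2, a.1)) ?_ ?_ ?_ ?_
  · rintro ⟨l, k⟩ -
    by_cases h : k = l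
    · simp [h]
    · have h' : ¬ l = k := fun e => h e.symm
      simp only [h, h', if_false]
      rw [det_updateCol_updateCol_swap _ _ _ h, hD l k]
      simp
  · rintro ⟨l, k⟩ - hne heq
    simp only [Prod.mk.injEq] at heq
    simp [heq.1] at hne
  · simp
  · simp

theorem hasFDerivAt_matrix_det {𝕜 E 𝔸 : Type*} [NontriviallyNormedField 𝕜]
    [NormedAddCommGroup E] [NormedSpace 𝕜 E] [NormedCommRing 𝔸] [NormedAlgebra 𝕜 𝔸]
    {A : E → Matrix ι ι 𝔸} {A' : ι → ι → E →L[𝕜] 𝔸} {x : E}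
    (h : ∀ i j, HasFDerivAt (fun y => A y i j) (A' i j) x) :
    ∃ L : E →L[𝕜] 𝔸, HasFDerivAt (fun y => (A y).det) L x ∧
      ∀ v, L v = ∑ k, ((A x).updateCol k (fun i => A' i k v)).det := by
  have h1 : HasFDerivAt (fun y => (A y).det)
      (∑ σ : Equiv.Perm ι, Equiv.Perm.sign σ •
        ∑ k, (∏ j ∈ Finset.univ.erase k, A x (σ j) j) • A' (σ k) k) x := by
    simp only [Matrix.det_apply]
    refine HasFDerivAt.fun_sum fun σ _ => ?_
    have h2 := HasFDerivAt.finsetProd (u := Finset.univ) (g := fun j y => A y (σ j) j)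
      (g' := fun j => A' (σ j) j) (x := x) fun j _ => h (σ j) j
    rcases Int.units_eq_one_or (Equiv.Perm.sign σ) with hs | hs
    · simpa only [hs, one_smul] using h2
    · simpa only [hs, Units.neg_smul, one_smul] using h2.fun_neg
  refine ⟨_, h1, fun v => ?_⟩
  have h3 : ∀ k, ((A x).updateCol k (fun i => A' i k v)).det =
      ∑ σ : Equiv.Perm ι, Equiv.Perm.sign σ •
        ((∏ j ∈ Finset.univ.erase k, A x (σ j) j) * A' (σ k) k v) := by
    intro k
    rw [Matrix.det_apply]
    refine Finset.sum_congr rfl fun σ _ => ?_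
    congr 1
    rw [← Finset.prod_erase_mul _ _ (Finset.mem_univ k)]
    congr 1
    · refine Finset.prod_congr rfl fun j hj => ?_
      simp [Finset.ne_of_mem_erase hj]
    · simp
  simp only [h3]
  rw [Finset.sum_comm]
  simp only [sum_apply]
  refine Finset.sum_congr rfl fun σ _ => ?_
  rw [← Finset.smul_sum]
  rcases Int.units_eq_one_or (Equiv.Perm.sign σ) with hs | hs <;>
    simp [hs, sum_apply]

/-- The Piola identity: columns of the cofactor matrix of a Jacobian are divergence free. -/
theorem sum_fderiv_det_updateCol {𝕜 : Type*} [NontriviallyNormedField 𝕜] [NormedAlgebra 𝕜 ℂ]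
    {A : (ι → 𝕜) → Matrix ι ι ℂ} {A' : ι → ι → (ι → 𝕜) →L[𝕜] ℂ} {x : ι → 𝕜}
    (h : ∀ i j, HasFDerivAt (fun y => A y i j) (A' i j) x)
    (hsymm : ∀ i k l, A' i k (Pi.single l 1) = A' i l (Pi.single k 1))
    {u : (ι → 𝕜) → ι → ℂ} {u' : ι → (ι → 𝕜) →L[𝕜] ℂ}
    (hu : ∀ i, HasFDerivAt (fun y => u y i) (u' i) x) :
    ∑ l, fderiv 𝕜 (fun y => ((A y).updateCol l (u y)).det) x (Pi.single l 1) =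
      ∑ l, ((A x).updateCol l (fun i => u' i (Pi.single l 1))).det := by
  have h1 : ∀ l, fderiv 𝕜 (fun y => ((A y).updateCol l (u y)).det) x (Pi.single l 1) =
      ((A x).updateCol l (fun i => u' i (Pi.single l 1))).det +
      ∑ k, if k = l then 0 else
        (((A x).updateCol l (u x)).updateCol k (fun i => A' i k (Pi.single l 1))).det := by
    intro l
    obtain ⟨L, hL, hL'⟩ := hasFDerivAt_matrix_det (A := fun y => (A y).updateCol l (u y))
      (A' := fun i j => if j = l then u' i else A' i j) (x := x) (by
        intro i j
        by_cases hj : j = l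
        · simpa [Matrix.updateCol_apply, hj] using hu i
        · simpa [Matrix.updateCol_apply, hj] using h i j)
    rw [hL.fderiv, hL', ← Finset.add_sum_erase _ _ (Finset.mem_univ l)]
    congr 1
    · simp [Matrix.updateCol_idem]
    · rw [← Finset.add_sum_erase (a := l) _ (fun k => if k = l then (0 : ℂ) else _)
        (Finset.mem_univ l)]
      simp only [if_true, zero_add]
      refine Finset.sum_congr rfl fun k hk => ?_
      have := Finset.ne_of_mem_erase hk
      simp [this]
  simp only [h1, Finset.sum_add_distrib]
  rw [sum_det_updateCol_updateCol_eq_zero (A x) (u x)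
    (fun l k i => A' i k (Pi.single l 1)) (fun l k => by ext i; exact hsymm i k l), add_zero]

end Determinants

section ParametricIntegrals

set_option linter.unusedSectionVars false

variable {𝕜 E X V : Type*} [RCLike 𝕜] [NormedAddCommGroup E] [NormedSpace 𝕜 E]
  [TopologicalSpace X] [MeasurableSpace X] [OpensMeasurableSpace X] [T2Space X]
  {μ : Measure X} [IsFiniteMeasureOnCompacts μ]
  [NormedAddCommGroup V] [NormedSpace ℝ V] [NormedSpace 𝕜 V] [SecondCountableTopology X]

theorem eventually_bound_of_continuousOn {E' V' : Type*} [TopologicalSpace E']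
    [NormedAddCommGroup V'] {u : E' → X → V'} {O : Set (E' × X)} (hO : IsOpen O) {K : Set X}
    (hK : IsCompact K) {s₀ : E'} (hKO : ∀ ξ ∈ K, (s₀, ξ) ∈ O)
    (hu : ContinuousOn (uncurry u) O) :
    ∃ C : ℝ, ∀ᶠ s in 𝓝 s₀, ∀ ξ ∈ K, (s, ξ) ∈ O ∧ ‖u s ξ‖ ≤ C := by
  have h1 : ContinuousOn (fun ξ => ‖u s₀ ξ‖) K :=
    (hu.comp (f := fun ξ => (s₀, ξ)) (by fun_prop) (fun ξ hξ => hKO ξ hξ)).norm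
  obtain ⟨C, hC⟩ := hK.bddAbove_image h1
  refine ⟨C + 1, hK.eventually_forall_of_forall_eventually fun ξ hξ => ?_⟩
  have h2 : ContinuousAt (fun p : E' × X => ‖u p.1 p.2‖) (s₀, ξ) :=
    (hu.continuousAt (hO.mem_nhds (hKO ξ hξ))).norm
  have h3 : ‖u s₀ ξ‖ < C + 1 := lt_of_le_of_lt (hC (mem_image_of_mem _ hξ)) (lt_add_one C)
  filter_upwards [hO.mem_nhds (hKO ξ hξ), h2.eventually (gt_mem_nhds h3)] with p hp hp'
  exact ⟨hp, hp'.le⟩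

theorem aestronglyMeasurable_slice {E' V' : Type*} [TopologicalSpace E'] [NormedAddCommGroup V']
    {u : E' → X → V'} {O : Set (E' × X)} {K : Set X} (hK : IsCompact K) {s : E'}
    (hKO : ∀ ξ ∈ K, (s, ξ) ∈ O) (hu : ContinuousOn (uncurry u) O) :
    AEStronglyMeasurable (u s) (μ.restrict K) :=
  ContinuousOn.aestronglyMeasurable_of_isCompact
    (hu.comp (f := fun ξ => (s, ξ)) (by fun_prop) (fun ξ hξ => hKO ξ hξ)) hK hK.measurableSet

theorem continuousAt_setIntegral_param {E' : Type*} [TopologicalSpace E'] [FirstCountableTopology E']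
    {u : E' → X → V} {O : Set (E' × X)} (hO : IsOpen O) {K : Set X}
    (hK : IsCompact K) {s₀ : E'} (hKO : ∀ ξ ∈ K, (s₀, ξ) ∈ O)
    (hu : ContinuousOn (uncurry u) O) :
    ContinuousAt (fun s => ∫ ξ in K, u s ξ ∂μ) s₀ := by
  obtain ⟨C, hC⟩ := eventually_bound_of_continuousOn hO hK hKO hu
  refine continuousAt_of_dominated (bound := fun _ => C) ?_ ?_ ?_ ?_
  · filter_upwards [hC] with s hs
    exact aestronglyMeasurable_slice hK (fun ξ hξ => (hs ξ hξ).1) hu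
  · filter_upwards [hC] with s hs
    exact (ae_restrict_iff' hK.measurableSet).2 (.of_forall fun ξ hξ => (hs ξ hξ).2)
  · exact integrableOn_const hK.measure_lt_top.ne
  · refine (ae_restrict_iff' hK.measurableSet).2 (.of_forall fun ξ hξ => ?_)
    exact (hu.continuousAt (hO.mem_nhds (hKO ξ hξ))).comp (f := fun s => (s, ξ)) (by fun_prop)

theorem hasFDerivAt_setIntegral_param {u : E → X → V} {u' : E → X → E →L[𝕜] V}
    {O : Set (E × X)} (hO : IsOpen O) {K : Set X} (hK : IsCompact K) {s₀ : E}
    (hKO : ∀ ξ ∈ K, (s₀, ξ) ∈ O) (hu : ContinuousOn (uncurry u) O)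
    (hu' : ContinuousOn (uncurry u') O)
    (hd : ∀ p ∈ O, HasFDerivAt (fun s => u s p.2) (u' p.1 p.2) p.1) :
    HasFDerivAt (fun s => ∫ ξ in K, u s ξ ∂μ) (∫ ξ in K, u' s₀ ξ ∂μ) s₀ := by
  obtain ⟨C, hC⟩ := eventually_bound_of_continuousOn hO hK hKO hu
  obtain ⟨C', hC'⟩ := eventually_bound_of_continuousOn hO hK hKO hu'
  have : IsFiniteMeasure (μ.restrict K) := ⟨by simpa using hK.measure_lt_top⟩
  refine hasFDerivAt_integral_of_dominated_of_fderiv_le (bound := fun _ => C') hC'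
    ?_ ?_ ?_ ?_ ?_ ?_
  · filter_upwards [hC] with s hs
    exact aestronglyMeasurable_slice hK (fun ξ hξ => (hs ξ hξ).1) hu
  · exact Integrable.of_bound (aestronglyMeasurable_slice hK hKO hu) C
      ((ae_restrict_iff' hK.measurableSet).2
        (.of_forall fun ξ hξ => (hC.self_of_nhds ξ hξ).2))
  · exact aestronglyMeasurable_slice hK hKO hu'
  · exact (ae_restrict_iff' hK.measurableSet).2
      (.of_forall fun ξ hξ s hs => (hs ξ hξ).2)
  · exact integrableOn_const hK.measure_lt_top.ne
  · exact (ae_restrict_iff' hK.measurableSet).2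
      (.of_forall fun ξ hξ s hs => hd (s, ξ) (hs ξ hξ).1)

theorem contDiffAt_setIntegral_param {u : E → X → V} {u' : E → X → E →L[𝕜] V}
    {O : Set (E × X)} (hO : IsOpen O) {K : Set X} (hK : IsCompact K) {s₀ : E}
    (hKO : ∀ ξ ∈ K, (s₀, ξ) ∈ O) (hu : ContinuousOn (uncurry u) O)
    (hu' : ContinuousOn (uncurry u') O)
    (hd : ∀ p ∈ O, HasFDerivAt (fun s => u s p.2) (u' p.1 p.2) p.1) :
    ContDiffAt 𝕜 1 (fun s => ∫ ξ in K, u s ξ ∂μ) s₀ := by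
  have hev : ∀ᶠ s in 𝓝 s₀, ∀ ξ ∈ K, (s, ξ) ∈ O :=
    hK.eventually_forall_of_forall_eventually fun ξ hξ => hO.mem_nhds (hKO ξ hξ)
  rw [contDiffAt_one_iff]
  refine ⟨fun s => ∫ ξ in K, u' s ξ ∂μ, _, hev, fun s hs => ?_, fun s hs => ?_⟩
  · exact (continuousAt_setIntegral_param hO hK hs hu').continuousWithinAt
  · exact hasFDerivAt_setIntegral_param hO hK hs hu hu' hd

theorem setIntegral_param_of_contDiffOn {E F V : Type*} [NormedAddCommGroup E] [NormedSpace ℝ E]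
    [NormedAddCommGroup F] [NormedSpace ℝ F] [MeasurableSpace F] [OpensMeasurableSpace F]
    [SecondCountableTopology F] {μ : Measure F} [IsFiniteMeasureOnCompacts μ]
    [NormedAddCommGroup V] [NormedSpace ℝ V] {u : E → F → V}
    {O : Set (E × F)} (hO : IsOpen O) {K : Set F} (hK : IsCompact K) {s₀ : E}
    (hKO : ∀ ξ ∈ K, (s₀, ξ) ∈ O) (hu : ContDiffOn ℝ 1 (uncurry u) O) :
    HasFDerivAt (fun s => ∫ ξ in K, u s ξ ∂μ) (∫ ξ in K, fderiv ℝ (fun s => u s ξ) s₀ ∂μ) s₀ ∧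
      ContDiffAt ℝ 1 (fun s => ∫ ξ in K, u s ξ ∂μ) s₀ := by
  have hd : ∀ p ∈ O, HasFDerivAt (fun s => u s p.2)
      ((fderiv ℝ (uncurry u) p).comp (inl ℝ E F)) p.1 := by
    intro p hp
    have h1 : HasFDerivAt (uncurry u) (fderiv ℝ (uncurry u) p) (p.1, p.2) :=
      ((hu.contDiffAt (hO.mem_nhds hp)).differentiableAt one_ne_zero).hasFDerivAt
    exact HasFDerivAt.comp (g := uncurry u) (f := fun e => (e, p.2)) p.1 h1
      (hasFDerivAt_prodMk_left p.1 p.2)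
  have hc : ContinuousOn (uncurry fun s ξ =>
      (fderiv ℝ (uncurry u) (s, ξ)).comp (inl ℝ E F)) O :=
    ((hu.continuousOn_fderiv_of_isOpen hO le_rfl).clm_comp continuousOn_const)
  refine ⟨?_, contDiffAt_setIntegral_param hO hK hKO hu.continuousOn hc hd⟩
  have h2 := hasFDerivAt_setIntegral_param (μ := μ) hO hK hKO hu.continuousOn hc hd
  convert h2 using 1
  refine setIntegral_congr_fun hK.measurableSet fun ξ hξ => ?_
  exact (hd (s₀, ξ) (hKO ξ hξ)).fderiv

theorem integral_fderiv_eq_zero_of_hasCompactSupport {F : Type*} [NormedAddCommGroup F]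
    [NormedSpace ℝ F] [FiniteDimensional ℝ F] [MeasurableSpace F] [BorelSpace F]
    {ν : Measure F} [ν.IsAddHaarMeasure] {g : F → ℂ} (hg : ContDiff ℝ 1 g)
    (hc : HasCompactSupport g) (v : F) : ∫ x, fderiv ℝ g x v ∂ν = 0 := by
  have h1 : Continuous (fun x => fderiv ℝ g x v) :=
    (hg.continuous_fderiv one_ne_zero).clm_apply continuous_const
  have h2 : HasCompactSupport (fun x => fderiv ℝ g x v) := hc.fderiv_apply (𝕜 := ℝ) v
  have := integral_mul_fderiv_eq_neg_fderiv_mul_of_integrable (μ := ν) (f := fun _ : F => (1 : ℂ))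
    (g := g) (v := v) (by simp) (by simpa using h1.integrable_of_hasCompactSupport h2)
    (by simpa using hg.continuous.integrable_of_hasCompactSupport hc)
    (fun x _ => by fun_prop) (fun x _ => hg.differentiable one_ne_zero x)
  simpa using this

end ParametricIntegrals

section FormIntegral

variable {ι : Type*} [Fintype ι] [DecidableEq ι]

/-- The Jacobian matrix of a map from real to complex coordinates. -/
noncomputable def jac (σ : (ι → ℝ) → ι → ℂ) (ξ : ι → ℝ) : Matrix ι ι ℂ :=
  Matrix.of fun i l => fderiv ℝ σ ξ (Pi.single l 1) i

/-- The integral of the pullback of the form `q dz₁ ∧ ⋯ ∧ dzₙ` by `σ`. -/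
noncomputable def formIntegral (q : (ι → ℂ) → ℂ) (σ : (ι → ℝ) → ι → ℂ) : ℂ :=
  ∫ ξ, q (σ ξ) * (jac σ ξ).det

theorem hasFDerivAt_jac {σ : (ι → ℝ) → ι → ℂ} (hσ : ContDiff ℝ 2 σ) (ξ : ι → ℝ) (i l : ι) :
    HasFDerivAt (fun y => jac σ y i l)
      ((ContinuousLinearMap.proj (R := ℝ) (φ := fun _ : ι => ℂ) i).comp
        ((fderiv ℝ (fderiv ℝ σ) ξ).flip (Pi.single l 1))) ξ := by
  have h1 : DifferentiableAt ℝ (fderiv ℝ σ) ξ :=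
    (hσ.fderiv_right (m := 1) (by norm_num)).differentiable one_ne_zero ξ
  have h2 := h1.hasFDerivAt.clm_apply (hasFDerivAt_const (Pi.single l (1 : ℝ)) ξ)
  have h3 := (ContinuousLinearMap.proj (R := ℝ) (φ := fun _ : ι => ℂ) i).hasFDerivAt.comp ξ h2
  refine HasFDerivAt.congr_fderiv (f := fun y => jac σ y i l) h3 ?_
  ext v
  simp

theorem jac_add_smul {σ w : (ι → ℝ) → ι → ℂ} (hσ : ContDiff ℝ 2 σ) (hw : ContDiff ℝ 2 w)
    (s : ℝ) (ξ : ι → ℝ) : jac (fun ξ => σ ξ + s • w ξ) ξ = jac σ ξ + s • jac w ξ := by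
  have h1 := (hσ.differentiable two_ne_zero ξ).hasFDerivAt
  have h2 := (hw.differentiable two_ne_zero ξ).hasFDerivAt
  ext i l
  simp only [jac, Matrix.of_apply, Matrix.add_apply, Matrix.smul_apply]
  rw [(h1.fun_add (h2.fun_const_smul s)).fderiv]
  simp

theorem contDiff_jac {σ : (ι → ℝ) → ι → ℂ} (hσ : ContDiff ℝ 2 σ) (i l : ι) :
    ContDiff ℝ 1 (fun ξ => jac σ ξ i l) := by
  have h1 : ContDiff ℝ 1 (fderiv ℝ σ) := hσ.fderiv_right (by norm_num)
  have h2 : ContDiff ℝ 1 (fun ξ => fderiv ℝ σ ξ (Pi.single l 1)) := h1.clm_apply contDiff_const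
  exact contDiff_pi.1 h2 i

theorem contDiff_matrix_det {E : Type*} [NormedAddCommGroup E] [NormedSpace ℝ E]
    {n : WithTop ℕ∞} {A : E → Matrix ι ι ℂ} (h : ∀ i j, ContDiff ℝ n (fun y => A y i j)) :
    ContDiff ℝ n (fun y => (A y).det) := by
  simp only [Matrix.det_apply']
  exact ContDiff.sum fun σ _ => contDiff_const.mul (contDiff_prod fun i _ => h _ _)

theorem formIntegral_homotopy {σ w : (ι → ℝ) → ι → ℂ} (hσ : ContDiff ℝ 2 σ)
    (hw : ContDiff ℝ 2 w) {K : Set (ι → ℝ)} (hK : IsCompact K) {Ω : Set (ι → ℂ)}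
    (hΩ : IsOpen Ω) {q : (ι → ℂ) → ℂ} (hq : ContDiffOn ℂ 1 q Ω)
    (hdet : ∀ ξ ∉ K, ∀ s : ℝ, (jac (fun ξ => σ ξ + s • w ξ) ξ).det = 0)
    (hcof : ∀ ξ ∉ K, ∀ s : ℝ, ∀ l,
      ((jac (fun ξ => σ ξ + s • w ξ) ξ).updateCol l (w ξ)).det = 0)
    (hmem : ∀ ξ ∈ K, ∀ s ∈ Icc (0 : ℝ) 1, σ ξ + s • w ξ ∈ Ω) :
    formIntegral q σ = formIntegral q (fun ξ => σ ξ + w ξ) := by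
  set J : ℝ → (ι → ℝ) → Matrix ι ι ℂ := fun s ξ => jac (fun ξ => σ ξ + s • w ξ) ξ with hJ
  set u : ℝ → (ι → ℝ) → ℂ := fun s ξ => q (σ ξ + s • w ξ) * (J s ξ).det with hu
  set O : Set (ℝ × (ι → ℝ)) := {p | σ p.2 + p.1 • w p.2 ∈ Ω} with hOdef
  have hcm : ContDiff ℝ 2 (fun p : ℝ × (ι → ℝ) => σ p.2 + p.1 • w p.2) := by fun_prop
  have hO : IsOpen O := hΩ.preimage hcm.continuous
  have hqR : ContDiffOn ℝ 1 q Ω := hq.restrict_scalars ℝ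
  have hdetC : ContDiff ℝ 1 (fun p : ℝ × (ι → ℝ) => (J p.1 p.2).det) := by
    refine contDiff_matrix_det fun i l => ?_
    simp only [hJ, jac_add_smul hσ hw, Matrix.add_apply, Matrix.smul_apply]
    exact ((contDiff_jac hσ i l).comp contDiff_snd).add
      (contDiff_fst.smul ((contDiff_jac hw i l).comp contDiff_snd))
  have huO : ContDiffOn ℝ 1 (uncurry u) O := by
    refine ContDiffOn.mul ?_ hdetC.contDiffOn
    exact hqR.comp ((hcm.of_le one_le_two).contDiffOn) (fun p hp => hp)
  -- the derivative in `s` is a divergence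
  have hσs : ∀ s : ℝ, ContDiff ℝ 2 (fun ξ => σ ξ + s • w ξ) := fun s => by fun_prop
  have hpt : ∀ s ∈ Icc (0 : ℝ) 1, ∀ ξ ∈ K, fderiv ℝ (fun s => u s ξ) s 1 =
      ∑ l, fderiv ℝ (fun y => q (σ y + s • w y) * ((J s y).updateCol l (w y)).det) ξ
        (Pi.single l 1) := by
    intro s hs ξ hξ
    have hq' : HasFDerivAt q (fderiv ℝ q (σ ξ + s • w ξ)) (σ ξ + s • w ξ) :=
      ((hqR.contDiffAt (hΩ.mem_nhds (hmem ξ hξ s hs))).differentiableAt one_ne_zero).hasFDerivAt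
    set q' := fderiv ℝ q (σ ξ + s • w ξ)
    have hlinC : ∀ (c : ℂ) v, q' (c • v) = c * q' v := by
      have h1 := ((hq.contDiffAt (hΩ.mem_nhds (hmem ξ hξ s hs))).differentiableAt
        one_ne_zero).hasFDerivAt
      have h2 := hq'.unique (h1.restrictScalars ℝ)
      intro c v
      rw [h2]; simp
    have hA : ∀ i j, HasFDerivAt (fun t : ℝ => J t ξ i j)
        (ContinuousLinearMap.toSpanSingleton ℝ (jac w ξ i j)) s := by
      intro i j
      simp only [hJ, jac_add_smul hσ hw, Matrix.add_apply, Matrix.smul_apply]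
      have := ((hasDerivAt_id s).smul_const (jac w ξ i j)).const_add (jac σ ξ i j)
      simpa [hasDerivAt_iff_hasFDerivAt] using this
    obtain ⟨L, hL, hL'⟩ := hasFDerivAt_matrix_det hA
    have hline : HasFDerivAt (fun t : ℝ => σ ξ + t • w ξ)
        (ContinuousLinearMap.toSpanSingleton ℝ (w ξ)) s := by
      have := ((hasDerivAt_id s).smul_const (w ξ)).const_add (σ ξ)
      simpa [hasDerivAt_iff_hasFDerivAt] using this
    have hLHS : HasFDerivAt (fun t => u t ξ) _ s := (hq'.comp s hline).mul hL
    rw [hLHS.fderiv]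
    have hB : ∀ i j, HasFDerivAt (fun y => J s y i j) _ ξ := fun i j =>
      hasFDerivAt_jac (hσs s) ξ i j
    have hwd : ∀ i, HasFDerivAt (fun y => w y i)
        ((ContinuousLinearMap.proj (R := ℝ) (φ := fun _ : ι => ℂ) i).comp (fderiv ℝ w ξ)) ξ :=
      fun i => (ContinuousLinearMap.proj (R := ℝ) (φ := fun _ : ι => ℂ) i).hasFDerivAt.comp ξ
        (hw.differentiable two_ne_zero ξ).hasFDerivAt
    have hsym : IsSymmSndFDerivAt ℝ (fun ξ => σ ξ + s • w ξ) ξ :=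
      (hσs s).contDiffAt.isSymmSndFDerivAt (by simp)
    have hpiola := sum_fderiv_det_updateCol hB (fun i k l => by
      simpa using congrFun (hsym.eq (Pi.single l 1) (Pi.single k 1)) i) hwd
    have hD : ∀ l, DifferentiableAt ℝ (fun y => ((J s y).updateCol l (w y)).det) ξ := by
      intro l
      obtain ⟨L, hL, -⟩ := hasFDerivAt_matrix_det (A := fun y => (J s y).updateCol l (w y))
        (A' := fun i j => if j = l then _ else _) (x := ξ) (by
          intro i j
          by_cases hj : j = l
          · simpa [Matrix.updateCol_apply, hj] using hwd i
          · simpa [Matrix.updateCol_apply, hj] using hB i j)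
      exact hL.differentiableAt
    have hq2 := hq'.comp ξ ((hσs s).differentiable two_ne_zero ξ).hasFDerivAt
    have hR : ∀ l, fderiv ℝ (fun y => q (σ y + s • w y) * ((J s y).updateCol l (w y)).det) ξ
        (Pi.single l 1) = q (σ ξ + s • w ξ) *
          fderiv ℝ (fun y => ((J s y).updateCol l (w y)).det) ξ (Pi.single l 1) +
          ((J s ξ).updateCol l (w ξ)).det *
            q' (fderiv ℝ (fun ξ => σ ξ + s • w ξ) ξ (Pi.single l 1)) := by
      intro l
      have := hq2.mul (hD l).hasFDerivAt
      erw [this.fderiv]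
      simp
    simp only [hR, Finset.sum_add_distrib, ← Finset.mul_sum, hpiola]
    have hcr : ∑ l, ((J s ξ).updateCol l (w ξ)).det •
        fderiv ℝ (fun ξ => σ ξ + s • w ξ) ξ (Pi.single l 1) = (J s ξ).det • w ξ := by
      rw [← Matrix.mulVec_cramer]
      ext i
      simp only [Finset.sum_apply, Pi.smul_apply, smul_eq_mul, Matrix.mulVec, dotProduct,
        Matrix.cramer_apply]
      exact Finset.sum_congr rfl fun l _ => mul_comm _ _
    have hcr' := congrArg q' hcr
    rw [map_sum] at hcr'
    simp only [hlinC] at hcr'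
    rw [hcr']
    simp [hL', jac, mul_comm]
  have hzero : ∀ s ∈ Icc (0 : ℝ) 1, HasDerivAt (fun s => ∫ ξ in K, u s ξ) 0 s := by
    intro s hs
    have hKO : ∀ ξ ∈ K, (s, ξ) ∈ O := fun ξ hξ => hmem ξ hξ s hs
    have h1 := (setIntegral_param_of_contDiffOn (μ := volume) hO hK hKO huO).1.hasDerivAt
    have hint : IntegrableOn (fun ξ => fderiv ℝ (fun s => u s ξ) s) K := by
      have hd : ∀ ξ ∈ K, fderiv ℝ (fun s => u s ξ) s =
          (fderiv ℝ (uncurry u) (s, ξ)).comp (inl ℝ ℝ (ι → ℝ)) := by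
        intro ξ hξ
        have h1 : HasFDerivAt (uncurry u) (fderiv ℝ (uncurry u) (s, ξ)) (s, ξ) :=
          ((huO.contDiffAt (hO.mem_nhds (hKO ξ hξ))).differentiableAt one_ne_zero).hasFDerivAt
        exact (HasFDerivAt.comp (g := uncurry u) (f := fun e => (e, ξ)) s h1
          (hasFDerivAt_prodMk_left s ξ)).fderiv
      refine IntegrableOn.congr_fun ?_ (fun ξ hξ => (hd ξ hξ).symm) hK.measurableSet
      refine ContinuousOn.integrableOn_compact hK ?_
      refine ContinuousOn.clm_comp ?_ continuousOn_const
      exact (huO.continuousOn_fderiv_of_isOpen hO le_rfl).comp (by fun_prop) hKO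
    rw [ContinuousLinearMap.integral_apply hint] at h1
    suffices h0 : ∫ ξ in K, fderiv ℝ (fun s => u s ξ) s 1 = 0 by rwa [h0] at h1
    rw [setIntegral_congr_fun hK.measurableSet (hpt s hs)]
    set V : ι → (ι → ℝ) → ℂ := fun l y => q (σ y + s • w y) * ((J s y).updateCol l (w y)).det
    have hV0 : ∀ l, ∀ y ∉ K, V l y = 0 := fun l y hy => by
      simp only [V, hJ, hcof y hy s l, mul_zero]
    have hVC : ∀ l, ContDiff ℝ 1 (V l) := by
      intro l
      rw [contDiff_iff_contDiffAt]
      intro y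
      by_cases hy : y ∈ K
      · refine ContDiffAt.mul ?_ ?_
        · exact (hqR.contDiffAt (hΩ.mem_nhds (hmem y hy s hs))).comp y
            ((hσs s).of_le one_le_two).contDiffAt
        · refine (contDiff_matrix_det fun i j => ?_).contDiffAt
          by_cases hj : j = l
          · simpa [Matrix.updateCol_apply, hj] using
              (contDiff_pi.1 (hw.of_le one_le_two) i)
          · simpa [Matrix.updateCol_apply, hj] using contDiff_jac (hσs s) i j
      · refine contDiffAt_const (c := (0 : ℂ)) |>.congr_of_eventuallyEq ?_
        filter_upwards [hK.isClosed.isOpen_compl.mem_nhds hy] with z hz using hV0 l z hz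
    have hVc : ∀ l, HasCompactSupport (V l) := fun l =>
      HasCompactSupport.intro hK (hV0 l)
    have hVi : ∀ l, ∫ y, fderiv ℝ (V l) y (Pi.single l 1) = 0 := fun l =>
      integral_fderiv_eq_zero_of_hasCompactSupport (hVC l) (hVc l) _
    rw [setIntegral_eq_integral_of_forall_compl_eq_zero]
    · rw [integral_finsetSum]
      · exact Finset.sum_eq_zero fun l _ => hVi l
      · intro l _
        exact (((hVC l).continuous_fderiv one_ne_zero).clm_apply
          continuous_const).integrable_of_hasCompactSupport ((hVc l).fderiv_apply (𝕜 := ℝ) _)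
    · intro y hy
      refine Finset.sum_eq_zero fun l _ => ?_
      have : V l =ᶠ[𝓝 y] fun _ => 0 := by
        filter_upwards [hK.isClosed.isOpen_compl.mem_nhds hy] with z hz using hV0 l z hz
      change fderiv ℝ (V l) y _ = 0
      rw [this.fderiv_eq]
      simp
  have hconst := constant_of_derivWithin_zero (f := fun s => ∫ ξ in K, u s ξ) (a := 0) (b := 1)
    (fun s hs => (hzero s hs).differentiableAt.differentiableWithinAt)
    (fun s hs => (hzero s (Ico_subset_Icc_self hs)).hasDerivWithinAt.derivWithin
      (uniqueDiffOn_Icc zero_lt_one s (Ico_subset_Icc_self hs))) 1 (by simp)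
  have hfull : ∀ s, ∫ ξ in K, u s ξ = formIntegral q (fun ξ => σ ξ + s • w ξ) := by
    intro s
    refine setIntegral_eq_integral_of_forall_compl_eq_zero fun ξ hξ => ?_
    simp [hu, hJ, hdet ξ hξ s]
  rw [hfull, hfull] at hconst
  simpa using hconst.symm

end FormIntegral

section Cycles

variable {m : ℕ}

/-- Coordinates `(ρ, x) ∈ ℂ × ℂᵐ` on the parameter space. -/
abbrev CycIdx (m : ℕ) : Type := (Fin 2 ⊕ Fin m) ⊕ Fin m

noncomputable def rhoL (m : ℕ) : (CycIdx m → ℝ) →L[ℝ] ℂ :=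
  ofRealCLM.comp (ContinuousLinearMap.proj (Sum.inl (Sum.inl 0))) +
    I • ofRealCLM.comp (ContinuousLinearMap.proj (Sum.inl (Sum.inl 1)))

noncomputable def xL (m : ℕ) : (CycIdx m → ℝ) →L[ℝ] Vec m :=
  ContinuousLinearMap.pi fun k =>
    ofRealCLM.comp (ContinuousLinearMap.proj (Sum.inl (Sum.inr k))) +
      I • ofRealCLM.comp (ContinuousLinearMap.proj (Sum.inr k))

/-- A smooth radial cutoff on `ℂ`, equal to `1` for `|ρ|² ≤ 1` and to `0` for `|ρ|² ≥ 2`. -/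
noncomputable def psi (ρ : ℂ) : ℝ := smoothTransition (2 - normSq ρ)

theorem contDiff_normSq {n : WithTop ℕ∞} : ContDiff ℝ n (fun z : ℂ => normSq z) := by
  have : (fun z : ℂ => normSq z) =
      fun z => reCLM z * reCLM z + imCLM z * imCLM z := by
    ext z; simp [normSq_apply]
  rw [this]
  fun_prop

theorem contDiff_psi : ContDiff ℝ 2 psi :=
  smoothTransition.contDiff.comp (contDiff_const.sub contDiff_normSq)

/-- The annulus carrying the derivative of `psi`. -/
def psiSet : Set ℂ := {ρ | 1 ≤ normSq ρ ∧ normSq ρ ≤ 2}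

theorem isCompact_psiSet : IsCompact psiSet := by
  refine isCompact_of_isClosed_isBounded ?_ ?_
  · exact (isClosed_le continuous_const continuous_normSq).inter
      (isClosed_le continuous_normSq continuous_const)
  · refine (isBounded_closedBall (x := (0 : ℂ)) (r := 2)).subset fun ρ hρ => ?_
    simp only [mem_closedBall, dist_zero_right]
    have := hρ.2
    rw [normSq_eq_norm_sq] at this
    nlinarith [norm_nonneg ρ]

theorem fderiv_psi_eq_zero {ρ : ℂ} (h : ρ ∉ psiSet) : fderiv ℝ psi ρ = 0 := by
  simp only [psiSet, mem_ofPred_eq, not_and_or, not_le] at h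
  rcases h with h | h
  · have : psi =ᶠ[𝓝 ρ] fun _ => 1 := by
      filter_upwards [continuous_normSq.continuousAt.eventually (gt_mem_nhds h)] with z hz
      exact smoothTransition.one_of_one_le (by linarith)
    rw [this.fderiv_eq]; simp
  · have : psi =ᶠ[𝓝 ρ] fun _ => 0 := by
      filter_upwards [continuous_normSq.continuousAt.eventually (lt_mem_nhds h)] with z hz
      exact smoothTransition.zero_of_nonpos (by linarith)
    rw [this.fderiv_eq]; simp

/-- The chain `ξ ↦ (χ(x), ψ(ρ), P ξ, Q ξ)` in `ℂ² × ℂᵐ × ℂᵐ`. -/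
noncomputable def cycle (χ : Vec m → ℝ) (P Q : (CycIdx m → ℝ) → Vec m)
    (ξ : CycIdx m → ℝ) : CycIdx m → ℂ :=
  Sum.elim (Sum.elim ![(χ (xL m ξ) : ℂ), (psi (rhoL m ξ) : ℂ)] (P ξ)) (Q ξ)

/-- Projection to the last two groups of coordinates. -/
def pairL (m : ℕ) (z : CycIdx m → ℂ) : Vec m × Vec m :=
  (fun k => z (Sum.inl (Sum.inr k)), fun k => z (Sum.inr k))

@[simp] theorem pairL_cycle (χ : Vec m → ℝ) (P Q : (CycIdx m → ℝ) → Vec m)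
    (ξ : CycIdx m → ℝ) : pairL m (cycle χ P Q ξ) = (P ξ, Q ξ) := rfl

theorem contDiff_pairL {n : WithTop ℕ∞} : ContDiff ℂ n (pairL m) := by
  unfold pairL; fun_prop

/-- The integral of `q dχ ∧ dψ ∧ dx ∧ dv` over a chain. -/
noncomputable def cycInt (q : Vec m × Vec m → ℂ) (χ : Vec m → ℝ)
    (P Q : (CycIdx m → ℝ) → Vec m) : ℂ :=
  formIntegral (fun z => q (pairL m z)) (cycle χ P Q)

theorem contDiff_cycle {χ : Vec m → ℝ} {P Q : (CycIdx m → ℝ) → Vec m}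
    (hχ : ContDiff ℝ 2 χ) (hP : ContDiff ℝ 2 P) (hQ : ContDiff ℝ 2 Q) :
    ContDiff ℝ 2 (cycle χ P Q) := by
  rw [contDiff_pi]
  rintro ((i | k) | k)
  · fin_cases i
    · exact ofRealCLM.contDiff.comp (hχ.comp (xL m).contDiff)
    · exact ofRealCLM.contDiff.comp (contDiff_psi.comp (rhoL m).contDiff)
  · exact contDiff_pi.1 hP k
  · exact contDiff_pi.1 hQ k

theorem jac_apply {ι : Type*} [Fintype ι] [DecidableEq ι] {σ : (ι → ℝ) → ι → ℂ} {ξ : ι → ℝ}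
    (h : DifferentiableAt ℝ σ ξ) (i l : ι) :
    jac σ ξ i l = fderiv ℝ (fun ξ => σ ξ i) ξ (Pi.single l 1) := by
  have h3 : HasFDerivAt (fun ξ => σ ξ i)
      ((ContinuousLinearMap.proj (R := ℝ) (φ := fun _ : ι => ℂ) i).comp (fderiv ℝ σ ξ)) ξ :=
    (ContinuousLinearMap.proj (R := ℝ) (φ := fun _ : ι => ℂ) i).hasFDerivAt.comp ξ h.hasFDerivAt
  rw [h3.fderiv]; rfl

/-- The parameters with `x ∈ Kχ` and `ρ` in the annulus. -/
def cycSet (Kχ : Set Vec m) : Set (CycIdx m → ℝ) :=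
  {ξ | xL m ξ ∈ Kχ ∧ rhoL m ξ ∈ psiSet}

theorem rhoL_re (ξ : CycIdx m → ℝ) : (rhoL m ξ).re = ξ (Sum.inl (Sum.inl 0)) := by
  simp [rhoL]

theorem rhoL_im (ξ : CycIdx m → ℝ) : (rhoL m ξ).im = ξ (Sum.inl (Sum.inl 1)) := by
  simp [rhoL]

theorem xL_re (ξ : CycIdx m → ℝ) (k : Fin m) : (xL m ξ k).re = ξ (Sum.inl (Sum.inr k)) := by
  simp [xL]

theorem xL_im (ξ : CycIdx m → ℝ) (k : Fin m) : (xL m ξ k).im = ξ (Sum.inr k) := by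
  simp [xL]

theorem isCompact_cycSet {Kχ : Set Vec m} (h : IsCompact Kχ) : IsCompact (cycSet Kχ) := by
  refine isCompact_of_isClosed_isBounded ?_ ?_
  · exact (h.isClosed.preimage (xL m).continuous).inter
      (isCompact_psiSet.isClosed.preimage (rhoL m).continuous)
  · obtain ⟨C, hC⟩ := h.isBounded.exists_norm_le
    obtain ⟨C', hC'⟩ := isCompact_psiSet.isBounded.exists_norm_le
    refine (isBounded_closedBall (x := (0 : CycIdx m → ℝ)) (r := max C (max C' 0))).subset
      fun ξ hξ => ?_
    have h1 := hC _ hξ.1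
    have h2 := hC' _ hξ.2
    simp only [mem_closedBall, dist_zero_right]
    rw [pi_norm_le_iff_of_nonneg (by positivity)]
    rintro ((i | k) | k)
    · fin_cases i
      · have := Complex.abs_re_le_norm (rhoL m ξ)
        rw [rhoL_re] at this
        exact (this.trans h2).trans ((le_max_left _ _).trans (le_max_right _ _))
      · have := Complex.abs_im_le_norm (rhoL m ξ)
        rw [rhoL_im] at this
        exact (this.trans h2).trans ((le_max_left _ _).trans (le_max_right _ _))
    · have := Complex.abs_re_le_norm (xL m ξ k)
      rw [xL_re] at this
      exact ((this.trans (norm_le_pi_norm _ k)).trans h1).trans (le_max_left _ _)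
    · have := Complex.abs_im_le_norm (xL m ξ k)
      rw [xL_im] at this
      exact ((this.trans (norm_le_pi_norm _ k)).trans h1).trans (le_max_left _ _)

theorem jac_cycle_chi {χ : Vec m → ℝ} {P Q : (CycIdx m → ℝ) → Vec m}
    {ξ : CycIdx m → ℝ} (hχ : DifferentiableAt ℝ χ (xL m ξ)) (hd : DifferentiableAt ℝ (cycle χ P Q) ξ)
    (l : CycIdx m) : jac (cycle χ P Q) ξ (Sum.inl (Sum.inl 0)) l =
      fderiv ℝ χ (xL m ξ) (xL m (Pi.single l 1)) := by
  rw [jac_apply hd]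
  have h1 := ofRealCLM.hasFDerivAt.comp ξ (hχ.hasFDerivAt.comp ξ (xL m).hasFDerivAt)
  have h2 : HasFDerivAt (fun ξ => cycle χ P Q ξ (Sum.inl (Sum.inl 0))) _ ξ := h1
  rw [h2.fderiv]
  rfl

theorem jac_cycle_psi {χ : Vec m → ℝ} {P Q : (CycIdx m → ℝ) → Vec m}
    {ξ : CycIdx m → ℝ} (hd : DifferentiableAt ℝ (cycle χ P Q) ξ)
    (l : CycIdx m) : jac (cycle χ P Q) ξ (Sum.inl (Sum.inl 1)) l =
      fderiv ℝ psi (rhoL m ξ) (rhoL m (Pi.single l 1)) := by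
  rw [jac_apply hd]
  have h1 := ofRealCLM.hasFDerivAt.comp ξ
    (((contDiff_psi.differentiable two_ne_zero) (rhoL m ξ)).hasFDerivAt.comp ξ (rhoL m).hasFDerivAt)
  have h2 : HasFDerivAt (fun ξ => cycle χ P Q ξ (Sum.inl (Sum.inl 1))) _ ξ := h1
  rw [h2.fderiv]
  rfl

theorem cycInt_homotopy {χ χ' : Vec m → ℝ} {P Q P' Q' : (CycIdx m → ℝ) → Vec m}
    (hχ : ContDiff ℝ 2 χ) (hP : ContDiff ℝ 2 P) (hQ : ContDiff ℝ 2 Q)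
    (hχ' : ContDiff ℝ 2 χ') (hP' : ContDiff ℝ 2 P') (hQ' : ContDiff ℝ 2 Q')
    {Kχ : Set Vec m} (hK : IsCompact Kχ)
    (h0 : ∀ x ∉ Kχ, fderiv ℝ χ x = 0 ∧ fderiv ℝ χ' x = 0 ∧ χ' x = χ x)
    {Ω : Set (Vec m × Vec m)} (hΩ : IsOpen Ω)
    {q : Vec m × Vec m → ℂ} (hq : ContDiffOn ℂ 1 q Ω)
    (hmem : ∀ ξ, xL m ξ ∈ Kχ → rhoL m ξ ∈ psiSet → ∀ s ∈ Icc (0 : ℝ) 1,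
      (P ξ + s • (P' ξ - P ξ), Q ξ + s • (Q' ξ - Q ξ)) ∈ Ω) :
    cycInt q χ P Q = cycInt q χ' P' Q' := by
  have hc := contDiff_cycle hχ hP hQ
  have hc' := contDiff_cycle hχ' hP' hQ'
  have hw : ContDiff ℝ 2 (fun ξ => cycle χ' P' Q' ξ - cycle χ P Q ξ) := hc'.sub hc
  have hjw : ∀ ξ i l, jac (fun ξ => cycle χ' P' Q' ξ - cycle χ P Q ξ) ξ i l =
      jac (cycle χ' P' Q') ξ i l - jac (cycle χ P Q) ξ i l := by
    intro ξ i l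
    have := ((hc'.differentiable two_ne_zero ξ).hasFDerivAt.fun_sub
      (hc.differentiable two_ne_zero ξ).hasFDerivAt).fderiv
    simp only [jac, Matrix.of_apply, this]
    simp
  have hrow : ∀ ξ ∉ cycSet Kχ, ∃ i, (∀ s : ℝ, ∀ l, jac (fun ξ => cycle χ P Q ξ + s •
      (cycle χ' P' Q' ξ - cycle χ P Q ξ)) ξ i l = 0) ∧
      cycle χ' P' Q' ξ i - cycle χ P Q ξ i = 0 := by
    intro ξ hξ
    by_cases hx : xL m ξ ∈ Kχ
    · have hr : rhoL m ξ ∉ psiSet := fun h => hξ ⟨hx, h⟩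
      refine ⟨Sum.inl (Sum.inl 1), fun s l => ?_, by simp [cycle]⟩
      rw [jac_add_smul hc hw]
      simp only [Matrix.add_apply, Matrix.smul_apply, hjw,
        jac_cycle_psi (hc.differentiable two_ne_zero ξ),
        jac_cycle_psi (hc'.differentiable two_ne_zero ξ), fderiv_psi_eq_zero hr]
      simp
    · obtain ⟨h1, h2, h3⟩ := h0 _ hx
      refine ⟨Sum.inl (Sum.inl 0), fun s l => ?_, by simp [cycle, h3]⟩
      rw [jac_add_smul hc hw]
      simp only [Matrix.add_apply, Matrix.smul_apply, hjw,
        jac_cycle_chi (hχ.differentiable two_ne_zero _) (hc.differentiable two_ne_zero ξ),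
        jac_cycle_chi (hχ'.differentiable two_ne_zero _) (hc'.differentiable two_ne_zero ξ), h1, h2]
      simp
  have := formIntegral_homotopy hc hw (isCompact_cycSet hK)
    (hΩ.preimage (contDiff_pairL (m := m) (n := 1)).continuous)
    (q := fun z => q (pairL m z)) (hq.comp contDiff_pairL.contDiffOn fun z hz => hz)
    (fun ξ hξ s => ?_) (fun ξ hξ s l => ?_) (fun ξ hξ s hs => ?_)
  · rw [cycInt, this, cycInt]
    simp
  · obtain ⟨i, hi, -⟩ := hrow ξ hξ
    exact Matrix.det_eq_zero_of_row_eq_zero i (hi s)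
  · obtain ⟨i, hi, hi'⟩ := hrow ξ hξ
    refine Matrix.det_eq_zero_of_row_eq_zero i fun j => ?_
    rw [Matrix.updateCol_apply]
    split_ifs
    · exact hi'
    · exact hi s j
  · exact hmem ξ hξ.1 hξ.2 s hs

/-- Change of the last group of variables. -/
theorem det_jac_cycle_comp {χ : Vec m → ℝ} {P Q : (CycIdx m → ℝ) → Vec m}
    {ξ : CycIdx m → ℝ} (hd : DifferentiableAt ℝ (cycle χ P Q) ξ)
    {L : Vec m × Vec m → Vec m}
    {L' : Vec m × Vec m →L[ℂ] Vec m} (hL : HasFDerivAt L L' (P ξ, Q ξ)) :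
    (jac (cycle χ P (fun ξ => L (P ξ, Q ξ))) ξ).det =
      (Matrix.of fun i j => L' (0, Pi.single j 1) i).det * (jac (cycle χ P Q) ξ).det := by
  have hcomp : ∀ i, HasFDerivAt (fun ξ => cycle χ P Q ξ i)
      ((ContinuousLinearMap.proj (R := ℝ) (φ := fun _ : CycIdx m => ℂ) i).comp
        (fderiv ℝ (cycle χ P Q) ξ)) ξ := fun i =>
    (ContinuousLinearMap.proj (R := ℝ) (φ := fun _ : CycIdx m => ℂ) i).hasFDerivAt.comp ξ
      hd.hasFDerivAt
  set D := fderiv ℝ (cycle χ P Q) ξ with hD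
  have hPQ : HasFDerivAt (fun ξ => (P ξ, Q ξ))
      ((ContinuousLinearMap.pi fun k => (ContinuousLinearMap.proj (R := ℝ)
          (φ := fun _ : CycIdx m => ℂ) (Sum.inl (Sum.inr k))).comp D).prod
        (ContinuousLinearMap.pi fun k => (ContinuousLinearMap.proj (R := ℝ)
          (φ := fun _ : CycIdx m => ℂ) (Sum.inr k)).comp D)) ξ :=
    (hasFDerivAt_pi.2 fun k => hcomp (Sum.inl (Sum.inr k))).prodMk
      (hasFDerivAt_pi.2 fun k => hcomp (Sum.inr k))
  have hLc := (hL.restrictScalars ℝ).comp ξ hPQ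
  have hLk : ∀ k, HasFDerivAt (fun ξ => L (P ξ, Q ξ) k)
      ((coordL ℝ k).comp _) ξ := fun k =>
    (coordL ℝ k).hasFDerivAt.comp ξ hLc
  have hd' : DifferentiableAt ℝ (cycle χ P (fun ξ => L (P ξ, Q ξ))) ξ := by
    rw [differentiableAt_pi]
    rintro (i | k)
    · exact (hcomp (Sum.inl i)).differentiableAt
    · exact (hLk k).differentiableAt
  have hmat : jac (cycle χ P (fun ξ => L (P ξ, Q ξ))) ξ =
      Matrix.fromBlocks (1 : Matrix (Fin 2 ⊕ Fin m) (Fin 2 ⊕ Fin m) ℂ) 0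
        (Matrix.of fun i j => Sum.elim (fun _ => 0) (fun k => L' (Pi.single k 1, 0) i) j)
        (Matrix.of fun i j => L' (0, Pi.single j 1) i) * jac (cycle χ P Q) ξ := by
    ext i l
    rw [jac_apply hd', Matrix.mul_apply, Fintype.sum_sum_type]
    rcases i with i | i
    · have h2 : HasFDerivAt (fun ξ => cycle χ P (fun ξ => L (P ξ, Q ξ)) ξ (Sum.inl i)) _ ξ :=
        hcomp (Sum.inl i)
      rw [h2.fderiv]
      simp [Matrix.one_apply, jac, hD]
    · have h2 : HasFDerivAt (fun ξ => cycle χ P (fun ξ => L (P ξ, Q ξ)) ξ (Sum.inr i)) _ ξ :=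
        hLk i
      rw [h2.fderiv]
      have hlin : ∀ a b : Vec m, L' (a, b) i = ∑ k, L' (Pi.single k 1, 0) i * a k +
          ∑ k, L' (0, Pi.single k 1) i * b k := by
        intro a b
        have ha : (a, b) = ∑ k, a k • ((Pi.single k 1 : Vec m), (0 : Vec m)) +
            ∑ k, b k • ((0 : Vec m), (Pi.single k 1 : Vec m)) := by
          ext j <;> simp [Prod.fst_sum, Prod.snd_sum, Finset.sum_apply, Pi.single_apply]
        conv_lhs => rw [ha]
        simp only [map_add, map_sum, map_smul, Pi.add_apply, Finset.sum_apply, Pi.smul_apply,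
          smul_eq_mul, mul_comm]
      simp only [comp_apply, ContinuousLinearMap.proj_apply,
        coe_restrictScalars', ContinuousLinearMap.prod_apply]
      rw [hlin]
      simp [Fintype.sum_sum_type, jac, hD]
  rw [hmat, Matrix.det_mul, Matrix.det_fromBlocks_zero₁₂, Matrix.det_one, one_mul]

end Cycles

section ModelCycle

variable {m : ℕ}

/-- The squared Euclidean norm on `ℂᵐ`. -/
noncomputable def sqNorm (y : Vec m) : ℝ := ∑ k, normSq (y k)

theorem contDiff_sqNorm {n : WithTop ℕ∞} : ContDiff ℝ n (sqNorm (m := m)) := by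
  unfold sqNorm
  exact ContDiff.sum fun k _ => contDiff_normSq.comp (contDiff_apply ℝ ℂ k)

theorem sqNorm_nonneg (y : Vec m) : 0 ≤ sqNorm y :=
  Finset.sum_nonneg fun _ _ => normSq_nonneg _

theorem sqNorm_pos {y : Vec m} (h : y ≠ 0) : 0 < sqNorm y := by
  obtain ⟨k, hk⟩ := Function.ne_iff.1 h
  exact Finset.sum_pos' (fun _ _ => normSq_nonneg _) ⟨k, Finset.mem_univ _,
    Complex.normSq_pos.2 hk⟩

theorem dotProduct_star_self (y : Vec m) : y ⬝ᵥ star y = (sqNorm y : ℂ) := by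
  simp [dotProduct, sqNorm, Complex.mul_conj]

theorem hasFDerivAt_normSq (z : ℂ) : HasFDerivAt (fun z : ℂ => normSq z)
    ((2 * z.re) • reCLM + (2 * z.im) • imCLM) z := by
  have h1 := (reCLM.hasFDerivAt (x := z)).mul (reCLM.hasFDerivAt (x := z))
  have h2 := (imCLM.hasFDerivAt (x := z)).mul (imCLM.hasFDerivAt (x := z))
  have h3 := h1.fun_add h2
  refine HasFDerivAt.congr_fderiv (f := fun z : ℂ => normSq z)
    (h3.congr_of_eventuallyEq (.of_forall fun z => ?_)) ?_
  · simp [normSq_apply]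
  · ext v
    simp
    ring

theorem fderiv_normSq_apply (z v : ℂ) :
    ((fderiv ℝ (fun z : ℂ => normSq z) z v : ℝ) : ℂ) =
      star z * v + z * star v := by
  rw [(hasFDerivAt_normSq z).fderiv]
  apply Complex.ext <;> simp <;> ring

theorem fderiv_sqNorm_apply (y v : Vec m) :
    ((fderiv ℝ sqNorm y v : ℝ) : ℂ) = ∑ k, (star (y k) * v k + y k * star (v k)) := by
  have h : HasFDerivAt sqNorm (∑ k, (fderiv ℝ (fun z : ℂ => normSq z) (y k)).comp
      (coordL ℝ k)) y := by
    refine HasFDerivAt.fun_sum fun k _ => ?_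
    exact HasFDerivAt.comp (g := fun z : ℂ => normSq z) y
      ((contDiff_normSq (n := 1)).differentiable one_ne_zero (y k)).hasFDerivAt
      (coordL ℝ k).hasFDerivAt
  rw [h.fderiv]
  simp only [sum_apply, comp_apply, Complex.ofReal_sum,
    ContinuousLinearMap.proj_apply, fderiv_normSq_apply]

/-- The standard radial cutoff. -/
noncomputable def chi0 (w x : Vec m) : ℝ := smoothTransition (2 - sqNorm (x - w))

theorem contDiff_chi0 {n : ℕ∞} (w : Vec m) : ContDiff ℝ n (chi0 w) :=
  smoothTransition.contDiff.comp
    (contDiff_const.sub (contDiff_sqNorm.comp (contDiff_id.sub contDiff_const)))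

theorem fderiv_chi0_apply (w x v : Vec m) : ((fderiv ℝ (chi0 w) x v : ℝ) : ℂ) =
    -((deriv smoothTransition (2 - sqNorm (x - w)) : ℝ) : ℂ) *
      ∑ k, (star ((x - w) k) * v k + (x - w) k * star (v k)) := by
  have h1 : HasFDerivAt (fun x => 2 - sqNorm (x - w)) (-(fderiv ℝ sqNorm (x - w))) x := by
    have := ((contDiff_sqNorm (m := m) (n := 1)).differentiable one_ne_zero (x - w)).hasFDerivAt.comp
      x ((hasFDerivAt_id x).sub_const w)
    simpa using this.const_sub 2
  have h2 : HasDerivAt smoothTransition _ (2 - sqNorm (x - w)) :=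
    (smoothTransition.contDiff (n := 1)).differentiable one_ne_zero _ |>.hasDerivAt
  have h3 : HasFDerivAt (chi0 w) _ x := h2.comp_hasFDerivAt x h1
  rw [h3.fderiv, ← fderiv_sqNorm_apply]
  simp

theorem fderiv_psi_apply (ρ v : ℂ) : ((fderiv ℝ psi ρ v : ℝ) : ℂ) =
    -((deriv smoothTransition (2 - normSq ρ) : ℝ) : ℂ) * (star ρ * v + ρ * star v) := by
  have h1 : HasFDerivAt (fun x => 2 - normSq x)
      (-(fderiv ℝ (fun z : ℂ => normSq z) ρ)) ρ := by
    simpa using ((contDiff_normSq (n := 1)).differentiable one_ne_zero ρ).hasFDerivAt.const_sub 2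
  have h2 : HasDerivAt smoothTransition _ (2 - normSq ρ) :=
    (smoothTransition.contDiff (n := 1)).differentiable one_ne_zero _ |>.hasDerivAt
  have h3 : HasFDerivAt psi _ ρ := h2.comp_hasFDerivAt ρ h1
  rw [h3.fderiv, ← fderiv_normSq_apply]
  simp

/-- The matrix expressing `(dρ, dρ̄, dx, dx̄)` in real coordinates. -/
noncomputable def realCoordMatrix (m : ℕ) : Matrix (CycIdx m) (CycIdx m) ℂ :=
  Matrix.of fun i l => Sum.elim (Sum.elim
    ![rhoL m (Pi.single l 1), star (rhoL m (Pi.single l 1))]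
    (xL m (Pi.single l 1))) (star (xL m (Pi.single l 1))) i

theorem det_realCoordMatrix_ne_zero : (realCoordMatrix m).det ≠ 0 := by
  intro h
  obtain ⟨c, hc, hc0⟩ := Matrix.exists_mulVec_eq_zero_iff.2 h
  have e := fun i => congrFun hc0 i
  refine hc ?_
  have h0 := e (Sum.inl (Sum.inl 0))
  have h1 := e (Sum.inl (Sum.inl 1))
  have hx := fun k => e (Sum.inl (Sum.inr k))
  have hv := fun k => e (Sum.inr k)
  simp [Matrix.mulVec, dotProduct, realCoordMatrix, Fintype.sum_sum_type, rhoL, xL,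
    Pi.single_apply, apply_ite (Complex.ofReal), apply_ite (starRingEnd ℂ)] at h0 h1 hx hv
  have key : ∀ a b : ℂ, a + I * b = 0 → a + -(I * b) = 0 → a = 0 ∧ b = 0 := by
    intro a b h h'
    have ha : a = 0 := by linear_combination (h + h') / 2
    refine ⟨ha, ?_⟩
    have : I * b = 0 := by linear_combination (h - h') / 2
    simpa using this
  ext i
  rcases i with (i | k) | k
  · fin_cases i
    · exact (key _ _ h0 h1).1
    · exact (key _ _ h0 h1).2
  · exact (key _ _ (hx k) (hv k)).1
  · exact (key _ _ (hx k) (hv k)).2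

theorem contDiff_star_sub (w : Vec m) :
    ContDiff ℝ 2 (fun ξ => rhoL m ξ • star (xL m ξ - w)) := by
  rw [contDiff_pi]
  intro k
  have h1 : ContDiff ℝ 2 (fun ξ => xL m ξ k - w k) :=
    (contDiff_pi.1 (xL m).contDiff k).sub contDiff_const
  exact (rhoL m).contDiff.mul (conjCLE.contDiff.comp h1)

theorem det_jac_model (w : Vec m) (ξ : CycIdx m → ℝ) (hρ : rhoL m ξ ≠ 0) :
    (jac (cycle (chi0 w) (xL m) (fun ξ => rhoL m ξ • star (xL m ξ - w))) ξ).det =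
      -((deriv smoothTransition (2 - sqNorm (xL m ξ - w)) *
        deriv smoothTransition (2 - normSq (rhoL m ξ)) *
        sqNorm (xL m ξ - w) : ℝ) : ℂ) * rhoL m ξ ^ m * (realCoordMatrix m).det := by
  set y := xL m ξ - w with hy
  set ρ := rhoL m ξ with hρd
  set a : ℂ := -((deriv smoothTransition (2 - sqNorm y) : ℝ) : ℂ) with ha
  set b : ℂ := -((deriv smoothTransition (2 - normSq ρ) : ℝ) : ℂ) with hb
  have hd := (contDiff_cycle (contDiff_chi0 (n := 2) w) (xL m).contDiff
    (contDiff_star_sub w)).differentiable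
    two_ne_zero ξ
  set T : Matrix (CycIdx m) (CycIdx m) ℂ := Matrix.fromBlocks
    (Matrix.fromBlocks !![0, 0; b * star ρ, b * ρ]
      (Matrix.of fun i k => if i = 0 then a * star (y k) else 0) 0 1)
    (Matrix.of fun i k => Sum.elim (fun i : Fin 2 => if i = 0 then a * y k else 0) (fun _ => 0) i)
    (Matrix.of fun k j => Sum.elim (fun j : Fin 2 => if j = 0 then star (y k) else 0)
      (fun _ => 0) j)
    (ρ • (1 : Matrix (Fin m) (Fin m) ℂ)) with hT
  have hjac : jac (cycle (chi0 w) (xL m) (fun ξ => rhoL m ξ • star (xL m ξ - w))) ξ =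
      T * realCoordMatrix m := by
    ext i l
    rw [Matrix.mul_apply, Fintype.sum_sum_type, Fintype.sum_sum_type, Fin.sum_univ_two]
    rcases i with (i | k) | k
    · fin_cases i
      · have := jac_cycle_chi ((contDiff_chi0 (n := 2) w).differentiable two_ne_zero _) hd l
        refine this.trans ?_
        rw [fderiv_chi0_apply, ← hy, ← ha]
        simp only [Finset.sum_add_distrib, mul_add, Finset.mul_sum, hT, realCoordMatrix]
        simp [mul_assoc]
      · have := jac_cycle_psi hd l
        refine this.trans ?_
        rw [fderiv_psi_apply]
        simp [hT, realCoordMatrix, ← hρd, hb]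
        ring
    · rw [jac_apply hd]
      have h2 : HasFDerivAt (fun ξ => cycle (chi0 w) (xL m)
          (fun ξ => rhoL m ξ • star (xL m ξ - w)) ξ (Sum.inl (Sum.inr k)))
          ((coordL ℝ k).comp (xL m)) ξ :=
        ((coordL ℝ k).comp (xL m)).hasFDerivAt
      rw [h2.fderiv]
      simp [hT, realCoordMatrix, Matrix.one_apply]
    · rw [jac_apply hd]
      have h1 : HasFDerivAt (fun ξ => star (xL m ξ k - w k))
          ((conjCLE : ℂ →L[ℝ] ℂ).comp
            ((coordL ℝ k).comp (xL m))) ξ :=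
        (conjCLE : ℂ →L[ℝ] ℂ).hasFDerivAt.comp ξ
          (((coordL ℝ k).comp
            (xL m)).hasFDerivAt.sub_const (w k))
      have h2 : HasFDerivAt (fun ξ => cycle (chi0 w) (xL m)
          (fun ξ => rhoL m ξ • star (xL m ξ - w)) ξ (Sum.inr k)) _ ξ :=
        (rhoL m).hasFDerivAt.mul h1
      rw [h2.fderiv]
      simp [hT, realCoordMatrix, Matrix.one_apply, hy]
      ring
  rw [hjac, Matrix.det_mul]
  congr 1
  have hinv : Invertible (ρ • (1 : Matrix (Fin m) (Fin m) ℂ)) :=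
    ⟨ρ⁻¹ • 1, by simp [smul_smul, hρ], by simp [smul_smul, hρ]⟩
  have hinv' : ⅟(ρ • (1 : Matrix (Fin m) (Fin m) ℂ)) = ρ⁻¹ • 1 :=
    invOf_eq_right_inv (by simp [smul_smul, hρ])
  rw [hT, Matrix.det_fromBlocks₂₂, hinv']
  have hsub : Matrix.fromBlocks !![0, 0; b * star ρ, b * ρ]
      (Matrix.of fun i k => if i = 0 then a * star (y k) else 0) 0 1 -
      (Matrix.of fun i k => Sum.elim (fun i : Fin 2 => if i = 0 then a * y k else 0)
        (fun _ : Fin m => 0) i) *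
      (ρ⁻¹ • (1 : Matrix (Fin m) (Fin m) ℂ)) *
      (Matrix.of fun k j => Sum.elim (fun j : Fin 2 => if j = 0 then star (y k) else 0)
      (fun _ : Fin m => 0) j) =
      Matrix.fromBlocks !![-(a * sqNorm y / ρ), 0; b * star ρ, b * ρ]
      (Matrix.of fun i k => if i = 0 then a * star (y k) else 0) 0 1 := by
    ext i j
    simp only [Matrix.mul_smul, Matrix.smul_mul, Matrix.mul_one, Matrix.sub_apply,
      Matrix.smul_apply, Matrix.mul_apply, Matrix.of_apply]
    rcases i with i | i <;> rcases j with j | j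
    · fin_cases i <;> fin_cases j
      · simp only [← dotProduct_star_self, dotProduct]
        simp [Finset.mul_sum, Finset.sum_div]
        refine Finset.sum_congr rfl fun k _ => ?_
        field_simp
      all_goals simp
    all_goals simp
  rw [hsub, Matrix.det_fromBlocks_zero₂₁]
  simp [Matrix.det_fin_two, ha, hb]
  field_simp

theorem deriv_smoothTransition_nonneg (u : ℝ) : 0 ≤ deriv smoothTransition u :=
  smoothTransition.monotone.deriv_nonneg

theorem deriv_smoothTransition_eq_zero {u : ℝ} (h : u < 0 ∨ 1 < u) :
    deriv smoothTransition u = 0 := by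
  rcases h with h | h
  · have : smoothTransition =ᶠ[𝓝 u] fun _ => 0 := by
      filter_upwards [gt_mem_nhds h] with z hz using smoothTransition.zero_of_nonpos hz.le
    rw [this.deriv_eq]; simp
  · have : smoothTransition =ᶠ[𝓝 u] fun _ => 1 := by
      filter_upwards [lt_mem_nhds h] with z hz using smoothTransition.one_of_one_le hz.le
    rw [this.deriv_eq]; simp

theorem exists_deriv_smoothTransition_pos :
    ∃ u ∈ Ioo (0 : ℝ) 1, 0 < deriv smoothTransition u := by
  obtain ⟨u, hu, h⟩ := exists_deriv_eq_slope smoothTransition zero_lt_one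
    smoothTransition.continuous.continuousOn
    ((smoothTransition.contDiff (n := 1)).differentiable one_ne_zero).differentiableOn
  refine ⟨u, hu, ?_⟩
  rw [h]; simp

/-- The integral of the model residue form with pole at `w`. -/
noncomputable def modelInt (w : Vec m) : ℂ :=
  cycInt (fun p => (((p.1 - w) ⬝ᵥ p.2) ^ m)⁻¹) (chi0 w) (xL m)
    (fun ξ => rhoL m ξ • star (xL m ξ - w))

/-- The real density of the model residue form. -/
noncomputable def modelDensity (w : Vec m) (ξ : CycIdx m → ℝ) : ℝ :=
  deriv smoothTransition (2 - sqNorm (xL m ξ - w)) *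
    deriv smoothTransition (2 - normSq (rhoL m ξ)) *
    max (sqNorm (xL m ξ - w)) 1 * ((max (sqNorm (xL m ξ - w)) 1) ^ m)⁻¹

theorem modelInt_eq (w : Vec m) :
    modelInt w = -((∫ ξ, modelDensity w ξ : ℝ) : ℂ) * (realCoordMatrix m).det := by
  have : ∀ ξ : CycIdx m → ℝ, (((xL m ξ - w) ⬝ᵥ (rhoL m ξ • star (xL m ξ - w))) ^ m)⁻¹ *
      (jac (cycle (chi0 w) (xL m) (fun ξ => rhoL m ξ • star (xL m ξ - w))) ξ).det =
      (modelDensity w ξ : ℂ) * -(realCoordMatrix m).det := by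
    intro ξ
    by_cases hρ : rhoL m ξ = 0
    · have h0 : deriv smoothTransition (2 - normSq (rhoL m ξ)) = 0 :=
        deriv_smoothTransition_eq_zero (Or.inr (by rw [hρ]; norm_num))
      have hd := (contDiff_cycle (contDiff_chi0 (n := 2) w) (xL m).contDiff
    (contDiff_star_sub w)).differentiable
        two_ne_zero ξ
      rw [Matrix.det_eq_zero_of_row_eq_zero (Sum.inl (Sum.inl 1))]
      · simp [modelDensity, h0]
      · intro j
        rw [jac_cycle_psi hd, fderiv_psi_apply, h0]
        simp
    rw [det_jac_model w ξ hρ, dotProduct_smul, dotProduct_star_self, smul_eq_mul, mul_pow]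
    by_cases hy : sqNorm (xL m ξ - w) < 1
    · have h0 : deriv smoothTransition (2 - sqNorm (xL m ξ - w)) = 0 :=
        deriv_smoothTransition_eq_zero (Or.inr (by linarith))
      simp [modelDensity, h0]
    · have hmax : max (sqNorm (xL m ξ - w)) 1 = sqNorm (xL m ξ - w) := max_eq_left (not_lt.1 hy)
      simp only [modelDensity, hmax]
      have : (sqNorm (xL m ξ - w) : ℂ) ≠ 0 := by
        exact_mod_cast (by linarith [not_lt.1 hy] : (0:ℝ) < sqNorm (xL m ξ - w)).ne'
      push_cast
      field_simp
  rw [modelInt, cycInt, formIntegral]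
  simp only [pairL_cycle]
  simp_rw [this]
  rw [integral_mul_const, integral_complex_ofReal]
  ring

theorem continuous_modelDensity (w : Vec m) : Continuous (modelDensity w) := by
  have h1 : Continuous (deriv smoothTransition) :=
    (smoothTransition.contDiff (n := 1)).continuous_deriv le_rfl
  have h2 : Continuous (fun ξ => sqNorm (xL m ξ - w)) :=
    (contDiff_sqNorm (n := 0)).continuous.comp ((xL m).continuous.sub continuous_const)
  have h3 : Continuous (fun ξ => normSq (rhoL m ξ)) :=
    continuous_normSq.comp (rhoL m).continuous
  have h4 : ∀ ξ, (max (sqNorm (xL m ξ - w)) 1) ^ m ≠ 0 := fun ξ => by positivity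
  unfold modelDensity
  exact (((h1.comp (continuous_const.sub h2)).mul (h1.comp (continuous_const.sub h3))).mul
    (h2.max continuous_const)).mul (((h2.max continuous_const).pow m).inv₀ h4)

theorem modelInt_ne_zero (hm : 1 ≤ m) (w : Vec m) : modelInt w ≠ 0 := by
  rw [modelInt_eq]
  refine mul_ne_zero (neg_ne_zero.2 (Complex.ofReal_ne_zero.2 (ne_of_gt ?_)))
    det_realCoordMatrix_ne_zero
  obtain ⟨u, hu, hu'⟩ := exists_deriv_smoothTransition_pos
  have hs : HasCompactSupport (modelDensity w) := by
    have hK : IsCompact {x : Vec m | sqNorm (x - w) ≤ 2} := by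
      refine isCompact_of_isClosed_isBounded ?_ ?_
      · exact isClosed_le ((contDiff_sqNorm (n := 0)).continuous.comp
          (continuous_id.sub continuous_const)) continuous_const
      · refine (isBounded_closedBall (x := w) (r := 2)).subset fun x hx => ?_
        rw [mem_closedBall, dist_eq_norm, pi_norm_le_iff_of_nonneg zero_le_two]
        intro k
        have h1 : normSq ((x - w) k) ≤ sqNorm (x - w) :=
          Finset.single_le_sum (f := fun k => normSq ((x - w) k))
            (fun _ _ => normSq_nonneg _) (Finset.mem_univ k)
        rw [normSq_eq_norm_sq] at h1
        have h2 : sqNorm (x - w) ≤ 2 := hx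
        nlinarith [norm_nonneg ((x - w) k)]
    refine HasCompactSupport.intro (isCompact_cycSet hK) fun ξ hξ => ?_
    by_cases hx : sqNorm (xL m ξ - w) ≤ 2
    · have hr : rhoL m ξ ∉ psiSet := fun h => hξ ⟨hx, h⟩
      have : deriv smoothTransition (2 - normSq (rhoL m ξ)) = 0 := by
        refine deriv_smoothTransition_eq_zero ?_
        simp only [psiSet, mem_ofPred_eq, not_and_or, not_le] at hr
        rcases hr with h | h
        · right; linarith
        · left; linarith
      simp [modelDensity, this]
    · have : deriv smoothTransition (2 - sqNorm (xL m ξ - w)) = 0 :=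
        deriv_smoothTransition_eq_zero (Or.inl (by linarith [not_le.1 hx]))
      simp [modelDensity, this]
  set ξ₀ : CycIdx m → ℝ := Sum.elim (Sum.elim ![√(2 - u), 0]
    (fun k => (w k).re + if k = ⟨0, hm⟩ then √(2 - u) else 0)) (fun k => (w k).im)
  have hu2 : 0 ≤ 2 - u := by linarith [hu.2]
  have h1 : normSq (rhoL m ξ₀) = 2 - u := by
    rw [normSq_apply, rhoL_re, rhoL_im]
    simp [ξ₀, Real.mul_self_sqrt hu2]
  have h2 : sqNorm (xL m ξ₀ - w) = 2 - u := by
    have : ∀ k, normSq ((xL m ξ₀ - w) k) = if k = ⟨0, hm⟩ then 2 - u else 0 := by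
      intro k
      rw [normSq_apply, Pi.sub_apply, Complex.sub_re, Complex.sub_im, xL_re, xL_im]
      by_cases hk : k = ⟨0, hm⟩
      · simp [ξ₀, hk, Real.mul_self_sqrt hu2]
      · simp [ξ₀, hk]
    rw [sqNorm, Finset.sum_congr rfl fun k _ => this k]
    simp
  refine (continuous_modelDensity w).integral_pos_of_hasCompactSupport_nonneg_nonzero hs
    (fun ξ => ?_) (x := ξ₀) ?_
  · have := deriv_smoothTransition_nonneg
    exact mul_nonneg (mul_nonneg (mul_nonneg (this _) (this _)) (by positivity)) (by positivity)
  · simp only [modelDensity, h1, h2, sub_sub_cancel]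
    have : 0 < max (2 - u) 1 := by positivity
    positivity

theorem modelInt_eq_modelInt_zero (w : Vec m) : modelInt w = modelInt (0 : Vec m) := by
  rw [modelInt_eq, modelInt_eq]
  congr 3
  set ξ₀ : CycIdx m → ℝ := Sum.elim (Sum.elim ![0, 0] (fun k => (w k).re)) (fun k => (w k).im)
  have h1 : rhoL m ξ₀ = 0 := Complex.ext (by rw [rhoL_re]; simp [ξ₀]) (by rw [rhoL_im]; simp [ξ₀])
  have h2 : xL m ξ₀ = w := funext fun k =>
    Complex.ext (by rw [xL_re]; simp [ξ₀]) (by rw [xL_im]; simp [ξ₀])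
  rw [← integral_add_right_eq_self _ ξ₀]
  simp [modelDensity, h1, h2]

end ModelCycle

section Reproducing

variable {m : ℕ}

theorem det_jac_cycle_eq_zero {χ : Vec m → ℝ} {P Q : (CycIdx m → ℝ) → Vec m}
    {ξ : CycIdx m → ℝ} (hχ : DifferentiableAt ℝ χ (xL m ξ)) (hd : DifferentiableAt ℝ (cycle χ P Q) ξ)
    (h : fderiv ℝ χ (xL m ξ) = 0 ∨ rhoL m ξ ∉ psiSet) : (jac (cycle χ P Q) ξ).det = 0 := by
  rcases h with h | h
  · refine Matrix.det_eq_zero_of_row_eq_zero (Sum.inl (Sum.inl 0)) fun l => ?_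
    rw [jac_cycle_chi hχ hd, h]; simp
  · refine Matrix.det_eq_zero_of_row_eq_zero (Sum.inl (Sum.inl 1)) fun l => ?_
    rw [jac_cycle_psi hd, fderiv_psi_eq_zero h]; simp

theorem contDiff_dotProduct {n : WithTop ℕ∞} :
    ContDiff ℂ n (fun p : Vec m × Vec m => p.1 ⬝ᵥ p.2) := by
  simp only [dotProduct]; fun_prop

theorem psiSet_ne_zero {ρ : ℂ} (h : ρ ∈ psiSet) : ρ ≠ 0 := by
  rintro rfl
  have := h.1
  norm_num at this

theorem contDiffOn_model (w : Vec m) :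
    ContDiffOn ℂ 1 (fun p : Vec m × Vec m => (((p.1 - w) ⬝ᵥ p.2) ^ m)⁻¹)
      {p | (p.1 - w) ⬝ᵥ p.2 ≠ 0} := by
  have h1 : ContDiff ℂ 1 (fun p : Vec m × Vec m => (p.1 - w) ⬝ᵥ p.2) :=
    contDiff_dotProduct.comp ((contDiff_fst.sub contDiff_const).prodMk contDiff_snd)
  exact (h1.pow m).contDiffOn.inv fun p hp => pow_ne_zero _ hp

theorem isOpen_model (w : Vec m) :
    IsOpen {p : Vec m × Vec m | (p.1 - w) ⬝ᵥ p.2 ≠ 0} := by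
  have h1 : ContDiff ℂ 1 (fun p : Vec m × Vec m => (p.1 - w) ⬝ᵥ p.2) :=
    contDiff_dotProduct.comp ((contDiff_fst.sub contDiff_const).prodMk contDiff_snd)
  exact isOpen_ne_fun h1.continuous continuous_const

theorem cycInt_model_congr {w : Vec m} {χ χ' : Vec m → ℝ} (hχ : ContDiff ℝ 2 χ)
    (hχ' : ContDiff ℝ 2 χ') (hs : HasCompactSupport χ) (hs' : HasCompactSupport χ') {c : ℝ}
    (hc : ∀ᶠ x in 𝓝 w, χ x = c) (hc' : ∀ᶠ x in 𝓝 w, χ' x = c) :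
    cycInt (fun p => (((p.1 - w) ⬝ᵥ p.2) ^ m)⁻¹) χ (xL m)
      (fun ξ => rhoL m ξ • star (xL m ξ - w)) =
    cycInt (fun p => (((p.1 - w) ⬝ᵥ p.2) ^ m)⁻¹) χ' (xL m)
      (fun ξ => rhoL m ξ • star (xL m ξ - w)) := by
  set A := interior {x | χ x = c ∧ χ' x = c} with hA
  have hwA : w ∈ A := mem_interior_iff_mem_nhds.2 (hc.and hc')
  have hK : IsCompact ((tsupport χ ∪ tsupport χ') \ A) := (hs.union hs').diff isOpen_interior
  refine cycInt_homotopy hχ (xL m).contDiff (contDiff_star_sub w) hχ' (xL m).contDiff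
    (contDiff_star_sub w) hK (fun x hx => ?_) (isOpen_model w) (contDiffOn_model w) ?_
  · by_cases hxA : x ∈ A
    · have h1 : χ =ᶠ[𝓝 x] fun _ => c := by
        filter_upwards [mem_interior_iff_mem_nhds.1 hxA] with y hy using hy.1
      have h2 : χ' =ᶠ[𝓝 x] fun _ => c := by
        filter_upwards [mem_interior_iff_mem_nhds.1 hxA] with y hy using hy.2
      rw [h1.fderiv_eq, h2.fderiv_eq, h1.self_of_nhds, h2.self_of_nhds]
      simp
    · have h1 : x ∉ tsupport χ := fun h => hx ⟨Or.inl h, hxA⟩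
      have h2 : x ∉ tsupport χ' := fun h => hx ⟨Or.inr h, hxA⟩
      have h3 := notMem_tsupport_iff_eventuallyEq.1 h1
      have h4 := notMem_tsupport_iff_eventuallyEq.1 h2
      rw [h3.fderiv_eq, h4.fderiv_eq, h3.self_of_nhds, h4.self_of_nhds]
      simp
  · intro ξ hξ hr s _
    simp only [sub_self, smul_zero, add_zero, mem_ofPred_eq]
    have hne : xL m ξ - w ≠ 0 := by
      intro h
      rw [sub_eq_zero.1 h] at hξ
      exact hξ.2 hwA
    rw [dotProduct_smul, dotProduct_star_self]
    exact mul_ne_zero (psiSet_ne_zero hr) (Complex.ofReal_ne_zero.2 (sqNorm_pos hne).ne')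

theorem hasFDerivAt_transpose_mulVec {h : Vec m → Matrix (Fin m) (Fin m) ℂ} {x v : Vec m}
    (hh : ∀ i j, DifferentiableAt ℂ (fun x => h x i j) x) :
    ∃ L' : Vec m × Vec m →L[ℂ] Vec m,
      HasFDerivAt (fun p : Vec m × Vec m => (h p.1).transpose.mulVec p.2) L' (x, v) ∧
      (Matrix.of fun i j => L' (0, Pi.single j 1) i) = (h x).transpose := by
  have hfst : ∀ i j, HasFDerivAt (fun p : Vec m × Vec m => h p.1 i j)
      ((fderiv ℂ (fun x => h x i j) x).comp (fst ℂ _ _)) (x, v) := fun i j =>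
    HasFDerivAt.comp (g := fun x => h x i j) (f := Prod.fst) (x, v) (hh i j).hasFDerivAt
      hasFDerivAt_fst
  have hsnd : ∀ k, HasFDerivAt (fun p : Vec m × Vec m => p.2 k)
      ((coordL ℂ k).comp
        (snd ℂ _ _)) (x, v) := fun k =>
    ((coordL ℂ k).comp
        (snd ℂ Vec m Vec m)).hasFDerivAt (x := (x, v))
  refine ⟨ContinuousLinearMap.pi fun i => ∑ k, (h x k i •
      ((coordL ℂ k).comp
        (snd ℂ _ _)) + v k •
      ((fderiv ℂ (fun x => h x k i) x).comp (fst ℂ _ _))), ?_, ?_⟩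
  · rw [hasFDerivAt_pi]
    intro i
    simp only [Matrix.mulVec, dotProduct, Matrix.transpose_apply]
    exact HasFDerivAt.fun_sum fun k _ => (hfst k i).fun_mul (hsnd k)
  · ext i j
    simp [Pi.single_apply]

theorem cycInt_reproducing {B : Set Vec m} (hB : IsOpen B) {F : Vec m → Vec m}
    {h : Vec m → Matrix (Fin m) (Fin m) ℂ} {w : Vec m}
    (hh : ∀ i j, ContDiffOn ℂ 2 (fun x => h x i j) B)
    (hF : ∀ x ∈ B, F x = (h x).mulVec (x - w)) {b : Vec m → Vec m}
    (hb : ContDiff ℝ 2 b) (hbB : tsupport b ⊆ B)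
    {χ χ' : Vec m → ℝ} (hχ : ContDiff ℝ 2 χ) (hχ' : ContDiff ℝ 2 χ')
    (hs : HasCompactSupport χ) (hs' : HasCompactSupport χ')
    {K : Set Vec m} (hK : IsCompact K) (hK0 : ∀ x ∉ K, fderiv ℝ χ x = 0) (hKB : K ⊆ B)
    (hpos : ∀ x ∈ K, 0 < (F x ⬝ᵥ b x).re) {c : ℝ}
    (hc : ∀ᶠ x in 𝓝 w, χ x = c) (hc' : ∀ᶠ x in 𝓝 w, χ' x = c) :
    cycInt (fun p => (h p.1).det * ((F p.1 ⬝ᵥ p.2) ^ m)⁻¹) χ (xL m)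
      (fun ξ => rhoL m ξ • b (xL m ξ)) =
    cycInt (fun p => (((p.1 - w) ⬝ᵥ p.2) ^ m)⁻¹) χ' (xL m)
      (fun ξ => rhoL m ξ • star (xL m ξ - w)) := by
  rw [← cycInt_model_congr hχ hχ' hs hs' hc hc']
  have hFb : ∀ x ∈ B, ∀ v, (x - w) ⬝ᵥ (h x).transpose.mulVec v = F x ⬝ᵥ v := by
    intro x hx v
    rw [hF x hx, Matrix.dotProduct_mulVec, Matrix.vecMul_transpose]
  have hQ0 : ContDiff ℝ 2 (fun ξ => rhoL m ξ • b (xL m ξ)) :=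
    (rhoL m).contDiff.smul (hb.comp (xL m).contDiff)
  have hhb : ContDiff ℝ 2 (fun x => (h x).transpose.mulVec (b x)) := by
    rw [contDiff_iff_contDiffAt]
    intro x
    by_cases hx : x ∈ tsupport b
    · rw [contDiffAt_pi]
      intro i
      simp only [Matrix.mulVec, dotProduct, Matrix.transpose_apply]
      refine ContDiffAt.sum fun k _ => ?_
      exact (((hh k i).restrict_scalars ℝ).contDiffAt (hB.mem_nhds (hbB hx))).mul
        (contDiff_pi.1 hb k).contDiffAt
    · refine contDiffAt_const (c := (0 : Vec m)) |>.congr_of_eventuallyEq ?_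
      filter_upwards [notMem_tsupport_iff_eventuallyEq.1 hx] with y hy
      rw [hy]; simp
  have hQ : ContDiff ℝ 2 (fun ξ => rhoL m ξ • (h (xL m ξ)).transpose.mulVec (b (xL m ξ))) :=
    (rhoL m).contDiff.smul (hhb.comp (xL m).contDiff)
  have hchain : cycInt (fun p => (h p.1).det * ((F p.1 ⬝ᵥ p.2) ^ m)⁻¹) χ (xL m)
      (fun ξ => rhoL m ξ • b (xL m ξ)) =
      cycInt (fun p => (((p.1 - w) ⬝ᵥ p.2) ^ m)⁻¹) χ (xL m)
      (fun ξ => rhoL m ξ • (h (xL m ξ)).transpose.mulVec (b (xL m ξ))) := by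
    unfold cycInt formIntegral
    refine integral_congr_ae (.of_forall fun ξ => ?_)
    simp only [pairL_cycle]
    have hd0 := (contDiff_cycle hχ (xL m).contDiff hQ0).differentiable two_ne_zero ξ
    have hd := (contDiff_cycle hχ (xL m).contDiff hQ).differentiable two_ne_zero ξ
    by_cases hξ : xL m ξ ∈ K
    · have hxB := hKB hξ
      obtain ⟨L', hL', hmat⟩ := hasFDerivAt_transpose_mulVec (h := h) (x := xL m ξ)
        (v := rhoL m ξ • b (xL m ξ))
        (fun i j => ((hh i j).contDiffAt (hB.mem_nhds hxB)).differentiableAt two_ne_zero)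
      have := det_jac_cycle_comp (L := fun p => (h p.1).transpose.mulVec p.2) hd0 hL'
      rw [hmat, Matrix.det_transpose] at this
      have e : (fun ξ => (h (xL m ξ)).transpose.mulVec (rhoL m ξ • b (xL m ξ))) =
          fun ξ => rhoL m ξ • (h (xL m ξ)).transpose.mulVec (b (xL m ξ)) := by
        ext ξ; rw [Matrix.mulVec_smul]
      simp only [e] at this
      rw [this, ← Matrix.mulVec_smul, hFb _ hxB]
      ring
    · have h1 := hK0 _ hξ
      rw [det_jac_cycle_eq_zero (hχ.differentiable two_ne_zero _) hd0 (Or.inl h1),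
        det_jac_cycle_eq_zero (hχ.differentiable two_ne_zero _) hd (Or.inl h1)]
      simp
  rw [hchain]
  refine cycInt_homotopy hχ (xL m).contDiff hQ hχ (xL m).contDiff
    (contDiff_star_sub w) hK (fun x hx => ⟨hK0 x hx, hK0 x hx, rfl⟩) (isOpen_model w)
    (contDiffOn_model w) ?_
  intro ξ hξ hr s hs01
  have hne : xL m ξ - w ≠ 0 := by
    intro h0
    have := hpos _ hξ
    rw [hF _ (hKB hξ), h0] at this
    simp at this
  simp only [sub_self, smul_zero, add_zero, mem_ofPred_eq]
  rw [← smul_sub, smul_comm, ← smul_add, dotProduct_smul, dotProduct_add, dotProduct_smul,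
    dotProduct_sub, hFb _ (hKB hξ), dotProduct_star_self]
  refine mul_ne_zero (psiSet_ne_zero hr) fun h0 => ?_
  have h1 := congrArg Complex.re h0
  have hp := hpos _ hξ
  have hp2 := sqNorm_pos hne
  simp only [Complex.add_re, Complex.smul_re, Complex.sub_re, ofReal_re, Complex.zero_re,
    smul_eq_mul] at h1
  rcases hs01.1.eq_or_lt with h | h
  · rw [← h] at h1; linarith
  · nlinarith [hs01.2, mul_pos h hp2, mul_nonneg (sub_nonneg.2 hs01.2) hp.le]

theorem hasCompactSupport_chi0 (w : Vec m) : HasCompactSupport (chi0 w) := by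
  refine HasCompactSupport.intro (K := closedBall w 2) (isCompact_closedBall _ _)
    fun x hx => ?_
  refine smoothTransition.zero_of_nonpos ?_
  rw [mem_closedBall, dist_eq_norm, pi_norm_le_iff_of_nonneg zero_le_two] at hx
  push Not at hx
  obtain ⟨k, hk⟩ := hx
  have h1 : normSq ((x - w) k) ≤ sqNorm (x - w) :=
    Finset.single_le_sum (f := fun k => normSq ((x - w) k))
      (fun _ _ => normSq_nonneg _) (Finset.mem_univ k)
  rw [normSq_eq_norm_sq] at h1
  nlinarith

theorem eventually_chi0 (w : Vec m) : ∀ᶠ x in 𝓝 w, chi0 w x = 1 := by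
  have h : Continuous fun x : Vec m => sqNorm (x - w) :=
    (contDiff_sqNorm (n := 0)).continuous.comp (continuous_id.sub continuous_const)
  have h0 : sqNorm (w - w) < 1 := by simp [sqNorm]
  filter_upwards [h.continuousAt.eventually (gt_mem_nhds h0)] with x hx
  exact smoothTransition.one_of_one_le (by linarith)

/-- The residue functional applied to the Hefer determinant is the indicator of the zeros where
the cutoff is `1`. -/
theorem cycInt_hefer {B : Set Vec m} (hB : IsOpen B) {F : Vec m → Vec m}
    {h : Vec m → Matrix (Fin m) (Fin m) ℂ} {w : Vec m}
    (hh : ∀ i j, ContDiffOn ℂ 2 (fun x => h x i j) B)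
    (hF : ∀ x ∈ B, F x = (h x).mulVec (x - w)) {b : Vec m → Vec m}
    (hb : ContDiff ℝ 2 b) (hbB : tsupport b ⊆ B)
    {χ : Vec m → ℝ} (hχ : ContDiff ℝ 2 χ) (hs : HasCompactSupport χ)
    {K : Set Vec m} (hK : IsCompact K) (hK0 : ∀ x ∉ K, fderiv ℝ χ x = 0) (hKB : K ⊆ B)
    (hpos : ∀ x ∈ K, 0 < (F x ⬝ᵥ b x).re) :
    ((∀ᶠ x in 𝓝 w, χ x = 1) → cycInt (fun p => (h p.1).det * ((F p.1 ⬝ᵥ p.2) ^ m)⁻¹) χ (xL m)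
      (fun ξ => rhoL m ξ • b (xL m ξ)) = modelInt (0 : Vec m)) ∧
    ((∀ᶠ x in 𝓝 w, χ x = 0) → cycInt (fun p => (h p.1).det * ((F p.1 ⬝ᵥ p.2) ^ m)⁻¹) χ (xL m)
      (fun ξ => rhoL m ξ • b (xL m ξ)) = 0) := by
  constructor
  · intro hc
    rw [cycInt_reproducing hB hh hF hb hbB hχ (contDiff_chi0 (n := 2) w) hs (hasCompactSupport_chi0 w)
      hK hK0 hKB hpos hc (eventually_chi0 w)]
    exact modelInt_eq_modelInt_zero w
  · intro hc
    rw [cycInt_reproducing hB hh hF hb hbB hχ (contDiff_const (c := (0 : ℝ))) hs HasCompactSupport.zero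
      hK hK0 hKB hpos hc (.of_forall fun _ => rfl)]
    unfold cycInt formIntegral
    refine integral_eq_zero_of_ae (.of_forall fun ξ => ?_)
    simp only [Pi.zero_apply]
    rw [det_jac_cycle_eq_zero (by fun_prop) ((contDiff_cycle contDiff_const (xL m).contDiff
      (contDiff_star_sub w)).differentiable two_ne_zero ξ) (Or.inl (by simp)), mul_zero]

end Reproducing

section Wirtinger

variable {E : Type*} [NormedAddCommGroup E] [NormedSpace ℂ E]

/-- The `ℂ`-linear part of the real derivative. -/
noncomputable def wd (h : E → ℂ) (p v : E) : ℂ :=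
  (1 / 2) * (fderiv ℝ h p v - I * fderiv ℝ h p (I • v))

theorem wd_add_right (h : E → ℂ) (p v w : E) : wd h p (v + w) = wd h p v + wd h p w := by
  simp only [wd, smul_add, map_add]; ring

theorem wd_smul_right (h : E → ℂ) (p v : E) (c : ℂ) : wd h p (c • v) = c * wd h p v := by
  have hc : ∀ u : E, c • u = c.re • u + c.im • (I • u) := by
    intro u
    conv_lhs => rw [← Complex.re_add_im c, add_smul, mul_smul, Complex.coe_smul, Complex.coe_smul]
  have hI : I • I • v = -v := by
    rw [smul_smul, I_mul_I, neg_one_smul]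
  simp only [wd]
  rw [smul_comm I c v, hc v, hc (I • v), hI]
  simp only [map_add, map_smul, map_neg, smul_neg, real_smul]
  conv_rhs => rw [← Complex.re_add_im c]
  linear_combination ((1/2 : ℂ) * c.im * fderiv ℝ h p (I • v)) * I_mul_I

theorem wd_sum_right {ι : Type*} (s : Finset ι) (h : E → ℂ) (p : E) (v : ι → E) :
    wd h p (∑ i ∈ s, v i) = ∑ i ∈ s, wd h p (v i) := by
  simp only [wd, Finset.smul_sum, map_sum, Finset.mul_sum, ← Finset.sum_sub_distrib]

theorem wd_mul {g h : E → ℂ} {p : E} (hg : DifferentiableAt ℝ g p) (hh : DifferentiableAt ℝ h p)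
    (v : E) : wd (fun q => g q * h q) p v = wd g p v * h p + g p * wd h p v := by
  simp only [wd, fderiv_fun_mul hg hh, add_apply, smul_apply,
    smul_eq_mul]
  ring

theorem wd_of_holo {h : E → ℂ} {p : E} (hh : DifferentiableAt ℂ h p) (v : E) :
    wd h p v = fderiv ℂ h p v := by
  have h1 : fderiv ℝ h p = (fderiv ℂ h p).restrictScalars ℝ := hh.fderiv_restrictScalars ℝ
  simp only [wd, h1, coe_restrictScalars', map_smul, smul_eq_mul]
  linear_combination (-(1 / 2 : ℂ) * fderiv ℂ h p v) * I_mul_I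

theorem wd_star_eq {h : E → ℂ} {p : E} (v : E) :
    wd (fun q => (starRingEnd ℂ) (h q)) p v =
      (starRingEnd ℂ) ((1 / 2) * (fderiv ℝ h p v + I * fderiv ℝ h p (I • v))) := by
  have h1 : fderiv ℝ (fun q => (starRingEnd ℂ) (h q)) p =
      (conjCLE : ℂ →L[ℝ] ℂ).comp (fderiv ℝ h p) :=
    conjCLE.comp_fderiv
  have h2 : (starRingEnd ℂ) 2 = 2 := Complex.conj_ofNat 2
  simp only [wd, h1]
  simp [h2]
  ring

theorem wd_star_of_holo {h : E → ℂ} {p : E} (hh : DifferentiableAt ℂ h p) (v : E) :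
    wd (fun q => (starRingEnd ℂ) (h q)) p v = 0 := by
  have h1 : fderiv ℝ h p = (fderiv ℂ h p).restrictScalars ℝ := hh.fderiv_restrictScalars ℝ
  rw [wd_star_eq, h1]
  simp only [coe_restrictScalars', map_smul, smul_eq_mul]
  rw [← mul_assoc, I_mul_I]
  simp

theorem wd_comp {E' : Type*} [NormedAddCommGroup E'] [NormedSpace ℂ E'] {B : E' → ℂ} {F : E → E'}
    {p : E} (hB : DifferentiableAt ℝ B (F p)) (hF : DifferentiableAt ℂ F p) (v : E) :
    wd (fun q => B (F q)) p v = wd B (F p) (fderiv ℂ F p v) := by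
  have h1 : fderiv ℝ F p = (fderiv ℂ F p).restrictScalars ℝ := hF.fderiv_restrictScalars ℝ
  have h2 : fderiv ℝ (fun q => B (F q)) p = (fderiv ℝ B (F p)).comp (fderiv ℝ F p) :=
    fderiv_comp p hB (hF.restrictScalars ℝ)
  simp only [wd, h2, h1, comp_apply, coe_restrictScalars',
    map_smul]

/-- A real differentiable function whose conjugate has no `ℂ`-linear part is holomorphic. -/
theorem differentiableAt_of_wd_star {h : ℂ → ℂ} {p : ℂ} (hd : DifferentiableAt ℝ h p)
    (h0 : wd (fun q => (starRingEnd ℂ) (h q)) p 1 = 0) : DifferentiableAt ℂ h p := by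
  rw [wd_star_eq, map_eq_zero] at h0
  have h1 : fderiv ℝ h p 1 + I * fderiv ℝ h p (I • 1) = 0 := by
    simpa using h0
  rw [differentiableAt_iff_restrictScalars ℝ hd]
  refine ⟨(fderiv ℝ h p 1) • (1 : ℂ →L[ℂ] ℂ), ?_⟩
  ext z
  have h3 : fderiv ℝ h p z = z.re * fderiv ℝ h p 1 + z.im * fderiv ℝ h p I := by
    have h4 : z = z.re • (1 : ℂ) + z.im • I := by simp
    conv_lhs => rw [h4]
    rw [map_add, map_smul, map_smul, real_smul, real_smul]
  simp only [smul_eq_mul, mul_one] at h1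
  have h2 := congrArg (fun z => -I * z) h1
  simp only [mul_add, ← mul_assoc, neg_mul, I_mul_I] at h2
  simp at h2
  rw [h3]
  simp
  conv_lhs => rw [← Complex.re_add_im z]
  linear_combination -h2 * z.im

end Wirtinger

section Flow

variable {m : ℕ}

/-- The partial Jacobian matrix `∂F_i/∂x_k`. -/
noncomputable def pjac (F : ℂ × Vec m → Vec m) (p : ℂ × Vec m) :
    Matrix (Fin m) (Fin m) ℂ :=
  Matrix.of fun i k => fderiv ℂ F p (0, Pi.single k 1) i

/-- The partial Jacobian determinant. -/
noncomputable def pdet (F : ℂ × Vec m → Vec m) (p : ℂ × Vec m) : ℂ :=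
  (pjac F p).det

/-- The Cramer minors of `∂F/∂ζ` with respect to the partial Jacobian. -/
noncomputable def pcof (F : ℂ × Vec m → Vec m) (k : Fin m) (p : ℂ × Vec m) : ℂ :=
  ((pjac F p).updateCol k (fderiv ℂ F p (1, 0))).det

/-- The vector field tangent to the fibres of `F`, with coefficients cleared of denominators. -/
noncomputable def flowVec (F : ℂ × Vec m → Vec m) (p : ℂ × Vec m) :
    ℂ × Vec m :=
  pdet F p • (1, 0) - ∑ k, pcof F k p • (0, Pi.single k 1)

/-- The derivative of `a` along `flowVec F`. -/
noncomputable def flow (F : ℂ × Vec m → Vec m) (a : ℂ × Vec m → ℂ)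
    (p : ℂ × Vec m) : ℂ :=
  fderiv ℂ a p (flowVec F p)

variable {O : Set (ℂ × Vec m)} {F : ℂ × Vec m → Vec m}

theorem contDiffOn_det_of_entries {E : Type*} [NormedAddCommGroup E] [NormedSpace ℂ E]
    {A : E → Matrix (Fin m) (Fin m) ℂ} {s : Set E} {n : WithTop ℕ∞}
    (h : ∀ i j, ContDiffOn ℂ n (fun x => A x i j) s) : ContDiffOn ℂ n (fun x => (A x).det) s := by
  simp only [Matrix.det_apply]
  refine ContDiffOn.sum fun σ _ => ?_
  exact (contDiffOn_prod fun i _ => h (σ i) i).const_smul (c := (Equiv.Perm.sign σ))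

theorem contDiffOn_fderiv_apply {E G : Type*} [NormedAddCommGroup E] [NormedSpace ℂ E]
    [NormedAddCommGroup G] [NormedSpace ℂ G]
    {F : E → G} {O : Set E} (hO : IsOpen O) (hF : ContDiffOn ℂ ω F O) (v : E) :
    ContDiffOn ℂ ω (fun p => fderiv ℂ F p v) O :=
  (hF.fderiv_of_isOpen hO (by simp)).clm_apply contDiffOn_const

theorem contDiffOn_pdet (hO : IsOpen O) (hF : ContDiffOn ℂ ω F O) : ContDiffOn ℂ ω (pdet F) O :=
  contDiffOn_det_of_entries fun i k =>
    contDiffOn_pi.1 (contDiffOn_fderiv_apply hO hF (0, Pi.single k 1)) i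

theorem contDiffOn_pcof (hO : IsOpen O) (hF : ContDiffOn ℂ ω F O) (k : Fin m) :
    ContDiffOn ℂ ω (pcof F k) O := by
  refine contDiffOn_det_of_entries fun i j => ?_
  by_cases h : j = k
  · subst h
    simpa using contDiffOn_pi.1 (contDiffOn_fderiv_apply hO hF (1, 0)) i
  · simpa [Matrix.updateCol_ne h, pjac] using
      contDiffOn_pi.1 (contDiffOn_fderiv_apply hO hF (0, Pi.single j 1)) i

theorem contDiffOn_flow (hO : IsOpen O) (hF : ContDiffOn ℂ ω F O) {a : ℂ × Vec m → ℂ}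
    (ha : ContDiffOn ℂ ω a O) : ContDiffOn ℂ ω (flow F a) O := by
  refine (ha.fderiv_of_isOpen hO (by simp)).clm_apply ?_
  exact ((contDiffOn_pdet hO hF).smul contDiffOn_const).sub
    (ContDiffOn.sum fun k _ => (contDiffOn_pcof hO hF k).smul contDiffOn_const)

theorem fderiv_flowVec (p : ℂ × Vec m) : fderiv ℂ F p (flowVec F p) = 0 := by
  ext i
  have h := congrFun (Matrix.mulVec_cramer (pjac F p) (fderiv ℂ F p (1, 0))) i
  simp only [Matrix.mulVec, dotProduct, Matrix.cramer_apply, Pi.smul_apply, smul_eq_mul] at h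
  simp only [flowVec, map_sub, map_sum, map_smul, Pi.sub_apply, Finset.sum_apply, Pi.smul_apply,
    smul_eq_mul, Pi.zero_apply, pdet]
  rw [← h, sub_eq_zero]
  exact Finset.sum_congr rfl fun k _ => mul_comm _ _

/-- The divergence of `flowVec F` vanishes. -/
theorem sum_fderiv_pcof (hO : IsOpen O) (hF : ContDiffOn ℂ ω F O) {p : ℂ × Vec m}
    (hp : p ∈ O) :
    ∑ k, fderiv ℂ (pcof F k) p (0, Pi.single k 1) = fderiv ℂ (pdet F) p (1, 0) := by
  have hF' : DifferentiableAt ℂ (fderiv ℂ F) p :=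
    ((hF.fderiv_of_isOpen hO (m := ω) (by simp)).contDiffAt (hO.mem_nhds hp)).differentiableAt
      (by simp)
  have hsym : IsSymmSndFDerivAt ℂ F p :=
    (hF.contDiffAt (hO.mem_nhds hp)).isSymmSndFDerivAt (by simp)
  have hent : ∀ i (v : ℂ × Vec m), HasFDerivAt (fun q => fderiv ℂ F q v i)
      ((coordL ℂ i).comp
        ((ContinuousLinearMap.apply ℂ Vec m v).comp (fderiv ℂ (fderiv ℂ F) p))) p := by
    intro i v
    exact ((coordL ℂ i).comp
      (ContinuousLinearMap.apply ℂ Vec m v)).hasFDerivAt.comp p hF'.hasFDerivAt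
  obtain ⟨L, hL, hL'⟩ := hasFDerivAt_matrix_det (A := pjac F) (x := p)
    (fun i k => hent i (0, Pi.single k 1))
  have hslice : HasFDerivAt (fun y : Vec m => (p.1, y)) (inr ℂ ℂ Vec m)
      p.2 := hasFDerivAt_prodMk_right p.1 p.2
  have hent2 : ∀ i (v : ℂ × Vec m), HasFDerivAt (fun y => fderiv ℂ F (p.1, y) v i)
      (((coordL ℂ i).comp
        ((ContinuousLinearMap.apply ℂ Vec m v).comp (fderiv ℂ (fderiv ℂ F) p))).comp
        (inr ℂ ℂ Vec m)) p.2 := fun i v =>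
    HasFDerivAt.comp (g := fun q => fderiv ℂ F q v i) p.2 (hent i v) hslice
  have key := sum_fderiv_det_updateCol (𝕜 := ℂ) (A := fun y => pjac F (p.1, y)) (x := p.2)
    (fun i k => hent2 i (0, Pi.single k 1))
    (fun i k l => by
      simp only [comp_apply, inr_apply]
      exact congrFun (hsym (0, Pi.single l 1) (0, Pi.single k 1)) i)
    (u := fun y => fderiv ℂ F (p.1, y) (1, 0)) (fun i => hent2 i (1, 0))
  rw [show fderiv ℂ (pdet F) p = L from hL.fderiv, hL']
  have e1 : ∀ k, fderiv ℂ (pcof F k) p (0, Pi.single k 1) =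
      fderiv ℂ (fun y => ((pjac F (p.1, y)).updateCol k (fderiv ℂ F (p.1, y) (1, 0))).det) p.2
        (Pi.single k 1) := by
    intro k
    have hd : DifferentiableAt ℂ (pcof F k) (p.1, p.2) :=
      ((contDiffOn_pcof hO hF k).contDiffAt (hO.mem_nhds hp)).differentiableAt (by simp)
    have := HasFDerivAt.comp (g := pcof F k) p.2 hd.hasFDerivAt hslice
    have h2 := this.fderiv
    simp only [Function.comp_def] at h2
    change _ = fderiv ℂ (fun y => pcof F k (p.1, y)) p.2 (Pi.single k 1)
    rw [h2]
    rfl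
  simp only [e1]
  rw [key]
  refine Finset.sum_congr rfl fun k _ => ?_
  congr 2
  ext i
  simp only [comp_apply, inr_apply]
  exact congrFun (hsym (0, Pi.single k 1) (1, 0)) i

end Flow

section WeightedIntegral

variable {m : ℕ} {O : Set (ℂ × Vec m)} {F : ℂ × Vec m → Vec m}
  {χ : Vec m → ℝ} {B : Vec m → ℝ}

/-- The integral of `A * conj C` over the slice at `ζ`, localized by `χ` and by `B ∘ F`. -/
noncomputable def wint (F : ℂ × Vec m → Vec m) (χ B : Vec m → ℝ)
    (A C : ℂ × Vec m → ℂ) (ζ : ℂ) : ℂ :=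
  ∫ x, A (ζ, x) * (starRingEnd ℂ) (C (ζ, x)) * ((χ x * B (F (ζ, x)) : ℝ) : ℂ)

theorem wint_star (A C : ℂ × Vec m → ℂ) (ζ : ℂ) :
    (starRingEnd ℂ) (wint F χ B A C ζ) = wint F χ B C A ζ := by
  unfold wint
  rw [← integral_conj]
  refine integral_congr_ae (.of_forall fun x => ?_)
  simp only [map_mul, Complex.conj_conj, Complex.conj_ofReal]
  ring

/-- The weighted density as a function on the total space. -/
noncomputable def wdens (F : ℂ × Vec m → Vec m) (χ B : Vec m → ℝ)
    (A C : ℂ × Vec m → ℂ) (p : ℂ × Vec m) : ℂ :=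
  A p * (starRingEnd ℂ) (C p) * ((χ p.2 * B (F p) : ℝ) : ℂ)

theorem wdens_eq_zero {A C : ℂ × Vec m → ℂ} {p : ℂ × Vec m} (h : p.2 ∉ tsupport χ) :
    wdens F χ B A C p = 0 := by
  simp [wdens, image_eq_zero_of_notMem_tsupport h]

theorem wint_eq_setIntegral (A C : ℂ × Vec m → ℂ) (ζ : ℂ) :
    wint F χ B A C ζ = ∫ x in tsupport χ, wdens F χ B A C (ζ, x) := by
  refine (setIntegral_eq_integral_of_forall_compl_eq_zero fun x hx => ?_).symm
  exact wdens_eq_zero hx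

theorem contDiffOn_wdens (hF : ContDiffOn ℂ ω F O) (hχ : ContDiff ℝ 1 χ)
    (hB : ContDiff ℝ 1 B) {A C : ℂ × Vec m → ℂ} (hA : ContDiffOn ℂ ω A O)
    (hC : ContDiffOn ℂ ω C O) : ContDiffOn ℝ 1 (wdens F χ B A C) O := by
  have hF' : ContDiffOn ℝ 1 F O := (hF.restrict_scalars ℝ).of_le le_top
  have hA' : ContDiffOn ℝ 1 A O := (hA.restrict_scalars ℝ).of_le le_top
  have hC' : ContDiffOn ℝ 1 C O := (hC.restrict_scalars ℝ).of_le le_top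
  refine (hA'.mul (conjCLE.contDiff.comp_contDiffOn hC')).mul
    (ofRealCLM.contDiff.comp_contDiffOn ?_)
  exact (hχ.comp contDiff_snd).contDiffOn.mul (hB.comp_contDiffOn hF')

theorem wd_wdens (hO : IsOpen O) (hF : ContDiffOn ℂ ω F O) (hχ : ContDiff ℝ 1 χ)
    (hB : ContDiff ℝ 1 B) {A C : ℂ × Vec m → ℂ} (hA : ContDiffOn ℂ ω A O)
    (hC : ContDiffOn ℂ ω C O) {p : ℂ × Vec m} (hp : p ∈ O) (v : ℂ × Vec m) :
    wd (wdens F χ B A C) p v = fderiv ℂ A p v * (starRingEnd ℂ) (C p) * ((χ p.2 * B (F p) : ℝ) : ℂ)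
      + A p * (starRingEnd ℂ) (C p) *
        wd (fun q => ((χ q.2 * B (F q) : ℝ) : ℂ)) p v := by
  have hA' : DifferentiableAt ℂ A p := (hA.contDiffAt (hO.mem_nhds hp)).differentiableAt (by simp)
  have hC' : DifferentiableAt ℂ C p := (hC.contDiffAt (hO.mem_nhds hp)).differentiableAt (by simp)
  have hF' : DifferentiableAt ℂ F p := (hF.contDiffAt (hO.mem_nhds hp)).differentiableAt (by simp)
  have hCs : DifferentiableAt ℝ (fun q => (starRingEnd ℂ) (C q)) p :=
    conjCLE.differentiableAt.comp p (hC'.restrictScalars ℝ)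
  have hβ : DifferentiableAt ℝ (fun q : ℂ × Vec m => ((χ q.2 * B (F q) : ℝ) : ℂ)) p := by
    refine ofRealCLM.differentiableAt.comp p ?_
    exact ((hχ.comp contDiff_snd).differentiable one_ne_zero p).fun_mul
      ((hB.differentiable one_ne_zero _).comp p (hF'.restrictScalars ℝ))
  unfold wdens
  rw [wd_mul ((hA'.restrictScalars ℝ).fun_mul hCs) hβ, wd_mul (hA'.restrictScalars ℝ) hCs,
    wd_of_holo hA', wd_star_of_holo hC', mul_zero, add_zero]

theorem wd_weight_flowVec (hO : IsOpen O) (hF : ContDiffOn ℂ ω F O) (hχ : ContDiff ℝ 1 χ)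
    (hB : ContDiff ℝ 1 B) {p : ℂ × Vec m} (hp : p ∈ O)
    (h : B (F p) = 0 ∨ fderiv ℝ χ p.2 = 0) :
    wd (fun q : ℂ × Vec m => ((χ q.2 * B (F q) : ℝ) : ℂ)) p (flowVec F p) = 0 := by
  have hF' : DifferentiableAt ℂ F p := (hF.contDiffAt (hO.mem_nhds hp)).differentiableAt (by simp)
  have hχ' : DifferentiableAt ℝ (fun y => (χ y : ℂ)) p.2 :=
    ofRealCLM.differentiableAt.comp p.2 (hχ.differentiable one_ne_zero p.2)
  have hB' : DifferentiableAt ℝ (fun y => (B y : ℂ)) (F p) :=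
    ofRealCLM.differentiableAt.comp (F p) (hB.differentiable one_ne_zero (F p))
  simp only [ofReal_mul]
  rw [wd_mul (g := fun q : ℂ × Vec m => (χ q.2 : ℂ)) (h := fun q => (B (F q) : ℂ))
    (DifferentiableAt.comp (g := fun y => (χ y : ℂ)) p hχ' differentiableAt_snd)
    (DifferentiableAt.comp (g := fun y => (B y : ℂ)) p hB' (hF'.restrictScalars ℝ)),
    wd_comp (B := fun y => (B y : ℂ)) hB' hF', fderiv_flowVec]
  have h0 : wd (fun y => (B y : ℂ)) (F p) 0 = 0 := by simp [wd]
  rw [h0, mul_zero, add_zero]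
  rcases h with h | h
  · rw [h]; simp
  · rw [wd_comp (B := fun y => (χ y : ℂ)) (F := Prod.snd) hχ' differentiableAt_snd]
    have : fderiv ℝ (fun y => (χ y : ℂ)) p.2 = 0 := by
      have := ofRealCLM.hasFDerivAt.comp p.2 (hχ.differentiable one_ne_zero p.2).hasFDerivAt
      rw [h] at this
      rw [ContinuousLinearMap.comp_zero] at this
      exact this.fderiv
    simp [wd, this]

/-- The transport identity, pointwise: differentiating a density along `ζ` equals differentiating
its coefficient along the flow, up to a divergence in `x`. -/
theorem wd_wdens_transport (hO : IsOpen O) (hF : ContDiffOn ℂ ω F O) (hχ : ContDiff ℝ 1 χ)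
    (hB : ContDiff ℝ 1 B) {a C : ℂ × Vec m → ℂ} (ha : ContDiffOn ℂ ω a O)
    (hC : ContDiffOn ℂ ω C O) {p : ℂ × Vec m} (hp : p ∈ O)
    (h : B (F p) = 0 ∨ fderiv ℝ χ p.2 = 0) :
    wd (wdens F χ B (fun q => a q * pdet F q) C) p (1, 0) =
      wdens F χ B (flow F a) C p +
        ∑ k, wd (wdens F χ B (fun q => a q * pcof F k q) C) p (0, Pi.single k 1) := by
  have hd := contDiffOn_pdet hO hF
  have hc := contDiffOn_pcof hO hF
  have ha' : DifferentiableAt ℂ a p := (ha.contDiffAt (hO.mem_nhds hp)).differentiableAt (by simp)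
  have hd' : DifferentiableAt ℂ (pdet F) p :=
    (hd.contDiffAt (hO.mem_nhds hp)).differentiableAt (by simp)
  have hc' : ∀ k, DifferentiableAt ℂ (pcof F k) p := fun k =>
    ((hc k).contDiffAt (hO.mem_nhds hp)).differentiableAt (by simp)
  have hw := wd_weight_flowVec hO hF hχ hB hp h
  rw [flowVec, sub_eq_add_neg, wd_add_right, ← neg_one_smul ℂ, wd_smul_right, wd_smul_right,
    wd_sum_right] at hw
  simp only [wd_smul_right] at hw
  rw [wd_wdens hO hF hχ hB (ha.mul hd) hC hp]
  simp only [wd_wdens hO hF hχ hB (ha.mul (hc _)) hC hp]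
  have e1 : ∀ v, fderiv ℂ (fun q => a q * pdet F q) p v =
      a p * fderiv ℂ (pdet F) p v + pdet F p * fderiv ℂ a p v := by
    intro v; rw [fderiv_fun_mul ha' hd']; simp
  have e2 : ∀ k v, fderiv ℂ (fun q => a q * pcof F k q) p v =
      a p * fderiv ℂ (pcof F k) p v + pcof F k p * fderiv ℂ a p v := by
    intro k v; rw [fderiv_fun_mul ha' (hc' k)]; simp
  simp only [e1, e2, wdens, flow, flowVec, map_sub, map_sum, map_smul, smul_eq_mul]
  rw [← sum_fderiv_pcof hO hF hp]
  simp only [add_mul, Finset.sum_add_distrib, Finset.sum_mul, sub_mul, Finset.mul_sum] at hw ⊢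
  set S1 := ∑ k, pcof F k p * fderiv ℂ a p (0, Pi.single k 1) * (starRingEnd ℂ) (C p) *
    ((χ p.2 * B (F p) : ℝ) : ℂ)
  have e3 : ∑ k, a p * pcof F k p * (starRingEnd ℂ) (C p) *
      wd (fun q : ℂ × Vec m => ((χ q.2 * B (F q) : ℝ) : ℂ)) p (0, Pi.single k 1) =
      a p * (starRingEnd ℂ) (C p) * ∑ k, pcof F k p *
      wd (fun q : ℂ × Vec m => ((χ q.2 * B (F q) : ℝ) : ℂ)) p (0, Pi.single k 1) := by
    rw [Finset.mul_sum]
    exact Finset.sum_congr rfl fun k _ => by ring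
  rw [e3]
  have hw' : pdet F p * wd (fun q : ℂ × Vec m => ((χ q.2 * B (F q) : ℝ) : ℂ)) p (1, 0) =
      ∑ k, pcof F k p *
      wd (fun q : ℂ × Vec m => ((χ q.2 * B (F q) : ℝ) : ℂ)) p (0, Pi.single k 1) := by
    rw [← Finset.mul_sum, neg_one_mul, ← sub_eq_add_neg] at hw
    exact sub_eq_zero.1 hw
  rw [← hw']
  ring

theorem integral_wd_slice_eq_zero {g : ℂ × Vec m → ℂ} {ζ : ℂ} {K : Set Vec m}
    (hK : IsCompact K) (hg : ∀ x ∈ K, ContDiffAt ℝ 1 g (ζ, x)) (h0 : ∀ᶠ s in 𝓝 ζ, ∀ x ∉ K, g (s, x) = 0)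
    (k : Fin m) : ∫ x in K, wd g (ζ, x) (0, Pi.single k 1) = 0 := by
  have hz : ∀ x ∉ K, g (ζ, x) = 0 := h0.self_of_nhds
  have hgl : ∀ x ∉ K, g =ᶠ[𝓝 (ζ, x)] fun _ => 0 := by
    intro x hx
    filter_upwards [(hK.isClosed.isOpen_compl.preimage continuous_snd).mem_nhds
      (show (ζ, x) ∈ Prod.snd ⁻¹' Kᶜ from hx), continuous_fst.continuousAt.eventually h0]
      with p hp1 hp2
    exact hp2 _ hp1
  have hg' : ∀ x, ContDiffAt ℝ 1 g (ζ, x) := fun x => by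
    by_cases hx : x ∈ K
    · exact hg x hx
    · exact contDiffAt_const.congr_of_eventuallyEq (hgl x hx)
  have hG : ContDiff ℝ 1 fun x => g (ζ, x) := by
    rw [contDiff_iff_contDiffAt]
    intro x
    exact ContDiffAt.comp (g := g) x (hg' x) (by fun_prop)
  have hcs : HasCompactSupport fun x => g (ζ, x) := HasCompactSupport.intro hK hz
  have hfd : ∀ x v, fderiv ℝ (fun y => g (ζ, y)) x v = fderiv ℝ g (ζ, x) (0, v) := by
    intro x v
    have := HasFDerivAt.comp (g := g) x ((hg' x).differentiableAt one_ne_zero).hasFDerivAt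
      (hasFDerivAt_prodMk_right (𝕜 := ℝ) ζ x)
    have h2 := this.fderiv
    simp only [Function.comp_def] at h2
    rw [h2]; rfl
  have hint : ∀ v, Integrable fun x => fderiv ℝ (fun y => g (ζ, y)) x v := fun v =>
    ((hG.continuous_fderiv one_ne_zero).clm_apply continuous_const).integrable_of_hasCompactSupport
      (hcs.fderiv_apply (𝕜 := ℝ) v)
  have e : ∀ x, wd g (ζ, x) (0, Pi.single k 1) =
      (1 / 2) * (fderiv ℝ (fun y => g (ζ, y)) x (Pi.single k 1) -
        I * fderiv ℝ (fun y => g (ζ, y)) x (I • Pi.single k 1)) := by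
    intro x
    simp only [wd, hfd, Prod.smul_mk, smul_zero]
  rw [setIntegral_eq_integral_of_forall_compl_eq_zero]
  · simp only [e]
    rw [integral_const_mul, integral_sub (hint _) ((hint _).const_mul _), integral_const_mul,
      integral_fderiv_eq_zero_of_hasCompactSupport hG hcs,
      integral_fderiv_eq_zero_of_hasCompactSupport hG hcs]
    simp
  · intro x hx
    have : fderiv ℝ g (ζ, x) = 0 := by
      rw [(hgl x hx).fderiv_eq]; simp
    simp [wd, this]

/-- Transport: the `ζ`-derivative of a weighted integral with holomorphic coefficient `a * det` is
the weighted integral of the flow derivative of `a`. -/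
theorem wd_wint (hO : IsOpen O) (hF : ContDiffOn ℂ ω F O) (hχ : ContDiff ℝ 1 χ)
    (hχc : HasCompactSupport χ) (hB : ContDiff ℝ 1 B) {a C : ℂ × Vec m → ℂ}
    (ha : ContDiffOn ℂ ω a O) (hC : ContDiffOn ℂ ω C O) {ζ : ℂ}
    (hζ : ∀ x ∈ tsupport χ, (ζ, x) ∈ O)
    (h : ∀ x ∈ tsupport χ, B (F (ζ, x)) = 0 ∨ fderiv ℝ χ x = 0) :
    wd (wint F χ B (fun q => a q * pdet F q) C) ζ 1 = wint F χ B (flow F a) C ζ := by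
  have hd := contDiffOn_pdet hO hF
  have hc := contDiffOn_pcof hO hF
  have hK : IsCompact (tsupport χ) := hχc
  have hu := contDiffOn_wdens hF hχ hB (ha.mul hd) hC
  have huk := fun k => contDiffOn_wdens hF hχ hB (ha.mul (hc k)) hC
  have huf := contDiffOn_wdens hF hχ hB (contDiffOn_flow hO hF ha) hC
  have hD := (setIntegral_param_of_contDiffOn (μ := (volume : Measure Vec m))
    (u := fun s x => wdens F χ B (fun q => a q * pdet F q) C (s, x)) hO hK hζ hu).1
  have e0 : wint F χ B (fun q => a q * pdet F q) C =
      fun s => ∫ x in tsupport χ, wdens F χ B (fun q => a q * pdet F q) C (s, x) :=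
    funext fun s => wint_eq_setIntegral _ _ s
  have hslice : ContinuousOn (fun x : Vec m => (ζ, x)) (tsupport χ) := by fun_prop
  have hcont : ∀ {g : ℂ × Vec m → ℂ}, ContDiffOn ℝ 1 g O → ∀ v,
      ContinuousOn (fun x => fderiv ℝ g (ζ, x) v) (tsupport χ) := fun {g} hg v =>
    ((hg.continuousOn_fderiv_of_isOpen hO le_rfl).comp hslice hζ).clm_apply continuousOn_const
  have hsl : ∀ x ∈ tsupport χ, fderiv ℝ (fun s => wdens F χ B (fun q => a q * pdet F q) C (s, x)) ζ =
      (fderiv ℝ (wdens F χ B (fun q => a q * pdet F q) C) (ζ, x)).comp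
        (inl ℝ ℂ Vec m) := by
    intro x hx
    have := HasFDerivAt.comp (g := wdens F χ B (fun q => a q * pdet F q) C)
      (f := fun s => (s, x)) ζ
      ((hu.contDiffAt (hO.mem_nhds (hζ x hx))).differentiableAt one_ne_zero).hasFDerivAt
      (hasFDerivAt_prodMk_left (𝕜 := ℝ) ζ x)
    exact this.fderiv
  have hfi : IntegrableOn (fun x => fderiv ℝ (fun s => wdens F χ B (fun q => a q * pdet F q) C (s, x)) ζ)
      (tsupport χ) := by
    refine ContinuousOn.integrableOn_compact hK ?_
    refine ContinuousOn.congr ?_ hsl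
    exact ((hu.continuousOn_fderiv_of_isOpen hO le_rfl).comp hslice hζ).clm_comp continuousOn_const
  have hwdint : ∀ {g : ℂ × Vec m → ℂ}, ContDiffOn ℝ 1 g O → ∀ v,
      IntegrableOn (fun x => wd g (ζ, x) v) (tsupport χ) := fun {g} hg v => by
    refine ContinuousOn.integrableOn_compact hK ?_
    exact continuousOn_const.mul ((hcont hg _).sub (continuousOn_const.mul (hcont hg _)))
  have e1 : wd (wint F χ B (fun q => a q * pdet F q) C) ζ 1 =
      ∫ x in tsupport χ, wd (wdens F χ B (fun q => a q * pdet F q) C) (ζ, x) (1, 0) := by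
    simp only [wd]
    rw [e0, hD.fderiv, ContinuousLinearMap.integral_apply hfi, ContinuousLinearMap.integral_apply hfi,
      ← integral_const_mul, ← integral_sub, ← integral_const_mul]
    · refine setIntegral_congr_fun hK.measurableSet fun x hx => ?_
      simp only [hsl x hx, comp_apply, ContinuousLinearMap.inl_apply,
        Prod.smul_mk, smul_zero]
    · exact hfi.apply_continuousLinearMap _
    · exact (hfi.apply_continuousLinearMap _).const_mul _
  rw [e1, wint_eq_setIntegral, setIntegral_congr_fun hK.measurableSet fun x hx =>
    wd_wdens_transport hO hF hχ hB ha hC (hζ x hx) (h x hx), integral_add, integral_finsetSum]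
  · rw [Finset.sum_eq_zero, add_zero]
    intro k _
    exact integral_wd_slice_eq_zero hK (fun x hx => (huk k).contDiffAt (hO.mem_nhds (hζ x hx)))
      (.of_forall fun s x hx => wdens_eq_zero hx) k
  · exact fun k _ => hwdint (huk k) _
  · exact ContinuousOn.integrableOn_compact hK (huf.continuousOn.comp hslice hζ)
  · exact integrable_finsetSum _ fun k _ => hwdint (huk k) _

theorem contDiffAt_wint (hO : IsOpen O) (hF : ContDiffOn ℂ ω F O) (hχ : ContDiff ℝ 1 χ)
    (hχc : HasCompactSupport χ) (hB : ContDiff ℝ 1 B) {A C : ℂ × Vec m → ℂ}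
    (hA : ContDiffOn ℂ ω A O) (hC : ContDiffOn ℂ ω C O) {ζ : ℂ}
    (hζ : ∀ x ∈ tsupport χ, (ζ, x) ∈ O) : ContDiffAt ℝ 1 (wint F χ B A C) ζ := by
  have hK : IsCompact (tsupport χ) := hχc
  have := (setIntegral_param_of_contDiffOn (μ := (volume : Measure Vec m))
    (u := fun s x => wdens F χ B A C (s, x)) hO hK hζ (contDiffOn_wdens hF hχ hB hA hC)).2
  exact this.congr_of_eventuallyEq (.of_forall fun s => wint_eq_setIntegral _ _ s)

end WeightedIntegral

section Consequences

variable {m : ℕ} {O : Set (ℂ × Vec m)} {F : ℂ × Vec m → Vec m}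
  {χ : Vec m → ℝ} {B : Vec m → ℝ}

/-- Admissibility of the localization at the parameter `ζ`: the weight has no boundary
contribution. -/
structure Adm (O : Set (ℂ × Vec m)) (F : ℂ × Vec m → Vec m)
    (χ B : Vec m → ℝ) (ζ : ℂ) : Prop where
  mem : ∀ x ∈ tsupport χ, (ζ, x) ∈ O
  sep : ∀ x ∈ tsupport χ, B (F (ζ, x)) = 0 ∨ fderiv ℝ χ x = 0

/-- The regularity assumptions on a localized family. -/
structure Fam (O : Set (ℂ × Vec m)) (F : ℂ × Vec m → Vec m)
    (χ B : Vec m → ℝ) : Prop where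
  isOpen : IsOpen O
  holo : ContDiffOn ℂ ω F O
  smooth : ContDiff ℝ 1 χ
  compact : HasCompactSupport χ
  smoothB : ContDiff ℝ 1 B
  nonneg : ∀ x, 0 ≤ χ x
  nonnegB : ∀ y, 0 ≤ B y

theorem flow_one (F : ℂ × Vec m → Vec m) (p) : flow F (fun _ => 1) p = 0 := by
  simp [flow]

theorem Fam.wd_wint_pdet (hf : Fam O F χ B) {a C : ℂ × Vec m → ℂ} (ha : ContDiffOn ℂ ω a O)
    (hC : ContDiffOn ℂ ω C O) {ζ : ℂ} (h : Adm O F χ B ζ) :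
    wd (wint F χ B (fun q => a q * pdet F q) C) ζ 1 = wint F χ B (flow F a) C ζ :=
  wd_wint hf.isOpen hf.holo hf.smooth hf.compact hf.smoothB ha hC h.mem h.sep

theorem Fam.wd_star_wint (hf : Fam O F χ B) {a C : ℂ × Vec m → ℂ} (ha : ContDiffOn ℂ ω a O)
    (hC : ContDiffOn ℂ ω C O) {ζ : ℂ} (h : Adm O F χ B ζ) :
    wd (fun s => (starRingEnd ℂ) (wint F χ B C (fun q => a q * pdet F q) s)) ζ 1 =
      wint F χ B (flow F a) C ζ := by
  simp only [wint_star]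
  exact hf.wd_wint_pdet ha hC h

theorem Fam.differentiableAt_wint (hf : Fam O F χ B) {C : ℂ × Vec m → ℂ}
    (hC : ContDiffOn ℂ ω C O) {ζ : ℂ} (h : Adm O F χ B ζ) :
    DifferentiableAt ℂ (wint F χ B C (pdet F)) ζ := by
  have hd := contDiffOn_pdet hf.isOpen hf.holo
  refine differentiableAt_of_wd_star ((contDiffAt_wint hf.isOpen hf.holo hf.smooth hf.compact
    hf.smoothB hC hd h.mem).differentiableAt one_ne_zero) ?_
  have := hf.wd_star_wint (a := fun _ => 1) contDiffOn_const hC h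
  simp only [one_mul] at this
  rw [this]
  unfold wint
  simp [flow_one]

/-- The total mass `∫ |det|² β` is locally constant in the parameter. -/
theorem Fam.deriv_wint_pdet (hf : Fam O F χ B) {ζ : ℂ} (h : Adm O F χ B ζ) :
    HasDerivAt (wint F χ B (pdet F) (pdet F)) 0 ζ := by
  have hd := contDiffOn_pdet hf.isOpen hf.holo
  have h1 := hf.differentiableAt_wint hd h
  have h2 := hf.wd_wint_pdet (a := fun _ => 1) contDiffOn_const hd h
  simp only [one_mul] at h2
  rw [wd_of_holo h1] at h2
  have h3 : wint F χ B (flow F fun _ => 1) (pdet F) ζ = 0 := by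
    unfold wint; simp [flow_one]
  have := h1.hasDerivAt
  rwa [show deriv (wint F χ B (pdet F) (pdet F)) ζ = 0 from by
    rw [← fderiv_apply_one_eq_deriv, h2, h3]] at this

theorem Fam.wint_pdet_eq (hf : Fam O F χ B) {D : Set ℂ} (hD : IsOpen D) (hDc : IsPreconnected D)
    (h : ∀ ζ ∈ D, Adm O F χ B ζ) {ζ ζ' : ℂ} (h1 : ζ ∈ D) (h2 : ζ' ∈ D) :
    wint F χ B (pdet F) (pdet F) ζ = wint F χ B (pdet F) (pdet F) ζ' :=
  hD.is_const_of_deriv_eq_zero hDc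
    (fun z hz => (hf.deriv_wint_pdet (h z hz)).differentiableAt.differentiableWithinAt)
    (fun z hz => (hf.deriv_wint_pdet (h z hz)).deriv) h1 h2

/-- The weighted square norm of a coefficient. -/
noncomputable def wsq (F : ℂ × Vec m → Vec m) (χ B : Vec m → ℝ)
    (A : ℂ × Vec m → ℂ) (ζ : ℂ) : ℝ :=
  ∫ x, ‖A (ζ, x)‖ ^ 2 * (χ x * B (F (ζ, x)))

theorem wint_self (A : ℂ × Vec m → ℂ) (ζ : ℂ) :
    wint F χ B A A ζ = (wsq F χ B A ζ : ℂ) := by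
  unfold wint wsq
  rw [← integral_complex_ofReal]
  refine integral_congr_ae (.of_forall fun x => ?_)
  simp only [Complex.mul_conj, normSq_eq_norm_sq]
  push_cast
  ring

theorem Fam.integrable_norm (hf : Fam O F χ B) {A C : ℂ × Vec m → ℂ}
    (hA : ContinuousOn A O) (hC : ContinuousOn C O) {ζ : ℂ} (h : ∀ x ∈ tsupport χ, (ζ, x) ∈ O) :
    Integrable fun x => ‖A (ζ, x)‖ * ‖C (ζ, x)‖ * (χ x * B (F (ζ, x))) := by
  have hK : IsCompact (tsupport χ) := hf.compact
  have hslice : ContinuousOn (fun x : Vec m => (ζ, x)) (tsupport χ) := by fun_prop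
  have h1 : IntegrableOn (fun x => ‖A (ζ, x)‖ * ‖C (ζ, x)‖ * (χ x * B (F (ζ, x))))
      (tsupport χ) := by
    refine ContinuousOn.integrableOn_compact hK ?_
    exact ((hA.comp hslice h).norm.mul (hC.comp hslice h).norm).mul
      (hf.smooth.continuous.continuousOn.mul
        (hf.smoothB.continuous.comp_continuousOn (hf.holo.continuousOn.comp hslice h)))
  refine (integrableOn_iff_integrable_of_support_subset ?_).1 h1
  intro x hx
  by_contra hx'
  exact hx (by simp [image_eq_zero_of_notMem_tsupport hx'])

theorem Fam.weight_nonneg (hf : Fam O F χ B) (p : ℂ × Vec m) : 0 ≤ χ p.2 * B (F p) :=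
  mul_nonneg (hf.nonneg _) (hf.nonnegB _)

theorem Fam.wsq_nonneg (hf : Fam O F χ B) (A : ℂ × Vec m → ℂ) (ζ : ℂ) : 0 ≤ wsq F χ B A ζ :=
  integral_nonneg fun x => mul_nonneg (by positivity) (hf.weight_nonneg (ζ, x))

theorem Fam.norm_wint_le (hf : Fam O F χ B) {A C : ℂ × Vec m → ℂ}
    (hA : ContinuousOn A O) (hC : ContinuousOn C O) {ζ : ℂ} (h : ∀ x ∈ tsupport χ, (ζ, x) ∈ O) :
    ‖wint F χ B A C ζ‖ ^ 2 ≤ wsq F χ B A ζ * wsq F χ B C ζ := by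
  set I := ∫ x, ‖A (ζ, x)‖ * ‖C (ζ, x)‖ * (χ x * B (F (ζ, x))) with hI
  have h1 : ‖wint F χ B A C ζ‖ ≤ I := by
    refine (norm_integral_le_integral_norm _).trans_eq ?_
    refine integral_congr_ae (.of_forall fun x => ?_)
    have := hf.weight_nonneg (ζ, x)
    simp only [norm_mul, RCLike.norm_conj, norm_real, Real.norm_eq_abs, abs_of_nonneg this,
      ← abs_mul]
  have hAA := hf.integrable_norm hA hA h
  have hAC := hf.integrable_norm hA hC h
  have hCC := hf.integrable_norm hC hC h
  have h2 : ∀ t : ℝ, 0 ≤ wsq F χ B A ζ * (t * t) + 2 * I * t + wsq F χ B C ζ := by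
    intro t
    have h3 : 0 ≤ ∫ x, (‖A (ζ, x)‖ * t + ‖C (ζ, x)‖) ^ 2 * (χ x * B (F (ζ, x))) :=
      integral_nonneg fun x => mul_nonneg (by positivity) (hf.weight_nonneg (ζ, x))
    have h4 : ∫ x, (‖A (ζ, x)‖ * t + ‖C (ζ, x)‖) ^ 2 * (χ x * B (F (ζ, x))) =
        wsq F χ B A ζ * (t * t) + 2 * I * t + wsq F χ B C ζ := by
      rw [hI, wsq, wsq, mul_comm 2, mul_assoc, ← integral_mul_const, ← integral_mul_const,
        ← integral_add, ← integral_add]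
      · exact integral_congr_ae (.of_forall fun x => by ring)
      · exact ((hAA.mul_const (t * t)).add (hAC.mul_const (2 * t))).congr
          (.of_forall fun x => by simp only [Pi.add_apply]; ring)
      · simpa only [pow_two] using hCC
      · simpa only [pow_two] using hAA.mul_const (t * t)
      · exact hAC.mul_const (2 * t)
    rwa [h4] at h3
  have h5 := discrim_le_zero h2
  rw [discrim] at h5
  have h6 : 0 ≤ ‖wint F χ B A C ζ‖ := norm_nonneg _
  nlinarith

theorem Fam.wsq_mul_le (hf : Fam O F χ B) {b A : ℂ × Vec m → ℂ} (hb : ContinuousOn b O)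
    (hA : ContinuousOn A O) {ζ : ℂ} (h : ∀ x ∈ tsupport χ, (ζ, x) ∈ O) {M : ℝ}
    (hM : ∀ x ∈ tsupport χ, B (F (ζ, x)) ≠ 0 → ‖b (ζ, x)‖ ≤ M) :
    wsq F χ B (fun q => b q * A q) ζ ≤ M ^ 2 * wsq F χ B A ζ := by
  unfold wsq
  rw [← integral_const_mul]
  refine integral_mono ?_ ?_ fun x => ?_
  · refine (hf.integrable_norm (hb.mul hA) (hb.mul hA) h).congr
      (.of_forall fun x => ?_)
    simp only [Pi.mul_apply]
    ring
  · refine ((hf.integrable_norm hA hA h).const_mul (M ^ 2)).congr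
      (.of_forall fun x => ?_)
    simp only []
    ring
  · simp only []
    by_cases hx : x ∈ tsupport χ
    · by_cases hB : B (F (ζ, x)) = 0
      · simp [hB]
      · have h1 := hM x hx hB
        have h2 := hf.weight_nonneg (ζ, x)
        have h3 : ‖b (ζ, x)‖ ^ 2 ≤ M ^ 2 := by gcongr
        have h4 : 0 ≤ ‖A (ζ, x)‖ ^ 2 * (χ x * B (F (ζ, x))) := mul_nonneg (by positivity) h2
        rw [norm_mul, mul_pow, mul_assoc]
        exact mul_le_mul_of_nonneg_right h3 h4
    · simp [image_eq_zero_of_notMem_tsupport hx]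

end Consequences

section RealCalculus

theorem HasFDerivAt.sqR {g : ℂ → ℝ} {L : ℂ →L[ℝ] ℝ} {z : ℂ} (h : HasFDerivAt g L z) :
    HasFDerivAt (fun y => g y ^ 2) ((2 * g z) • L) z := by
  have := h.fun_mul h
  simp only [← pow_two] at this
  refine this.congr_fderiv ?_
  ext y
  simp
  ring

theorem HasFDerivAt.ofRealC {g : ℂ → ℝ} {L : ℂ →L[ℝ] ℝ} {z : ℂ} (h : HasFDerivAt g L z) :
    HasFDerivAt (fun y => (g y : ℂ)) (ofRealCLM.comp L) z :=
  ofRealCLM.hasFDerivAt.comp z h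

theorem sqrt_le_sqrt_add_of_deriv_le {u u' : ℝ → ℝ} {K : ℝ}
    (hu : ∀ s ∈ Icc (0 : ℝ) 1, HasDerivAt u (u' s) s) (h0 : ∀ s, 0 ≤ u s)
    (hK : ∀ s ∈ Icc (0 : ℝ) 1, u' s ≤ 2 * (K * √(u s))) (hK0 : 0 ≤ K) : √(u 1) ≤ √(u 0) + K := by
  refine le_of_forall_pos_le_add fun δ hδ => ?_
  have hpos : ∀ s, 0 < u s + δ ^ 2 := fun s => by have := h0 s; positivity
  have hv : ∀ s ∈ Icc (0 : ℝ) 1, HasDerivAt (fun s => √(u s + δ ^ 2)) (u' s / (2 * √(u s + δ ^ 2))) s :=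
    fun s hs => ((hu s hs).add_const _).sqrt (hpos s).ne'
  have h1 := (convex_Icc (0 : ℝ) 1).image_sub_le_mul_sub_of_deriv_le
    (f := fun s => √(u s + δ ^ 2)) (fun s hs => (hv s hs).continuousAt.continuousWithinAt)
    (fun s hs => (hv s (interior_subset hs)).differentiableAt.differentiableWithinAt) (C := K)
    (fun s hs => by
      rw [(hv s (interior_subset hs)).deriv, div_le_iff₀ (by have := Real.sqrt_pos.2 (hpos s); linarith)]
      have h2 := hK s (interior_subset hs)
      have h3 : √(u s) ≤ √(u s + δ ^ 2) := Real.sqrt_le_sqrt (by nlinarith)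
      nlinarith)
    0 (by simp) 1 (by simp) zero_le_one
  have h2 : √(u 1) ≤ √(u 1 + δ ^ 2) := Real.sqrt_le_sqrt (by nlinarith)
  have h3 : √(u 0 + δ ^ 2) ≤ √(u 0) + δ := by
    have := Real.sqrt_nonneg (u 0)
    rw [Real.sqrt_le_left (by positivity)]
    nlinarith [Real.sq_sqrt (h0 0)]
  linarith

theorem mul_le_add_of_sq_le {ρ T v N w : ℝ} (hv : 0 ≤ v) (hw : 0 ≤ w) (hN : 0 ≤ N)
    (h : T ^ 2 ≤ N * (w * v)) : 4 * ρ * T ≤ 4 * v * N + ρ ^ 2 * w := by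
  refine (abs_le_of_sq_le_sq' ?_ (by positivity)).2
  have h1 := mul_le_mul_of_nonneg_left h (by positivity : 0 ≤ 16 * ρ ^ 2)
  have h2 := sq_nonneg (4 * v * N - ρ ^ 2 * w)
  linarith [show (4 * ρ * T) ^ 2 = 16 * ρ ^ 2 * T ^ 2 by ring,
    show (4 * v * N + ρ ^ 2 * w) ^ 2 = (4 * v * N - ρ ^ 2 * w) ^ 2 + 16 * ρ ^ 2 * (N * (w * v)) by ring]

theorem second_deriv_nonpos_of_isLocalMax {φ φ' : ℝ → ℝ} {d : ℝ}
    (h1 : ∀ᶠ s in 𝓝 0, HasDerivAt φ (φ' s) s) (h2 : HasDerivAt φ' d 0) (h3 : IsLocalMax φ 0) :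
    d ≤ 0 := by
  by_contra! hd
  have e1 : deriv φ =ᶠ[𝓝 0] φ' := h1.mono fun s hs => hs.deriv
  have e2 : deriv (deriv φ) 0 = d := by rw [e1.deriv_eq, h2.deriv]
  have h4 : IsLocalMin φ 0 := isLocalMin_of_deriv_deriv_pos (by rw [e2]; exact hd)
    h3.deriv_eq_zero h1.self_of_nhds.continuousAt
  have h5 : φ =ᶠ[𝓝 0] fun _ => φ 0 := by
    filter_upwards [h3, h4] with s hs hs'
    exact le_antisymm hs hs'
  have h6 : deriv φ =ᶠ[𝓝 0] fun _ => 0 := by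
    have := h5.deriv
    simpa using this
  rw [h6.deriv_eq] at e2
  simp at e2
  linarith

theorem laplacian_nonpos_of_isLocalMax {Φ : ℂ → ℝ} {W : ℂ → ℂ} {L : ℂ →L[ℝ] ℂ} {z : ℂ}
    (h1 : ∀ᶠ y in 𝓝 z, ∃ L' : ℂ →L[ℝ] ℝ, HasFDerivAt Φ L' y ∧ ∀ v, L' v = 2 * (W y * v).re)
    (h2 : HasFDerivAt W L z) (h3 : IsLocalMax Φ z) : (L 1 + I * L I).re ≤ 0 := by
  have key : ∀ e : ℂ, (L e * e).re ≤ 0 := by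
    intro e
    have hline : ∀ s : ℝ, HasDerivAt (fun s : ℝ => z + s • e) e s := fun s => by
      simpa using ((hasDerivAt_id s).smul_const e).const_add z
    have hcont : Tendsto (fun s : ℝ => z + s • e) (𝓝 0) (𝓝 z) := by
      have := (hline 0).continuousAt.tendsto
      simpa using this
    have hd : HasDerivAt (fun s : ℝ => 2 * (W (z + s • e) * e).re) (2 * (L e * e).re) 0 := by
      have h2' : HasFDerivAt W L (z + (0 : ℝ) • e) := by simpa using h2
      have h4 : HasDerivAt (fun s : ℝ => W (z + s • e)) (L e) 0 := h2'.comp_hasDerivAt 0 (hline 0)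
      have h5 := (reCLM.hasFDerivAt.comp_hasDerivAt 0 (h4.mul_const e)).const_mul 2
      exact h5
    have := second_deriv_nonpos_of_isLocalMax (φ := fun s : ℝ => Φ (z + s • e)) ?_ hd ?_
    · linarith
    · filter_upwards [hcont.eventually h1] with s hs
      obtain ⟨L', hL', hv⟩ := hs
      rw [← hv]
      exact hL'.comp_hasDerivAt s (hline s)
    · have h4 := hcont.eventually h3
      filter_upwards [h4] with s hs
      simpa using hs
  have k1 := key 1
  have k2 := key I
  simp only [mul_one, Complex.add_re] at *
  rw [mul_comm I]
  linarith

/-- Interior gradient estimate: if `∂̄∂u = v`, `∂̄∂v = w` and `|∂v|² ≤ v w`, then `v` at the centre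
is controlled by the supremum of `u`. -/
theorem sq_mul_le_of_wirtinger {u v w : ℂ → ℝ} {u₁ v₁ : ℂ → ℂ} {r M : ℝ} (hr : 0 < r)
    {Lu Lv : ℂ → ℂ →L[ℝ] ℝ} {Lu₁ Lv₁ : ℂ → ℂ →L[ℝ] ℂ}
    (hu : ∀ z ∈ closedBall (0 : ℂ) r, HasFDerivAt u (Lu z) z)
    (hu' : ∀ z ∈ closedBall (0 : ℂ) r, ∀ y, Lu z y = 2 * (u₁ z * y).re)
    (hv : ∀ z ∈ closedBall (0 : ℂ) r, HasFDerivAt v (Lv z) z)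
    (hv' : ∀ z ∈ closedBall (0 : ℂ) r, ∀ y, Lv z y = 2 * (v₁ z * y).re)
    (hu₁ : ∀ z ∈ closedBall (0 : ℂ) r, HasFDerivAt u₁ (Lu₁ z) z)
    (hu₁' : ∀ z ∈ closedBall (0 : ℂ) r, (Lu₁ z 1 + I * Lu₁ z I).re = 2 * v z)
    (hv₁ : ∀ z ∈ closedBall (0 : ℂ) r, HasFDerivAt v₁ (Lv₁ z) z)
    (hv₁' : ∀ z ∈ closedBall (0 : ℂ) r, (Lv₁ z 1 + I * Lv₁ z I).re = 2 * w z)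
    (hv0 : ∀ z, 0 ≤ v z) (hw0 : ∀ z, 0 ≤ w z) (hu0 : ∀ z, 0 ≤ u z)
    (hvw : ∀ z ∈ closedBall (0 : ℂ) r, ‖v₁ z‖ ^ 2 ≤ w z * v z)
    (hM : ∀ z ∈ closedBall (0 : ℂ) r, u z ≤ M) : r ^ 2 * v 0 ≤ 2 * M := by
  refine le_of_forall_pos_le_add fun ε hε => ?_
  set Φ : ℂ → ℝ := fun z => (r ^ 2 - (z.re ^ 2 + z.im ^ 2)) ^ 2 * v z + 2 * r ^ 2 * u z +
    ε * (z.re ^ 2 + z.im ^ 2) with hΦ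
  set W : ℂ → ℂ := fun z => ((-2 * (r ^ 2 - (z.re ^ 2 + z.im ^ 2)) * v z : ℝ) : ℂ) *
    (starRingEnd ℂ) z + (((r ^ 2 - (z.re ^ 2 + z.im ^ 2)) ^ 2 : ℝ) : ℂ) * v₁ z +
    ((2 * r ^ 2 : ℝ) : ℂ) * u₁ z + (ε : ℂ) * (starRingEnd ℂ) z with hW
  have hre : ∀ z : ℂ, HasFDerivAt (fun z : ℂ => z.re) reCLM z := fun z =>
    reCLM.hasFDerivAt
  have him : ∀ z : ℂ, HasFDerivAt (fun z : ℂ => z.im) imCLM z := fun z =>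
    imCLM.hasFDerivAt
  have hcj : ∀ z : ℂ, HasFDerivAt (fun z : ℂ => (starRingEnd ℂ) z) (conjCLE : ℂ →L[ℝ] ℂ) z :=
    fun z => conjCLE.hasFDerivAt
  have hN : ∀ z : ℂ, HasFDerivAt (fun z : ℂ => z.re ^ 2 + z.im ^ 2)
      ((2 * z.re) • reCLM + (2 * z.im) • imCLM) z := by
    intro z
    refine (((hre z).sqR).fun_add ((him z).sqR)).congr_fderiv ?_
    ext y; simp
  have hΦd : ∀ z ∈ closedBall (0 : ℂ) r, ∃ L' : ℂ →L[ℝ] ℝ, HasFDerivAt Φ L' z ∧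
      ∀ y, L' y = 2 * (W z * y).re := by
    intro z hz
    refine ⟨_, ((((hN z).const_sub (r ^ 2)).sqR).fun_mul (hv z hz)).fun_add ((hu z hz).const_mul (2 * r ^ 2))
      |>.fun_add ((hN z).const_mul ε), fun y => ?_⟩
    simp [hW, hu' z hz, hv' z hz, Complex.mul_re, Complex.mul_im, -ofReal_mul,
      -ofReal_pow, -Complex.ofReal_sub, -Complex.ofReal_add, -Complex.ofReal_neg]
    ring
  obtain ⟨z, hz, hmax⟩ := (isCompact_closedBall (0 : ℂ) r).exists_isMaxOn
    ⟨0, mem_closedBall_self hr.le⟩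
    (f := Φ) (fun z hz => by
      obtain ⟨L', hL', -⟩ := hΦd z hz
      exact hL'.continuousAt.continuousWithinAt)
  have hzn : z.re ^ 2 + z.im ^ 2 = ‖z‖ ^ 2 := by
    rw [← normSq_eq_norm_sq, normSq_apply]; ring
  have h0 : Φ 0 ≤ Φ z := hmax (mem_closedBall_self hr.le)
  have hzr : ‖z‖ ≤ r := by simpa using hz
  rcases hzr.eq_or_lt with h | h
  · simp only [hΦ] at h0
    rw [hzn, h] at h0
    simp at h0
    have h1 := hM z hz
    have h2 := hu0 0
    have h3 : r ^ 2 * (r ^ 2 * v 0) ≤ r ^ 2 * (2 * M + ε) := by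
      nlinarith [mul_nonneg (sq_nonneg r) h2, mul_le_mul_of_nonneg_left h1 (sq_nonneg r)]
    exact le_of_mul_le_mul_left h3 (by positivity)
  · exfalso
    have hzi : z ∈ ball (0 : ℂ) r := by simpa using h
    have hnb : ball (0 : ℂ) r ∈ 𝓝 z := isOpen_ball.mem_nhds hzi
    have hW' := (((((((hN z).const_sub (r ^ 2)).const_mul (-2)).fun_mul (hv z hz)).ofRealC.fun_mul
      (hcj z)).fun_add ((((hN z).const_sub (r ^ 2)).sqR).ofRealC.fun_mul (hv₁ z hz))).fun_add
      ((hu₁ z hz).const_mul ((2 * r ^ 2 : ℝ) : ℂ))).fun_add ((hcj z).const_mul (ε : ℂ))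
    have h1 := laplacian_nonpos_of_isLocalMax (Φ := Φ) (W := W)
      (by filter_upwards [hnb] with y hy using hΦd y (ball_subset_closedBall hy)) hW'
      (hmax.isLocalMax (mem_of_superset hnb ball_subset_closedBall))
    have a1 := hu₁' z hz
    have a2 := hv₁' z hz
    have a3 := hvw z hz
    have e1 := hv' z hz 1
    have e2 := hv' z hz I
    simp [Complex.mul_re, Complex.mul_im, -ofReal_mul,
      -ofReal_pow, -Complex.ofReal_sub, -Complex.ofReal_add, -Complex.ofReal_neg]
      at e1 e2 a1 a2 h1
    rw [e1, e2] at h1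
    have b1 : (Lu₁ z 1).re = 2 * v z + (Lu₁ z I).im := by linarith
    have b2 : (Lv₁ z 1).re = 2 * w z + (Lv₁ z I).im := by linarith
    rw [b1, b2] at h1
    rw [← normSq_eq_norm_sq, normSq_apply] at a3
    set N : ℝ := z.re ^ 2 + z.im ^ 2 with hNdef
    set T : ℝ := z.re * (v₁ z).re - z.im * (v₁ z).im with hT
    have hN0 : 0 ≤ N := by positivity
    have c1 : T ^ 2 ≤ N * (w z * v z) := by
      refine le_trans ?_ (mul_le_mul_of_nonneg_left a3 hN0)
      rw [hT, hNdef]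
      nlinarith [sq_nonneg (z.re * (v₁ z).im + z.im * (v₁ z).re)]
    have c2 : 4 * (r ^ 2 - N) * T ≤ 4 * v z * N + (r ^ 2 - N) ^ 2 * w z :=
      mul_le_add_of_sq_le (hv0 z) (hw0 z) hN0 c1
    have c3 : 8 * v z * N + 2 * ((r ^ 2 - N) ^ 2 * w z) - 8 * (r ^ 2 - N) * T + 2 * ε ≤ 0 := by
      refine le_trans (le_of_eq ?_) h1
      rw [hT, hNdef]
      ring
    linarith

end RealCalculus

section Transported

variable {m : ℕ} {O : Set (ℂ × Vec m)} {F : ℂ × Vec m → Vec m}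
  {χ B : Vec m → ℝ}

theorem wint_congr {A A' C C' : ℂ × Vec m → ℂ} {ζ : ℂ}
    (hA : ∀ x ∈ tsupport χ, A (ζ, x) = A' (ζ, x)) (hC : ∀ x ∈ tsupport χ, C (ζ, x) = C' (ζ, x)) :
    wint F χ B A C ζ = wint F χ B A' C' ζ := by
  unfold wint
  congr 1
  ext x
  by_cases hx : x ∈ tsupport χ
  · rw [hA x hx, hC x hx]
  · simp [image_eq_zero_of_notMem_tsupport hx]

theorem fderiv_real_eq_wd {u : ℂ → ℝ} {h : ℂ → ℂ} {ζ : ℂ} (hh : ∀ z, h z = (u z : ℂ))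
    (hd : DifferentiableAt ℝ h ζ) :
    HasFDerivAt u (fderiv ℝ u ζ) ζ ∧ ∀ y, fderiv ℝ u ζ y = 2 * (wd h ζ 1 * y).re := by
  have hu : u = fun z => (h z).re := by ext z; simp [hh]
  have hud : DifferentiableAt ℝ u ζ := by
    rw [hu]; exact reCLM.differentiableAt.comp ζ hd
  have hfd : fderiv ℝ h ζ = ofRealCLM.comp (fderiv ℝ u ζ) := by
    have : h = fun z => (u z : ℂ) := funext hh
    rw [this]
    exact (ofRealCLM.hasFDerivAt.comp ζ hud.hasFDerivAt).fderiv
  refine ⟨hud.hasFDerivAt, fun y => ?_⟩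
  have hy : y = y.re • (1 : ℂ) + y.im • I := by
    simp only [real_smul, mul_one]; exact (Complex.re_add_im y).symm
  have e : fderiv ℝ u ζ y = y.re * fderiv ℝ u ζ 1 + y.im * fderiv ℝ u ζ I := by
    conv_lhs => rw [hy]
    simp only [map_add, map_smul, smul_eq_mul]
  rw [e]
  simp [wd, hfd, Complex.mul_re, Complex.mul_im]
  ring

theorem re_dbar_eq {h : ℂ → ℂ} {ζ : ℂ} {v : ℝ}
    (hw : wd (fun s => (starRingEnd ℂ) (h s)) ζ 1 = v) :
    (fderiv ℝ h ζ 1 + I * fderiv ℝ h ζ I).re = 2 * v := by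
  rw [wd_star_eq] at hw
  have := congrArg Complex.re hw
  simp [Complex.mul_re] at this ⊢
  linarith

variable {g ψ : ℂ × Vec m → ℂ}

theorem Fam.hasFDerivAt_wsq (hf : Fam O F χ B) (hg : ContDiffOn ℂ ω g O)
    (hgψ : ∀ p ∈ O, flow F g p = ψ p * pdet F p) {ζ : ℂ} (h : Adm O F χ B ζ) :
    let u := wsq F χ B fun q => g q * pdet F q
    HasFDerivAt u (fderiv ℝ u ζ) ζ ∧ ∀ y, fderiv ℝ u ζ y =
      2 * (wint F χ B (fun q => ψ q * pdet F q) (fun q => g q * pdet F q) ζ * y).re := by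
  have hd := contDiffOn_pdet hf.isOpen hf.holo
  have hs := (contDiffAt_wint hf.isOpen hf.holo hf.smooth hf.compact hf.smoothB (hg.mul hd)
    (hg.mul hd) h.mem).differentiableAt one_ne_zero
  have := fderiv_real_eq_wd (fun z => wint_self (F := F) (χ := χ) (B := B)
    (fun q => g q * pdet F q) z) hs
  refine ⟨this.1, fun y => ?_⟩
  rw [this.2, hf.wd_wint_pdet hg (hg.mul hd) h]
  congr 3
  exact wint_congr (fun x hx => hgψ _ (h.mem x hx)) fun x hx => rfl

theorem Fam.re_dbar_wint (hf : Fam O F χ B) (hg : ContDiffOn ℂ ω g O) (hψ : ContDiffOn ℂ ω ψ O)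
    (hgψ : ∀ p ∈ O, flow F g p = ψ p * pdet F p) {ζ : ℂ} (h : Adm O F χ B ζ) :
    let u₁ := wint F χ B (fun q => ψ q * pdet F q) (fun q => g q * pdet F q)
    HasFDerivAt u₁ (fderiv ℝ u₁ ζ) ζ ∧ (fderiv ℝ u₁ ζ 1 + I * fderiv ℝ u₁ ζ I).re =
      2 * wsq F χ B (fun q => ψ q * pdet F q) ζ := by
  have hd := contDiffOn_pdet hf.isOpen hf.holo
  refine ⟨((contDiffAt_wint hf.isOpen hf.holo hf.smooth hf.compact hf.smoothB (hψ.mul hd)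
    (hg.mul hd) h.mem).differentiableAt one_ne_zero).hasFDerivAt, re_dbar_eq ?_⟩
  rw [hf.wd_star_wint hg (hψ.mul hd) h, ← wint_self]
  exact wint_congr (fun x hx => hgψ _ (h.mem x hx)) fun x hx => rfl

/-- Gradient estimate for weighted square norms of functions transported by the flow. -/
theorem Fam.sq_mul_wsq_le (hf : Fam O F χ B) (hg : ContDiffOn ℂ ω g O) (hψ : ContDiffOn ℂ ω ψ O)
    (hgψ : ∀ p ∈ O, flow F g p = ψ p * pdet F p) {r M : ℝ} (hr : 0 < r)
    (h : ∀ ζ ∈ closedBall (0 : ℂ) r, Adm O F χ B ζ)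
    (hM : ∀ ζ ∈ closedBall (0 : ℂ) r, wsq F χ B (fun q => g q * pdet F q) ζ ≤ M) :
    r ^ 2 * wsq F χ B (fun q => ψ q * pdet F q) 0 ≤ 2 * M := by
  have hd := contDiffOn_pdet hf.isOpen hf.holo
  have hfl := contDiffOn_flow hf.isOpen hf.holo hψ
  refine sq_mul_le_of_wirtinger (u := wsq F χ B fun q => g q * pdet F q)
    (v := wsq F χ B fun q => ψ q * pdet F q) (w := wsq F χ B (flow F ψ))
    (v₁ := wint F χ B (flow F ψ) fun q => ψ q * pdet F q) (Lv := fderiv ℝ (wsq F χ B fun q => ψ q * pdet F q)) hr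
    (fun z hz => (hf.hasFDerivAt_wsq hg hgψ (h z hz)).1)
    (fun z hz => (hf.hasFDerivAt_wsq hg hgψ (h z hz)).2) ?_ ?_
    (fun z hz => (hf.re_dbar_wint hg hψ hgψ (h z hz)).1)
    (fun z hz => (hf.re_dbar_wint hg hψ hgψ (h z hz)).2)
    (fun z hz => ((contDiffAt_wint hf.isOpen hf.holo hf.smooth hf.compact hf.smoothB hfl
      (hψ.mul hd) (h z hz).mem).differentiableAt one_ne_zero).hasFDerivAt)
    (fun z hz => re_dbar_eq ?_)
    (hf.wsq_nonneg _) (hf.wsq_nonneg _) (hf.wsq_nonneg _) (fun z hz => ?_) hM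
  · intro z hz
    have hs := (contDiffAt_wint hf.isOpen hf.holo hf.smooth hf.compact hf.smoothB (hψ.mul hd)
      (hψ.mul hd) (h z hz).mem).differentiableAt one_ne_zero
    exact (fderiv_real_eq_wd (fun z => wint_self (F := F) (χ := χ) (B := B) _ z) hs).1
  · intro z hz
    have hs := (contDiffAt_wint hf.isOpen hf.holo hf.smooth hf.compact hf.smoothB (hψ.mul hd)
      (hψ.mul hd) (h z hz).mem).differentiableAt one_ne_zero
    have := (fderiv_real_eq_wd (fun z => wint_self (F := F) (χ := χ) (B := B) _ z) hs).2
    intro y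
    rw [this, hf.wd_wint_pdet hψ (hψ.mul hd) (h z hz)]
  · rw [hf.wd_star_wint hψ hfl (h z hz), ← wint_self]
  · exact hf.norm_wint_le hfl.continuousOn (hψ.mul hd).continuousOn (h z hz).mem

theorem Fam.sqrt_wsq_le (hf : Fam O F χ B) (hg : ContDiffOn ℂ ω g O) (hψ : ContDiffOn ℂ ω ψ O)
    (hgψ : ∀ p ∈ O, flow F g p = ψ p * pdet F p) {ζ : ℂ} {M N : ℝ} (hM0 : 0 ≤ M)
    (h : ∀ s ∈ Icc (0 : ℝ) 1, Adm O F χ B (s • ζ))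
    (hM : ∀ s ∈ Icc (0 : ℝ) 1, ∀ x ∈ tsupport χ, B (F (s • ζ, x)) ≠ 0 → ‖ψ (s • ζ, x)‖ ≤ M)
    (hN : ∀ s ∈ Icc (0 : ℝ) 1, wsq F χ B (pdet F) (s • ζ) ≤ N) :
    √(wsq F χ B (fun q => g q * pdet F q) ζ) ≤
      √(wsq F χ B (fun q => g q * pdet F q) 0) + ‖ζ‖ * (M * √N) := by
  have hd := contDiffOn_pdet hf.isOpen hf.holo
  have hline : ∀ s : ℝ, HasDerivAt (fun s : ℝ => s • ζ) ((1 : ℝ) • ζ) s := fun s =>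
    (hasDerivAt_id s).smul_const ζ
  have hder : ∀ s ∈ Icc (0 : ℝ) 1, HasDerivAt
      (fun s : ℝ => wsq F χ B (fun q => g q * pdet F q) (s • ζ))
      (fderiv ℝ (wsq F χ B fun q => g q * pdet F q) (s • ζ) ((1 : ℝ) • ζ)) s := fun s hs =>
    HasFDerivAt.comp_hasDerivAt (l := wsq F χ B fun q => g q * pdet F q) s
      (hf.hasFDerivAt_wsq hg hgψ (h s hs)).1 (hline s)
  have key := sqrt_le_sqrt_add_of_deriv_le
    (u := fun s => wsq F χ B (fun q => g q * pdet F q) (s • ζ)) (K := ‖ζ‖ * (M * √N)) hder (fun s => hf.wsq_nonneg _ _) ?_ (by positivity)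
  · simpa using key
  · intro s hs
    rw [(hf.hasFDerivAt_wsq hg hgψ (h s hs)).2]
    have h1 := hf.norm_wint_le (hψ.mul hd).continuousOn (hg.mul hd).continuousOn (h s hs).mem
    have h2 := hf.wsq_mul_le hψ.continuousOn hd.continuousOn (h s hs).mem (hM s hs)
    set U := wsq F χ B (fun q => g q * pdet F q) (s • ζ) with hU
    have hU0 : 0 ≤ U := hf.wsq_nonneg _ _
    set P := wint F χ B (fun q => ψ q * pdet F q) (fun q => g q * pdet F q) (s • ζ) with hP
    have hN0 : 0 ≤ N := (hf.wsq_nonneg _ _).trans (hN s hs)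
    have h3 : ‖P‖ ≤ M * √N * √U := by
      refine abs_le_of_sq_le_sq' ?_ (by positivity) |>.2
      rw [mul_pow, mul_pow, Real.sq_sqrt hN0, Real.sq_sqrt hU0]
      refine h1.trans (mul_le_mul_of_nonneg_right (h2.trans ?_) hU0)
      exact mul_le_mul_of_nonneg_left (hN s hs) (by positivity)
    have h4 : (P * (1 : ℝ) • ζ).re ≤ ‖P‖ * ‖ζ‖ := by
      refine (Complex.re_le_norm _).trans (by simp)
    have h5 := mul_le_mul_of_nonneg_right h3 (norm_nonneg ζ)
    linarith

/-- The partial gradient in the fibre variables. -/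
noncomputable def pgrad (f : ℂ × Vec m → ℂ) (p : ℂ × Vec m) : Vec m :=
  fun k => fderiv ℂ f p (0, Pi.single k 1)

/-- The Legendre-type function `f - a - ⟨∂ₓ f, x⟩`. -/
noncomputable def ham (f : ℂ × Vec m → ℂ) (a : ℂ) (p : ℂ × Vec m) : ℂ :=
  f p - a - ∑ k, pgrad f p k * p.2 k

variable {f : ℂ × Vec m → ℂ}

theorem contDiffOn_pgrad (hO : IsOpen O) (hf : ContDiffOn ℂ ω f O) : ContDiffOn ℂ ω (pgrad f) O :=
  contDiffOn_pi.2 fun _ => contDiffOn_fderiv_apply hO hf _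

theorem contDiffOn_ham (hO : IsOpen O) (hf : ContDiffOn ℂ ω f O) (a : ℂ) :
    ContDiffOn ℂ ω (ham f a) O := by
  refine (hf.sub contDiffOn_const).sub (ContDiffOn.sum fun k _ =>
    (contDiffOn_fderiv_apply hO hf _).mul ?_)
  exact (contDiff_apply ℂ ℂ k |>.comp contDiff_snd).contDiffOn

theorem flow_ham (hO : IsOpen O) (hf : ContDiffOn ℂ ω f O) (a : ℂ) {p : ℂ × Vec m}
    (hp : p ∈ O) : flow (pgrad f) (ham f a) p = fderiv ℂ f p (1, 0) * pdet (pgrad f) p := by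
  have hf' : DifferentiableAt ℂ f p := (hf.contDiffAt (hO.mem_nhds hp)).differentiableAt (by simp)
  have hF' : DifferentiableAt ℂ (pgrad f) p :=
    ((contDiffOn_pgrad hO hf).contDiffAt (hO.mem_nhds hp)).differentiableAt (by simp)
  set F := pgrad f with hF
  set V := flowVec F p with hV
  have h1 : HasFDerivAt (ham f a) (fderiv ℂ f p - ∑ k, (F p k • (ContinuousLinearMap.proj k).comp
      (snd ℂ ℂ Vec m) + p.2 k • (ContinuousLinearMap.proj k).comp
      (fderiv ℂ F p))) p := by
    refine (hf'.hasFDerivAt.sub_const a).fun_sub (HasFDerivAt.fun_sum fun k _ => ?_)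
    refine HasFDerivAt.fun_mul ?_ ?_
    · exact (coordL ℂ k).hasFDerivAt.comp p
        hF'.hasFDerivAt
    · exact ((coordL ℂ k).comp
        (snd ℂ ℂ Vec m)).hasFDerivAt
  have h2 : fderiv ℂ F p V = 0 := fderiv_flowVec p
  have h3 : V.2 = fun k => - pcof F k p := by
    ext i
    simp [hV, flowVec, Prod.snd_sum, Finset.sum_apply, Pi.single_apply]
  have h4 : fderiv ℂ f p V = pdet F p * fderiv ℂ f p (1, 0) - ∑ k, pcof F k p * F p k := by
    simp only [hV, flowVec, map_sub, map_sum, map_smul, smul_eq_mul]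
    rfl
  unfold flow
  rw [h1.fderiv, ← hV]
  simp [h2, h3, h4, sum_apply, mul_comm]

end Transported

section Kernel

variable {m : ℕ}

/-- A radial bump function supported in the unit ball. -/
noncomputable def bump (y : Vec m) : ℝ := smoothTransition (1 - sqNorm y)

theorem contDiff_bump : ContDiff ℝ ∞ (bump (m := m)) :=
  smoothTransition.contDiff.comp (contDiff_const.sub contDiff_sqNorm)

theorem bump_nonneg (y : Vec m) : 0 ≤ bump y := smoothTransition.nonneg _

theorem norm_sq_le_sqNorm (y : Vec m) : ‖y‖ ^ 2 ≤ sqNorm y := by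
  have h : ‖y‖ ≤ √(sqNorm y) := by
    refine (pi_norm_le_iff_of_nonneg (Real.sqrt_nonneg _)).2 fun i => ?_
    refine Real.le_sqrt_of_sq_le ?_
    rw [← normSq_eq_norm_sq]
    exact Finset.single_le_sum (f := fun k => normSq (y k)) (fun k _ => normSq_nonneg _)
      (Finset.mem_univ i)
  calc ‖y‖ ^ 2 ≤ √(sqNorm y) ^ 2 := by gcongr
    _ = sqNorm y := Real.sq_sqrt (sqNorm_nonneg y)

theorem norm_lt_one_of_bump_ne_zero {y : Vec m} (h : bump y ≠ 0) : ‖y‖ < 1 := by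
  by_contra! h1
  refine h (smoothTransition.zero_of_nonpos ?_)
  nlinarith [norm_sq_le_sqNorm y]

theorem hasCompactSupport_bump : HasCompactSupport (bump (m := m)) := by
  refine HasCompactSupport.intro (isCompact_closedBall (0 : Vec m) 1) fun y hy => ?_
  by_contra h
  exact hy (by simpa using (norm_lt_one_of_bump_ne_zero h).le)

theorem integral_bump_pos : 0 < ∫ y : Vec m, bump y := by
  have h0 : (0 : ℝ) < bump (0 : Vec m) := smoothTransition.pos_of_pos (by simp [sqNorm])
  exact contDiff_bump.continuous.integral_pos_of_hasCompactSupport_nonneg_nonzero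
    hasCompactSupport_bump bump_nonneg h0.ne'

theorem bump_smul_of_norm_one {c : ℂ} (hc : ‖c‖ = 1) (y : Vec m) : bump (c • y) = bump y := by
  have : sqNorm (c • y) = sqNorm y := by
    simp [sqNorm, normSq_eq_norm_sq, hc]
  rw [bump, this, bump]

/-- The normalized bump of radius `η` centred at `c`. -/
noncomputable def kap (η : ℝ) (c y : Vec m) : ℝ :=
  (∫ y : Vec m, bump y)⁻¹ * ((η ^ (2 * m))⁻¹ * bump (η⁻¹ • (y - c)))

theorem contDiff_kap (η : ℝ) (c : Vec m) : ContDiff ℝ 1 (kap η c) := by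
  have h1 : ContDiff ℝ 1 fun y : Vec m => η⁻¹ • (y - c) :=
    (contDiff_id.sub contDiff_const).const_smul η⁻¹
  have h2 : ContDiff ℝ 1 fun y : Vec m => bump (η⁻¹ • (y - c)) :=
    (contDiff_bump.of_le (by simp)).comp h1
  exact contDiff_const.mul (contDiff_const.mul h2)

theorem kap_nonneg (η : ℝ) (c y : Vec m) : 0 ≤ kap η c y :=
  mul_nonneg (inv_nonneg.2 integral_bump_pos.le)
    (mul_nonneg (inv_nonneg.2 ((even_two_mul m).pow_nonneg η)) (bump_nonneg _))

theorem norm_sub_lt_of_kap_ne_zero {η : ℝ} (hη : 0 < η) {c y : Vec m} (h : kap η c y ≠ 0) :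
    ‖y - c‖ < η := by
  have h1 : bump (η⁻¹ • (y - c)) ≠ 0 := fun h' => h (by simp [kap, h'])
  have := norm_lt_one_of_bump_ne_zero h1
  rw [norm_smul, Real.norm_eq_abs, abs_of_pos (inv_pos.2 hη), inv_mul_lt_one₀ hη] at this
  exact this

theorem integral_kap {η : ℝ} (hη : 0 < η) (c : Vec m) : ∫ y, kap η c y = 1 := by
  unfold kap
  rw [integral_const_mul, integral_const_mul,
    integral_sub_right_eq_self (fun y : Vec m => bump (η⁻¹ • y)) c,
    Measure.integral_comp_smul]
  have h : Module.finrank ℝ Vec m = 2 * m := by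
    rw [Module.finrank_pi_fintype]; simp [Complex.finrank_real_complex, mul_comm]
  rw [h, smul_eq_mul, inv_pow, inv_inv, abs_of_pos (by positivity)]
  have := integral_bump_pos (m := m)
  field_simp

end Kernel

section SliceDet

variable {m : ℕ}

/-- The complex Jacobian determinant. -/
noncomputable def sdet (G : Vec m → Vec m) (x : Vec m) : ℂ :=
  (Matrix.of fun i k => fderiv ℂ G x (Pi.single k 1) i).det

theorem sdet_eq_det (G : Vec m → Vec m) (x : Vec m) :
    sdet G x = (fderiv ℂ G x).det := by
  rw [ContinuousLinearMap.det, ← LinearMap.det_toMatrix', sdet]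
  congr 1

theorem pdet_eq_sdet {F : ℂ × Vec m → Vec m} {ζ : ℂ} {x : Vec m}
    (hF : DifferentiableAt ℂ F (ζ, x)) : pdet F (ζ, x) = sdet (fun y => F (ζ, y)) x := by
  have h : HasFDerivAt (fun y => F (ζ, y)) ((fderiv ℂ F (ζ, x)).comp
      (inr ℂ ℂ Vec m)) x :=
    hF.hasFDerivAt.comp x (hasFDerivAt_prodMk_right ζ x)
  simp [pdet, pjac, sdet, h.fderiv]

theorem abs_det_restrictScalars (L : Vec m →L[ℂ] Vec m) :
    |(L.restrictScalars ℝ).det| = ‖L.det‖ ^ 2 := by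
  simp [ContinuousLinearMap.det, LinearMap.det_restrictScalars, Algebra.norm_complex_eq,
    normSq_eq_norm_sq]

theorem exists_nhds_integral_sdet {Ω : Set Vec m} (hΩ : IsOpen Ω)
    {G : Vec m → Vec m} (hG : ContDiffOn ℂ ω G Ω) {w : Vec m} (hw : w ∈ Ω)
    (hdet : sdet G w ≠ 0) {V₀ : Set Vec m} (hV₀ : V₀ ∈ 𝓝 w) :
    ∃ V ⊆ V₀ ∩ Ω, IsOpen V ∧ w ∈ V ∧ InjOn G V ∧ ∃ η₀ > 0, ball (G w) η₀ ⊆ G '' V ∧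
      ∀ β : Vec m → ℝ, (∀ y ∉ ball (G w) η₀, β y = 0) →
        ∫ x in V, ‖sdet G x‖ ^ 2 * β (G x) = ∫ y, β y := by
  have hGa : ContDiffAt ℂ ω G w := hG.contDiffAt (hΩ.mem_nhds hw)
  have hst : HasStrictFDerivAt G (fderiv ℂ G w) w := hGa.hasStrictFDerivAt (by simp)
  rw [sdet_eq_det] at hdet
  rw [← ContinuousLinearMap.coe_toContinuousLinearEquivOfDetNeZero _ hdet] at hst
  set e := hst.toOpenPartialHomeomorph G with he
  have hew : w ∈ e.source := hst.mem_toOpenPartialHomeomorph_source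
  have heG : (e : Vec m → Vec m) = G := hst.toOpenPartialHomeomorph_coe
  set V := e.source ∩ (interior V₀ ∩ Ω) with hV
  have hVo : IsOpen V := e.open_source.inter (isOpen_interior.inter hΩ)
  have hwV : w ∈ V := ⟨hew, mem_interior_iff_mem_nhds.2 hV₀, hw⟩
  have hinj : InjOn G V := by
    rw [← heG]; exact e.injOn.mono inter_subset_left
  have him : IsOpen (G '' V) := by
    rw [← heG]; exact e.isOpen_image_of_subset_source hVo inter_subset_left
  obtain ⟨η₀, hη₀, hball⟩ := isOpen_iff.1 him (G w) (mem_image_of_mem G hwV)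
  refine ⟨V, fun x hx => ⟨interior_subset hx.2.1, hx.2.2⟩, hVo, hwV, hinj, η₀, hη₀, hball,
    fun β hβ => ?_⟩
  have h1 := integral_image_eq_integral_abs_det_fderiv_smul volume hVo.measurableSet
    (f := G) (f' := fun x => (fderiv ℂ G x).restrictScalars ℝ) (fun x hx =>
      (((hG.contDiffAt (hΩ.mem_nhds hx.2.2)).differentiableAt (by simp)).hasFDerivAt.restrictScalars
        ℝ).hasFDerivWithinAt) hinj β
  rw [setIntegral_eq_integral_of_forall_compl_eq_zero fun y hy => hβ y fun h => hy (hball h)] at h1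
  rw [h1]
  simp only [abs_det_restrictScalars, sdet_eq_det, smul_eq_mul]

end SliceDet

section Mass

variable {m : ℕ}

/-- `∫ φ |det G'|² χ B(G)`. -/
noncomputable def mass (G : Vec m → Vec m) (χ B : Vec m → ℝ)
    (φ : Vec m → ℂ) : ℂ :=
  ∫ x, φ x * ((‖sdet G x‖ ^ 2 * (χ x * B (G x)) : ℝ) : ℂ)

/-- The zeros of `G` inside the support of `χ` are isolated from the region where `χ` varies. -/
structure IsoZ (Ω : Set Vec m) (G : Vec m → Vec m) (χ : Vec m → ℝ)
    (r : ℝ) : Prop where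
  isOpen : IsOpen Ω
  holo : ContDiffOn ℂ ω G Ω
  smooth : ContDiff ℝ 1 χ
  compact : HasCompactSupport χ
  nonneg : ∀ x, 0 ≤ χ x
  sub : tsupport χ ⊆ Ω
  pos : 0 < r
  sep : ∀ x ∈ tsupport χ, fderiv ℝ χ x = 0 ∨ r ≤ ‖G x‖

theorem wint_eq_mass {O : Set (ℂ × Vec m)} {F : ℂ × Vec m → Vec m}
    {χ B : Vec m → ℝ} (hO : IsOpen O) (hF : ContDiffOn ℂ ω F O)
    (φ : ℂ × Vec m → ℂ) {ζ : ℂ} (h : ∀ x ∈ tsupport χ, (ζ, x) ∈ O) :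
    wint F χ B (fun q => φ q * pdet F q) (pdet F) ζ =
      mass (fun x => F (ζ, x)) χ B fun x => φ (ζ, x) := by
  unfold wint mass
  congr 1
  ext x
  by_cases hx : x ∈ tsupport χ
  · have e := pdet_eq_sdet ((hF.contDiffAt (hO.mem_nhds (h x hx))).differentiableAt (by simp))
    have e2 := Complex.mul_conj (sdet (fun y => F (ζ, y)) x)
    rw [normSq_eq_norm_sq] at e2
    simp only [e]
    rw [mul_assoc (φ (ζ, x)), e2]
    push_cast
    ring
  · simp [image_eq_zero_of_notMem_tsupport hx]

theorem sdet_smul_sub (a : ℂ) (b : Vec m) {G : Vec m → Vec m} {x : Vec m}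
    (hG : DifferentiableAt ℂ G x) : sdet (fun y => a • (G y - b)) x = a ^ m * sdet G x := by
  have h : fderiv ℂ (fun y => a • (G y - b)) x = a • fderiv ℂ G x :=
    ((hG.hasFDerivAt.sub_const b).const_smul a).fderiv
  have h2 : (Matrix.of fun i k => (a • fderiv ℂ G x) (Pi.single k 1) i : Matrix (Fin m) (Fin m) ℂ) =
      a • Matrix.of fun i k => fderiv ℂ G x (Pi.single k 1) i := by
    ext i k; simp
  rw [sdet, h, h2, Matrix.det_smul, sdet, Fintype.card_fin]

theorem mass_smul_sub {Ω : Set Vec m} {G : Vec m → Vec m} {χ : Vec m → ℝ}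
    (hΩ : IsOpen Ω) (hG : ContDiffOn ℂ ω G Ω) (hχ : tsupport χ ⊆ Ω) {a : ℂ} (ha : a ≠ 0)
    (b : Vec m) (φ : Vec m → ℂ) :
    mass (fun x => a • (G x - b)) χ (kap 1 0) φ = mass G χ (kap ‖a‖⁻¹ b) φ := by
  unfold mass
  congr 1
  ext x
  by_cases hx : x ∈ tsupport χ
  · congr 2
    rw [sdet_smul_sub a b ((hG.contDiffAt (hΩ.mem_nhds (hχ hx))).differentiableAt (by simp))]
    have h1 : bump (a • (G x - b)) = bump ((‖a‖⁻¹)⁻¹ • (G x - b)) := by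
      rw [inv_inv]
      have : a • (G x - b) = (a / ‖a‖ : ℂ) • (‖a‖ • (G x - b)) := by
        rw [← Complex.coe_smul, smul_smul, div_mul_cancel₀ _ (by simpa using ha)]
      rw [this, bump_smul_of_norm_one (by simp [ha])]
    simp only [kap, inv_one, one_smul, sub_zero, h1, norm_mul, norm_pow]
    have : ‖a‖ ≠ 0 := by simpa using ha
    simp only [one_pow, inv_one, one_mul, inv_pow, inv_inv]
    ring
  · simp [image_eq_zero_of_notMem_tsupport hx]

theorem eq_of_re_invariant {h : ℂ → ℂ} {L : ℝ} (hd : ∀ ζ : ℂ, ζ.re < L → DifferentiableAt ℂ h ζ)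
    (hi : ∀ ζ : ℂ, h ζ = h ζ.re) {a b : ℝ} (ha : a < L) (hb : b < L) : h a = h b := by
  have hD : IsOpen {ζ : ℂ | ζ.re < L} := isOpen_lt Complex.continuous_re continuous_const
  have hc : IsPreconnected {ζ : ℂ | ζ.re < L} := (convex_halfSpace_re_lt L).isPreconnected
  refine hD.is_const_of_deriv_eq_zero hc (fun z hz => (hd z hz).differentiableWithinAt) ?_
    (by simpa using ha) (by simpa using hb)
  intro z hz
  have hl : HasDerivAt (fun t : ℝ => z + t * I) (1 * I) 0 :=
    ((ofRealCLM.hasDerivAt (x := (0 : ℝ))).mul_const I).const_add z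
  have h1 : HasDerivAt h (deriv h z) (z + (0 : ℝ) * I) := by simpa using (hd z hz).hasDerivAt
  have h2 := h1.comp (0 : ℝ) hl
  have h3 : (h ∘ fun t : ℝ => z + t * I) = fun _ => h z := by
    ext t
    simp only [Function.comp]
    rw [hi, hi z]
    simp
  rw [h3] at h2
  have := h2.unique (hasDerivAt_const (0 : ℝ) (h z))
  simpa using this

variable {Ω : Set Vec m} {G : Vec m → Vec m} {χ : Vec m → ℝ} {r : ℝ}

theorem kap_one_zero_eq_zero {y : Vec m} (h : 1 ≤ ‖y‖) : kap 1 0 y = 0 := by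
  by_contra h'
  have := norm_sub_lt_of_kap_ne_zero one_pos h'
  rw [sub_zero] at this
  linarith

theorem IsoZ.mass_kap_eq (hG : IsoZ Ω G χ r) {φ : Vec m → ℂ} (hφ : ContDiffOn ℂ ω φ Ω)
    {η η' : ℝ} (h0 : 0 < η) (h1 : η < r) (h0' : 0 < η') (h1' : η' < r) :
    mass G χ (kap η 0) φ = mass G χ (kap η' 0) φ := by
  set F : ℂ × Vec m → Vec m := fun p => Complex.exp (-p.1) • (G p.2 - 0) with hF
  set O : Set (ℂ × Vec m) := univ ×ˢ Ω with hO
  have hOo : IsOpen O := isOpen_univ.prod hG.isOpen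
  have hm : MapsTo Prod.snd O Ω := fun p hp => hp.2
  have hFh : ContDiffOn ℂ ω F O := by
    refine ContDiffOn.smul (contDiff_fst.neg.cexp).contDiffOn ?_
    simp only [sub_zero]
    exact hG.holo.comp contDiff_snd.contDiffOn hm
  have hf : Fam O F χ (kap 1 0) := ⟨hOo, hFh, hG.smooth, hG.compact, contDiff_kap 1 0, hG.nonneg,
    kap_nonneg 1 0⟩
  have hadm : ∀ ζ : ℂ, ζ.re < Real.log r → Adm O F χ (kap 1 0) ζ := by
    refine fun ζ hζ => ⟨fun x hx => ⟨mem_univ _, hG.sub hx⟩, fun x hx => ?_⟩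
    refine (hG.sep x hx).symm.imp (fun h => kap_one_zero_eq_zero ?_) id
    rw [hF]
    simp only [sub_zero, norm_smul, Complex.norm_exp, Complex.neg_re]
    have : Real.exp ζ.re ≤ ‖G x‖ := by
      refine le_trans ?_ h
      rw [← Real.exp_log hG.pos]
      exact Real.exp_le_exp.2 hζ.le
    rw [Real.exp_neg, inv_mul_eq_div, one_le_div (Real.exp_pos _)]
    exact this
  set C : ℂ × Vec m → ℂ := fun q => φ q.2 * pdet F q
  have hC : ContDiffOn ℂ ω C O :=
    (hφ.comp contDiff_snd.contDiffOn hm).mul (contDiffOn_pdet hOo hFh)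
  have hval : ∀ ζ : ℂ, wint F χ (kap 1 0) C (pdet F) ζ = mass G χ (kap (Real.exp ζ.re) 0) φ := by
    intro ζ
    rw [wint_eq_mass hOo hFh (fun q => φ q.2) (fun x hx => ⟨mem_univ _, hG.sub hx⟩)]
    have := mass_smul_sub (χ := χ) hG.isOpen hG.holo hG.sub (Complex.exp_ne_zero (-ζ)) 0 φ
    rw [Complex.norm_exp, Complex.neg_re, Real.exp_neg, inv_inv] at this
    exact this
  have key := eq_of_re_invariant (h := wint F χ (kap 1 0) C (pdet F)) (L := Real.log r)
    (fun ζ hζ => hf.differentiableAt_wint hC (hadm ζ hζ)) (fun ζ => by rw [hval, hval]; simp)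
    (Real.log_lt_log h0 h1) (Real.log_lt_log h0' h1')
  rw [hval, hval] at key
  simpa [Real.exp_log h0, Real.exp_log h0'] using key

theorem IsoZ.sub_const (hG : IsoZ Ω G χ r) {c : Vec m} {r' : ℝ} (h0 : 0 < r')
    (h : ‖c‖ + r' ≤ r) : IsoZ Ω (fun x => G x - c) χ r' :=
  ⟨hG.isOpen, hG.holo.sub contDiffOn_const, hG.smooth, hG.compact, hG.nonneg, hG.sub, h0,
    fun x hx => (hG.sep x hx).imp id fun h' => by
      have := norm_sub_norm_le (G x) c
      linarith⟩

theorem mass_sub_const (c : Vec m) (η : ℝ) (φ : Vec m → ℂ) :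
    mass (fun x => G x - c) χ (kap η 0) φ = mass G χ (kap η c) φ := by
  have h : ∀ x, sdet (fun x => G x - c) x = sdet G x := fun x => by
    simp only [sdet, fderiv_sub_const]
  simp only [mass, h, kap, sub_zero]

theorem IsoZ.mass_center (hG : IsoZ Ω G χ r) {c : Vec m} {η : ℝ} (h0 : 0 < η)
    (h : ‖c‖ + η < r) : mass G χ (kap η c) 1 = mass G χ (kap η 0) 1 := by
  obtain ⟨ρ, hρ1, hρ⟩ : ∃ ρ > (1 : ℝ), ρ * ‖c‖ + η < r := by
    have : ∀ᶠ ρ in 𝓝[>] (1 : ℝ), ρ * ‖c‖ + η < r := by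
      have hc : ContinuousAt (fun ρ : ℝ => ρ * ‖c‖ + η) 1 := by fun_prop
      exact (hc.eventually_lt continuousAt_const (by simpa using h)).filter_mono nhdsWithin_le_nhds
    obtain ⟨ρ, h1, h2⟩ := (this.and self_mem_nhdsWithin).exists
    exact ⟨ρ, h2, h1⟩
  set F : ℂ × Vec m → Vec m := fun p => (η⁻¹ : ℂ) • (G p.2 - p.1 • c) with hF
  set O : Set (ℂ × Vec m) := univ ×ˢ Ω with hO
  have hOo : IsOpen O := isOpen_univ.prod hG.isOpen
  have hm : MapsTo Prod.snd O Ω := fun p hp => hp.2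
  have hFh : ContDiffOn ℂ ω F O := by
    refine ContDiffOn.const_smul _ ((hG.holo.comp contDiff_snd.contDiffOn hm).sub ?_)
    exact (contDiff_fst.smul contDiff_const).contDiffOn
  have hf : Fam O F χ (kap 1 0) := ⟨hOo, hFh, hG.smooth, hG.compact, contDiff_kap 1 0, hG.nonneg,
    kap_nonneg 1 0⟩
  have hadm : ∀ ζ ∈ ball (0 : ℂ) ρ, Adm O F χ (kap 1 0) ζ := by
    refine fun ζ hζ => ⟨fun x hx => ⟨mem_univ _, hG.sub hx⟩, fun x hx => ?_⟩
    refine (hG.sep x hx).symm.imp (fun h => kap_one_zero_eq_zero ?_) id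
    rw [hF]
    simp only [norm_smul, norm_inv, norm_real, Real.norm_eq_abs, abs_of_pos h0]
    rw [inv_mul_eq_div, one_le_div h0]
    have h2 := norm_sub_norm_le (G x) (ζ • c)
    rw [norm_smul] at h2
    have h3 : ‖ζ‖ < ρ := by simpa using hζ
    have h4 : ‖ζ‖ * ‖c‖ ≤ ρ * ‖c‖ := mul_le_mul_of_nonneg_right h3.le (norm_nonneg c)
    linarith
  have hval : ∀ ζ : ℂ, wint F χ (kap 1 0) (pdet F) (pdet F) ζ = mass G χ (kap η (ζ • c)) 1 := by
    intro ζ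
    have h1 := wint_eq_mass (χ := χ) (B := kap 1 0) hOo hFh (fun q => 1) (ζ := ζ)
      (fun x hx => ⟨mem_univ _, hG.sub hx⟩)
    simp only [one_mul] at h1
    rw [h1]
    have h0' : (η⁻¹ : ℂ) ≠ 0 := inv_ne_zero (by exact_mod_cast h0.ne')
    have := mass_smul_sub (χ := χ) hG.isOpen hG.holo hG.sub h0' (ζ • c) (fun _ => 1)
    rw [norm_inv, norm_real, Real.norm_eq_abs, abs_of_pos h0, inv_inv] at this
    exact this
  have key := hf.wint_pdet_eq isOpen_ball (convex_ball (0 : ℂ) ρ).isPreconnected hadm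
    (ζ := 1) (ζ' := 0) (by simpa using hρ1) (by simp; linarith)
  rw [hval, hval] at key
  simpa using key

theorem exists_forall_norm_lt_of_eq_zero {X E E' : Type*} [TopologicalSpace X]
    [NormedAddCommGroup E] [NormedAddCommGroup E'] {K : Set X} (hK : IsCompact K) {G : X → E}
    (hG : ContinuousOn G K) {φ : X → E'} (hφ : ContinuousOn φ K) {c : E} (h : ∀ x ∈ K, G x = c → φ x = 0)
    {ε : ℝ} (hε : 0 < ε) : ∃ η > 0, ∀ x ∈ K, ‖G x - c‖ < η → ‖φ x‖ < ε := by
  have hK' : IsCompact (K ∩ {x | x ∈ K ∧ ε ≤ ‖φ x‖}) := by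
    have : IsClosed {x : K | ε ≤ ‖φ x‖} :=
      isClosed_le continuous_const (continuousOn_iff_continuous_domRestrict.1 hφ.norm)
    have h2 := (isCompact_iff_compactSpace.1 hK)
    have h3 := (this.isCompact).image continuous_subtype_val
    convert h3 using 1
    ext x
    simp
    tauto
  by_contra! hcon
  rcases (K ∩ {x | x ∈ K ∧ ε ≤ ‖φ x‖}).eq_empty_or_nonempty with he | hne
  · obtain ⟨x, hx, -, h2⟩ := hcon 1 one_pos
    exact (he ▸ (show x ∈ K ∩ {x | x ∈ K ∧ ε ≤ ‖φ x‖} from ⟨hx, hx, h2⟩) : x ∈ (∅ : Set _))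
  · obtain ⟨x, hx, hmin⟩ := hK'.exists_isMinOn hne
      (((hG.sub continuousOn_const).norm).mono inter_subset_left : ContinuousOn (fun x => ‖G x - c‖) _)
    rcases (norm_nonneg (G x - c)).eq_or_lt with h0 | h0
    · have := h x hx.1 (by rw [eq_comm, norm_eq_zero, sub_eq_zero] at h0; exact h0)
      have h3 := hx.2.2
      rw [this, norm_zero] at h3
      linarith
    · obtain ⟨y, hy, h1, h2⟩ := hcon _ h0
      exact absurd (hmin (show y ∈ K ∩ {x | x ∈ K ∧ ε ≤ ‖φ x‖} from ⟨hy, hy, h2⟩)) (not_le.2 h1)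

end Mass

section MassLimits

variable {m : ℕ} {Ω : Set Vec m} {G : Vec m → Vec m} {χ : Vec m → ℝ} {r : ℝ}

theorem continuousOn_sdet (hΩ : IsOpen Ω) (hG : ContDiffOn ℂ ω G Ω) : ContinuousOn (sdet G) Ω := by
  have h : ContinuousOn (fderiv ℂ G) Ω := hG.continuousOn_fderiv_of_isOpen hΩ (by simp)
  unfold sdet
  refine Continuous.comp_continuousOn (continuous_id.matrix_det) ?_
  refine continuousOn_pi.2 fun i => continuousOn_pi.2 fun k => ?_
  exact (continuous_apply i).comp_continuousOn (h.clm_apply continuousOn_const)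

theorem IsoZ.continuous_integrand (hG : IsoZ Ω G χ r) {B : Vec m → ℝ} (hB : Continuous B)
    {φ : Vec m → ℂ} (hφ : ContinuousOn φ Ω) :
    Continuous fun x => φ x * ((‖sdet G x‖ ^ 2 * (χ x * B (G x)) : ℝ) : ℂ) := by
  have h : ContinuousOn (fun x => φ x * ((‖sdet G x‖ ^ 2 * (χ x * B (G x)) : ℝ) : ℂ)) Ω := by
    refine hφ.mul (continuous_ofReal.comp_continuousOn ?_)
    exact ((continuousOn_sdet hG.isOpen hG.holo).norm.pow 2).mul
      (hG.smooth.continuous.continuousOn.mul (hB.comp_continuousOn hG.holo.continuousOn))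
  refine continuous_of_tsupport fun x hx => h.continuousAt (hG.isOpen.mem_nhds (hG.sub ?_))
  refine closure_mono (fun y hy => ?_) hx
  contrapose! hy
  simp [Function.notMem_support.1 hy]

theorem IsoZ.hasCompactSupport_integrand (hG : IsoZ Ω G χ r) (B : Vec m → ℝ)
    (φ : Vec m → ℂ) :
    HasCompactSupport fun x => φ x * ((‖sdet G x‖ ^ 2 * (χ x * B (G x)) : ℝ) : ℂ) := by
  refine hG.compact.mono fun y hy => ?_
  contrapose! hy
  simp [Function.notMem_support.1 hy]

theorem IsoZ.integrable (hG : IsoZ Ω G χ r) {B : Vec m → ℝ} (hB : Continuous B)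
    {φ : Vec m → ℂ} (hφ : ContinuousOn φ Ω) :
    Integrable fun x => φ x * ((‖sdet G x‖ ^ 2 * (χ x * B (G x)) : ℝ) : ℂ) :=
  (hG.continuous_integrand hB hφ).integrable_of_hasCompactSupport
    (hG.hasCompactSupport_integrand B φ)

theorem IsoZ.mass_sub (hG : IsoZ Ω G χ r) {B : Vec m → ℝ} (hB : Continuous B)
    {φ ψ : Vec m → ℂ} (hφ : ContinuousOn φ Ω) (hψ : ContinuousOn ψ Ω) :
    mass G χ B (fun x => φ x - ψ x) = mass G χ B φ - mass G χ B ψ := by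
  unfold mass
  rw [← integral_sub (hG.integrable hB hφ) (hG.integrable hB hψ)]
  simp only [sub_mul]

theorem mass_const_mul (B : Vec m → ℝ) (a : ℂ) (φ : Vec m → ℂ) :
    mass G χ B (fun x => a * φ x) = a * mass G χ B φ := by
  unfold mass
  rw [← integral_const_mul]
  simp only [mul_assoc]

theorem IsoZ.mass_sum (hG : IsoZ Ω G χ r) {B : Vec m → ℝ} (hB : Continuous B) {ι : Type*}
    (S : Finset ι) {φ : ι → Vec m → ℂ} (hφ : ∀ i ∈ S, ContinuousOn (φ i) Ω) :
    mass G χ B (fun x => ∑ i ∈ S, φ i x) = ∑ i ∈ S, mass G χ B (φ i) := by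
  unfold mass
  rw [← integral_finsetSum _ fun i hi => hG.integrable hB (hφ i hi)]
  simp only [Finset.sum_mul]

theorem mass_one_eq (B : Vec m → ℝ) :
    mass G χ B 1 = ((∫ x, ‖sdet G x‖ ^ 2 * (χ x * B (G x)) : ℝ) : ℂ) := by
  unfold mass
  rw [← integral_complex_ofReal]
  simp only [Pi.one_apply, one_mul]

theorem IsoZ.mass_one_nonneg (hG : IsoZ Ω G χ r) {B : Vec m → ℝ} (hB0 : ∀ y, 0 ≤ B y) :
    0 ≤ (mass G χ B 1).re := by
  rw [mass_one_eq, ofReal_re]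
  exact integral_nonneg fun x => mul_nonneg (sq_nonneg _) (mul_nonneg (hG.nonneg x) (hB0 _))

theorem IsoZ.norm_mass_le (hG : IsoZ Ω G χ r) {B : Vec m → ℝ} (hB : Continuous B)
    (hB0 : ∀ y, 0 ≤ B y) {φ : Vec m → ℂ} {ε : ℝ}
    (h : ∀ x ∈ tsupport χ, B (G x) ≠ 0 → ‖φ x‖ ≤ ε) :
    ‖mass G χ B φ‖ ≤ ε * (mass G χ B 1).re := by
  rw [mass_one_eq, ofReal_re, ← integral_const_mul]
  have hi : Integrable fun x => ‖sdet G x‖ ^ 2 * (χ x * B (G x)) := by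
    have := (hG.integrable hB (φ := 1) continuousOn_const).re
    simpa [-ofReal_mul, -ofReal_pow] using this
  refine norm_integral_le_of_norm_le (hi.const_mul ε) (ae_of_all _ fun x => ?_)
  have h0 : 0 ≤ ‖sdet G x‖ ^ 2 * (χ x * B (G x)) :=
    mul_nonneg (sq_nonneg _) (mul_nonneg (hG.nonneg x) (hB0 _))
  rw [norm_mul, norm_real, Real.norm_eq_abs, abs_of_nonneg h0]
  by_cases hx : x ∈ tsupport χ
  · by_cases hb : B (G x) = 0
    · simp [hb]
    · exact mul_le_mul_of_nonneg_right (h x hx hb) h0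
  · simp [image_eq_zero_of_notMem_tsupport hx]

theorem IsoZ.mass_center_mem (hG : IsoZ Ω G χ r) {c : Vec m} {φ : Vec m → ℂ}
    (hφ : ContDiffOn ℂ ω φ Ω) {η η' : ℝ} (h0 : 0 < η) (h1 : ‖c‖ + η < r) (h0' : 0 < η')
    (h1' : ‖c‖ + η' < r) : mass G χ (kap η c) φ = mass G χ (kap η' c) φ := by
  rw [← mass_sub_const c η, ← mass_sub_const c η']
  exact (hG.sub_const (c := c) (r' := r - ‖c‖) (by linarith) (by linarith)).mass_kap_eq hφ h0
    (by linarith) h0' (by linarith)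

theorem continuous_kap (η : ℝ) (c : Vec m) : Continuous (kap η c) := (contDiff_kap η c).continuous

theorem IsoZ.tendsto_mass_zero (hG : IsoZ Ω G χ r) {c : Vec m} (hc : ‖c‖ < r)
    {φ : Vec m → ℂ} (hφ : ContinuousOn φ Ω) (h : ∀ x ∈ tsupport χ, G x = c → φ x = 0) :
    Tendsto (fun η => mass G χ (kap η c) φ) (𝓝[>] 0) (𝓝 0) := by
  rw [Metric.tendsto_nhds]
  intro ε hε
  set N := (mass G χ (kap ((r - ‖c‖) / 2) c) 1).re
  have hN : 0 ≤ N := hG.mass_one_nonneg (kap_nonneg _ _)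
  obtain ⟨η₀, hη₀, hs⟩ := exists_forall_norm_lt_of_eq_zero hG.compact
    (hG.holo.continuousOn.mono hG.sub) (hφ.mono hG.sub) h (ε := ε / (N + 1)) (by positivity)
  filter_upwards [Ioo_mem_nhdsGT (show (0 : ℝ) < min η₀ (r - ‖c‖) from lt_min hη₀ (by linarith))]
    with η hη
  have h1 := lt_min_iff.1 hη.2
  rw [dist_zero_right]
  have h2 := hG.norm_mass_le (continuous_kap η c) (kap_nonneg η c) (φ := φ) (ε := ε / (N + 1))
    fun x hx hk => (hs x hx ((norm_sub_lt_of_kap_ne_zero hη.1 hk).trans h1.1)).le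
  have h3 : mass G χ (kap η c) 1 = mass G χ (kap ((r - ‖c‖) / 2) c) 1 :=
    hG.mass_center_mem contDiffOn_const hη.1 (by linarith) (by linarith) (by linarith)
  rw [h3] at h2
  refine h2.trans_lt ?_
  rw [div_mul_eq_mul_div, div_lt_iff₀ (by positivity)]
  nlinarith

theorem IsoZ.mass_eq_zero (hG : IsoZ Ω G χ r) {c : Vec m} {η : ℝ} (h0 : 0 < η)
    (h1 : ‖c‖ + η < r) {φ : Vec m → ℂ} (hφ : ContDiffOn ℂ ω φ Ω)
    (h : ∀ x ∈ tsupport χ, G x = c → φ x = 0) : mass G χ (kap η c) φ = 0 := by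
  refine tendsto_nhds_unique (tendsto_const_nhds.congr' ?_)
    (hG.tendsto_mass_zero (by linarith) hφ.continuousOn h)
  filter_upwards [Ioo_mem_nhdsGT h0] with η' h'
  exact hG.mass_center_mem hφ h0 h1 h'.1 (by linarith [h'.2])

theorem IsoZ.mass_congr (hG : IsoZ Ω G χ r) {c : Vec m} {η : ℝ} (h0 : 0 < η)
    (h1 : ‖c‖ + η < r) {φ ψ : Vec m → ℂ} (hφ : ContDiffOn ℂ ω φ Ω) (hψ : ContDiffOn ℂ ω ψ Ω)
    (h : ∀ x ∈ tsupport χ, G x = c → φ x = ψ x) : mass G χ (kap η c) φ = mass G χ (kap η c) ψ := by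
  rw [← sub_eq_zero, ← hG.mass_sub (continuous_kap η c) hφ.continuousOn hψ.continuousOn]
  exact hG.mass_eq_zero h0 h1 (hφ.sub hψ) fun x hx hc => sub_eq_zero.2 (h x hx hc)

theorem IsoZ.mass_of_unique_zero (hG : IsoZ Ω G χ r) {c : Vec m} {η : ℝ} (h0 : 0 < η)
    (h1 : ‖c‖ + η < r) {φ : Vec m → ℂ} (hφ : ContDiffOn ℂ ω φ Ω) {p : Vec m}
    (h : ∀ x ∈ tsupport χ, G x = c → x = p) :
    mass G χ (kap η c) φ = φ p * mass G χ (kap η c) 1 := by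
  rw [← mass_const_mul]
  exact hG.mass_congr h0 h1 hφ (contDiffOn_const (c := φ p * 1)) fun x hx hc => by rw [h x hx hc]; simp

theorem IsoZ.continuous_mass (hG : IsoZ Ω G χ r) (η : ℝ) {φ : Vec m → ℂ}
    (hφ : ContinuousOn φ Ω) : Continuous fun c => mass G χ (kap η c) φ := by
  have hb : ∃ M, ∀ y : Vec m, ‖bump y‖ ≤ M :=
    (contDiff_bump.continuous).bounded_above_of_compact_support hasCompactSupport_bump
  obtain ⟨M, hM⟩ := hb
  set k : ℝ := ‖(∫ y : Vec m, bump y)⁻¹ * (η ^ (2 * m))⁻¹‖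
  have hkM : ∀ c y : Vec m, ‖kap η c y‖ ≤ k * M := by
    intro c y
    rw [kap, ← mul_assoc, norm_mul]
    exact mul_le_mul_of_nonneg_left (hM _) (norm_nonneg _)
  have hint := ((hG.integrable (B := fun _ => k * M) continuous_const hφ).norm)
  refine continuous_of_dominated (bound := fun x =>
      ‖φ x * ((‖sdet G x‖ ^ 2 * (χ x * (k * M)) : ℝ) : ℂ)‖)
    (fun c => (hG.continuous_integrand (continuous_kap η c) hφ).aestronglyMeasurable)
    (fun c => ae_of_all _ fun x => ?_) hint (ae_of_all _ fun x => ?_)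
  · simp only [norm_mul, norm_real]
    gcongr
    exact (hkM c _).trans ((le_abs_self _).trans (norm_mul k M).le)
  · refine continuous_const.mul (continuous_ofReal.comp (continuous_const.mul
      (continuous_const.mul ?_)))
    unfold kap
    have := (contDiff_bump (m := m)).continuous
    fun_prop

/-- At a regular zero, the local contribution to the mass is the value of the weight. -/
theorem IsoZ.eventually_le_integral (hG : IsoZ Ω G χ r) {w : Vec m}
    (hχ : ∀ᶠ x in 𝓝 w, χ x = 1) (hdet : sdet G w ≠ 0) {u : Vec m → ℝ}
    (hu : ContinuousOn u Ω) (hu0 : ∀ x, 0 ≤ u x) {ε : ℝ} (hε : 0 < ε) :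
    ∀ᶠ η in 𝓝[>] (0 : ℝ), u w - ε ≤ ∫ x, u x * (‖sdet G x‖ ^ 2 * (χ x * kap η (G w) (G x))) := by
  have hwΩ : w ∈ Ω := hG.sub (subset_tsupport _ (by simp [hχ.self_of_nhds]))
  have huw : ∀ᶠ x in 𝓝 w, u w - ε < u x :=
    (hu.continuousAt (hG.isOpen.mem_nhds hwΩ)).eventually_const_lt (by linarith)
  obtain ⟨V, hV, hVo, hwV, -, η₀, hη₀, -, hint⟩ :=
    exists_nhds_integral_sdet hG.isOpen hG.holo hwΩ hdet (hχ.and huw)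
  filter_upwards [Ioo_mem_nhdsGT hη₀] with η hη
  have hβ := hint (kap η (G w)) fun y hy => by
    by_contra h'
    exact hy (by simpa [dist_eq_norm] using (norm_sub_lt_of_kap_ne_zero hη.1 h').trans hη.2)
  rw [integral_kap hη.1] at hβ
  have hpos : ∀ x, 0 ≤ ‖sdet G x‖ ^ 2 * (χ x * kap η (G w) (G x)) := fun x =>
    mul_nonneg (sq_nonneg _) (mul_nonneg (hG.nonneg x) (kap_nonneg _ _ _))
  have hi : Integrable fun x => u x * (‖sdet G x‖ ^ 2 * (χ x * kap η (G w) (G x))) := by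
    have := (hG.integrable (continuous_kap η (G w)) (φ := fun x => (u x : ℂ))
      (continuous_ofReal.comp_continuousOn hu)).re
    simp only [← ofReal_mul] at this
    simpa [-ofReal_mul, -ofReal_pow] using this
  have hi1 : Integrable fun x => ‖sdet G x‖ ^ 2 * (χ x * kap η (G w) (G x)) := by
    have := (hG.integrable (continuous_kap η (G w)) (φ := 1) continuousOn_const).re
    simpa [-ofReal_mul, -ofReal_pow] using this
  calc u w - ε = (u w - ε) * ∫ x in V, ‖sdet G x‖ ^ 2 * (χ x * kap η (G w) (G x)) := by
        rw [setIntegral_congr_fun hVo.measurableSet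
          (g := fun x => ‖sdet G x‖ ^ 2 * kap η (G w) (G x)) fun x hx => by
            simp only [(hV hx).1.1, one_mul], hβ, mul_one]
    _ = ∫ x in V, (u w - ε) * (‖sdet G x‖ ^ 2 * (χ x * kap η (G w) (G x))) := by
        rw [integral_const_mul]
    _ ≤ ∫ x in V, u x * (‖sdet G x‖ ^ 2 * (χ x * kap η (G w) (G x))) :=
        setIntegral_mono_on (hi1.const_mul _).integrableOn hi.integrableOn hVo.measurableSet
          fun x hx => mul_le_mul_of_nonneg_right (hV hx).1.2.le (hpos x)
    _ ≤ _ := setIntegral_le_integral hi (ae_of_all _ fun x => mul_nonneg (hu0 x) (hpos x))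

theorem IsoZ.one_le_mass (hG : IsoZ Ω G χ r) {w : Vec m} (hχ : ∀ᶠ x in 𝓝 w, χ x = 1)
    (hdet : sdet G w ≠ 0) {η : ℝ} (h0 : 0 < η) (h1 : ‖G w‖ + η < r) :
    1 ≤ (mass G χ (kap η (G w)) 1).re := by
  refine le_of_forall_pos_sub_le fun ε hε => ?_
  obtain ⟨η', h2, h3⟩ := ((hG.eventually_le_integral hχ hdet (u := fun _ => 1) continuousOn_const
    (fun _ => zero_le_one) hε).and (Ioo_mem_nhdsGT h0)).exists
  rw [hG.mass_center_mem (φ := 1) contDiffOn_const h0 h1 h3.1 (by linarith [h3.2]), mass_one_eq,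
    ofReal_re]
  simpa using h2

end MassLimits

section Regular

variable {m : ℕ}

theorem Fam.mass_one_eq_of_adm {O : Set (ℂ × Vec m)} {F : ℂ × Vec m → Vec m}
    {χ B : Vec m → ℝ} (hf : Fam O F χ B) {D : Set ℂ} (hD : IsOpen D) (hDc : IsPreconnected D)
    (h : ∀ ζ ∈ D, Adm O F χ B ζ) {ζ ζ' : ℂ} (h1 : ζ ∈ D) (h2 : ζ' ∈ D) :
    mass (fun x => F (ζ, x)) χ B 1 = mass (fun x => F (ζ', x)) χ B 1 := by
  have key := hf.wint_pdet_eq hD hDc h h1 h2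
  have e : ∀ ζ ∈ D, wint F χ B (pdet F) (pdet F) ζ = mass (fun x => F (ζ, x)) χ B 1 := by
    intro ζ hζ
    have := wint_eq_mass hf.isOpen hf.holo (χ := χ) (B := B) (fun _ => 1) (h ζ hζ).mem
    simp only [one_mul] at this
    exact this
  rwa [e ζ h1, e ζ' h2] at key

variable {Ω : Set Vec m} {G : Vec m → Vec m} {χ : Vec m → ℝ} {r : ℝ}

theorem exists_det_add_smul_ne_zero (M : Matrix (Fin m) (Fin m) ℂ) {δ : ℝ} (hδ : 0 < δ) :
    ∃ ζ : ℂ, ‖ζ‖ < δ ∧ (M + ζ • (1 : Matrix (Fin m) (Fin m) ℂ)).det ≠ 0 := by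
  have h1 : {ζ : ℂ | (-M).charpoly.IsRoot ζ}.Finite :=
    Polynomial.finite_setOfPred_isRoot (-M).charpoly_monic.ne_zero
  have h2 : (ball (0 : ℂ) δ).Infinite := infinite_of_mem_nhds 0 (ball_mem_nhds _ hδ)
  obtain ⟨ζ, h3, h4⟩ := (h2.sdiff h1).nonempty
  refine ⟨ζ, by simpa using h3, fun h => h4 ?_⟩
  have : (-M).charpoly.eval ζ = (M + ζ • (1 : Matrix (Fin m) (Fin m) ℂ)).det := by
    rw [Matrix.eval_charpoly, sub_neg_eq_add, add_comm, Matrix.smul_one_eq_diagonal]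
    rfl
  show (-M).charpoly.eval ζ = 0
  rw [this, h]

theorem IsoZ.one_le_mass_zero (hG : IsoZ Ω G χ r) {w : Vec m} (hχ : ∀ᶠ x in 𝓝 w, χ x = 1)
    (hw : G w = 0) {η : ℝ} (h0 : 0 < η) (h1 : η < r) : 1 ≤ (mass G χ (kap η 0) 1).re := by
  have hwΩ : w ∈ Ω := hG.sub (subset_tsupport _ (by simp [hχ.self_of_nhds]))
  obtain ⟨D, hD⟩ : ∃ D, ∀ x ∈ tsupport χ, ‖x - w‖ ≤ D :=
    hG.compact.exists_bound_of_continuousOn (f := fun x => x - w) (by fun_prop)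
  set δ : ℝ := r / 2 / (|D| + 1) with hδ
  have hr := hG.pos
  have hδ0 : 0 < δ := by positivity
  have hδD : ∀ ζ : ℂ, ‖ζ‖ < δ → ∀ x ∈ tsupport χ, ‖ζ • (x - w)‖ ≤ r / 2 := by
    intro ζ hζ x hx
    rw [norm_smul]
    calc ‖ζ‖ * ‖x - w‖ ≤ δ * (|D| + 1) := by
          have := (hD x hx).trans (le_abs_self D)
          gcongr
          linarith
      _ = r / 2 := by rw [hδ]; field_simp
  obtain ⟨ζ, hζ, hdet⟩ := exists_det_add_smul_ne_zero
    (Matrix.of fun i k => fderiv ℂ G w (Pi.single k 1) i) hδ0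
  set F : ℂ × Vec m → Vec m := fun p => G p.2 + p.1 • (p.2 - w) with hF
  set O : Set (ℂ × Vec m) := univ ×ˢ Ω with hO
  have hOo : IsOpen O := isOpen_univ.prod hG.isOpen
  have hm : MapsTo Prod.snd O Ω := fun p hp => hp.2
  have hFh : ContDiffOn ℂ ω F O :=
    (hG.holo.comp contDiff_snd.contDiffOn hm).add
      (contDiff_fst.smul (contDiff_snd.sub contDiff_const)).contDiffOn
  have hsep : ∀ ζ : ℂ, ‖ζ‖ < δ → ∀ x ∈ tsupport χ, fderiv ℝ χ x = 0 ∨ r / 2 ≤ ‖F (ζ, x)‖ := by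
    refine fun ζ hζ x hx => (hG.sep x hx).imp id fun h => ?_
    have h2 := norm_sub_norm_le (G x) (-(ζ • (x - w)))
    rw [norm_neg, sub_neg_eq_add] at h2
    have h3 := hδD ζ hζ x hx
    simp only [hF]
    linarith
  have e0 : (fun x => F (0, x)) = G := by ext x; simp [hF]
  have hζZ : IsoZ Ω (fun x => F (ζ, x)) χ (r / 2) := ⟨hG.isOpen,
    hFh.comp (contDiff_prodMk_right ζ).contDiffOn fun x hx => ⟨mem_univ _, hx⟩, hG.smooth,
    hG.compact, hG.nonneg, hG.sub, by positivity, hsep ζ hζ⟩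
  have hFw : F (ζ, w) = 0 := by simp [hF, hw]
  have hd : sdet (fun x => F (ζ, x)) w ≠ 0 := by
    have hfd : HasFDerivAt (fun x => F (ζ, x))
        (fderiv ℂ G w + ζ • ContinuousLinearMap.id ℂ Vec m) w :=
      ((hG.holo.contDiffAt (hG.isOpen.mem_nhds hwΩ)).differentiableAt (by simp)).hasFDerivAt.add
        (((hasFDerivAt_id w).sub_const w).const_smul ζ)
    rw [sdet, hfd.fderiv]
    convert hdet using 2
    ext i k
    simp [Matrix.one_apply, Pi.single_apply]
  have hle := hζZ.one_le_mass hχ hd (η := r / 4) (by positivity) (by rw [hFw]; simp; linarith)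
  rw [hFw] at hle
  have hcont : ∀ η', 0 < η' → η' < r / 2 → mass (fun x => F (ζ, x)) χ (kap η' 0) 1 =
      mass G χ (kap η' 0) 1 := by
    intro η' h2 h3
    have hf' : Fam O F χ (kap η' 0) := ⟨hOo, hFh, hG.smooth, hG.compact, contDiff_kap _ 0,
      hG.nonneg, kap_nonneg _ 0⟩
    have hadm' : ∀ ζ ∈ ball (0 : ℂ) δ, Adm O F χ (kap η' 0) ζ := by
      refine fun ζ hζ => ⟨fun x hx => ⟨mem_univ _, hG.sub hx⟩, fun x hx => ?_⟩
      refine (hsep ζ (by simpa using hζ) x hx).symm.imp (fun h => ?_) id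
      by_contra h'
      have := norm_sub_lt_of_kap_ne_zero h2 h'
      rw [sub_zero] at this
      linarith
    have := hf'.mass_one_eq_of_adm isOpen_ball (convex_ball (0 : ℂ) δ).isPreconnected hadm'
      (ζ := 0) (ζ' := ζ) (by simpa using hδ0) (by simpa using hζ)
    rw [e0] at this
    exact this.symm
  rw [hcont _ (by positivity) (by linarith),
    hG.mass_kap_eq (φ := 1) contDiffOn_const (by positivity) (by linarith) h0 h1] at hle
  exact hle

theorem analyticOnNhd_sdet (hΩ : IsOpen Ω) (hG : ContDiffOn ℂ ω G Ω) :
    AnalyticOnNhd ℂ (sdet G) Ω := by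
  have h : ContDiffOn ℂ ω (sdet G) Ω := by
    refine contDiffOn_det_of_entries fun i k => ?_
    have h1 := contDiffOn_fderiv_apply hΩ hG (Pi.single k 1)
    exact contDiffOn_pi.1 h1 i
  exact fun x hx => (h.contDiffAt (hΩ.mem_nhds hx)).analyticAt

theorem IsoZ.frequently_sdet_ne_zero (hG : IsoZ Ω G χ r) (hΩ : IsPreconnected Ω) {w : Vec m}
    (hχ : ∀ᶠ x in 𝓝 w, χ x = 1) (hw : G w = 0) {p : Vec m} (hp : p ∈ Ω) :
    ∃ᶠ x in 𝓝 p, sdet G x ≠ 0 := by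
  by_contra hcon
  rw [not_frequently] at hcon
  have h0 := (analyticOnNhd_sdet hG.isOpen hG.holo).eqOn_zero_of_preconnected_of_eventuallyEq_zero
    hΩ hp (by filter_upwards [hcon] with x hx; simpa using hx)
  have h1 := hG.one_le_mass_zero hχ hw (η := r / 2) (by linarith [hG.pos]) (by linarith [hG.pos])
  have h2 : mass G χ (kap (r / 2) 0) 1 = 0 := by
    unfold mass
    rw [← integral_zero Vec m ℂ]
    congr 1
    ext x
    by_cases hx : x ∈ tsupport χ
    · simp [h0 (hG.sub hx)]
    · simp [image_eq_zero_of_notMem_tsupport hx]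
  rw [h2] at h1
  norm_num at h1

theorem frequently_regular_value (hΩ : IsOpen Ω) (hG : ContDiffOn ℂ ω G Ω) {p : Vec m}
    (hp : p ∈ Ω) (h : ∃ᶠ x in 𝓝 p, sdet G x ≠ 0) :
    ∃ᶠ x in 𝓝 p, ∀ y ∈ Ω, G y = G x → sdet G y ≠ 0 := by
  rw [frequently_iff]
  intro U hU
  obtain ⟨w, ⟨hwU, hwΩ⟩, hw⟩ := frequently_iff.1 h
    (inter_mem (interior_mem_nhds.2 hU) (hΩ.mem_nhds hp))
  obtain ⟨V, hV, -, -, -, η₀, hη₀, hball, -⟩ :=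
    exists_nhds_integral_sdet hΩ hG hwΩ hw (isOpen_interior.mem_nhds hwU)
  have hnull : volume (G '' {y ∈ Ω | sdet G y = 0}) = 0 := by
    refine addHaar_image_eq_zero_of_det_fderivWithin_eq_zero volume
      (f' := fun y => (fderiv ℂ G y).restrictScalars ℝ) (fun y hy => ?_) fun y hy => ?_
    · exact (((hG.contDiffAt (hΩ.mem_nhds hy.1)).differentiableAt (by simp)).hasFDerivAt
        |>.restrictScalars ℝ).hasFDerivWithinAt
    · have := abs_det_restrictScalars (fderiv ℂ G y)
      rw [← sdet_eq_det, hy.2] at this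
      simpa using this
  have hne : ¬ ball (G w) η₀ ⊆ G '' {y ∈ Ω | sdet G y = 0} := fun h' =>
    (measure_ball_pos volume (G w) hη₀).ne' (measure_mono_null h' hnull)
  obtain ⟨c, hc, hc'⟩ := not_subset.1 hne
  obtain ⟨x, hxV, rfl⟩ := hball hc
  exact ⟨x, interior_subset (hV hxV).1, fun y hy hyx h0 => hc' ⟨y, ⟨hy, h0⟩, hyx⟩⟩

end Regular

section FiniteZeros

variable {m : ℕ}

theorem exists_separating_poly (S : Finset Vec m) {p : Vec m} (hp : p ∉ S) :
    ∃ φ : Vec m → ℂ, ContDiff ℂ ω φ ∧ φ p = 1 ∧ ∀ v ∈ S, φ v = 0 := by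
  have h : ∀ v : Vec m, v ≠ p → ∃ ψ : Vec m → ℂ, ContDiff ℂ ω ψ ∧ ψ p = 1 ∧ ψ v = 0 := by
    intro v hv
    obtain ⟨i, hi⟩ : ∃ i, p i - v i ≠ 0 := by
      by_contra! h'
      exact hv (funext fun i => (sub_eq_zero.1 (h' i)).symm)
    exact ⟨fun x => (x i - v i) / (p i - v i),
      (((contDiff_apply ℂ ℂ i).sub contDiff_const).div_const _), div_self hi, by simp⟩
  choose! ψ hψ hψp hψv using h
  have hne : ∀ v ∈ S, v ≠ p := fun v hv h' => hp (h' ▸ hv)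
  exact ⟨fun x => ∏ v ∈ S, ψ v x, contDiff_prod fun v hv => hψ v (hne v hv),
    Finset.prod_eq_one fun v hv => hψp v (hne v hv),
    fun v hv => Finset.prod_eq_zero hv (hψv v (hne v hv))⟩

variable {Ω : Set Vec m} {G : Vec m → Vec m} {χ : Vec m → ℝ} {r : ℝ}

theorem IsoZ.finite_regular_fibre (hG : IsoZ Ω G χ r) {c : Vec m}
    (hc : ∀ y ∈ Ω, G y = c → sdet G y ≠ 0) : {x ∈ tsupport χ | G x = c}.Finite := by
  have hK : IsCompact {x ∈ tsupport χ | G x = c} := by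
    have := (hG.holo.continuousOn.mono hG.sub).preimage_isClosed_of_isClosed
      (isClosed_tsupport χ) (isClosed_singleton (x := c))
    exact hG.compact.of_isClosed_subset this inter_subset_left
  refine hK.finite (isDiscrete_iff_forall_mem_exists_isOpen.2 fun w hw => ?_)
  obtain ⟨V, hV, hVo, hwV, hinj, -⟩ := exists_nhds_integral_sdet hG.isOpen hG.holo (hG.sub hw.1)
    (hc w (hG.sub hw.1) hw.2) univ_mem
  refine ⟨V, hVo, ?_⟩
  ext x
  simp only [mem_inter_iff, mem_ofPred_eq, mem_singleton_iff]
  constructor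
  · rintro ⟨h1, -, h2⟩
    exact hinj h1 hwV (h2.trans hw.2.symm)
  · rintro rfl
    exact ⟨hwV, hw⟩

/-- On a regular fibre the mass is a positive discrete measure with atoms of mass at least one. -/
theorem IsoZ.exists_weights (hG : IsoZ Ω G χ r)
    (hχ1 : ∀ x ∈ tsupport χ, ‖G x‖ < r → ∀ᶠ y in 𝓝 x, χ y = 1) {w : Vec m}
    (hw : w ∈ tsupport χ) (hwr : ‖G w‖ < r) (hc : ∀ y ∈ Ω, G y = G w → sdet G y ≠ 0) {N : ℝ}
    (hN : ∀ η, 0 < η → ‖G w‖ + η < r → (mass G χ (kap η (G w)) 1).re = N) :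
    ∃ (i₀ : Fin ⌊N⌋₊) (e : Fin ⌊N⌋₊ → Vec m) (μ : Fin ⌊N⌋₊ → ℝ), e i₀ = w ∧ 1 ≤ μ i₀ ∧
      (∀ i, e i ∈ tsupport χ) ∧ (∀ i, μ i ∈ Icc 0 N) ∧
      ∀ φ, ContDiffOn ℂ ω φ Ω → ∀ η, 0 < η → ‖G w‖ + η < r →
        mass G χ (kap η (G w)) φ = ∑ i, (μ i : ℂ) * φ (e i) := by
  classical
  set S := (hG.finite_regular_fibre hc).toFinset with hS
  have hmemS : ∀ x, x ∈ S ↔ x ∈ tsupport χ ∧ G x = G w := fun x => by simp [hS]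
  have hex : ∀ u : S, ∃ φ : Vec m → ℂ, ContDiff ℂ ω φ ∧ φ u = 1 ∧ ∀ v ∈ S.erase u, φ v = 0 :=
    fun u => exists_separating_poly (S.erase u) (Finset.notMem_erase _ _)
  choose δ hδ hδ1 hδ0 using hex
  set η₀ := (r - ‖G w‖) / 2
  have hη₀ : 0 < η₀ := by simp only [η₀]; linarith
  have hη₀' : ‖G w‖ + η₀ < r := by simp only [η₀]; linarith
  have hdelta : ∀ u v : S, δ u v = if u = v then 1 else 0 := by
    intro u v
    split_ifs with h
    · rw [← h, hδ1]
    · exact hδ0 u v (Finset.mem_erase.2 ⟨fun h' => h (Subtype.ext h'.symm), v.2⟩)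
  have hwt : ∀ u : S, ∃ a : ℝ, 1 ≤ a ∧ mass G χ (kap η₀ (G w)) (δ u) = a := by
    intro u
    have hu := (hmemS u).1 u.2
    have hsq : ContinuousOn (fun x => ((‖δ u x‖ ^ 2 : ℝ) : ℂ)) Ω :=
      (continuous_ofReal.comp ((hδ u).continuous.norm.pow 2)).continuousOn
    have h1 : Tendsto (fun η => mass G χ (kap η (G w)) fun x => δ u x - ((‖δ u x‖ ^ 2 : ℝ) : ℂ))
        (𝓝[>] 0) (𝓝 0) := by
      refine hG.tendsto_mass_zero hwr ((hδ u).continuous.continuousOn.sub hsq) fun x hx hxc => ?_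
      have := hdelta u ⟨x, (hmemS x).2 ⟨hx, hxc⟩⟩
      simp only at this
      rw [this]
      split_ifs <;> simp
    have h2 : Tendsto (fun η => mass G χ (kap η (G w)) fun x => ((‖δ u x‖ ^ 2 : ℝ) : ℂ)) (𝓝[>] 0)
        (𝓝 (mass G χ (kap η₀ (G w)) (δ u))) := by
      have h3 : Tendsto (fun η => mass G χ (kap η (G w)) (δ u)) (𝓝[>] 0)
          (𝓝 (mass G χ (kap η₀ (G w)) (δ u))) := by
        refine tendsto_const_nhds.congr' ?_
        filter_upwards [Ioo_mem_nhdsGT hη₀] with η hη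
        exact hG.mass_center_mem (hδ u).contDiffOn hη₀ hη₀' hη.1 (by linarith [hη.2])
      have h4 := h3.sub h1
      rw [sub_zero] at h4
      refine h4.congr fun η => ?_
      rw [hG.mass_sub (continuous_kap _ _) (hδ u).continuous.continuousOn hsq]
      ring
    have hreal : ∀ η, mass G χ (kap η (G w)) (fun x => ((‖δ u x‖ ^ 2 : ℝ) : ℂ)) =
        ((∫ x, ‖δ u x‖ ^ 2 * (‖sdet G x‖ ^ 2 * (χ x * kap η (G w) (G x))) : ℝ) : ℂ) := by
      intro η
      unfold mass
      rw [← integral_complex_ofReal]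
      simp only [ofReal_mul]
    simp only [hreal] at h2
    have h5 := (Complex.continuous_re.tendsto _).comp h2
    have h6 := (Complex.continuous_im.tendsto _).comp h2
    simp only [Function.comp_def, ofReal_re, Complex.ofReal_im] at h5 h6
    refine ⟨(mass G χ (kap η₀ (G w)) (δ u)).re, ?_, ?_⟩
    · refine le_of_forall_pos_sub_le fun ε hε => ge_of_tendsto h5 ?_
      have := hG.eventually_le_integral (w := (u : Vec m)) (hχ1 u hu.1 (hu.2 ▸ hwr))
        (hc u (hG.sub hu.1) hu.2) (u := fun x => ‖δ u x‖ ^ 2)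
        ((hδ u).continuous.norm.pow 2).continuousOn (fun x => sq_nonneg _) hε
      simpa [hδ1, hu.2] using this
    · refine Complex.ext (by simp) ?_
      simpa using tendsto_nhds_unique h6 tendsto_const_nhds
  choose a ha1 ha using hwt
  have hsum : ∀ φ, ContDiffOn ℂ ω φ Ω → ∀ η, 0 < η → ‖G w‖ + η < r →
      mass G χ (kap η (G w)) φ = ∑ u : S, (a u : ℂ) * φ u := by
    intro φ hφ η h0 h1
    rw [hG.mass_center_mem hφ h0 h1 hη₀ hη₀', hG.mass_congr hη₀ hη₀' hφ
      (ψ := fun x => ∑ u : S, φ u * δ u x)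
      (ContDiffOn.sum fun u _ => (contDiffOn_const.mul (hδ u).contDiffOn)) ?_,
      hG.mass_sum (φ := fun (u : S) x => φ u * δ u x) (continuous_kap _ _) _ fun u _ =>
        continuousOn_const.mul (hδ u).continuous.continuousOn]
    · refine Finset.sum_congr rfl fun u _ => ?_
      rw [mass_const_mul, ha, mul_comm]
    · intro x hx hxc
      have := fun u => hdelta u ⟨x, (hmemS x).2 ⟨hx, hxc⟩⟩
      simp only at this
      simp [this]
  have htot : ∑ u : S, a u = N := by
    have h1 := hsum 1 contDiffOn_const η₀ hη₀ hη₀'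
    rw [← hN η₀ hη₀ hη₀', h1]
    simp
  have hcard : Fintype.card S ≤ ⌊N⌋₊ := by
    refine Nat.le_floor ?_
    rw [← htot]
    calc (Fintype.card S : ℝ) = ∑ u : S, (1 : ℝ) := by simp
      _ ≤ _ := Finset.sum_le_sum fun u _ => ha1 u
  obtain ⟨g⟩ : Nonempty (S ↪ Fin ⌊N⌋₊) := Function.Embedding.nonempty_of_card_le (by simpa using hcard)
  set w' : S := ⟨w, (hmemS w).2 ⟨hw, rfl⟩⟩
  have hext : ∀ u, Function.extend g a 0 (g u) = a u := fun u => g.injective.extend_apply _ _ _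
  have hext' : ∀ u, Function.extend g (fun u : S => (u : Vec m)) (fun _ => w) (g u) = u :=
    fun u => g.injective.extend_apply _ _ _
  refine ⟨g w', Function.extend g (fun u : S => (u : Vec m)) (fun _ => w),
    Function.extend g a 0, hext' w', by rw [hext]; exact ha1 _, fun i => ?_, fun i => ?_,
    fun φ hφ η h0 h1 => ?_⟩
  · by_cases hi : ∃ u, g u = i
    · obtain ⟨u, rfl⟩ := hi
      rw [hext']
      exact ((hmemS u).1 u.2).1
    · rw [Function.extend_apply' _ _ _ hi]
      exact hw
  · by_cases hi : ∃ u, g u = i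
    · obtain ⟨u, rfl⟩ := hi
      rw [hext]
      refine ⟨zero_le_one.trans (ha1 u), ?_⟩
      rw [← htot]
      exact Finset.single_le_sum (f := a) (fun v _ => zero_le_one.trans (ha1 v)) (Finset.mem_univ u)
    · rw [Function.extend_apply' _ _ _ hi]
      exact ⟨le_rfl, htot ▸ Finset.sum_nonneg fun v _ => zero_le_one.trans (ha1 v)⟩
  · rw [hsum φ hφ η h0 h1]
    refine Fintype.sum_of_injective g g.injective _ _ (fun i hi => ?_) fun u => ?_
    · rw [Function.extend_apply' _ _ _ hi]
      simp
    · rw [hext, hext']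

theorem IsoZ.exists_weights_zero (hG : IsoZ Ω G χ r)
    (hχ1 : ∀ x ∈ tsupport χ, ‖G x‖ < r → ∀ᶠ y in 𝓝 x, χ y = 1)
    (hfreq : ∀ p ∈ Ω, ∃ᶠ x in 𝓝 p, sdet G x ≠ 0) {p : Vec m} (hp : p ∈ tsupport χ)
    (hp0 : G p = 0) :
    ∃ (n : ℕ) (i₀ : Fin n) (e : Fin n → Vec m) (μ : Fin n → ℝ), e i₀ = p ∧ 1 ≤ μ i₀ ∧
      (∀ i, 0 ≤ μ i) ∧ ∀ φ, ContDiffOn ℂ ω φ Ω →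
        mass G χ (kap (r / 4) 0) φ = ∑ i, (μ i : ℂ) * φ (e i) := by
  have hr := hG.pos
  set N := (mass G χ (kap (r / 4) 0) 1).re
  have hpΩ := hG.sub hp
  have hGc := hG.holo.continuousOn.continuousAt (hG.isOpen.mem_nhds hpΩ)
  have hev : ∀ᶠ x in 𝓝 p, x ∈ tsupport χ ∧ ‖G x‖ < r / 2 := by
    refine ((hχ1 p hp (by simpa [hp0] using hr)).mono fun x hx =>
      subset_tsupport χ (by simp [hx])).and ?_
    exact hGc.norm.eventually_lt continuousAt_const (by simpa [hp0] using hr)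
  obtain ⟨w, hw, hwr⟩ := exists_seq_forall_of_frequently
    ((frequently_regular_value hG.isOpen hG.holo hpΩ (hfreq p hpΩ)).and_eventually hev)
  have hrep := fun k => hG.exists_weights hχ1 (hwr k).2.1 (by linarith [(hwr k).2.2]) (hwr k).1
    (N := N) fun η h0 h1 => by
      rw [hG.mass_center h0 h1, hG.mass_kap_eq (φ := 1) contDiffOn_const h0
        (by linarith [norm_nonneg (G (w k))]) (by positivity) (by linarith : r / 4 < r)]
  choose i e μ hi hμ he hμN hrep using hrep
  have hKc : IsCompact ((univ : Set (Fin ⌊N⌋₊)) ×ˢ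
      (univ.pi (fun _ : Fin ⌊N⌋₊ => tsupport χ)) ×ˢ (univ.pi fun _ : Fin ⌊N⌋₊ => Icc 0 N)) :=
    isCompact_univ.prod ((isCompact_univ_pi fun _ => hG.compact).prod
      (isCompact_univ_pi fun _ => isCompact_Icc))
  obtain ⟨⟨i', e', μ'⟩, hmem, σ, hσ, hlim⟩ := hKc.tendsto_subseq (x := fun k => (i k, e k, μ k))
    fun k => ⟨mem_univ _, fun j _ => he k j, fun j _ => hμN k j⟩
  have hli : ∀ᶠ k in atTop, i (σ k) = i' := by
    have h1 : Tendsto (fun k => i (σ k)) atTop (𝓝 i') := (continuous_fst.tendsto _).comp hlim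
    rw [nhds_discrete, tendsto_pure] at h1
    exact h1
  have hle : ∀ j, Tendsto (fun k => e (σ k) j) atTop (𝓝 (e' j)) := fun j =>
    ((continuous_apply j).comp (continuous_fst.comp continuous_snd)).tendsto _ |>.comp hlim
  have hlμ : ∀ j, Tendsto (fun k => μ (σ k) j) atTop (𝓝 (μ' j)) := fun j =>
    ((continuous_apply j).comp (continuous_snd.comp continuous_snd)).tendsto _ |>.comp hlim
  have hwσ : Tendsto (fun k => w (σ k)) atTop (𝓝 p) := hw.comp hσ.tendsto_atTop
  refine ⟨_, i', e', μ', tendsto_nhds_unique (hle i') (hwσ.congr' ?_),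
    ge_of_tendsto (hlμ i') ?_, fun j => (hmem.2.2 j (mem_univ j)).1, fun φ hφ => ?_⟩
  · filter_upwards [hli] with k hk
    rw [← hk, hi]
  · filter_upwards [hli] with k hk
    rw [← hk]
    exact hμ _
  · have h1 : Tendsto (fun k => mass G χ (kap (r / 4) (G (w (σ k)))) φ) atTop
        (𝓝 (mass G χ (kap (r / 4) 0) φ)) := by
      have := (hG.continuous_mass (r / 4) hφ.continuousOn).tendsto 0
      refine this.comp ?_
      rw [← hp0]
      exact hGc.tendsto.comp hwσ
    refine tendsto_nhds_unique h1 ?_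
    have h2 : ∀ k, mass G χ (kap (r / 4) (G (w (σ k)))) φ =
        ∑ j, (μ (σ k) j : ℂ) * φ (e (σ k) j) := fun k =>
      hrep _ φ hφ _ (by positivity) (by linarith [(hwr (σ k)).2.2])
    simp only [h2]
    refine tendsto_finsetSum _ fun j _ => ?_
    refine ((continuous_ofReal.tendsto _).comp (hlμ j)).mul ?_
    have hj := hG.sub (hmem.2.1 j (mem_univ j))
    exact (hφ.continuousOn.continuousAt (hG.isOpen.mem_nhds hj)).tendsto.comp (hle j)

theorem IsoZ.finite_zeros (hG : IsoZ Ω G χ r)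
    (hχ1 : ∀ x ∈ tsupport χ, ‖G x‖ < r → ∀ᶠ y in 𝓝 x, χ y = 1)
    (hfreq : ∀ p ∈ Ω, ∃ᶠ x in 𝓝 p, sdet G x ≠ 0) : {x ∈ tsupport χ | G x = 0}.Finite := by
  classical
  rcases {x ∈ tsupport χ | G x = 0}.eq_empty_or_nonempty with h | ⟨p₀, hp₀, hp₀'⟩
  · rw [h]; exact finite_empty
  obtain ⟨n, -, e, μ, -, -, -, hrep⟩ := hG.exists_weights_zero hχ1 hfreq hp₀ hp₀'
  refine (Set.finite_range e).subset fun p hp => ?_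
  by_contra hpe
  obtain ⟨n', i', e', μ', hi', hμ', hμ0, hrep'⟩ := hG.exists_weights_zero hχ1 hfreq hp.1 hp.2
  obtain ⟨φ, hφ, hφ1, hφ0⟩ := exists_separating_poly
    (Finset.univ.image e ∪ (Finset.univ.image e').erase p) (p := p) (by
      simpa using fun x hx => hpe ⟨x, hx⟩)
  have h1 := hrep φ hφ.contDiffOn
  rw [Finset.sum_eq_zero fun i _ => by rw [hφ0 _ (by simp)]; simp, hrep' φ hφ.contDiffOn] at h1
  have h2 : ∀ i, φ (e' i) = ((if e' i = p then 1 else 0 : ℝ) : ℂ) := by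
    intro i
    split_ifs with h
    · rw [h, hφ1]; simp
    · rw [hφ0 _ (by simp [h])]; simp
  simp only [h2, ← ofReal_mul, ← Complex.ofReal_sum] at h1
  have h3 : ∑ i, μ' i * (if e' i = p then 1 else 0 : ℝ) = 0 := by exact_mod_cast h1
  have h4 := Finset.single_le_sum (f := fun i => μ' i * (if e' i = p then 1 else 0 : ℝ))
    (fun i _ => mul_nonneg (hμ0 i) (by split_ifs <;> simp)) (Finset.mem_univ i')
  simp only [hi', if_true, mul_one] at h4
  linarith

end FiniteZeros

section HamiltonianFamily

variable {m : ℕ}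

/-- A one-parameter family of functions whose critical points inside the support of the cutoff `χ`
stay away from the region where `χ` varies. -/
structure HamFam (O : Set (ℂ × Vec m)) (f : ℂ × Vec m → ℂ) (χ : Vec m → ℝ)
    (r : ℝ) (D : Set ℂ) : Prop where
  isOpen : IsOpen O
  holo : ContDiffOn ℂ ω f O
  smooth : ContDiff ℝ 1 χ
  compact : HasCompactSupport χ
  nonneg : ∀ x, 0 ≤ χ x
  pos : 0 < r
  mem : ∀ ζ ∈ D, ∀ x ∈ tsupport χ, (ζ, x) ∈ O
  sep : ∀ ζ ∈ D, ∀ x ∈ tsupport χ, fderiv ℝ χ x = 0 ∨ r ≤ ‖pgrad f (ζ, x)‖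

variable {O : Set (ℂ × Vec m)} {f : ℂ × Vec m → ℂ} {χ : Vec m → ℝ} {r : ℝ}
  {D : Set ℂ}

theorem HamFam.holo_pgrad (h : HamFam O f χ r D) : ContDiffOn ℂ ω (pgrad f) O :=
  contDiffOn_pgrad h.isOpen h.holo

theorem HamFam.isoZ (h : HamFam O f χ r D) {ζ : ℂ} (hζ : ζ ∈ D) :
    IsoZ {x | (ζ, x) ∈ O} (fun x => pgrad f (ζ, x)) χ r :=
  ⟨h.isOpen.preimage (by fun_prop),
    h.holo_pgrad.comp (contDiff_prodMk_right ζ).contDiffOn fun _ hx => hx,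
    h.smooth, h.compact, h.nonneg, h.mem ζ hζ, h.pos, h.sep ζ hζ⟩

theorem HamFam.fam (h : HamFam O f χ r D) (η : ℝ) (c : Vec m) :
    Fam O (pgrad f) χ (kap η c) :=
  ⟨h.isOpen, h.holo_pgrad, h.smooth, h.compact, contDiff_kap η c, h.nonneg, kap_nonneg η c⟩

theorem HamFam.adm (h : HamFam O f χ r D) {η : ℝ} {c : Vec m} (h0 : 0 < η)
    (h1 : ‖c‖ + η < r) {ζ : ℂ} (hζ : ζ ∈ D) : Adm O (pgrad f) χ (kap η c) ζ := by
  refine ⟨h.mem ζ hζ, fun x hx => (h.sep ζ hζ x hx).symm.imp (fun h2 => ?_) id⟩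
  by_contra h'
  have := norm_sub_lt_of_kap_ne_zero h0 h'
  have h3 := norm_sub_norm_le (pgrad f (ζ, x)) c
  linarith

theorem HamFam.wsq_eq_integral (h : HamFam O f χ r D) (B : Vec m → ℝ)
    (g : ℂ × Vec m → ℂ) {ζ : ℂ} (hζ : ζ ∈ D) :
    wsq (pgrad f) χ B (fun q => g q * pdet (pgrad f) q) ζ =
      ∫ x, ‖g (ζ, x)‖ ^ 2 * (‖sdet (fun x => pgrad f (ζ, x)) x‖ ^ 2 *
        (χ x * B (pgrad f (ζ, x)))) := by
  unfold wsq
  congr 1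
  ext x
  by_cases hx : x ∈ tsupport χ
  · have e := pdet_eq_sdet ((h.holo_pgrad.contDiffAt
      (h.isOpen.mem_nhds (h.mem ζ hζ x hx))).differentiableAt (by simp))
    simp only [e, norm_mul]
    ring
  · simp [image_eq_zero_of_notMem_tsupport hx]

theorem HamFam.wsq_pdet (h : HamFam O f χ r D) (B : Vec m → ℝ) {ζ : ℂ} (hζ : ζ ∈ D) :
    wsq (pgrad f) χ B (pdet (pgrad f)) ζ = (mass (fun x => pgrad f (ζ, x)) χ B 1).re := by
  have := h.wsq_eq_integral B (fun _ => 1) hζ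
  simp only [one_mul, norm_one, one_pow] at this
  rw [mass_one_eq, ofReal_re, ← this]

theorem HamFam.mass_eq (h : HamFam O f χ r D) (hD : IsOpen D) (hDc : IsPreconnected D)
    {ζ ζ' : ℂ} (hζ : ζ ∈ D) (hζ' : ζ' ∈ D) {η η' : ℝ} {c c' : Vec m} (h0 : 0 < η)
    (h1 : ‖c‖ + η < r) (h0' : 0 < η') (h1' : ‖c'‖ + η' < r) :
    mass (fun x => pgrad f (ζ, x)) χ (kap η c) 1 =
      mass (fun x => pgrad f (ζ', x)) χ (kap η' c') 1 := by
  rw [(h.fam η c).mass_one_eq_of_adm hD hDc (fun z hz => h.adm h0 h1 hz) hζ hζ',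
    (h.isoZ hζ').mass_center h0 h1, (h.isoZ hζ').mass_center h0' h1']
  exact (h.isoZ hζ').mass_kap_eq (φ := 1) contDiffOn_const h0 (by linarith [norm_nonneg c]) h0'
    (by linarith [norm_nonneg c'])

/-- The pointwise bound at a regular point furnished by bounds on the weighted square norms. -/
theorem HamFam.norm_sq_le (h : HamFam O f χ r D) {g : ℂ × Vec m → ℂ}
    (hg : ContinuousOn g O) {ζ : ℂ} (hζ : ζ ∈ D) {w : Vec m} (hχ : ∀ᶠ x in 𝓝 w, χ x = 1)
    (hdet : sdet (fun x => pgrad f (ζ, x)) w ≠ 0) {M : ℝ}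
    (hM : ∀ᶠ η in 𝓝[>] (0 : ℝ),
      wsq (pgrad f) χ (kap η (pgrad f (ζ, w))) (fun q => g q * pdet (pgrad f) q) ζ ≤ M) :
    ‖g (ζ, w)‖ ^ 2 ≤ M := by
  refine le_of_forall_pos_sub_le fun ε hε => ?_
  have hu : ContinuousOn (fun x => ‖g (ζ, x)‖ ^ 2) {x | (ζ, x) ∈ O} :=
    (hg.comp (f := fun x : Vec m => (ζ, x)) (s := {x | (ζ, x) ∈ O}) (by fun_prop)
      fun _ hx => hx).norm.pow 2
  obtain ⟨η, h1, h2⟩ := ((h.isoZ hζ).eventually_le_integral hχ hdet hu (fun _ => sq_nonneg _) hε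
    |>.and hM).exists
  rw [h.wsq_eq_integral _ g hζ] at h2
  exact h1.trans h2

/-- The critical values of the members of a family do not move. -/
theorem HamFam.critical_value_eq (h : HamFam O f χ r D) (hD : IsOpen D) (hDc : IsPreconnected D)
    (hseg : ∀ s ∈ Icc (0 : ℝ) 1, s • (1 : ℂ) ∈ D)
    (hcrit : ∀ s ∈ Icc (0 : ℝ) 1, ∀ x ∈ tsupport χ, pgrad f (s • (1 : ℂ), x) = 0 →
      fderiv ℂ f (s • (1 : ℂ), x) (1, 0) = 0) {a : ℂ}
    (ha : ∀ x ∈ tsupport χ, pgrad f (0, x) = 0 → f (0, x) = a) {p : Vec m}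
    (hχ : ∀ᶠ x in 𝓝 p, χ x = 1) (hp : pgrad f (1, p) = 0)
    (hfreq : ∃ᶠ x in 𝓝 p, sdet (fun x => pgrad f (1, x)) x ≠ 0) : f (1, p) = a := by
  have h0D : (0 : ℂ) ∈ D := by simpa using hseg 0 (by simp)
  have h1D : (1 : ℂ) ∈ D := by simpa using hseg 1 (by simp)
  have hr := h.pos
  have hpK : p ∈ tsupport χ := subset_tsupport χ (by simp [hχ.self_of_nhds])
  set g := ham f a with hgdef
  have hg : ContDiffOn ℂ ω g O := contDiffOn_ham h.isOpen h.holo a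
  set ψ : ℂ × Vec m → ℂ := fun q => fderiv ℂ f q (1, 0)
  have hψ : ContDiffOn ℂ ω ψ O := contDiffOn_fderiv_apply h.isOpen h.holo (1, 0)
  set N := (mass (fun x => pgrad f (0, x)) χ (kap (r / 2) 0) 1).re
  have hN0 : 0 ≤ N := (h.isoZ h0D).mass_one_nonneg (kap_nonneg _ _)
  have hsl : ContinuousOn (fun x => g (0, x)) (tsupport χ) :=
    hg.continuousOn.comp (by fun_prop) fun x hx => h.mem 0 h0D x hx
  have hKs : IsCompact (Icc (0 : ℝ) 1 ×ˢ tsupport χ) := isCompact_Icc.prod h.compact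
  have hmaps : MapsTo (fun q : ℝ × Vec m => (q.1 • (1 : ℂ), q.2)) (Icc (0 : ℝ) 1 ×ˢ tsupport χ) O :=
    fun q hq => h.mem _ (hseg _ hq.1) _ hq.2
  have hcq : Continuous (fun q : ℝ × Vec m => (q.1 • (1 : ℂ), q.2)) := by fun_prop
  have key : ∀ ε > 0, ‖g (1, p)‖ ≤ ε * √N + ε * √N := by
    intro ε hε
    obtain ⟨ρ₁, hρ₁, hs1⟩ := exists_forall_norm_lt_of_eq_zero h.compact
      ((h.isoZ h0D).holo.continuousOn.mono (h.isoZ h0D).sub) hsl (c := 0) (ε := ε) (by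
        intro x hx hx0
        simp only [hgdef, ham, hx0, ha x hx hx0]
        simp) hε
    obtain ⟨ρ₂, hρ₂, hs2⟩ := exists_forall_norm_lt_of_eq_zero hKs
      (h.holo_pgrad.continuousOn.comp hcq.continuousOn hmaps)
      (hψ.continuousOn.comp hcq.continuousOn hmaps) (c := 0) (ε := ε)
      (fun q hq hq0 => hcrit q.1 hq.1 q.2 hq.2 hq0) hε
    set ρ := min (min ρ₁ ρ₂) r
    have hρ : 0 < ρ := by positivity
    have hρ1 : ρ ≤ ρ₁ := (min_le_left _ _).trans (min_le_left _ _)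
    have hρ2 : ρ ≤ ρ₂ := (min_le_left _ _).trans (min_le_right _ _)
    have hρr : ρ ≤ r := min_le_right _ _
    have hFc : ContinuousAt (fun x => pgrad f (1, x)) p :=
      (h.isoZ h1D).holo.continuousOn.continuousAt
        ((h.isoZ h1D).isOpen.mem_nhds (h.mem 1 h1D p hpK))
    have hgc : ContinuousAt (fun x => g (1, x)) p :=
      (hg.continuousOn.comp (f := fun x : Vec m => ((1 : ℂ), x)) (s := {x | ((1 : ℂ), x) ∈ O})
        (by fun_prop) fun x hx => hx).continuousAt
        ((h.isoZ h1D).isOpen.mem_nhds (h.mem 1 h1D p hpK))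
    have hev : ∀ᶠ w in 𝓝 p, ‖pgrad f (1, w)‖ < ρ / 2 ∧ ∀ᶠ x in 𝓝 w, χ x = 1 :=
      (hFc.norm.eventually_lt continuousAt_const (by simpa [hp] using hρ)).and
        hχ.eventually_nhds
    refine le_of_tendsto_of_frequently hgc.norm ((hfreq.and_eventually hev).mono fun w hw => ?_)
    obtain ⟨hdet, hwρ, hχw⟩ := hw
    set c := pgrad f (1, w)
    have hsmall : ∀ η : ℝ, 0 < η → η < ρ / 2 → ∀ y, kap η c y ≠ 0 → ‖y - 0‖ < ρ := by
      intro η h0 h1 y hy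
      have h2 := norm_sub_lt_of_kap_ne_zero h0 hy
      have h3 := norm_sub_norm_le y c
      rw [sub_zero]
      linarith
    have := h.norm_sq_le hg.continuousOn h1D hχw hdet (M := (ε * √N + ε * √N) ^ 2) (by
      filter_upwards [Ioo_mem_nhdsGT (half_pos hρ)] with η hη
      have hηr : ‖c‖ + η < r := by linarith [hη.2]
      have hNeq : ∀ ζ ∈ D, wsq (pgrad f) χ (kap η c) (pdet (pgrad f)) ζ = N := fun ζ hζ => by
        rw [h.wsq_pdet _ hζ, h.mass_eq hD hDc hζ h0D hη.1 hηr (half_pos hr) (by rw [norm_zero]; linarith)]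
      have h1 := (h.fam η c).sqrt_wsq_le hg hψ (fun q hq => flow_ham h.isOpen h.holo a hq) (ζ := 1)
        hε.le (N := N) (fun s hs => h.adm hη.1 hηr (hseg s hs))
        (fun s hs x hx hk => (hs2 (s, x) ⟨hs, hx⟩
          ((hsmall η hη.1 hη.2 _ hk).trans_le hρ2)).le)
        (fun s hs => (hNeq _ (hseg s hs)).le)
      have h2 := (h.fam η c).wsq_mul_le hg.continuousOn
        (contDiffOn_pdet h.isOpen h.holo_pgrad).continuousOn (h.mem 0 h0D) (M := ε)
        (fun x hx hk => (hs1 x hx ((hsmall η hη.1 hη.2 _ hk).trans_le hρ1)).le)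
      rw [hNeq 0 h0D] at h2
      have h3 : √(wsq (pgrad f) χ (kap η c) (fun q => g q * pdet (pgrad f) q) 0) ≤ ε * √N := by
        rw [← Real.sqrt_sq hε.le, ← Real.sqrt_mul (sq_nonneg ε)]
        exact Real.sqrt_le_sqrt h2
      rw [norm_one, one_mul] at h1
      exact (Real.sqrt_le_left (by positivity)).1 (h1.trans (by linarith)))
    exact le_of_sq_le_sq this (by positivity)
  have hzero : ‖g (1, p)‖ ≤ 0 := by
    refine le_of_forall_pos_le_add fun δ hδ => ?_
    have h1 := key (δ / (2 * (√N + 1))) (by positivity)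
    refine h1.trans ?_
    rw [zero_add, ← two_mul]
    have : 2 * (δ / (2 * (√N + 1)) * √N) = δ * (√N / (√N + 1)) := by field_simp
    rw [this]
    exact mul_le_of_le_one_right hδ.le (div_le_one_of_le₀ (by linarith) (by positivity))
  have hz := norm_le_zero_iff.1 hzero
  simp only [hgdef, ham, hp] at hz
  simpa [sub_eq_zero] using hz

end HamiltonianFamily

section Osgood

variable {E F : Type*} [NormedAddCommGroup E] [NormedSpace ℂ E] [NormedAddCommGroup F]
  [NormedSpace ℂ F]

theorem norm_fderiv_le_of_forall_norm_le {f : E → F} {x : E} {ρ M : ℝ} (hρ : 0 < ρ)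
    (hf : ∀ y ∈ closedBall x ρ, DifferentiableAt ℂ f y)
    (hM : ∀ y ∈ closedBall x ρ, ‖f y‖ ≤ M) : ‖fderiv ℂ f x‖ ≤ M / ρ := by
  have hM0 : 0 ≤ M := (norm_nonneg _).trans (hM x (mem_closedBall_self hρ.le))
  refine ContinuousLinearMap.opNorm_le_bound _ (by positivity) fun v => ?_
  rcases eq_or_ne v 0 with rfl | hv
  · simp
  have hv' : 0 < ‖v‖ := norm_pos_iff.2 hv
  have hmem : ∀ ζ ∈ closedBall (0 : ℂ) (ρ / ‖v‖), x + ζ • v ∈ closedBall x ρ := by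
    intro ζ hζ
    rw [mem_closedBall_zero_iff, le_div_iff₀ hv'] at hζ
    simpa [norm_smul] using hζ
  have hd : ∀ ζ ∈ closedBall (0 : ℂ) (ρ / ‖v‖),
      HasDerivAt (fun ζ : ℂ => f (x + ζ • v)) (fderiv ℂ f (x + ζ • v) v) ζ := by
    intro ζ hζ
    refine HasFDerivAt.comp_hasDerivAt (l := f) ζ (hf _ (hmem ζ hζ)).hasFDerivAt ?_
    simpa using ((hasDerivAt_id ζ).smul_const v).const_add x
  have h := Complex.norm_deriv_le_of_forall_mem_sphere_norm_le (c := 0) (R := ρ / ‖v‖) (C := M)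
    (f := fun ζ : ℂ => f (x + ζ • v)) (by positivity)
    (DifferentiableOn.diffContOnCl fun ζ hζ => (hd ζ (closure_ball_subset_closedBall hζ)).differentiableAt.differentiableWithinAt)
    (fun z hz => hM _ (hmem z (sphere_subset_closedBall hz)))
  rw [(hd 0 (by simp; positivity)).deriv] at h
  simp only [zero_smul, add_zero] at h
  refine h.trans (le_of_eq ?_)
  field_simp

theorem norm_iteratedFDeriv_le_of_forall_norm_le {f : E → F} {U : Set E} (hU : IsOpen U)
    (hf : ContDiffOn ℂ ∞ f U) {x : E} {δ M : ℝ} (hδ : 0 < δ) (K : ℕ)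
    (hx : closedBall x (K * δ) ⊆ U) (hM : ∀ y ∈ closedBall x (K * δ), ‖f y‖ ≤ M) :
    ‖iteratedFDeriv ℂ K f x‖ ≤ M / δ ^ K := by
  have key : ∀ k ≤ K, ∀ y ∈ closedBall x ((K - k) * δ),
      ‖iteratedFDeriv ℂ k f y‖ ≤ M / δ ^ k := by
    intro k
    induction k with
    | zero => intro _ y hy; simpa using hM y (by simpa using hy)
    | succ k ih =>
      intro hk y hy
      have hsub : closedBall y δ ⊆ closedBall x ((K - k) * δ) := by
        refine closedBall_subset_closedBall' ?_
        rw [mem_closedBall] at hy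
        push_cast at hy
        linarith
      have hsubU : closedBall x ((K - k) * δ) ⊆ U :=
        (closedBall_subset_closedBall (by nlinarith [(k.cast_nonneg : (0:ℝ) ≤ k)])).trans hx
      rw [← norm_fderiv_iteratedFDeriv, pow_succ, ← div_div]
      refine norm_fderiv_le_of_forall_norm_le hδ (fun z hz => ?_)
        (fun z hz => ih (by omega) z (hsub hz))
      exact ((hf.contDiffAt (hU.mem_nhds (hsubU (hsub hz)))).differentiableAt_iteratedFDeriv
        (by exact_mod_cast WithTop.coe_lt_top _))
  simpa using key K le_rfl x (by simp)

theorem iteratedDeriv_comp_line {f : E → F} {U : Set E} (hU : IsOpen U) (hf : ContDiffOn ℂ ∞ f U)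
    (x v : E) (k : ℕ) {ζ : ℂ} (hζ : x + ζ • v ∈ U) :
    iteratedDeriv k (fun ζ : ℂ => f (x + ζ • v)) ζ =
      iteratedFDeriv ℂ k f (x + ζ • v) (fun _ => v) := by
  induction k generalizing ζ with
  | zero => simp
  | succ k ih =>
    rw [iteratedDeriv_succ, iteratedFDeriv_succ_apply_left]
    have hO : IsOpen {ζ : ℂ | x + ζ • v ∈ U} := hU.preimage (by fun_prop)
    have he : iteratedDeriv k (fun ζ : ℂ => f (x + ζ • v)) =ᶠ[𝓝 ζ]
        fun ζ => iteratedFDeriv ℂ k f (x + ζ • v) (fun _ => v) :=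
      (hO.eventually_mem hζ).mono fun z hz => ih hz
    rw [he.deriv_eq]
    have hd := ((hf.contDiffAt (hU.mem_nhds hζ)).differentiableAt_iteratedFDeriv (m := k)
        (by exact_mod_cast WithTop.coe_lt_top _)).hasFDerivAt
    have h1 : HasDerivAt (fun ζ : ℂ => x + ζ • v) v ζ := by
      simpa using ((hasDerivAt_id ζ).smul_const v).const_add x
    have h2 := HasFDerivAt.comp_hasDerivAt (l := iteratedFDeriv ℂ k f) ζ hd h1
    have h3 := ((ContinuousMultilinearMap.apply ℂ (fun _ : Fin k => E) F fun _ => v).hasFDerivAt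
      (x := iteratedFDeriv ℂ k f (x + ζ • v))).comp_hasDerivAt ζ h2
    exact h3.deriv

theorem ContDiffOn.analyticOnNhd_of_infty [CompleteSpace F] {f : E → F} {U : Set E} (hU : IsOpen U)
    (hf : ContDiffOn ℂ ∞ f U) : AnalyticOnNhd ℂ f U := by
  intro x hx
  obtain ⟨ρ, hρ, hρU, hb⟩ : ∃ ρ > 0, closedBall x ρ ⊆ U ∧
      ∀ y ∈ closedBall x ρ, ‖f y‖ ≤ ‖f x‖ + 1 := by
    have h1 : ∀ᶠ y in 𝓝 x, ‖f y‖ < ‖f x‖ + 1 :=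
      (hf.continuousOn.continuousAt (hU.mem_nhds hx)).norm.eventually_lt continuousAt_const
        (by linarith)
    obtain ⟨ρ, hρ, h⟩ := nhds_basis_closedBall.mem_iff.1 (h1.and (hU.mem_nhds hx))
    exact ⟨ρ, hρ, fun y hy => (h hy).2, fun y hy => (h hy).1.le⟩
  set M := ‖f x‖ + 1
  have hM0 : 0 ≤ M := by positivity
  set p : FormalMultilinearSeries ℂ E F := fun k => ((k.factorial : ℂ)⁻¹) • iteratedFDeriv ℂ k f x
  have hp : ∀ k, ‖p k‖ * (ρ / 3) ^ k ≤ M := by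
    intro k
    rcases Nat.eq_zero_or_pos k with rfl | hk
    · simp only [p, norm_smul]
      simpa using hb x (mem_closedBall_self hρ.le)
    have hk' : (0 : ℝ) < k := by exact_mod_cast hk
    have e : (k : ℝ) * (ρ / k) = ρ := by field_simp
    have h1 := norm_iteratedFDeriv_le_of_forall_norm_le hU hf (x := x) (M := M)
      (δ := ρ / k) (by positivity) k (by rwa [e]) (by rwa [e])
    have h2 : (k : ℝ) ^ k / k.factorial ≤ 3 ^ k := by
      refine (Real.pow_div_factorial_le_exp _ hk'.le k).trans ?_
      rw [← mul_one (k : ℝ), Real.exp_nat_mul]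
      exact pow_le_pow_left₀ (Real.exp_pos _).le (Real.exp_one_lt_d9.le.trans (by norm_num)) k
    simp only [p, norm_smul, norm_inv, Complex.norm_natCast]
    calc (k.factorial : ℝ)⁻¹ * ‖iteratedFDeriv ℂ k f x‖ * (ρ / 3) ^ k
        ≤ (k.factorial : ℝ)⁻¹ * (M / (ρ / k) ^ k) * (ρ / 3) ^ k := by gcongr
      _ = M * ((k : ℝ) ^ k / k.factorial) / 3 ^ k := by
        rw [div_pow, div_pow]; field_simp
      _ ≤ M * 3 ^ k / 3 ^ k := by gcongr
      _ = M := by field_simp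
  refine ⟨p, ENNReal.ofReal (ρ / 3), ?_, by simpa using hρ, fun {y} hy => ?_⟩
  · rw [ENNReal.ofReal]
    refine p.le_radius_of_bound M fun k => ?_
    rw [Real.coe_toNNReal _ (by positivity)]
    exact hp k
  · have hy' : ‖y‖ < ρ / 3 := by
      rw [eball_ofReal, mem_ball_zero_iff] at hy
      exact hy
    have hmem : ∀ ζ ∈ ball (0 : ℂ) 2, x + ζ • y ∈ U := by
      intro ζ hζ
      refine hρU ?_
      rw [mem_ball_zero_iff] at hζ
      rw [mem_closedBall, dist_self_add_left, norm_smul]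
      nlinarith [norm_nonneg y, norm_nonneg ζ]
    have hd : DifferentiableOn ℂ (fun ζ : ℂ => f (x + ζ • y)) (ball 0 2) :=
      (hf.differentiableOn (by simp)).comp (by fun_prop) hmem
    have h := Complex.hasSum_taylorSeries_on_ball hd (z := 1) (by simp)
    simp only [sub_zero, one_pow, one_smul] at h
    convert h using 1
    ext k
    rw [iteratedDeriv_comp_line hU hf x y k (hmem 0 (by simp))]
    simp [p]

end Osgood

section Holomorphic

universe u

variable {E F : Type u} [NormedAddCommGroup E] [NormedSpace ℂ E] [NormedAddCommGroup F]
  [NormedSpace ℂ F]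

theorem ContDiffOn.complex_one_of_real {f : E → F} {U : Set E} (hU : IsOpen U)
    (hf : ContDiffOn ℝ 1 f U) (hd : DifferentiableOn ℂ f U) : ContDiffOn ℂ 1 f U := by
  refine (contDiffOn_succ_iff_fderiv_of_isOpen (n := 0) hU).2 ⟨hd, by simp, contDiffOn_zero.2 ?_⟩
  rw [(ContinuousLinearMap.restrictScalarsIsometry ℂ E F ℝ ℝ).isometry.isEmbedding.continuousOn_iff]
  exact (hf.continuousOn_fderiv_of_isOpen hU le_rfl).congr fun x hx =>
    ((hd.differentiableAt (hU.mem_nhds hx)).fderiv_restrictScalars ℝ).symm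

theorem ContDiffOn.fderiv_apply_complex [CompleteSpace F] {f : E → F} {U : Set E}
    (hU : IsOpen U) (hf : ContDiffOn ℂ 1 f U) (v : E) :
    ContDiffOn ℂ 1 (fun x => fderiv ℂ f x v) U := by
  intro x₀ hx₀
  refine ContDiffAt.contDiffWithinAt ?_
  have hda : ∀ x ∈ U, DifferentiableAt ℂ f x := fun x hx =>
    (hf.contDiffAt (hU.mem_nhds hx)).differentiableAt one_ne_zero
  have hc := hf.continuousOn_fderiv_of_isOpen hU le_rfl
  have hO : IsOpen {p : E × ℂ | p.1 + p.2 • v ∈ U} := hU.preimage (by fun_prop)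
  obtain ⟨R, hR, hRU⟩ : ∃ R > 0, ∀ ζ ∈ closedBall (0 : ℂ) R, x₀ + ζ • v ∈ U := by
    have h1 : ∀ᶠ ζ in 𝓝 (0 : ℂ), x₀ + ζ • v ∈ U :=
      (continuous_const.add (continuous_id.smul continuous_const)).tendsto' 0 x₀ (by simp)
        (hU.mem_nhds hx₀)
    obtain ⟨R, hR, h⟩ := nhds_basis_closedBall.mem_iff.1 h1
    exact ⟨R, hR, fun ζ hζ => h hζ⟩
  have hev : ∀ᶠ x in 𝓝 x₀, ∀ ζ ∈ closedBall (0 : ℂ) R, x + ζ • v ∈ U :=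
    (isCompact_closedBall (0 : ℂ) R).eventually_forall_of_forall_eventually fun ζ hζ =>
      hO.mem_nhds (hRU ζ hζ)
  set k : ℝ → ℂ := fun θ => _root_.deriv (circleMap 0 R) θ * (1 / (circleMap 0 R θ - 0) ^ 2)
  have hk : Continuous k := by
    simp only [k, deriv_circleMap, sub_zero]
    refine Continuous.mul (by fun_prop) ?_
    refine Continuous.div (by fun_prop) (by fun_prop) fun θ => pow_ne_zero _ ?_
    simp [circleMap_eq_center_iff, hR.ne']
  have hO' : IsOpen {p : E × ℝ | p.1 + circleMap 0 R p.2 • v ∈ U} := hU.preimage (by fun_prop)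
  have hmain := contDiffAt_setIntegral_param (𝕜 := ℂ) (μ := (volume : Measure ℝ))
    (u := fun x θ => k θ • f (x + circleMap 0 R θ • v))
    (u' := fun x θ => k θ • fderiv ℂ f (x + circleMap 0 R θ • v)) hO'
    (isCompact_Icc (a := (0 : ℝ)) (b := 2 * Real.pi)) (s₀ := x₀)
    (fun θ _ => hRU _ (by simp [abs_of_pos hR]))
    ((hk.comp continuous_snd).continuousOn.smul
      (hf.continuousOn.comp (f := fun p : E × ℝ => p.1 + circleMap 0 R p.2 • v)
        (by fun_prop) fun p hp => hp))
    ((hk.comp continuous_snd).continuousOn.smul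
      (hc.comp (f := fun p : E × ℝ => p.1 + circleMap 0 R p.2 • v)
        (by fun_prop) fun p hp => hp))
    (fun p hp => ((hasFDerivAt_comp_add_right (circleMap 0 R p.2 • v)).2 (hda _ hp).hasFDerivAt).const_smul (k p.2))
  refine (hmain.const_smul ((2 * Real.pi * I : ℂ)⁻¹)).congr_of_eventuallyEq ?_
  filter_upwards [hev] with x hx
  have hd : ∀ ζ ∈ closedBall (0 : ℂ) R,
      HasDerivAt (fun ζ : ℂ => f (x + ζ • v)) (fderiv ℂ f (x + ζ • v) v) ζ := by
    intro ζ hζ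
    refine HasFDerivAt.comp_hasDerivAt (l := f) ζ (hda _ (hx ζ hζ)).hasFDerivAt ?_
    simpa using ((hasDerivAt_id ζ).smul_const v).const_add x
  have h := DifferentiableOn.deriv_eq_smul_circleIntegral (c := 0) (f := fun ζ : ℂ => f (x + ζ • v)) hR
    (fun ζ hζ => (hd ζ hζ).differentiableAt.differentiableWithinAt)
  rw [(hd 0 (by simp [hR.le])).deriv, zero_smul, add_zero] at h
  replace h := (eq_inv_smul_iff₀ Complex.two_pi_I_ne_zero).2 h.symm
  simp only [h]
  congr 1
  rw [circleIntegral, intervalIntegral.integral_of_le (by positivity), integral_Icc_eq_integral_Ioc]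
  congr 1
  ext θ
  simp only [k, smul_smul]

/-- Continuous complex differentiability on an open subset of a finite dimensional space implies
analyticity. -/
theorem ContDiffOn.analyticOnNhd_complex [FiniteDimensional ℂ E] [CompleteSpace F] {f : E → F}
    {U : Set E} (hU : IsOpen U) (hf : ContDiffOn ℂ 1 f U) : AnalyticOnNhd ℂ f U := by
  refine ContDiffOn.analyticOnNhd_of_infty hU (contDiffOn_infty.2 fun n => ?_)
  have key : ∀ (n : ℕ) (F : Type u) [NormedAddCommGroup F] [NormedSpace ℂ F] [CompleteSpace F]
      (f : E → F), ContDiffOn ℂ 1 f U → ContDiffOn ℂ n f U := by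
    intro n
    induction n with
    | zero => intro F _ _ _ f hf; exact contDiffOn_zero.2 hf.continuousOn
    | succ n ih =>
      intro F _ _ _ f hf
      have h2 := (contDiffOn_clm_apply (n := 1)).2 fun v => hf.fderiv_apply_complex hU v
      have := (contDiffOn_succ_iff_fderiv_of_isOpen (n := n) (f := f) hU).2
        ⟨hf.differentiableOn one_ne_zero, by simp, ih _ _ h2⟩
      exact_mod_cast this
  exact key n F f hf

theorem ContDiffOn.omega_of_one [FiniteDimensional ℂ E] [CompleteSpace F] {f : E → F}
    {U : Set E} (hU : IsOpen U) (hf : ContDiffOn ℂ 1 f U) : ContDiffOn ℂ ω f U :=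
  (hf.analyticOnNhd_complex hU).contDiffOn hU.uniqueDiffOn

end Holomorphic

section Push

variable {m : ℕ}

/-- The holomorphic gradient of a function on `ℂᵐ`. -/
noncomputable def hgrad (g : Vec m → ℂ) (x : Vec m) : Vec m :=
  fun k => fderiv ℂ g x (Pi.single k 1)

theorem fderiv_eq_dotProduct_hgrad (g : Vec m → ℂ) (x h : Vec m) :
    fderiv ℂ g x h = hgrad g x ⬝ᵥ h := by
  conv_lhs => rw [← Finset.univ_sum_single h, map_sum]
  refine Finset.sum_congr rfl fun k _ => ?_
  have : Pi.single k (h k) = h k • (Pi.single k 1 : Vec m) := by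
    rw [← Pi.single_smul, smul_eq_mul, mul_one]
  rw [this, map_smul, smul_eq_mul, mul_comm, hgrad]

theorem contDiffOn_hgrad {g : Vec m → ℂ} {Ω : Set Vec m} (hΩ : IsOpen Ω)
    (hg : ContDiffOn ℂ ω g Ω) : ContDiffOn ℂ ω (hgrad g) Ω :=
  contDiffOn_pi.2 fun _ => contDiffOn_fderiv_apply hΩ hg _

/-- The difference function `g(x) - g(y)`. -/
def gdiff (g : Vec m → ℂ) (z : Vec m × Vec m) : ℂ := g z.1 - g z.2

/-- The squared Euclidean norm of the gradient of `gdiff g`. -/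
noncomputable def gsq (g : Vec m → ℂ) (z : Vec m × Vec m) : ℝ :=
  sqNorm (hgrad g z.1) + sqNorm (hgrad g z.2)

theorem gsq_nonneg (g : Vec m → ℂ) (z : Vec m × Vec m) : 0 ≤ gsq g z :=
  add_nonneg (sqNorm_nonneg _) (sqNorm_nonneg _)

/-- The conjugate gradient of `gdiff g`. -/
noncomputable def gvec (g : Vec m → ℂ) (z : Vec m × Vec m) :
    Vec m × Vec m :=
  (star (hgrad g z.1), -star (hgrad g z.2))

theorem norm_gvec_sq_le (g : Vec m → ℂ) (z : Vec m × Vec m) :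
    ‖gvec g z‖ ^ 2 ≤ gsq g z := by
  have h1 := norm_sq_le_sqNorm (hgrad g z.1)
  have h2 := norm_sq_le_sqNorm (hgrad g z.2)
  have h3 := sqNorm_nonneg (hgrad g z.1)
  have h4 := sqNorm_nonneg (hgrad g z.2)
  rw [gvec, Prod.norm_mk, norm_neg, norm_star, norm_star, gsq]
  rcases max_cases ‖hgrad g z.1‖ ‖hgrad g z.2‖ with h | h <;> rw [h.1] <;> linarith

/-- The cut off vector field along which the absolute value of `gdiff g` grows. -/
noncomputable def pushVec (g : Vec m → ℂ) (l : ℝ) (β : Vec m → ℝ)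
    (z : Vec m × Vec m) : Vec m × Vec m :=
  (((β z.1 * β z.2 * psi (gdiff g z / l) : ℝ) : ℂ) * gdiff g z) • gvec g z

theorem contDiff_pushVec {g : Vec m → ℂ} {Ω : Set Vec m} (hΩ : IsOpen Ω)
    (hg : ContDiffOn ℂ ω g Ω) {β : Vec m → ℝ} (hβ : ContDiff ℝ 2 β)
    (hβΩ : tsupport β ⊆ Ω) (l : ℝ) : ContDiff ℝ 2 (pushVec g l β) := by
  rw [contDiff_iff_contDiffAt]
  intro z
  by_cases hz : z.1 ∈ tsupport β ∧ z.2 ∈ tsupport β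
  · have hreal : ∀ {x : Vec m}, x ∈ tsupport β → ContDiffAt ℝ 2 g x ∧
        ContDiffAt ℝ 2 (hgrad g) x := fun hx =>
      ⟨((hg.contDiffAt (hΩ.mem_nhds (hβΩ hx))).restrict_scalars ℝ).of_le le_top,
        (((contDiffOn_hgrad hΩ hg).contDiffAt (hΩ.mem_nhds (hβΩ hx))).restrict_scalars ℝ).of_le
          le_top⟩
    have hstar : ContDiff ℝ 2 (fun y : Vec m => star y) := (starL' ℝ (A := Vec m)).contDiff
    have h1 : ContDiffAt ℝ 2 (gdiff g) z :=
      ((hreal hz.1).1.comp z contDiffAt_fst).sub ((hreal hz.2).1.comp z contDiffAt_snd)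
    have h2 : ContDiffAt ℝ 2 (gvec g) z :=
      ((hstar.contDiffAt.comp z ((hreal hz.1).2.comp z contDiffAt_fst))).prodMk
        (hstar.contDiffAt.comp z ((hreal hz.2).2.comp z contDiffAt_snd)).neg
    have h3 : ContDiffAt ℝ 2 (fun z => psi (gdiff g z / l)) z :=
      contDiff_psi.contDiffAt.comp z (h1.div_const _)
    have h4 : ContDiffAt ℝ 2 (fun z : Vec m × Vec m => β z.1 * β z.2) z :=
      ((hβ.comp contDiff_fst).mul (hβ.comp contDiff_snd)).contDiffAt
    have h5 : ContDiffAt ℝ 2 (fun z => ((β z.1 * β z.2 * psi (gdiff g z / l) : ℝ) : ℂ)) z :=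
      ofRealCLM.contDiff.contDiffAt.comp z (h4.mul h3)
    exact (h5.mul h1).smul h2
  · refine ContDiffAt.congr_of_eventuallyEq (f := fun _ => 0) contDiffAt_const ?_
    rw [not_and_or] at hz
    rcases hz with hz | hz
    · filter_upwards [continuous_fst.continuousAt.eventually (notMem_tsupport_iff_eventuallyEq.1 hz)]
        with y hy
      simp [pushVec, hy]
    · filter_upwards [continuous_snd.continuousAt.eventually (notMem_tsupport_iff_eventuallyEq.1 hz)]
        with y hy
      simp [pushVec, hy]

theorem norm_growth_bounds {G G' : ℂ} {a S C : ℝ} (ha : 0 ≤ a) (hS : 0 ≤ S)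
    (h : ‖G' - G * (1 + a * S)‖ ≤ 2 * C * (a * ‖G‖) ^ 2 * S) (hC : 4 * C * (a * ‖G‖) ≤ 1) :
    ‖G‖ * (1 + a * S / 2) ≤ ‖G'‖ ∧ ‖G'‖ ≤ ‖G‖ * (1 + 3 / 2 * (a * S)) := by
  have h1 : ‖G * (1 + a * S)‖ = ‖G‖ * (1 + a * S) := by
    rw [norm_mul]
    congr 1
    rw [show (1 + a * S : ℂ) = ((1 + a * S : ℝ) : ℂ) by push_cast; ring, norm_real,
      Real.norm_of_nonneg (by positivity)]
  have h2 : 2 * C * (a * ‖G‖) ^ 2 * S ≤ ‖G‖ * (a * S) / 2 := by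
    have : 0 ≤ ‖G‖ * a * S := by positivity
    nlinarith
  have h3 := norm_sub_norm_le (G * (1 + a * S)) G'
  have h4 := norm_sub_norm_le G' (G * (1 + a * S))
  rw [norm_sub_rev] at h3
  constructor <;> nlinarith

/-- One step of the push. -/
theorem push_bounds {g : Vec m → ℂ} {β : Vec m → ℝ} {l R₂ σ C M δ : ℝ} (hl : 0 < l)
    (hβ : ∀ x, ‖x‖ ≤ R₂ → β x = 1) (hC0 : 0 ≤ C) (hM0 : 0 ≤ M)
    (hC : ∀ x, ‖x‖ ≤ R₂ → ∀ h, ‖h‖ ≤ σ → ‖g (x + h) - g x - hgrad g x ⬝ᵥ h‖ ≤ C * ‖h‖ ^ 2)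
    (hM : ∀ z, ‖z‖ ≤ R₂ → gsq g z ≤ M ^ 2) (hδ1 : 8 * C * δ * l ≤ 1) (hδ2 : 3 / 2 * (δ * M ^ 2) ≤ 1)
    (hδ3 : δ * (2 * l) * M ≤ σ) {a : ℝ} (ha : a ∈ Icc 0 δ) {z : Vec m × Vec m}
    (hz : ‖z‖ ≤ R₂) :
    ‖a • pushVec g l β z‖ ≤ a * psi (gdiff g z / l) * ‖gdiff g z‖ * √(gsq g z) ∧
      ‖a • pushVec g l β z‖ ≤ σ ∧
      ‖gdiff g z‖ * (1 + a * psi (gdiff g z / l) * gsq g z / 2) ≤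
        ‖gdiff g (z + a • pushVec g l β z)‖ ∧
      ‖gdiff g (z + a • pushVec g l β z)‖ ≤ 2 * ‖gdiff g z‖ ∧
      (psi (gdiff g z / l) ≠ 0 → ‖gdiff g z‖ ≤ 2 * l) := by
  have hz1 : ‖z.1‖ ≤ R₂ := (norm_fst_le z).trans hz
  have hz2 : ‖z.2‖ ≤ R₂ := (norm_snd_le z).trans hz
  set θ := psi (gdiff g z / l) with hθ
  have hθ0 : 0 ≤ θ := smoothTransition.nonneg _
  have hθ1 : θ ≤ 1 := smoothTransition.le_one _
  have hS := gsq_nonneg g z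
  have hsupp : θ ≠ 0 → ‖gdiff g z‖ ≤ 2 * l := by
    intro h
    have h2 : normSq (gdiff g z / l) ≤ 2 := by
      by_contra! h'
      exact h (smoothTransition.zero_of_nonpos (by linarith))
    rw [normSq_eq_norm_sq, norm_div, norm_real, Real.norm_of_nonneg hl.le, div_pow,
      div_le_iff₀ (by positivity)] at h2
    exact le_of_sq_le_sq (by nlinarith) (by positivity)
  have hθG : θ * ‖gdiff g z‖ ≤ 2 * l := by
    by_cases h : θ = 0
    · rw [h, zero_mul]; positivity
    · exact (mul_le_of_le_one_left (norm_nonneg _) hθ1).trans (hsupp h)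
  have hpv : a • pushVec g l β z = ((a * θ : ℝ) * gdiff g z : ℂ) • gvec g z := by
    rw [pushVec, hβ _ hz1, hβ _ hz2, ← hθ, ← Complex.coe_smul, smul_smul]
    push_cast
    ring_nf
  have hgv : ‖gvec g z‖ ≤ √(gsq g z) := Real.le_sqrt_of_sq_le (norm_gvec_sq_le g z)
  have hsM : √(gsq g z) ≤ M := Real.sqrt_le_iff.2 ⟨hM0, hM z hz⟩
  have hcoef : ‖((a * θ : ℝ) * gdiff g z : ℂ)‖ = a * θ * ‖gdiff g z‖ := by
    rw [norm_mul, norm_real, Real.norm_of_nonneg (mul_nonneg ha.1 hθ0)]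
  have hn : ‖a • pushVec g l β z‖ ≤ a * θ * ‖gdiff g z‖ * √(gsq g z) := by
    rw [hpv, norm_smul, hcoef]
    have := ha.1
    gcongr
  have hδ0 : 0 ≤ δ := ha.1.trans ha.2
  have hnσ : ‖a • pushVec g l β z‖ ≤ σ := by
    refine hn.trans (le_trans ?_ hδ3)
    rw [mul_assoc a]
    have := ha.1
    have := ha.2
    gcongr
  have hfst : (z + a • pushVec g l β z).1 = z.1 + (a • pushVec g l β z).1 := rfl
  have hsnd : (z + a • pushVec g l β z).2 = z.2 + (a • pushVec g l β z).2 := rfl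
  have key : ‖gdiff g (z + a • pushVec g l β z) - gdiff g z * (1 + (a * θ : ℝ) * (gsq g z : ℝ))‖ ≤
      2 * C * (a * θ * ‖gdiff g z‖) ^ 2 * gsq g z := by
    have e1 := hC z.1 hz1 _ ((norm_fst_le _).trans hnσ)
    have e2 := hC z.2 hz2 _ ((norm_snd_le _).trans hnσ)
    have e3 : hgrad g z.1 ⬝ᵥ (a • pushVec g l β z).1 - hgrad g z.2 ⬝ᵥ (a • pushVec g l β z).2 =
        gdiff g z * ((a * θ : ℝ) * (gsq g z : ℝ)) := by
      rw [hpv, gvec, gsq]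
      simp only [Prod.smul_fst, Prod.smul_snd, dotProduct_smul, dotProduct_neg,
        dotProduct_star_self, smul_eq_mul]
      push_cast
      ring
    have e4 : gdiff g (z + a • pushVec g l β z) -
        gdiff g z * (1 + (a * θ : ℝ) * (gsq g z : ℝ)) =
        (g (z.1 + (a • pushVec g l β z).1) - g z.1 - hgrad g z.1 ⬝ᵥ (a • pushVec g l β z).1) -
        (g (z.2 + (a • pushVec g l β z).2) - g z.2 - hgrad g z.2 ⬝ᵥ (a • pushVec g l β z).2) := by
      rw [mul_add, ← e3, mul_one]
      simp only [gdiff, hfst, hsnd]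
      ring
    rw [e4]
    refine (norm_sub_le _ _).trans ((add_le_add e1 e2).trans ?_)
    have f1 : ‖(a • pushVec g l β z).1‖ ^ 2 ≤ (a * θ * ‖gdiff g z‖) ^ 2 * gsq g z := by
      rw [← Real.sq_sqrt hS, ← mul_pow]
      exact pow_le_pow_left₀ (norm_nonneg _) ((norm_fst_le _).trans hn) 2
    have f2 : ‖(a • pushVec g l β z).2‖ ^ 2 ≤ (a * θ * ‖gdiff g z‖) ^ 2 * gsq g z := by
      rw [← Real.sq_sqrt hS, ← mul_pow]
      exact pow_le_pow_left₀ (norm_nonneg _) ((norm_snd_le _).trans hn) 2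
    nlinarith
  have hCb : 4 * C * (a * θ * ‖gdiff g z‖) ≤ 1 := by
    refine le_trans ?_ hδ1
    have := ha.1
    have := ha.2
    calc 4 * C * (a * θ * ‖gdiff g z‖) = 4 * C * (a * (θ * ‖gdiff g z‖)) := by ring
      _ ≤ 4 * C * (δ * (2 * l)) := by gcongr
      _ = 8 * C * δ * l := by ring
  obtain ⟨g1, g2⟩ := norm_growth_bounds (mul_nonneg ha.1 hθ0) hS key hCb
  refine ⟨hn, hnσ, g1, g2.trans ?_, hsupp⟩
  have : a * θ * gsq g z ≤ δ * M ^ 2 :=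
    mul_le_mul ((mul_le_of_le_one_right ha.1 hθ1).trans ha.2) (hM z hz) hS hδ0
  nlinarith [norm_nonneg (gdiff g z)]

end Push

section PushMap

variable {m : ℕ}

set_option maxSynthPendingDepth 3 in
theorem exists_quadratic_bound {g : Vec m → ℂ} {R R₂ R₃ : ℝ}
    (hg : ContDiffOn ℂ ω g (ball 0 R)) (h3 : R₃ < R) :
    ∃ C, 0 ≤ C ∧ ∀ x, ‖x‖ ≤ R₂ → ∀ h, ‖h‖ ≤ R₃ - R₂ →
      ‖g (x + h) - g x - hgrad g x ⬝ᵥ h‖ ≤ C * ‖h‖ ^ 2 := by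
  have hO : IsOpen (ball (0 : Vec m) R) := isOpen_ball
  have hsub : closedBall (0 : Vec m) R₃ ⊆ ball 0 R :=
    closedBall_subset_ball h3
  have h1 : ContDiffOn ℂ ω (fderiv ℂ g) (ball 0 R) := hg.fderiv_of_isOpen hO le_top
  have h2 : ContDiffOn ℂ ω (fderiv ℂ (fderiv ℂ g)) (ball 0 R) :=
    h1.fderiv_of_isOpen hO le_top
  have h2c : ContinuousOn (fun x => ‖fderiv ℂ (fderiv ℂ g) x‖) (closedBall 0 R₃) :=
    continuous_norm.comp_continuousOn (h2.continuousOn.mono hsub)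
  obtain ⟨C, hC⟩ := (isCompact_closedBall (0 : Vec m) R₃).exists_bound_of_continuousOn h2c
  simp only [Real.norm_eq_abs, abs_norm] at hC
  refine ⟨|C|, abs_nonneg C, fun x hx h hh => ?_⟩
  have hball : ∀ w ∈ segment ℝ x (x + h), w ∈ closedBall (0 : Vec m) R₃ := by
    refine fun w hw => (convex_closedBall (0 : Vec m) R₃).segment_subset ?_ ?_ hw
    · rw [mem_closedBall_zero_iff]; linarith [norm_nonneg h]
    · rw [mem_closedBall_zero_iff]; linarith [norm_add_le x h]
  have hx3 : x ∈ closedBall (0 : Vec m) R₃ := hball x (left_mem_segment ℝ _ _)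
  have hb : ∀ w ∈ segment ℝ x (x + h), ‖fderiv ℂ g w - fderiv ℂ g x‖ ≤ |C| * ‖h‖ := by
    intro w hw
    have e1 := (convex_closedBall (0 : Vec m) R₃).norm_image_sub_le_of_norm_fderiv_le
      (𝕜 := ℂ) (f := fderiv ℂ g) (C := |C|)
      (fun y hy => (h1.contDiffAt (hO.mem_nhds (hsub hy))).differentiableAt (by simp))
      (fun y hy => (hC y hy).trans (le_abs_self C)) hx3 (hball w hw)
    refine e1.trans ?_
    gcongr
    rw [segment_eq_image'] at hw
    obtain ⟨t, ht, rfl⟩ := hw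
    simp only [add_sub_cancel_left]
    rw [norm_smul, Real.norm_of_nonneg ht.1]
    exact mul_le_of_le_one_left (norm_nonneg _) ht.2
  have := (convex_segment x (x + h)).norm_image_sub_le_of_norm_fderiv_le' (𝕜 := ℂ) (f := g)
    (fun y hy => (hg.contDiffAt (hO.mem_nhds (hsub (hball y hy)))).differentiableAt (by simp)) hb
    (left_mem_segment ℝ _ _) (right_mem_segment ℝ _ _)
  rw [add_sub_cancel_left, fderiv_eq_dotProduct_hgrad] at this
  refine this.trans (le_of_eq (by ring))

theorem sqNorm_pos_of_norm_pos {y : Vec m} {r : ℝ} (h : r ≤ ‖y‖) (hr : 0 < r) :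
    r ^ 2 ≤ sqNorm y :=
  (pow_le_pow_left₀ hr.le h 2).trans (norm_sq_le_sqNorm y)

theorem exists_push_map {g : Vec m → ℂ} {R R₁ R₂ r l : ℝ}
    (hg : ContDiffOn ℂ ω g (ball 0 R)) (hR₁ : 0 < R₁) (h2 : R₂ < R) (hl : 0 < l) (hr : 0 < r)
    (hshell : ∀ x, R₁ ≤ ‖x‖ → ‖x‖ ≤ R₂ → r ≤ ‖hgrad g x‖) (hlr : R₁ + 8 * l / r < R₂)
    (hcrit : ∀ x y, ‖x‖ ≤ R₂ → ‖y‖ ≤ R₂ → hgrad g x = 0 → hgrad g y = 0 → g x = g y)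
    {ε : ℝ} (hε : 0 < ε) :
    ∃ T : Vec m × Vec m → Vec m × Vec m, ContDiff ℝ 2 T ∧
      ∃ κ > 1, ∃ ρ ≥ R₁, ρ + 8 * l / r ≤ R₂ ∧
        ∀ z, ‖z‖ ≤ ρ + 2 / r * min ‖gdiff g z‖ (4 * l) → ε ≤ ‖gdiff g z‖ →
          (∀ u ∈ Icc (0 : ℝ) 1, ‖z + u • (T z - z)‖ ≤ R₂ ∧ ε ≤ ‖gdiff g (z + u • (T z - z))‖) ∧
          ‖T z‖ ≤ ρ + 2 / r * min ‖gdiff g (T z)‖ (4 * l) ∧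
          min (κ * ‖gdiff g z‖) l ≤ ‖gdiff g (T z)‖ := by
  set R₃ := (R₂ + R) / 2 with hR₃
  have hlr0 : 0 < 8 * l / r := by positivity
  set σ := min (R₃ - R₂) (R₂ - R₁ - 8 * l / r) with hσ
  have hσ0 : 0 < σ := lt_min (by linarith) (by linarith)
  have hσ1 : σ ≤ R₃ - R₂ := min_le_left _ _
  have hσ2 : σ ≤ R₂ - R₁ - 8 * l / r := min_le_right _ _
  have hsub : closedBall (0 : Vec m) R₂ ⊆ ball 0 R :=
    closedBall_subset_ball h2
  have hO : IsOpen (ball (0 : Vec m) R) := isOpen_ball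
  obtain ⟨C, hC0, hC⟩ := exists_quadratic_bound (R₂ := R₂) hg (show R₃ < R by linarith)
  have hgrc := (contDiffOn_hgrad hO hg).continuousOn
  have hm1 : MapsTo Prod.fst (closedBall (0 : Vec m × Vec m) R₂)
      (ball 0 R) := fun z hz => hsub (by
    rw [mem_closedBall_zero_iff] at hz ⊢; exact (norm_fst_le z).trans hz)
  have hm2 : MapsTo Prod.snd (closedBall (0 : Vec m × Vec m) R₂)
      (ball 0 R) := fun z hz => hsub (by
    rw [mem_closedBall_zero_iff] at hz ⊢; exact (norm_snd_le z).trans hz)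
  have hsqc : Continuous (sqNorm (m := m)) := (contDiff_sqNorm (n := 1)).continuous
  have hgsq : ContinuousOn (gsq g) (closedBall 0 R₂) :=
    (hsqc.comp_continuousOn (hgrc.comp continuous_fst.continuousOn hm1)).add
      (hsqc.comp_continuousOn (hgrc.comp continuous_snd.continuousOn hm2))
  have hgd : ContinuousOn (gdiff g) (closedBall 0 R₂) :=
    (hg.continuousOn.comp continuous_fst.continuousOn hm1).sub
      (hg.continuousOn.comp continuous_snd.continuousOn hm2)
  have hcpt := isCompact_closedBall (0 : Vec m × Vec m) R₂
  obtain ⟨M', hM'⟩ := hcpt.exists_bound_of_continuousOn hgsq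
  set M := |M'| + 1
  have hM0 : 0 < M := by positivity
  have hM : ∀ z, ‖z‖ ≤ R₂ → gsq g z ≤ M ^ 2 := by
    intro z hz
    have e1 := hM' z (by simpa using hz)
    rw [Real.norm_of_nonneg (gsq_nonneg g z)] at e1
    have e2 := le_abs_self M'
    nlinarith [abs_nonneg M']
  obtain ⟨c, hc0, hc⟩ : ∃ c > 0, ∀ z, ‖z‖ ≤ R₂ → ε ≤ ‖gdiff g z‖ → c ≤ gsq g z := by
    have hK : IsCompact {z ∈ closedBall (0 : Vec m × Vec m) R₂ |
        ε ≤ ‖gdiff g z‖} :=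
      hcpt.of_isClosed_subset
        (hgd.norm.preimage_isClosed_of_isClosed isClosed_closedBall isClosed_Ici)
        fun z hz => hz.1
    obtain ⟨c, hc0, hc⟩ := hK.exists_forall_le' (f := gsq g) (a := 0)
      (hgsq.mono fun z hz => hz.1) (fun z hz => by
        refine lt_of_le_of_ne (gsq_nonneg g z) fun h0 => ?_
        have hz' : ‖z‖ ≤ R₂ := by simpa using hz.1
        have hzz : hgrad g z.1 = 0 ∧ hgrad g z.2 = 0 := by
          constructor <;> by_contra hne <;> have := sqNorm_pos hne <;> rw [gsq] at h0
          · linarith [sqNorm_nonneg (hgrad g z.2)]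
          · linarith [sqNorm_nonneg (hgrad g z.1)]
        have := hcrit z.1 z.2 ((norm_fst_le z).trans hz') ((norm_snd_le z).trans hz') hzz.1 hzz.2
        have h3 := hz.2
        rw [gdiff, this, sub_self, norm_zero] at h3
        linarith)
    exact ⟨c, hc0, fun z hz hz' => hc z ⟨by simpa using hz, hz'⟩⟩
  set δ := min (min (1 / (8 * C * l + 1)) (1 / (3 / 2 * M ^ 2))) (σ / (2 * l * M)) with hδ
  have hδ0 : 0 < δ := by positivity
  have hδ1 : 8 * C * δ * l ≤ 1 := by
    have e : δ ≤ 1 / (8 * C * l + 1) := (min_le_left _ _).trans (min_le_left _ _)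
    rw [le_div_iff₀ (by positivity)] at e
    linarith
  have hδ2 : 3 / 2 * (δ * M ^ 2) ≤ 1 := by
    have e : δ ≤ 1 / (3 / 2 * M ^ 2) := (min_le_left _ _).trans (min_le_right _ _)
    rw [le_div_iff₀ (by positivity)] at e
    linarith
  have hδ3 : δ * (2 * l) * M ≤ σ := by
    have e : δ ≤ σ / (2 * l * M) := min_le_right _ _
    rw [le_div_iff₀ (by positivity)] at e
    linarith
  have hR₂0 : 0 < R₂ := by linarith
  set β : ContDiffBump (0 : Vec m) := ⟨R₂, R₃, hR₂0, by linarith⟩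
  have hβ : ∀ x, ‖x‖ ≤ R₂ → β x = 1 := fun x hx => β.one_of_mem_closedBall (by simpa using hx)
  have hpv : ContDiff ℝ 2 (pushVec g l β) := contDiff_pushVec hO hg β.contDiff
    (by rw [β.tsupport_eq]; exact closedBall_subset_ball (show R₃ < R by linarith)) l
  have hstep := fun {a : ℝ} (ha : a ∈ Icc 0 δ) {z} (hz : ‖z‖ ≤ R₂) =>
    push_bounds (β := β) hl hβ hC0 hM0.le (fun x hx h hh => hC x hx h (hh.trans hσ1)) hM hδ1 hδ2 hδ3
      ha hz
  have hψ0 : ∀ z, 0 ≤ psi (gdiff g z / l) := fun z => smoothTransition.nonneg _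
  refine ⟨fun z => z + δ • pushVec g l β z, contDiff_id.add (hpv.const_smul δ),
    1 + δ * c / 2, by have : 0 < δ * c := by positivity
                      linarith, R₁ + σ, by linarith, by linarith, ?_⟩
  intro z hinv hGε
  have hzR₂ : ‖z‖ ≤ R₂ := by
    have : 2 / r * min ‖gdiff g z‖ (4 * l) ≤ 2 / r * (4 * l) := by gcongr; exact min_le_right _ _
    have e : 2 / r * (4 * l) = 8 * l / r := by ring
    linarith
  have hinv' : ∀ a ∈ Icc (0 : ℝ) δ, ‖z + a • pushVec g l β z‖ ≤
      R₁ + σ + 2 / r * min ‖gdiff g (z + a • pushVec g l β z)‖ (4 * l) := by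
    intro a ha
    obtain ⟨b1, b2, b3, b4, b5⟩ := hstep ha hzR₂
    set z' := z + a • pushVec g l β z
    by_cases hψ : psi (gdiff g z / l) = 0
    · have : z' = z := by
        rw [hψ, mul_zero, zero_mul, zero_mul] at b1
        simp only [z', norm_le_zero_iff.1 b1, add_zero]
      rw [this]; exact hinv
    · have hG2 := b5 hψ
      have hS0 := gsq_nonneg g z
      have hp := hψ0 z
      have ha0 := ha.1
      have hGG : ‖gdiff g z‖ ≤ ‖gdiff g z'‖ := by
        refine le_trans ?_ b3
        have : 0 ≤ ‖gdiff g z‖ * (a * psi (gdiff g z / l) * gsq g z) := by positivity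
        linarith
      rw [min_eq_left (by linarith)] at hinv ⊢
      rcases le_or_gt R₁ ‖z‖ with hz1 | hz1
      · have hSr : r ^ 2 ≤ gsq g z := by
          rw [gsq]
          rcases max_choice ‖z.1‖ ‖z.2‖ with h | h
          · have e : ‖z‖ = ‖z.1‖ := by rw [Prod.norm_def, h]
            rw [e] at hz1
            linarith [sqNorm_pos_of_norm_pos (hshell z.1 hz1 ((norm_fst_le z).trans hzR₂)) hr,
              sqNorm_nonneg (hgrad g z.2)]
          · have e : ‖z‖ = ‖z.2‖ := by rw [Prod.norm_def, h]
            rw [e] at hz1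
            linarith [sqNorm_pos_of_norm_pos (hshell z.2 hz1 ((norm_snd_le z).trans hzR₂)) hr,
              sqNorm_nonneg (hgrad g z.1)]
        have hs : √(gsq g z) ≤ gsq g z / r := by
          rw [le_div_iff₀ hr]
          have : r ≤ √(gsq g z) := Real.le_sqrt_of_sq_le hSr
          nlinarith [Real.sq_sqrt hS0, Real.sqrt_nonneg (gsq g z)]
        have hd : ‖a • pushVec g l β z‖ ≤ 2 / r * (‖gdiff g z'‖ - ‖gdiff g z‖) := by
          refine b1.trans ?_
          calc a * psi (gdiff g z / l) * ‖gdiff g z‖ * √(gsq g z)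
              ≤ a * psi (gdiff g z / l) * ‖gdiff g z‖ * (gsq g z / r) := by gcongr
            _ = 2 / r * (‖gdiff g z‖ * (a * psi (gdiff g z / l) * gsq g z / 2)) := by
              field_simp
            _ ≤ _ := by gcongr; linarith
        have := norm_add_le z (a • pushVec g l β z)
        linarith
      · have := norm_add_le z (a • pushVec g l β z)
        have h0 : 0 ≤ 2 / r * ‖gdiff g z'‖ := by positivity
        linarith
  have hmono : ∀ a ∈ Icc (0 : ℝ) δ, ‖gdiff g z‖ ≤ ‖gdiff g (z + a • pushVec g l β z)‖ := by
    intro a ha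
    obtain ⟨-, -, b3, -, -⟩ := hstep ha hzR₂
    refine le_trans ?_ b3
    have hS0 := gsq_nonneg g z
    have hp := hψ0 z
    have ha0 := ha.1
    have : 0 ≤ ‖gdiff g z‖ * (a * psi (gdiff g z / l) * gsq g z) := by positivity
    linarith
  refine ⟨fun u hu => ?_, hinv' δ ⟨hδ0.le, le_rfl⟩, ?_⟩
  · have hua : u * δ ∈ Icc 0 δ := ⟨mul_nonneg hu.1 hδ0.le, mul_le_of_le_one_left hδ0.le hu.2⟩
    have e : z + u • (z + δ • pushVec g l β z - z) = z + (u * δ) • pushVec g l β z := by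
      rw [add_sub_cancel_left, smul_smul]
    rw [e]
    refine ⟨(hinv' _ hua).trans ?_, hGε.trans (hmono _ hua)⟩
    have : 2 / r * min ‖gdiff g (z + (u * δ) • pushVec g l β z)‖ (4 * l) ≤ 2 / r * (4 * l) := by
      gcongr; exact min_le_right _ _
    have e : 2 / r * (4 * l) = 8 * l / r := by ring
    linarith
  · rcases le_or_gt l ‖gdiff g z‖ with h | h
    · exact (min_le_right _ _).trans (h.trans (hmono δ ⟨hδ0.le, le_rfl⟩))
    · refine (min_le_left _ _).trans ?_
      obtain ⟨-, -, b3, -, -⟩ := hstep ⟨hδ0.le, le_rfl⟩ hzR₂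
      have hψ1 : psi (gdiff g z / l) = 1 := by
        refine smoothTransition.one_of_one_le ?_
        rw [normSq_eq_norm_sq, norm_div, norm_real, Real.norm_of_nonneg hl.le,
          div_pow]
        have : ‖gdiff g z‖ ^ 2 / l ^ 2 ≤ 1 := by
          rw [div_le_one (by positivity)]
          exact pow_le_pow_left₀ (norm_nonneg _) h.le 2
        linarith
      rw [hψ1, mul_one] at b3
      refine le_trans ?_ b3
      rw [mul_comm]
      have := hc z hzR₂ hGε
      gcongr

end PushMap

section Push

variable {m : ℕ}

theorem exists_push {g : Vec m → ℂ} {R R₁ R₂ r l : ℝ}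
    (hg : ContDiffOn ℂ ω g (ball 0 R)) (hR₁ : 0 < R₁) (h2 : R₂ < R) (hl : 0 < l) (hr : 0 < r)
    (hshell : ∀ x, R₁ ≤ ‖x‖ → ‖x‖ ≤ R₂ → r ≤ ‖hgrad g x‖) (hlr : R₁ + 8 * l / r < R₂)
    (hcrit : ∀ x y, ‖x‖ ≤ R₂ → ‖y‖ ≤ R₂ → hgrad g x = 0 → hgrad g y = 0 → g x = g y)
    {χ : Vec m → ℝ} (hχ : ContDiff ℝ 2 χ) {K : Set Vec m} (hK : IsCompact K)
    (hK0 : ∀ x ∉ K, fderiv ℝ χ x = 0) {P Q : (CycIdx m → ℝ) → Vec m}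
    (hP : ContDiff ℝ 2 P) (hQ : ContDiff ℝ 2 Q)
    (hPQ : ∀ ξ ∈ cycSet K, ‖(P ξ, Q ξ)‖ ≤ R₁ ∧ gdiff g (P ξ, Q ξ) ≠ 0) :
    ∃ ε > 0, ∃ P' Q' : (CycIdx m → ℝ) → Vec m, ContDiff ℝ 2 P' ∧ ContDiff ℝ 2 Q' ∧
      (∀ ξ ∈ cycSet K, ‖(P' ξ, Q' ξ)‖ ≤ R₂ ∧ l ≤ ‖gdiff g (P' ξ, Q' ξ)‖) ∧
      (∀ ξ ∈ cycSet K, ε ≤ ‖gdiff g (P ξ, Q ξ)‖) ∧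
      ∀ Ω, IsOpen Ω → (∀ z, ‖z‖ ≤ R₂ → ε ≤ ‖gdiff g z‖ → z ∈ Ω) → ∀ q, ContDiffOn ℂ 1 q Ω →
        cycInt q χ P Q = cycInt q χ P' Q' := by
  have hlr0 : 0 < 8 * l / r := by positivity
  have hcont : ContinuousOn (fun ξ => ‖gdiff g (P ξ, Q ξ)‖) (cycSet K) := by
    have hm1 : MapsTo P (cycSet K) (ball 0 R) := fun ξ hξ => by
      rw [mem_ball_zero_iff]; linarith [(norm_fst_le (P ξ, Q ξ)), (hPQ ξ hξ).1]
    have hm2 : MapsTo Q (cycSet K) (ball 0 R) := fun ξ hξ => by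
      rw [mem_ball_zero_iff]; linarith [(norm_snd_le (P ξ, Q ξ)), (hPQ ξ hξ).1]
    exact ((hg.continuousOn.comp hP.continuous.continuousOn hm1).sub
      (hg.continuousOn.comp hQ.continuous.continuousOn hm2)).norm
  obtain ⟨ε₀, hε₀, hmin⟩ := (isCompact_cycSet hK).exists_forall_le' hcont (a := 0)
    fun ξ hξ => norm_pos_iff.2 (hPQ ξ hξ).2
  have hε : 0 < min ε₀ l := lt_min hε₀ hl
  obtain ⟨T, hT, κ, hκ, ρ, hρ, -, hstep⟩ :=
    exists_push_map hg hR₁ h2 hl hr hshell hlr hcrit hε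
  set ε := min ε₀ l with hε_def
  have hTn : ∀ k : ℕ, ContDiff ℝ 2 (T^[k]) := fun k => by
    induction k with
    | zero => exact contDiff_id
    | succ k ih => rw [Function.iterate_succ']; exact hT.comp ih
  set Z : ℕ → (CycIdx m → ℝ) → Vec m × Vec m := fun k ξ => T^[k] (P ξ, Q ξ) with hZ
  have hZs : ∀ k ξ, Z (k + 1) ξ = T (Z k ξ) := fun k ξ => Function.iterate_succ_apply' T k _
  have hZc : ∀ k, ContDiff ℝ 2 (Z k) := fun k => (hTn k).comp (hP.prodMk hQ)
  have hinv : ∀ k, ∀ ξ ∈ cycSet K,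
      ‖Z k ξ‖ ≤ ρ + 2 / r * min ‖gdiff g (Z k ξ)‖ (4 * l) ∧
        min (κ ^ k * ε) l ≤ ‖gdiff g (Z k ξ)‖ ∧ ε ≤ ‖gdiff g (Z k ξ)‖ := by
    intro k ξ hξ
    induction k with
    | zero =>
      have h1 : ε ≤ ‖gdiff g (Z 0 ξ)‖ := (min_le_left _ _).trans (hmin ξ hξ)
      refine ⟨?_, by rw [pow_zero, one_mul]; exact (min_le_left _ _).trans h1, h1⟩
      have h0 : 0 ≤ 2 / r * min ‖gdiff g (Z 0 ξ)‖ (4 * l) := by positivity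
      have : ‖Z 0 ξ‖ ≤ R₁ := (hPQ ξ hξ).1
      linarith
    | succ k ih =>
      obtain ⟨i1, i2, i3⟩ := ih
      obtain ⟨s1, s2, s3⟩ := hstep (Z k ξ) i1 i3
      rw [hZs]
      refine ⟨s2, ?_, ?_⟩
      · refine le_trans (le_min ?_ (min_le_right _ _)) s3
        rcases min_le_iff.1 i2 with h | h
        · refine (min_le_left _ _).trans ?_
          rw [pow_succ', mul_assoc]
          gcongr
        · refine (min_le_right _ _).trans (h.trans ?_)
          exact le_mul_of_one_le_left (norm_nonneg _) hκ.le
      · have := (s1 1 ⟨zero_le_one, le_rfl⟩).2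
        rwa [one_smul, add_sub_cancel] at this
  have hR₂ : ∀ k, ∀ ξ ∈ cycSet K, ∀ u ∈ Icc (0 : ℝ) 1,
      ‖Z k ξ + u • (Z (k + 1) ξ - Z k ξ)‖ ≤ R₂ ∧
        ε ≤ ‖gdiff g (Z k ξ + u • (Z (k + 1) ξ - Z k ξ))‖ := fun k ξ hξ u hu => by
    rw [hZs]
    exact (hstep (Z k ξ) (hinv k ξ hξ).1 (hinv k ξ hξ).2.2).1 u hu
  obtain ⟨N, hN⟩ : ∃ N : ℕ, l / ε < κ ^ N := pow_unbounded_of_one_lt _ hκ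
  rw [div_lt_iff₀ hε] at hN
  refine ⟨ε, hε, fun ξ => (Z N ξ).1, fun ξ => (Z N ξ).2, (hZc N).fst, (hZc N).snd,
    fun ξ hξ => ⟨?_, ?_⟩, fun ξ hξ => (min_le_left _ _).trans (hmin ξ hξ), ?_⟩
  · have := (hR₂ N ξ hξ 0 ⟨le_rfl, zero_le_one⟩).1
    rwa [zero_smul, add_zero] at this
  · have := (hinv N ξ hξ).2.1
    rwa [min_eq_right hN.le] at this
  · intro Ω hΩ hmem q hq
    have key : ∀ k, cycInt q χ P Q = cycInt q χ (fun ξ => (Z k ξ).1) (fun ξ => (Z k ξ).2) := by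
      intro k
      induction k with
      | zero => rfl
      | succ k ih =>
        rw [ih]
        refine cycInt_homotopy hχ (hZc k).fst (hZc k).snd hχ (hZc _).fst (hZc _).snd hK
          (fun x hx => ⟨hK0 x hx, hK0 x hx, rfl⟩) hΩ hq fun ξ h1 h2 u hu => ?_
        have := hR₂ k ξ ⟨h1, h2⟩ u hu
        exact hmem _ this.1 this.2
    exact key N

end Push

section Hadamard

variable {m : ℕ}

theorem fderiv_prodMk_zero (g : ℂ × Vec m → ℂ) (p : ℂ × Vec m) (h : Vec m) :
    fderiv ℂ g p (0, h) = ∑ k, pgrad g p k * h k := by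
  have : ((0 : ℂ), h) = ∑ k, h k • ((0 : ℂ), (Pi.single k 1 : Vec m)) := by
    ext i
    · simp [Prod.fst_sum]
    · simp [Prod.snd_sum, Finset.sum_apply, Pi.single_apply]
  conv_lhs => rw [this, map_sum]
  refine Finset.sum_congr rfl fun k _ => ?_
  rw [map_smul, smul_eq_mul, mul_comm, pgrad]

set_option maxSynthPendingDepth 3 in
theorem exists_hadamard {D : Set ℂ} (hD : IsOpen D) {R : ℝ} {g : ℂ × Vec m → ℂ}
    (hg : ContDiffOn ℂ ω g (D ×ˢ ball 0 R)) :
    ∃ e : ℂ × Vec m × Vec m → Vec m,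
      ContDiffOn ℂ ω e (D ×ˢ ball 0 R ×ˢ ball 0 R) ∧
      (∀ ζ ∈ D, ∀ x ∈ ball (0 : Vec m) R, ∀ y ∈ ball (0 : Vec m) R,
        g (ζ, x) - g (ζ, y) = e (ζ, x, y) ⬝ᵥ (x - y)) ∧
      ∀ ζ x, e (ζ, x, x) = pgrad g (ζ, x) := by
  have hO : IsOpen (D ×ˢ ball (0 : Vec m) R) := hD.prod isOpen_ball
  have hG := contDiffOn_pgrad hO hg
  let A₀ : ℂ × Vec m × Vec m →L[ℂ] ℂ × Vec m :=
    (fst ℂ ℂ _).prod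
      (snd ℂ _ _ ∘L snd ℂ ℂ _)
  let A₁ : ℂ × Vec m × Vec m →L[ℂ] ℂ × Vec m :=
    (0 : ℂ × Vec m × Vec m →L[ℂ] ℂ).prod
      ((fst ℂ _ _ ∘L snd ℂ ℂ _) -
        (snd ℂ _ _ ∘L snd ℂ ℂ _))
  let A' : ℝ → ℂ × Vec m × Vec m →L[ℂ] ℂ × Vec m := fun u => A₀ + (u : ℂ) • A₁
  have hA'c : Continuous A' := continuous_const.add (continuous_ofReal.smul continuous_const)
  have hA'a : ∀ u p, A' u p = (p.1, p.2.2 + (u : ℂ) • (p.2.1 - p.2.2)) := fun u p => by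
    simp [A', A₀, A₁]
  set Q : Set ((ℂ × Vec m × Vec m) × ℝ) := {q | A' q.2 q.1 ∈ D ×ˢ ball (0 : Vec m) R} with hQ
  have hAc : Continuous fun q : (ℂ × Vec m × Vec m) × ℝ => A' q.2 q.1 := by
    simp only [hA'a]; fun_prop
  have hQo : IsOpen Q := hO.preimage hAc
  have hKQ : ∀ ζ ∈ D, ∀ x ∈ ball (0 : Vec m) R, ∀ y ∈ ball (0 : Vec m) R,
      ∀ u ∈ Icc (0 : ℝ) 1, ((ζ, x, y), u) ∈ Q := by
    intro ζ hζ x hx y hy u hu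
    simp only [hQ, mem_ofPred_eq, hA'a]
    refine ⟨hζ, ?_⟩
    have := (convex_ball (0 : Vec m) R).add_smul_sub_mem hy hx hu
    simpa using this
  refine ⟨fun p => ∫ u in Icc (0 : ℝ) 1, pgrad g (A' u p), ?_, ?_, ?_⟩
  · refine ContDiffOn.omega_of_one (hD.prod (isOpen_ball.prod isOpen_ball)) ?_
    rintro ⟨ζ, x, y⟩ ⟨hζ, hx, hy⟩
    refine ContDiffAt.contDiffWithinAt ?_
    refine contDiffAt_setIntegral_param (𝕜 := ℂ) (μ := volume) (u := fun p u => pgrad g (A' u p))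
      (u' := fun p u => (fderiv ℂ (pgrad g) (A' u p)).comp (A' u)) hQo isCompact_Icc
      (s₀ := (ζ, x, y)) (hKQ ζ hζ x hx y hy) ?_ ?_ ?_
    · exact hG.continuousOn.comp hAc.continuousOn fun q hq => hq
    · have h1 : ContinuousOn (fderiv ℂ (pgrad g)) (D ×ˢ ball 0 R) :=
        (hG.fderiv_of_isOpen hO (m := ω) le_top).continuousOn
      exact (h1.comp (t := D ×ˢ ball 0 R) (f := fun q : (ℂ × Vec m × Vec m) × ℝ => A' q.2 q.1)
        hAc.continuousOn fun q hq => hq).clm_comp (hA'c.comp continuous_snd).continuousOn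
    · intro q hq
      have h1 := ((hG.contDiffAt (hO.mem_nhds hq)).differentiableAt (by simp)).hasFDerivAt
      exact h1.comp q.1 (A' q.2).hasFDerivAt
  · intro ζ hζ x hx y hy
    have hd : ∀ u ∈ uIcc (0 : ℝ) 1, HasDerivAt (fun u => g (A' u (ζ, x, y)))
        (pgrad g (A' u (ζ, x, y)) ⬝ᵥ (x - y)) u := by
      intro u hu
      rw [uIcc_of_le zero_le_one] at hu
      have h1 := ((hg.contDiffAt (hO.mem_nhds (hKQ ζ hζ x hx y hy u hu))).differentiableAt
        (by simp)).hasFDerivAt.restrictScalars ℝ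
      have h2 : HasDerivAt (fun u : ℝ => A' u (ζ, x, y)) ((0 : ℂ), x - y) u := by
        simp only [hA'a]
        refine (hasDerivAt_const u ζ).prodMk ?_
        have h3 := ((ofRealCLM.hasDerivAt (x := u)).smul_const (x - y)).const_add y
        simpa using h3
      have h3 := h1.comp_hasDerivAt u h2
      refine h3.congr_deriv ?_
      exact fderiv_prodMk_zero g _ _
    have hc : ContinuousOn (fun u : ℝ => pgrad g (A' u (ζ, x, y))) (Icc 0 1) :=
      hG.continuousOn.comp (hAc.comp (by fun_prop : Continuous fun u : ℝ =>
        ((ζ, x, y), u))).continuousOn fun u hu => hKQ ζ hζ x hx y hy u hu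
    have hc' : ContinuousOn (fun u : ℝ => pgrad g (A' u (ζ, x, y)) ⬝ᵥ (x - y)) (Icc 0 1) := by
      unfold dotProduct
      exact continuousOn_finsetSum _ fun k _ => (continuousOn_pi.1 hc k).mul continuousOn_const
    have := intervalIntegral.integral_eq_sub_of_hasDerivAt hd
      ((uIcc_of_le (zero_le_one' ℝ)).symm ▸ hc').intervalIntegrable
    have e1 : g (A' 1 (ζ, x, y)) - g (A' 0 (ζ, x, y)) = g (ζ, x) - g (ζ, y) := by
      simp [hA'a]
    rw [← e1, ← this, intervalIntegral.integral_of_le zero_le_one, ← integral_Icc_eq_integral_Ioc]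
    unfold dotProduct
    have hi : ∀ k, IntegrableOn (fun u : ℝ => pgrad g (A' u (ζ, x, y)) k) (Icc 0 1) := fun k =>
      (continuousOn_pi.1 hc k).integrableOn_Icc
    rw [integral_finsetSum _ fun k _ => (hi k).mul_const _]
    refine Finset.sum_congr rfl fun k _ => ?_
    rw [integral_mul_const, ← eval_integral hi]
  · intro ζ x
    simp [hA'a]

end Hadamard

section Hefer

variable {m : ℕ}

section Param

variable {χ : Vec m → ℝ} {P Q : (CycIdx m → ℝ) → Vec m} {K : Set Vec m}

theorem cycInt_eq_setIntegral (hχ : ContDiff ℝ 2 χ) (hP : ContDiff ℝ 2 P) (hQ : ContDiff ℝ 2 Q)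
    (hK0 : ∀ x ∉ K, fderiv ℝ χ x = 0) (q : Vec m × Vec m → ℂ) :
    cycInt q χ P Q = ∫ ξ in cycSet K, q (P ξ, Q ξ) * (jac (cycle χ P Q) ξ).det := by
  unfold cycInt formIntegral
  rw [setIntegral_eq_integral_of_forall_compl_eq_zero]
  · rfl
  · intro ξ hξ
    rw [det_jac_cycle_eq_zero (hχ.differentiable two_ne_zero _)
      ((contDiff_cycle hχ hP hQ).differentiable two_ne_zero ξ) ?_, mul_zero]
    by_contra! h
    exact hξ ⟨by_contra fun hx => h.1 (hK0 _ hx), h.2⟩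

theorem continuous_det_jac_cycle (hχ : ContDiff ℝ 2 χ) (hP : ContDiff ℝ 2 P)
    (hQ : ContDiff ℝ 2 Q) : Continuous fun ξ => (jac (cycle χ P Q) ξ).det :=
  (contDiff_matrix_det fun i j => contDiff_jac (contDiff_cycle hχ hP hQ) i j).continuous

theorem continuousAt_cycInt (hχ : ContDiff ℝ 2 χ) (hP : ContDiff ℝ 2 P) (hQ : ContDiff ℝ 2 Q)
    (hK : IsCompact K) (hK0 : ∀ x ∉ K, fderiv ℝ χ x = 0) {E : Type*} [TopologicalSpace E]
    [FirstCountableTopology E] {q : E → Vec m × Vec m → ℂ}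
    {O : Set (E × (Vec m × Vec m))} (hO : IsOpen O)
    (hq : ContinuousOn (uncurry q) O) {s₀ : E}
    (hmem : ∀ ξ ∈ cycSet K, (s₀, (P ξ, Q ξ)) ∈ O) :
    ContinuousAt (fun s => cycInt (q s) χ P Q) s₀ := by
  simp only [cycInt_eq_setIntegral hχ hP hQ hK0]
  have hA : Continuous fun p : E × (CycIdx m → ℝ) => (p.1, (P p.2, Q p.2)) :=
    continuous_fst.prodMk ((hP.continuous.comp continuous_snd).prodMk
      (hQ.continuous.comp continuous_snd))
  refine continuousAt_setIntegral_param (O := (fun p : E × (CycIdx m → ℝ) =>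
    (p.1, (P p.2, Q p.2))) ⁻¹' O) (hO.preimage hA) (isCompact_cycSet hK) hmem ?_
  exact (hq.comp hA.continuousOn fun p hp => hp).mul
    ((continuous_det_jac_cycle hχ hP hQ).comp continuous_snd).continuousOn

theorem contDiffOn_cycInt (hχ : ContDiff ℝ 2 χ) (hP : ContDiff ℝ 2 P) (hQ : ContDiff ℝ 2 Q)
    (hK : IsCompact K) (hK0 : ∀ x ∉ K, fderiv ℝ χ x = 0) {E : Type} [NormedAddCommGroup E]
    [NormedSpace ℂ E] [FiniteDimensional ℂ E] {q : E → Vec m × Vec m → ℂ}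
    {O : Set (E × (Vec m × Vec m))} (hO : IsOpen O)
    (hq : ContDiffOn ℂ ω (uncurry q) O) {Λ : Set E} (hΛ : IsOpen Λ)
    (hmem : ∀ s ∈ Λ, ∀ ξ ∈ cycSet K, (s, (P ξ, Q ξ)) ∈ O) :
    ContDiffOn ℂ ω (fun s => cycInt (q s) χ P Q) Λ := by
  refine ContDiffOn.omega_of_one hΛ fun s hs => ContDiffAt.contDiffWithinAt ?_
  simp only [cycInt_eq_setIntegral hχ hP hQ hK0]
  have hA : Continuous fun p : E × (CycIdx m → ℝ) => (p.1, (P p.2, Q p.2)) :=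
    continuous_fst.prodMk ((hP.continuous.comp continuous_snd).prodMk
      (hQ.continuous.comp continuous_snd))
  have hj := (continuous_det_jac_cycle hχ hP hQ).comp (continuous_snd (X := E))
  refine contDiffAt_setIntegral_param (𝕜 := ℂ) (O := (fun p : E × (CycIdx m → ℝ) =>
    (p.1, (P p.2, Q p.2))) ⁻¹' O)
    (u := fun s ξ => q s (P ξ, Q ξ) * (jac (cycle χ P Q) ξ).det)
    (u' := fun s ξ => (jac (cycle χ P Q) ξ).det • (fderiv ℂ (uncurry q) (s, (P ξ, Q ξ))).comp
      (inl ℂ E _)) (hO.preimage hA) (isCompact_cycSet hK) (hmem s hs) ?_ ?_ ?_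
  · exact (hq.continuousOn.comp hA.continuousOn fun p hp => hp).mul hj.continuousOn
  · refine hj.continuousOn.smul (ContinuousOn.clm_comp ?_ continuousOn_const)
    exact (hq.fderiv_of_isOpen hO (m := ω) le_top).continuousOn.comp
      (f := fun p : E × (CycIdx m → ℝ) => (p.1, (P p.2, Q p.2))) (t := O) hA.continuousOn
      fun p hp => hp
  · intro p hp
    have h1 := ((hq.contDiffAt (hO.mem_nhds hp)).differentiableAt (by simp)).hasFDerivAt
    have h2 : HasFDerivAt (fun s => q s (P p.2, Q p.2))
        ((fderiv ℂ (uncurry q) (p.1, (P p.2, Q p.2))).comp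
          (inl ℂ E _)) p.1 :=
      HasFDerivAt.comp (f := fun s => (s, (P p.2, Q p.2))) (g := uncurry q) p.1 h1
        (hasFDerivAt_prodMk_left p.1 (P p.2, Q p.2))
    exact h2.mul_const _

end Param

/-- Division data for a function and its partial gradient. -/
structure Hefer (D : Set ℂ) (R : ℝ) (f : ℂ × Vec m → ℂ)
    (e : ℂ × Vec m × Vec m → Vec m)
    (h : ℂ × Vec m × Vec m → Matrix (Fin m) (Fin m) ℂ) : Prop where
  isOpen : IsOpen D
  holo : ContDiffOn ℂ ω f (D ×ˢ ball 0 R)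
  holo_e : ContDiffOn ℂ ω e (D ×ˢ ball 0 R ×ˢ ball 0 R)
  sub_e : ∀ ζ ∈ D, ∀ x ∈ ball (0 : Vec m) R, ∀ y ∈ ball (0 : Vec m) R,
    f (ζ, x) - f (ζ, y) = e (ζ, x, y) ⬝ᵥ (x - y)
  diag_e : ∀ ζ x, e (ζ, x, x) = pgrad f (ζ, x)
  holo_h : ∀ i j, ContDiffOn ℂ ω (fun p => h p i j) (D ×ˢ ball 0 R ×ˢ ball 0 R)
  sub_h : ∀ ζ ∈ D, ∀ x ∈ ball (0 : Vec m) R, ∀ y ∈ ball (0 : Vec m) R,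
    pgrad f (ζ, x) - pgrad f (ζ, y) = (h (ζ, x, y)).mulVec (x - y)

theorem exists_hefer {D : Set ℂ} (hD : IsOpen D) {R : ℝ} {f : ℂ × Vec m → ℂ}
    (hf : ContDiffOn ℂ ω f (D ×ˢ ball 0 R)) : ∃ e h, Hefer D R f e h := by
  obtain ⟨e, he, hs, hd⟩ := exists_hadamard hD hf
  have hp := fun i => contDiffOn_pi.1 (contDiffOn_pgrad (hD.prod isOpen_ball) hf) i
  choose h hh hhs _ using fun i => exists_hadamard hD (hp i)
  refine ⟨e, fun p => Matrix.of fun i j => h i p j, hD, hf, he, hs, hd,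
    fun i j => contDiffOn_pi.1 (hh i) j, fun ζ hζ x hx y hy => ?_⟩
  ext i
  exact hhs i ζ hζ x hx y hy

/-- The kernel of the integral separating the zeros of the gradient. -/
noncomputable def sepKer (f : ℂ × Vec m → ℂ)
    (h : ℂ × Vec m × Vec m → Matrix (Fin m) (Fin m) ℂ) (s : ℂ × Vec m)
    (z : Vec m × Vec m) : ℂ :=
  (h (s.1, z.1, s.2)).det * ((f (s.1, z.1) - f (s.1, z.2)) ^ m)⁻¹

variable {D : Set ℂ} {R : ℝ} {f : ℂ × Vec m → ℂ}
  {e : ℂ × Vec m × Vec m → Vec m}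
  {h : ℂ × Vec m × Vec m → Matrix (Fin m) (Fin m) ℂ}

/-- The domain of holomorphy of `sepKer`. -/
def sepDom (D : Set ℂ) (R : ℝ) (f : ℂ × Vec m → ℂ) :
    Set ((ℂ × Vec m) × (Vec m × Vec m)) :=
  {p | p.1.1 ∈ D ∧ p.1.2 ∈ ball 0 R ∧ p.2.1 ∈ ball 0 R ∧ p.2.2 ∈ ball 0 R ∧
    f (p.1.1, p.2.1) - f (p.1.1, p.2.2) ≠ 0}

theorem Hefer.isOpen_sepDom (H : Hefer D R f e h) : IsOpen (sepDom D R f) := by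
  have h1 : IsOpen {p : (ℂ × Vec m) × (Vec m × Vec m) |
      p.1.1 ∈ D ∧ p.1.2 ∈ ball 0 R ∧ p.2.1 ∈ ball 0 R ∧ p.2.2 ∈ ball 0 R} :=
    (H.isOpen.preimage (by fun_prop)).inter ((isOpen_ball.preimage (by fun_prop)).inter
      ((isOpen_ball.preimage (by fun_prop)).inter (isOpen_ball.preimage (by fun_prop))))
  have h2 : ContinuousOn (fun p : (ℂ × Vec m) × (Vec m × Vec m) =>
      f (p.1.1, p.2.1) - f (p.1.1, p.2.2)) {p | p.1.1 ∈ D ∧ p.1.2 ∈ ball 0 R ∧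
        p.2.1 ∈ ball 0 R ∧ p.2.2 ∈ ball 0 R} := by
    refine ContinuousOn.sub ?_ ?_
    · exact H.holo.continuousOn.comp (by fun_prop) fun p hp => ⟨hp.1, hp.2.2.1⟩
    · exact H.holo.continuousOn.comp (by fun_prop) fun p hp => ⟨hp.1, hp.2.2.2⟩
  convert h2.isOpen_inter_preimage h1 (isOpen_ne (x := (0 : ℂ))) using 1
  ext p
  simp only [sepDom, mem_ofPred_eq, mem_inter_iff, mem_preimage]
  tauto

theorem Hefer.contDiffOn_sepKer (H : Hefer D R f e h) :
    ContDiffOn ℂ ω (uncurry (sepKer f h)) (sepDom D R f) := by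
  refine ContDiffOn.mul ?_ (ContDiffOn.inv (ContDiffOn.pow (ContDiffOn.sub ?_ ?_) m) ?_)
  · refine contDiffOn_det_of_entries fun i j => ?_
    exact (H.holo_h i j).comp (f := fun p : (ℂ × Vec m) × (Vec m × Vec m) =>
      (p.1.1, p.2.1, p.1.2)) (ContDiff.contDiffOn (by fun_prop))
      fun p hp => ⟨hp.1, hp.2.2.1, hp.2.1⟩
  · exact H.holo.comp (f := fun p : (ℂ × Vec m) × (Vec m × Vec m) =>
      (p.1.1, p.2.1)) (ContDiff.contDiffOn (by fun_prop)) fun p hp => ⟨hp.1, hp.2.2.1⟩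
  · exact H.holo.comp (f := fun p : (ℂ × Vec m) × (Vec m × Vec m) =>
      (p.1.1, p.2.2)) (ContDiff.contDiffOn (by fun_prop)) fun p hp => ⟨hp.1, hp.2.2.2.1⟩
  · exact fun p hp => pow_ne_zero _ hp.2.2.2.2

end Hefer

section HeferStart

variable {m : ℕ} {D : Set ℂ} {R : ℝ} {f : ℂ × Vec m → ℂ}
  {e : ℂ × Vec m × Vec m → Vec m}
  {h : ℂ × Vec m × Vec m → Matrix (Fin m) (Fin m) ℂ}

/-- The kernel `sepKer` in the coordinates `(x, v)`, `y = x - σ v`, after scaling. -/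
noncomputable def blowKer (e : ℂ × Vec m × Vec m → Vec m)
    (h : ℂ × Vec m × Vec m → Matrix (Fin m) (Fin m) ℂ) (s : ℂ × Vec m) (σ : ℝ)
    (p : Vec m × Vec m) : ℂ :=
  (h (s.1, p.1, s.2)).det * ((e (s.1, p.1, p.1 - (σ : ℂ) • p.2) ⬝ᵥ p.2) ^ m)⁻¹

theorem contDiff_rho_smul {b : Vec m → Vec m} (hb : ContDiff ℝ 2 b) :
    ContDiff ℝ 2 fun ξ => rhoL m ξ • b (xL m ξ) :=
  (rhoL m).contDiff.smul (hb.comp (xL m).contDiff)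

theorem contDiff_start {b : Vec m → Vec m} (hb : ContDiff ℝ 2 b) (σ : ℝ) :
    ContDiff ℝ 2 fun ξ => xL m ξ - (σ : ℂ) • rhoL m ξ • b (xL m ξ) :=
  (xL m).contDiff.sub ((contDiff_rho_smul hb).const_smul (σ : ℂ))

theorem Hefer.cycInt_sepKer_start (H : Hefer D R f e h) {ζ : ℂ} (hζ : ζ ∈ D)
    {b : Vec m → Vec m} (hb : ContDiff ℝ 2 b) {χ : Vec m → ℝ}
    (hχ : ContDiff ℝ 2 χ) {K : Set Vec m} (hK : IsCompact K)
    (hK0 : ∀ x ∉ K, fderiv ℝ χ x = 0) (hKB : K ⊆ ball 0 R) {σ : ℝ} (hσ : 0 < σ)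
    (hmem : ∀ x ∈ K, ∀ ρ ∈ psiSet, x - (σ : ℂ) • ρ • b x ∈ ball 0 R) (w : Vec m) :
    cycInt (sepKer f h (ζ, w)) χ (xL m) (fun ξ => xL m ξ - (σ : ℂ) • rhoL m ξ • b (xL m ξ)) =
      (-1) ^ m * cycInt (blowKer e h (ζ, w) σ) χ (xL m) (fun ξ => rhoL m ξ • b (xL m ξ)) := by
  rw [cycInt_eq_setIntegral hχ (xL m).contDiff (contDiff_start hb σ) hK0,
    cycInt_eq_setIntegral hχ (xL m).contDiff (contDiff_rho_smul hb) hK0, ← integral_const_mul]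
  refine setIntegral_congr_fun (isCompact_cycSet hK).measurableSet fun ξ hξ => ?_
  have hd := (contDiff_cycle hχ (xL m).contDiff (contDiff_rho_smul hb)).differentiable two_ne_zero ξ
  let L' : Vec m × Vec m →L[ℂ] Vec m :=
    fst ℂ _ _ - (σ : ℂ) • snd ℂ _ _
  have hdet := det_jac_cycle_comp hd (L := fun p => p.1 - (σ : ℂ) • p.2) (L' := L')
    L'.hasFDerivAt
  have hdL : (Matrix.of fun i j => L' (0, Pi.single j 1) i).det = (-(σ : ℂ)) ^ m := by
    have : (Matrix.of fun i j => L' (0, Pi.single j 1) i) =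
        (-(σ : ℂ)) • (1 : Matrix (Fin m) (Fin m) ℂ) := by
      ext i j
      simp only [L', Matrix.of_apply, Matrix.smul_apply, Matrix.one_apply, Pi.single_apply,
        sub_apply, smul_apply, ContinuousLinearMap.coe_fst',
        ContinuousLinearMap.coe_snd', Pi.sub_apply, Pi.smul_apply, smul_eq_mul, Pi.zero_apply]
      split_ifs <;> simp
    rw [this, Matrix.det_smul]
    simp
  rw [hdL] at hdet
  simp only [] at hdet ⊢
  rw [hdet]
  have hx := hKB hξ.1
  have hy := hmem _ hξ.1 _ hξ.2
  have hs := H.sub_e ζ hζ _ hx _ hy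
  rw [sub_sub_cancel, dotProduct_smul] at hs
  simp only [sepKer, blowKer]
  rw [hs, smul_eq_mul, mul_pow, mul_inv]
  have hσ' : (σ : ℂ) ^ m ≠ 0 := pow_ne_zero _ (by exact_mod_cast hσ.ne')
  rw [neg_pow]
  field_simp

theorem Hefer.cycInt_start (H : Hefer D R f e h) {ζ : ℂ} (hζ : ζ ∈ D)
    {b : Vec m → Vec m} (hb : ContDiff ℝ 2 b) (hbB : tsupport b ⊆ ball 0 R)
    {χ : Vec m → ℝ} (hχ : ContDiff ℝ 2 χ) (hs : HasCompactSupport χ)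
    {K : Set Vec m} (hK : IsCompact K) (hK0 : ∀ x ∉ K, fderiv ℝ χ x = 0)
    (hKB : K ⊆ ball 0 R) {σ₀ : ℝ} (hσ₀ : 0 < σ₀)
    (hpos : ∀ σ ∈ Icc 0 σ₀, ∀ x ∈ K, ∀ ρ ∈ psiSet, x - (σ : ℂ) • ρ • b x ∈ ball 0 R ∧
      0 < (e (ζ, x, x - (σ : ℂ) • ρ • b x) ⬝ᵥ b x).re)
    {w : Vec m} (hwR : w ∈ ball 0 R) (hw : pgrad f (ζ, w) = 0) :
    ((∀ᶠ x in 𝓝 w, χ x = 1) → cycInt (sepKer f h (ζ, w)) χ (xL m)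
      (fun ξ => xL m ξ - (σ₀ : ℂ) • rhoL m ξ • b (xL m ξ)) =
        (-1) ^ m * modelInt (0 : Vec m)) ∧
    ((∀ᶠ x in 𝓝 w, χ x = 0) → cycInt (sepKer f h (ζ, w)) χ (xL m)
      (fun ξ => xL m ξ - (σ₀ : ℂ) • rhoL m ξ • b (xL m ξ)) = 0) := by
  set I : ℝ → ℂ := fun σ =>
    cycInt (blowKer e h (ζ, w) σ) χ (xL m) (fun ξ => rhoL m ξ • b (xL m ξ)) with hI
  have hne : ∀ σ ∈ Icc 0 σ₀, ∀ x ∈ K, ∀ ρ ∈ psiSet,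
      e (ζ, x, x - (σ : ℂ) • ρ • b x) ⬝ᵥ ρ • b x ≠ 0 := fun σ hσ x hx ρ hρ h0 => by
    rw [dotProduct_smul, smul_eq_mul, mul_eq_zero] at h0
    have := (hpos σ hσ x hx ρ hρ).2
    rw [h0.resolve_left (psiSet_ne_zero hρ)] at this
    simp at this
  have hS : ∀ σ ∈ Ioc 0 σ₀, cycInt (sepKer f h (ζ, w)) χ (xL m)
      (fun ξ => xL m ξ - (σ : ℂ) • rhoL m ξ • b (xL m ξ)) = (-1) ^ m * I σ := fun σ hσ =>
    H.cycInt_sepKer_start hζ hb hχ hK hK0 hKB hσ.1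
      (fun x hx ρ hρ => (hpos σ ⟨hσ.1.le, hσ.2⟩ x hx ρ hρ).1) w
  have hconst : ∀ σ ∈ Ioc 0 σ₀, I σ = I σ₀ := by
    intro σ hσ
    have h1 : ((-1 : ℂ)) ^ m ≠ 0 := pow_ne_zero _ (by norm_num)
    refine mul_left_cancel₀ h1 ?_
    rw [← hS σ hσ, ← hS σ₀ ⟨hσ₀, le_rfl⟩]
    have hsl : ContDiff ℂ ω fun z : Vec m × Vec m => ((ζ, w), z) :=
      contDiff_prodMk_right _
    refine cycInt_homotopy hχ (xL m).contDiff (contDiff_start hb _) hχ (xL m).contDiff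
      (contDiff_start hb _) hK (fun x hx => ⟨hK0 x hx, hK0 x hx, rfl⟩)
      (H.isOpen_sepDom.preimage hsl.continuous)
      ((H.contDiffOn_sepKer.comp (f := fun z => ((ζ, w), z)) hsl.contDiffOn fun z hz => hz).of_le
        le_top) fun ξ h1 h2 u hu => ?_
    set σ' := σ + u * (σ₀ - σ) with hσ'
    have hσ'm : σ' ∈ Ioc 0 σ₀ := by
      constructor
      · have := mul_nonneg hu.1 (sub_nonneg.2 hσ.2)
        linarith [hσ.1]
      · have := mul_le_of_le_one_left (sub_nonneg.2 hσ.2) hu.2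
        linarith
    have e1 : xL m ξ - (σ : ℂ) • rhoL m ξ • b (xL m ξ) + u • (xL m ξ - (σ₀ : ℂ) • rhoL m ξ • b (xL m ξ) -
        (xL m ξ - (σ : ℂ) • rhoL m ξ • b (xL m ξ))) = xL m ξ - (σ' : ℂ) • rhoL m ξ • b (xL m ξ) := by
      ext k
      simp only [Pi.add_apply, Pi.sub_apply, Pi.smul_apply, smul_eq_mul, real_smul, hσ']
      push_cast
      ring
    simp only [sub_self, smul_zero, add_zero]
    rw [e1]
    obtain ⟨p1, p2⟩ := hpos σ' ⟨hσ'm.1.le, hσ'm.2⟩ _ h1 _ h2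
    refine ⟨hζ, hwR, hKB h1, p1, ?_⟩
    have := H.sub_e ζ hζ _ (hKB h1) _ p1
    simp only [this]
    rw [sub_sub_cancel, dotProduct_smul, smul_eq_mul]
    exact mul_ne_zero (by exact_mod_cast hσ'm.1.ne') (hne σ' ⟨hσ'm.1.le, hσ'm.2⟩ _ h1 _ h2)
  have hcont : ContinuousAt I 0 := by
    set O₁ : Set (ℝ × (Vec m × Vec m)) := {p | p.2.1 ∈ ball 0 R ∧
      p.2.1 - (p.1 : ℂ) • p.2.2 ∈ ball 0 R}
    have hm : Continuous fun p : ℝ × (Vec m × Vec m) => p.2.1 - (p.1 : ℂ) • p.2.2 :=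
      (by fun_prop : Continuous fun p : ℝ × (Vec m × Vec m) => p.2.1).sub
        ((continuous_ofReal.comp continuous_fst).smul (by fun_prop))
    have hO₁ : IsOpen O₁ :=
      (isOpen_ball.preimage (by fun_prop)).inter (isOpen_ball.preimage hm)
    have hec : ContinuousOn (fun p : ℝ × (Vec m × Vec m) =>
        e (ζ, p.2.1, p.2.1 - (p.1 : ℂ) • p.2.2) ⬝ᵥ p.2.2) O₁ := by
      have h1 : ContinuousOn (fun p : ℝ × (Vec m × Vec m) =>
          e (ζ, p.2.1, p.2.1 - (p.1 : ℂ) • p.2.2)) O₁ :=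
        H.holo_e.continuousOn.comp (f := fun p : ℝ × (Vec m × Vec m) =>
          (ζ, p.2.1, p.2.1 - (p.1 : ℂ) • p.2.2))
          (continuous_const.prodMk ((by fun_prop : Continuous fun p : ℝ × (Vec m ×
            Vec m) => p.2.1).prodMk hm)).continuousOn fun p hp => ⟨hζ, hp.1, hp.2⟩
      unfold dotProduct
      exact continuousOn_finsetSum _ fun k _ => (continuousOn_pi.1 h1 k).mul (by fun_prop)
    have hO : IsOpen (O₁ ∩ (fun p : ℝ × (Vec m × Vec m) =>
        e (ζ, p.2.1, p.2.1 - (p.1 : ℂ) • p.2.2) ⬝ᵥ p.2.2) ⁻¹' {0}ᶜ) :=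
      hec.isOpen_inter_preimage hO₁ isOpen_compl_singleton
    refine continuousAt_cycInt (q := blowKer e h (ζ, w)) hχ (xL m).contDiff (contDiff_rho_smul hb)
      hK hK0 hO ?_ ?_
    · refine ContinuousOn.mul ?_ (ContinuousOn.inv₀ ((hec.mono inter_subset_left).pow m)
        fun p hp => pow_ne_zero _ hp.2)
      have h1 : ContDiffOn ℂ ω (fun p => (h p).det) (D ×ˢ ball 0 R ×ˢ ball 0 R) :=
        contDiffOn_det_of_entries H.holo_h
      exact h1.continuousOn.comp (f := fun p : ℝ × (Vec m × Vec m) => (ζ, p.2.1, w))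
        (by fun_prop) fun p hp => ⟨hζ, hp.1.1, hwR⟩
    · intro ξ hξ
      have h0 : (0 : ℝ) ∈ Icc 0 σ₀ := ⟨le_rfl, hσ₀.le⟩
      exact ⟨⟨hKB hξ.1, (hpos 0 h0 _ hξ.1 _ hξ.2).1⟩, hne 0 h0 _ hξ.1 _ hξ.2⟩
  have hI0 : I σ₀ = I 0 := by
    have h1 : Tendsto I (𝓝[>] 0) (𝓝 (I 0)) := hcont.tendsto.mono_left nhdsWithin_le_nhds
    have h2 : Tendsto I (𝓝[>] 0) (𝓝 (I σ₀)) := by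
      refine tendsto_const_nhds.congr' ?_
      filter_upwards [Ioc_mem_nhdsGT hσ₀] with σ hσ
      exact (hconst σ hσ).symm
    exact tendsto_nhds_unique h2 h1
  have hker : blowKer e h (ζ, w) 0 = fun p => (h (ζ, p.1, w)).det *
      ((pgrad f (ζ, p.1) ⬝ᵥ p.2) ^ m)⁻¹ := by
    ext p
    simp [blowKer, H.diag_e]
  have hfer := cycInt_hefer (h := fun x => h (ζ, x, w)) (F := fun x => pgrad f (ζ, x)) (w := w)
    isOpen_ball
    (fun i j => ((H.holo_h i j).comp (f := fun x => (ζ, x, w))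
      (ContDiff.contDiffOn (by fun_prop)) fun x hx => ⟨hζ, hx, hwR⟩).of_le le_top)
    (fun x hx => by have := H.sub_h ζ hζ x hx w hwR; rwa [hw, sub_zero] at this)
    hb hbB hχ hs hK hK0 hKB (fun x hx => by
      obtain ⟨ρ, hρ⟩ : ∃ ρ, ρ ∈ psiSet := ⟨1, by simp [psiSet]⟩
      have := (hpos 0 ⟨le_rfl, hσ₀.le⟩ x hx ρ hρ).2
      simpa [H.diag_e] using this)
  rw [hS σ₀ ⟨hσ₀, le_rfl⟩, hI0, hI]
  simp only [hker]
  exact ⟨fun hc => by rw [hfer.1 hc], fun hc => by rw [hfer.2 hc, mul_zero]⟩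

end HeferStart

section ShellFamily

variable {m : ℕ}

/-- A one-parameter family of functions on a ball whose critical points stay in a smaller ball. -/
structure ShellFam (D : Set ℂ) (R₁ R r : ℝ) (f : ℂ × Vec m → ℂ) : Prop where
  isOpen : IsOpen D
  conn : IsPreconnected D
  pos : 0 < r
  pos₁ : 0 < R₁
  lt : R₁ < R
  holo : ContDiffOn ℂ ω f (D ×ˢ ball 0 R)
  shell : ∀ ζ ∈ D, ∀ x : Vec m, R₁ ≤ ‖x‖ → ‖x‖ < R → r ≤ ‖pgrad f (ζ, x)‖

theorem exists_cutoff_ball {R₁ R : ℝ} (h0 : 0 < R₁) (h : R₁ < R) :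
    ∃ β : Vec m → ℝ, ContDiff ℝ 2 β ∧ HasCompactSupport β ∧ (∀ x, 0 ≤ β x) ∧
      (∀ x ∈ ball 0 R₁, β x = 1) ∧ tsupport β ⊆ ball 0 R := by
  let b : ContDiffBump (0 : Vec m) := ⟨R₁, (R₁ + R) / 2, h0, by linarith⟩
  refine ⟨b, b.contDiff, b.hasCompactSupport, fun x => b.nonneg, fun x hx =>
    b.one_of_mem_closedBall (ball_subset_closedBall hx), ?_⟩
  rw [b.tsupport_eq]
  exact closedBall_subset_ball (by show (R₁ + R) / 2 < R; linarith)

theorem pgrad_eq_hgrad {f : ℂ × Vec m → ℂ} {ζ : ℂ} {x : Vec m}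
    (hf : DifferentiableAt ℂ f (ζ, x)) : pgrad f (ζ, x) = hgrad (fun y => f (ζ, y)) x := by
  ext k
  unfold pgrad hgrad
  have := (hf.hasFDerivAt.comp (f := fun y : Vec m => (ζ, y)) x
    (hasFDerivAt_prodMk_right ζ x)).fderiv
  simp only [Function.comp_def] at this
  rw [this]
  simp

variable {D : Set ℂ} {R₁ R r : ℝ} {f : ℂ × Vec m → ℂ}

theorem ShellFam.isOpen_prod (h : ShellFam D R₁ R r f) :
    IsOpen (D ×ˢ ball (0 : Vec m) R) := h.isOpen.prod isOpen_ball

theorem ShellFam.differentiableAt (h : ShellFam D R₁ R r f) {ζ : ℂ} (hζ : ζ ∈ D) {x : Vec m}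
    (hx : ‖x‖ < R) : DifferentiableAt ℂ f (ζ, x) :=
  (h.holo.contDiffAt (h.isOpen_prod.mem_nhds ⟨hζ, by simpa using hx⟩)).differentiableAt (by simp)

theorem ShellFam.slice (h : ShellFam D R₁ R r f) {ζ : ℂ} (hζ : ζ ∈ D) :
    ContDiffOn ℂ ω (fun x => f (ζ, x)) (ball 0 R) :=
  h.holo.comp (contDiff_prodMk_right ζ).contDiffOn fun _ hx => ⟨hζ, hx⟩

theorem ShellFam.hamFam (h : ShellFam D R₁ R r f) {χ : Vec m → ℝ} (hχ : ContDiff ℝ 1 χ)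
    (hs : HasCompactSupport χ) (h0 : ∀ x, 0 ≤ χ x) (h1 : ∀ x ∈ ball 0 R₁, χ x = 1)
    (hR : tsupport χ ⊆ ball 0 R) : HamFam (D ×ˢ ball 0 R) f χ r D := by
  refine ⟨h.isOpen_prod, h.holo, hχ, hs, h0, h.pos, fun ζ hζ x hx => ⟨hζ, hR hx⟩,
    fun ζ hζ x hx => ?_⟩
  rcases lt_or_ge ‖x‖ R₁ with hlt | hge
  · left
    have : χ =ᶠ[𝓝 x] fun _ => 1 := by
      filter_upwards [isOpen_ball.mem_nhds (by simpa using hlt : x ∈ ball 0 R₁)]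
        with y hy using h1 y hy
    rw [this.fderiv_eq]
    simp
  · exact Or.inr (h.shell ζ hζ x hge (by simpa using hR hx))

theorem HamFam.analyticOnNhd_mass {O : Set (ℂ × Vec m)} {χ : Vec m → ℝ}
    (h : HamFam O f χ r D) (hD : IsOpen D) {φ : ℂ × Vec m → ℂ} (hφ : ContDiffOn ℂ ω φ O)
    {η : ℝ} (h0 : 0 < η) (h1 : η < r) :
    AnalyticOnNhd ℂ (fun ζ => mass (fun x => pgrad f (ζ, x)) χ (kap η 0) fun x => φ (ζ, x)) D := by
  refine DifferentiableOn.analyticOnNhd (fun ζ hζ => DifferentiableAt.differentiableWithinAt ?_) hD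
  have hd := (h.fam η 0).differentiableAt_wint
    (hφ.mul (contDiffOn_pdet h.isOpen h.holo_pgrad)) (h.adm h0 (by simpa using h1) hζ)
  refine hd.congr_of_eventuallyEq ?_
  filter_upwards [hD.mem_nhds hζ] with z hz
  exact (wint_eq_mass h.isOpen h.holo_pgrad φ (h.mem z hz)).symm

theorem contDiff_smul_star {β : Vec m → ℝ} (hβ : ContDiff ℝ 2 β) {Ω : Set Vec m}
    (hΩ : IsOpen Ω) {F : Vec m → Vec m} (hF : ContDiffOn ℂ ω F Ω)
    (hs : tsupport β ⊆ Ω) : ContDiff ℝ 2 fun x => β x • star (F x) := by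
  refine contDiff_iff_contDiffAt.2 fun x => ?_
  by_cases hx : x ∈ tsupport β
  swap
  · refine (contDiffAt_const (c := (0 : Vec m))).congr_of_eventuallyEq ?_
    filter_upwards [(isClosed_tsupport β).isOpen_compl.mem_nhds hx] with y hy
    rw [image_eq_zero_of_notMem_tsupport hy, zero_smul]
  have hx' : x ∈ Ω := hs hx
  have h1 : ContDiffAt ℝ 2 F x := ((hF.contDiffAt (hΩ.mem_nhds hx')).restrict_scalars ℝ).of_le le_top
  exact hβ.contDiffAt.smul ((starL' ℝ (A := Vec m)).contDiff.contDiffAt.comp x h1)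

theorem ShellFam.exists_separator (h : ShellFam D R₁ R r f) (hm : 1 ≤ m) (h1 : (1 : ℂ) ∈ D)
    {R₂ l : ℝ} (h2 : R₂ < R) (hl : 0 < l) (hlr : R₁ + 8 * l / r < R₂)
    (hcrit : ∀ x y : Vec m, ‖x‖ ≤ R₂ → ‖y‖ ≤ R₂ → pgrad f (1, x) = 0 → pgrad f (1, y) = 0 →
      f (1, x) = f (1, y))
    (hclose : ∀ ζ ∈ D, ∀ x : Vec m, ‖x‖ ≤ R₂ → ‖f (ζ, x) - f (1, x)‖ ≤ l / 4)
    {χ : Vec m → ℝ} (hχ : ContDiff ℝ 2 χ) (hχs : HasCompactSupport χ)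
    {K : Set Vec m} (hK : IsCompact K) (hKR : K ⊆ ball 0 R₁)
    (hK0 : ∀ x ∉ K, fderiv ℝ χ x = 0) (hne : ∀ x ∈ K, pgrad f (1, x) ≠ 0) :
    ∃ E : ℂ × Vec m → ℂ, ContDiffOn ℂ ω E (D ×ˢ ball 0 R) ∧
      ∀ᶠ ζ in 𝓝 (1 : ℂ), (∀ x ∈ K, pgrad f (ζ, x) ≠ 0) ∧ ∀ w ∈ ball 0 R,
        pgrad f (ζ, w) = 0 → ((∀ᶠ x in 𝓝 w, χ x = 1) → E (ζ, w) = 1) ∧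
          ((∀ᶠ x in 𝓝 w, χ x = 0) → E (ζ, w) = 0) := by
  obtain ⟨e, hh, H⟩ := exists_hefer h.isOpen h.holo
  obtain ⟨β, hβ, hβs, -, hβ1, hβR⟩ := exists_cutoff_ball (m := m) h.pos₁ h.lt
  have hr := h.pos
  have hRR₁ : ball (0 : Vec m) R₁ ⊆ ball 0 R := ball_subset_ball h.lt.le
  set F : Vec m → Vec m := fun x => pgrad f (1, x)
  have hF : ContDiffOn ℂ ω F (ball 0 R) :=
    (contDiffOn_pgrad h.isOpen_prod h.holo).comp (contDiff_prodMk_right 1).contDiffOn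
      fun _ hx => ⟨h1, hx⟩
  set b : Vec m → Vec m := fun x => β x • star (F x) with hbdef
  have hb : ContDiff ℝ 2 b := contDiff_smul_star hβ isOpen_ball hF hβR
  have hbR : tsupport b ⊆ ball 0 R :=
    (closure_mono (Function.support_smul_subset_left _ _)).trans hβR
  -- positivity near the start
  have hcb : Continuous b := hb.continuous
  have hmap : Continuous fun p : (ℂ × ℝ) × (Vec m × ℂ) =>
      p.2.1 - (p.1.2 : ℂ) • p.2.2 • b p.2.1 :=
    (by fun_prop : Continuous fun p : (ℂ × ℝ) × (Vec m × ℂ) => p.2.1).sub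
      ((continuous_ofReal.comp (by fun_prop)).smul
        ((by fun_prop : Continuous fun p : (ℂ × ℝ) × (Vec m × ℂ) => p.2.2).smul
          (hcb.comp (by fun_prop))))
  have hev : ∀ᶠ p : ℂ × ℝ in 𝓝 (1, 0), ∀ k ∈ K ×ˢ psiSet, p.1 ∈ D ∧
      k.1 - (p.2 : ℂ) • k.2 • b k.1 ∈ ball 0 R₁ ∧
      0 < (e (p.1, k.1, k.1 - (p.2 : ℂ) • k.2 • b k.1) ⬝ᵥ b k.1).re := by
    refine (hK.prod isCompact_psiSet).eventually_forall_of_forall_eventually fun k hk => ?_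
    have hk1 : k.1 ∈ ball 0 R₁ := hKR hk.1
    have t1 : ∀ᶠ p : (ℂ × ℝ) × (Vec m × ℂ) in 𝓝 ((1, 0), k), p.1.1 ∈ D :=
      (continuous_fst.fst.tendsto ((1, 0), k)).eventually (h.isOpen.mem_nhds h1)
    have e0 : k.1 - ((0 : ℝ) : ℂ) • k.2 • b k.1 = k.1 := by simp
    have t2 : ∀ᶠ p : (ℂ × ℝ) × (Vec m × ℂ) in 𝓝 ((1, 0), k),
        p.2.1 - (p.1.2 : ℂ) • p.2.2 • b p.2.1 ∈ ball 0 R₁ := by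
      refine (hmap.tendsto ((1, 0), k)).eventually (isOpen_ball.mem_nhds ?_)
      show k.1 - ((0 : ℝ) : ℂ) • k.2 • b k.1 ∈ _
      rwa [e0]
    have hc : ContinuousAt (fun p : (ℂ × ℝ) × (Vec m × ℂ) =>
        (e (p.1.1, p.2.1, p.2.1 - (p.1.2 : ℂ) • p.2.2 • b p.2.1) ⬝ᵥ b p.2.1).re) ((1, 0), k) := by
      refine Complex.continuous_re.continuousAt.comp ?_
      have he : ContinuousAt (fun p : (ℂ × ℝ) × (Vec m × ℂ) =>
          e (p.1.1, p.2.1, p.2.1 - (p.1.2 : ℂ) • p.2.2 • b p.2.1)) ((1, 0), k) := by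
        refine ContinuousAt.comp (f := fun p : (ℂ × ℝ) × (Vec m × ℂ) =>
          (p.1.1, p.2.1, p.2.1 - (p.1.2 : ℂ) • p.2.2 • b p.2.1)) (g := e) ?_
          (continuous_fst.fst.prodMk ((by fun_prop : Continuous fun p : (ℂ × ℝ) ×
            (Vec m × ℂ) => p.2.1).prodMk hmap)).continuousAt
        refine H.holo_e.continuousOn.continuousAt ((h.isOpen.prod (isOpen_ball.prod
          isOpen_ball)).mem_nhds ⟨h1, hRR₁ hk1, ?_⟩)
        simpa using hRR₁ hk1
      unfold dotProduct
      exact tendsto_finsetSum _ fun i _ => ((continuous_apply i).continuousAt.comp he).mul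
        ((continuous_apply i).continuousAt.comp (hcb.continuousAt.comp (by fun_prop)))
    have t3 := hc.eventually (lt_mem_nhds (a := (0 : ℝ)) (by
      show 0 < (e (1, k.1, k.1 - ((0 : ℝ) : ℂ) • k.2 • b k.1) ⬝ᵥ b k.1).re
      rw [e0, H.diag_e]
      simp only [hbdef, hβ1 _ hk1, one_smul]
      rw [show pgrad f (1, k.1) = F k.1 from rfl, dotProduct_star_self, ofReal_re]
      exact sqNorm_pos (hne _ hk.1)))
    filter_upwards [t1, t2, t3] with p p1 p2 p3 using ⟨p1, p2, p3⟩
  obtain ⟨δ, hδ, hδs⟩ := eventually_nhds_iff_ball.1 hev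
  set σ₀ := δ / 2 with hσ₀
  have hσ₀pos : 0 < σ₀ := half_pos hδ
  have hstart : ∀ ζ, ‖ζ - 1‖ < δ → ∀ σ ∈ Icc 0 σ₀, ∀ x ∈ K, ∀ ρ ∈ psiSet, ζ ∈ D ∧
      x - (σ : ℂ) • ρ • b x ∈ ball 0 R₁ ∧
      0 < (e (ζ, x, x - (σ : ℂ) • ρ • b x) ⬝ᵥ b x).re := fun ζ hζ σ hσ x hx ρ hρ => by
    refine hδs (ζ, σ) ?_ (x, ρ) ⟨hx, hρ⟩
    rw [mem_ball, Prod.dist_eq, max_lt_iff, dist_eq_norm, dist_eq_norm, sub_zero,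
      Real.norm_of_nonneg hσ.1]
    exact ⟨hζ, by linarith [hσ.2]⟩
  -- push the cycle
  set g : Vec m → ℂ := fun x => f (1, x) with hgdef
  have hgr : ∀ x : Vec m, ‖x‖ < R → hgrad g x = pgrad f (1, x) := fun x hx =>
    (pgrad_eq_hgrad (h.differentiableAt h1 hx)).symm
  have hR₁2 : R₁ < R₂ := by
    have : 0 < 8 * l / r := by positivity
    linarith
  obtain ⟨ε, hε, P', Q', hP', hQ', hfin, hst, hpush⟩ := exists_push (g := g) (h.slice h1) h.pos₁ h2
    hl hr (fun x hx1 hx2 => by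
      rw [hgr x (by linarith)]; exact h.shell 1 h1 x hx1 (by linarith)) hlr
    (fun x y hx hy hx0 hy0 => hcrit x y hx hy (by rwa [← hgr x (by linarith)])
      (by rwa [← hgr y (by linarith)]))
    hχ hK hK0 (xL m).contDiff (contDiff_start hb σ₀) (fun ξ hξ => by
      obtain ⟨-, s1, s2⟩ := hstart 1 (by simpa using hδ) σ₀ ⟨hσ₀pos.le, le_rfl⟩ _ hξ.1 _ hξ.2
      have hx := hKR hξ.1
      refine ⟨max_le (mem_ball_zero_iff.1 hx).le (mem_ball_zero_iff.1 s1).le, ?_⟩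
      have hs := H.sub_e 1 h1 _ (hRR₁ hx) _ (hRR₁ s1)
      simp only [gdiff, hgdef]
      rw [hs, sub_sub_cancel, dotProduct_smul, dotProduct_smul, smul_eq_mul, smul_eq_mul]
      refine mul_ne_zero (by exact_mod_cast hσ₀pos.ne') (mul_ne_zero (psiSet_ne_zero hξ.2) fun h0 => ?_)
      rw [h0] at s2
      simp at s2)
  set c : ℂ := (-1) ^ m * modelInt (0 : Vec m)
  have hc : c ≠ 0 := mul_ne_zero (pow_ne_zero _ (by norm_num)) (modelInt_ne_zero hm 0)
  refine ⟨fun p => cycInt (sepKer f hh p) χ P' Q' * c⁻¹, ?_, ?_⟩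
  · refine (contDiffOn_cycInt hχ hP' hQ' hK hK0 H.isOpen_sepDom H.contDiffOn_sepKer
      h.isOpen_prod fun s hs ξ hξ => ?_).mul contDiffOn_const
    obtain ⟨f1, f2⟩ := hfin ξ hξ
    have n1 := (norm_fst_le (P' ξ, Q' ξ)).trans f1
    have n2 := (norm_snd_le (P' ξ, Q' ξ)).trans f1
    refine ⟨hs.1, hs.2, mem_ball_zero_iff.2 (n1.trans_lt h2), mem_ball_zero_iff.2 (n2.trans_lt h2),
      fun h0 => ?_⟩
    have c1 := hclose s.1 hs.1 _ n1
    have c2 := hclose s.1 hs.1 _ n2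
    simp only [gdiff, hgdef] at f2
    have : f (1, P' ξ) - f (1, Q' ξ) = (f (s.1, Q' ξ) - f (1, Q' ξ)) -
        (f (s.1, P' ξ) - f (1, P' ξ)) := by
      simp only [] at h0
      linear_combination h0
    rw [this] at f2
    linarith [norm_sub_le (f (s.1, Q' ξ) - f (1, Q' ξ)) (f (s.1, P' ξ) - f (1, P' ξ))]
  · have hnear : ∀ᶠ ζ in 𝓝 (1 : ℂ), ∀ x ∈ closedBall (0 : Vec m) R₂,
        ‖f (ζ, x) - f (1, x)‖ < ε / 4 := by
      refine (isCompact_closedBall _ _).eventually_forall_of_forall_eventually fun x hx => ?_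
      have hxR : ‖x‖ < R := (mem_closedBall_zero_iff.1 hx).trans_lt h2
      have a1 : ContinuousAt (fun p : ℂ × Vec m => f p) (1, x) :=
        (h.differentiableAt h1 hxR).continuousAt
      have a2 : ContinuousAt (fun p : ℂ × Vec m => f (1, p.2)) (1, x) :=
        ContinuousAt.comp (f := fun p : ℂ × Vec m => ((1 : ℂ), p.2)) (g := f) a1 (by fun_prop)
      exact (a1.sub a2).norm.eventually_lt continuousAt_const (by simpa using hε)
    filter_upwards [hnear, ball_mem_nhds 1 hδ, h.isOpen.mem_nhds h1] with ζ hζ hζδ hζD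
    rw [mem_ball_iff_norm] at hζδ
    have hst' := hstart ζ hζδ
    have h00 : (0 : ℝ) ∈ Icc 0 σ₀ := ⟨le_rfl, hσ₀pos.le⟩
    refine ⟨fun x hx h0 => ?_, fun w hw hw0 => ?_⟩
    · have := (hst' 0 h00 x hx 1 (by simp [psiSet])).2.2
      simp [H.diag_e, h0] at this
    · have hcyc := hpush {z | ((ζ, w), z) ∈ sepDom D R f}
        (H.isOpen_sepDom.preimage (by fun_prop)) (fun z hz hz2 => by
          have n1 := (norm_fst_le z).trans hz
          have n2 := (norm_snd_le z).trans hz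
          refine ⟨hζD, hw, mem_ball_zero_iff.2 (n1.trans_lt h2), mem_ball_zero_iff.2 (n2.trans_lt h2),
            fun h0 => ?_⟩
          have c1 := hζ _ (mem_closedBall_zero_iff.2 n1)
          have c2 := hζ _ (mem_closedBall_zero_iff.2 n2)
          simp only [gdiff, hgdef] at hz2
          have : f (1, z.1) - f (1, z.2) = (f (ζ, z.2) - f (1, z.2)) -
              (f (ζ, z.1) - f (1, z.1)) := by
            simp only [] at h0
            linear_combination h0
          rw [this] at hz2
          linarith [norm_sub_le (f (ζ, z.2) - f (1, z.2)) (f (ζ, z.1) - f (1, z.1))])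
        (sepKer f hh (ζ, w)) ((H.contDiffOn_sepKer.comp (f := fun z => ((ζ, w), z))
          (contDiff_prodMk_right _).contDiffOn fun z hz => hz).of_le le_top)
      obtain ⟨q1, q2⟩ := H.cycInt_start hζD hb hbR hχ hχs hK hK0 (hKR.trans hRR₁) hσ₀pos
        (fun σ hσ x hx ρ hρ => ⟨hRR₁ (hst' σ hσ x hx ρ hρ).2.1, (hst' σ hσ x hx ρ hρ).2.2⟩) hw hw0
      refine ⟨fun hc1 => ?_, fun hc0 => ?_⟩
      · show cycInt (sepKer f hh (ζ, w)) χ P' Q' * c⁻¹ = 1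
        rw [← hcyc, q1 hc1, mul_inv_cancel₀ hc]
      · show cycInt (sepKer f hh (ζ, w)) χ P' Q' * c⁻¹ = 0
        rw [← hcyc, q2 hc0, zero_mul]

end ShellFamily

section UniqueZero

variable {m : ℕ} {D : Set ℂ} {R₁ R r : ℝ} {f : ℂ × Vec m → ℂ}

theorem ShellFam.fderiv_cutoff (h : ShellFam D R₁ R r f) {β : Vec m → ℝ}
    (h1 : ∀ x ∈ ball 0 R₁, β x = 1) {ζ : ℂ} (hζ : ζ ∈ D) {x : Vec m}
    (hx : x ∈ ball 0 R) : fderiv ℝ β x = 0 ∨ r ≤ ‖pgrad f (ζ, x)‖ := by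
  rcases lt_or_ge ‖x‖ R₁ with hlt | hge
  · left
    have : β =ᶠ[𝓝 x] fun _ => 1 := by
      filter_upwards [isOpen_ball.mem_nhds (by simpa using hlt : x ∈ ball 0 R₁)]
        with y hy using h1 y hy
    rw [this.fderiv_eq]
    simp
  · exact Or.inr (h.shell ζ hζ x hge (by simpa using hx))

theorem ShellFam.norm_lt_of_pgrad_eq_zero (h : ShellFam D R₁ R r f) {ζ : ℂ} (hζ : ζ ∈ D)
    {x : Vec m} (hx : x ∈ ball 0 R) (h0 : pgrad f (ζ, x) = 0) : ‖x‖ < R₁ := by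
  by_contra! hge
  have := h.shell ζ hζ x hge (by simpa using hx)
  rw [h0, norm_zero] at this
  exact absurd h.pos (not_lt.2 this)

theorem IsoZ.mass_eq_add {Ω : Set Vec m} {G : Vec m → Vec m}
    {χ χ' : Vec m → ℝ} {r r' : ℝ} (h : IsoZ Ω G χ r) (h' : IsoZ Ω G χ' r')
    {B : Vec m → ℝ} (hB : Continuous B) {φ : Vec m → ℂ} (hφ : ContinuousOn φ Ω) :
    mass G (fun x => χ x + χ' x) B φ = mass G χ B φ + mass G χ' B φ := by
  unfold mass
  rw [← integral_add (h.integrable hB hφ) (h'.integrable hB hφ)]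
  congr 1
  ext x
  push_cast
  ring

theorem ShellFam.finite_zeros (h : ShellFam D R₁ R r f) {ζ : ℂ} (hζ : ζ ∈ D) {a : Vec m}
    (ha : a ∈ ball 0 R) (ha0 : pgrad f (ζ, a) = 0) :
    {x ∈ ball 0 R | pgrad f (ζ, x) = 0}.Finite := by
  obtain ⟨β, hβ, hβs, hβ0, hβ1, hβR⟩ := exists_cutoff_ball (m := m) h.pos₁ h.lt
  have hev : ∀ x ∈ ball (0 : Vec m) R₁, ∀ᶠ y in 𝓝 x, β y = 1 := fun x hx => by
    filter_upwards [isOpen_ball.mem_nhds hx] with y hy using hβ1 y hy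
  have hI := (h.hamFam (hβ.of_le one_le_two) hβs hβ0 hβ1 hβR).isoZ hζ
  have hΩ : {x : Vec m | (ζ, x) ∈ D ×ˢ ball (0 : Vec m) R} = ball 0 R := by
    ext x; simp [hζ]
  rw [hΩ] at hI
  have hz := fun {x : Vec m} (hx : x ∈ ball 0 R) (h0 : pgrad f (ζ, x) = 0) =>
    mem_ball_zero_iff.2 (h.norm_lt_of_pgrad_eq_zero hζ hx h0)
  have hfin := hI.finite_zeros (fun x hx hlt => hev x (by
      by_contra hge
      exact absurd hlt (not_lt.2 (h.shell ζ hζ x (by simpa using hge) (by simpa using hβR hx)))))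
    (fun p hp => hI.frequently_sdet_ne_zero (convex_ball 0 R).isPreconnected (hev a (hz ha ha0))
      ha0 hp)
  refine hfin.subset fun x hx => ⟨subset_tsupport _ ?_, hx.2⟩
  simp [hβ1 x (hz hx.1 hx.2)]

theorem ShellFam.unique_zero (h : ShellFam D R₁ R r f) (hm : 1 ≤ m) (h0 : (0 : ℂ) ∈ D)
    (h1 : (1 : ℂ) ∈ D) {w₀ : Vec m}
    (huniq : ∀ x ∈ ball 0 R, pgrad f (0, x) = 0 → x = w₀)
    {R₂ l : ℝ} (h2 : R₂ < R) (hl : 0 < l) (hlr : R₁ + 8 * l / r < R₂)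
    (hcrit : ∀ x y : Vec m, ‖x‖ ≤ R₂ → ‖y‖ ≤ R₂ → pgrad f (1, x) = 0 → pgrad f (1, y) = 0 →
      f (1, x) = f (1, y))
    (hclose : ∀ ζ ∈ D, ∀ x : Vec m, ‖x‖ ≤ R₂ → ‖f (ζ, x) - f (1, x)‖ ≤ l / 4)
    {a b : Vec m} (ha : a ∈ ball 0 R) (ha0 : pgrad f (1, a) = 0)
    (hb : b ∈ ball 0 R) (hb0 : pgrad f (1, b) = 0) : a = b := by
  by_contra hab
  obtain ⟨β, hβ, hβs, hβ0, hβ1, hβR⟩ := exists_cutoff_ball (m := m) h.pos₁ h.lt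
  have hRR₁ : ball (0 : Vec m) R₁ ⊆ ball 0 R := ball_subset_ball h.lt.le
  have hz := fun {ζ : ℂ} (hζ : ζ ∈ D) {x : Vec m} (hx : x ∈ ball 0 R)
    (h0 : pgrad f (ζ, x) = 0) => mem_ball_zero_iff.2 (h.norm_lt_of_pgrad_eq_zero hζ hx h0)
  have hH := h.hamFam (hβ.of_le one_le_two) hβs hβ0 hβ1 hβR
  -- a ball containing no other zero
  set Z : Set Vec m := {x ∈ ball 0 R | pgrad f (1, x) = 0} \ {a} with hZ
  have hZf : Z.Finite := (h.finite_zeros h1 ha ha0).sdiff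
  obtain ⟨d, hd, hdsub⟩ : ∃ d > 0, closedBall a d ⊆ ball 0 R₁ ∩ Zᶜ :=
    nhds_basis_closedBall.mem_iff.1 ((isOpen_ball.inter
      hZf.isClosed.isOpen_compl).mem_nhds ⟨hz h1 ha ha0, by simp [hZ]⟩)
  let χ : ContDiffBump a := ⟨d / 2, d, half_pos hd, half_lt_self hd⟩
  have hχ : ContDiff ℝ 2 χ := χ.contDiff
  have hχin : ∀ x ∈ ball a (d / 2), ∀ᶠ y in 𝓝 x, χ y = 1 := fun x hx => by
    filter_upwards [isOpen_ball.mem_nhds hx] with y hy using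
      χ.one_of_mem_closedBall (ball_subset_closedBall hy)
  have hχts : tsupport χ = closedBall a d := χ.tsupport_eq
  have hχout : ∀ x ∉ closedBall a d, ∀ᶠ y in 𝓝 x, χ y = 0 := fun x hx => by
    rw [← hχts] at hx
    exact notMem_tsupport_iff_eventuallyEq.1 hx
  set K : Set Vec m := closedBall a d \ ball a (d / 2) with hKdef
  have hK : IsCompact K := (isCompact_closedBall a d).diff isOpen_ball
  have hKR : K ⊆ ball 0 R₁ := fun x hx => (hdsub hx.1).1
  have hK0 : ∀ x ∉ K, fderiv ℝ χ x = 0 := fun x hx => by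
    by_cases hx1 : x ∈ ball a (d / 2)
    · rw [(show χ =ᶠ[𝓝 x] fun _ => 1 from hχin x hx1).fderiv_eq]; simp
    · have : x ∉ closedBall a d := fun hx2 => hx ⟨hx2, hx1⟩
      rw [(show χ =ᶠ[𝓝 x] fun _ => 0 from hχout x this).fderiv_eq]; simp
  have hne : ∀ x ∈ K, pgrad f (1, x) ≠ 0 := fun x hx h0 => by
    refine (hdsub hx.1).2 ⟨⟨hRR₁ (hKR hx), h0⟩, ?_⟩
    rintro rfl
    exact hx.2 (mem_ball_self (half_pos hd))
  obtain ⟨E, hE, hEev⟩ := h.exists_separator hm h1 h2 hl hlr hcrit hclose hχ χ.hasCompactSupport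
    hK hKR hK0 hne
  -- a uniform lower bound near `1`
  have hFc : ContinuousOn (pgrad f) (D ×ˢ ball 0 R) := hH.holo_pgrad.continuousOn
  obtain ⟨r₁, hr₁, hr₁K⟩ := hK.exists_forall_le' (a := (0 : ℝ)) (f := fun x => ‖pgrad f (1, x)‖)
    (hFc.comp (f := fun x : Vec m => ((1 : ℂ), x)) (by fun_prop)
      fun x hx => ⟨h1, hRR₁ (hKR hx)⟩).norm fun x hx => norm_pos_iff.2 (hne x hx)
  set r' := min (r₁ / 2) r with hr'
  have hr'0 : 0 < r' := lt_min (half_pos hr₁) h.pos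
  have hlow : ∀ᶠ ζ in 𝓝 (1 : ℂ), ∀ x ∈ K, r' < ‖pgrad f (ζ, x)‖ := by
    refine hK.eventually_forall_of_forall_eventually fun x hx => ?_
    have hc : ContinuousAt (pgrad f) (1, x) :=
      hFc.continuousAt (h.isOpen_prod.mem_nhds ⟨h1, hRR₁ (hKR hx)⟩)
    refine hc.norm.eventually (lt_mem_nhds ?_)
    have := hr₁K x hx
    have := min_le_left (r₁ / 2) r
    simp only [hr']
    linarith
  obtain ⟨δ, hδ, hδs⟩ := eventually_nhds_iff_ball.1
    ((hEev.and hlow).and (h.isOpen.mem_nhds h1))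
  set D' : Set ℂ := ball 1 δ
  have hD'D : D' ⊆ D := fun ζ hζ => (hδs ζ hζ).2
  have h1' : (1 : ℂ) ∈ D' := mem_ball_self hδ
  have hA : HamFam (D ×ˢ ball 0 R) f χ r' D' := by
    refine ⟨h.isOpen_prod, h.holo, χ.contDiff, χ.hasCompactSupport, fun x => χ.nonneg, hr'0,
      fun ζ hζ x hx => ⟨hD'D hζ, hRR₁ (hdsub (hχts ▸ hx)).1⟩, fun ζ hζ x hx => ?_⟩
    by_cases hxK : x ∈ K
    · exact Or.inr ((hδs ζ hζ).1.2 x hxK).le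
    · exact Or.inl (hK0 x hxK)
  have hBts : tsupport (fun x => β x - χ x) ⊆ ball 0 R := by
    refine (tsupport_sub β χ).trans (union_subset hβR ?_)
    rw [hχts]
    exact fun x hx => hRR₁ (hdsub hx).1
  have hB : HamFam (D ×ˢ ball 0 R) f (fun x => β x - χ x) r' D' := by
    refine ⟨h.isOpen_prod, h.holo, (hβ.of_le one_le_two).sub χ.contDiff,
      hβs.sub χ.hasCompactSupport, fun x => ?_, hr'0,
      fun ζ hζ x hx => ⟨hD'D hζ, hBts hx⟩, fun ζ hζ x hx => ?_⟩
    · by_cases hx : x ∈ closedBall a d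
      · rw [hβ1 x (hdsub hx).1]
        linarith [χ.le_one (x := x)]
      · rw [(hχout x hx).self_of_nhds, sub_zero]
        exact hβ0 x
    · by_cases hxK : x ∈ K
      · exact Or.inr ((hδs ζ hζ).1.2 x hxK).le
      · rcases h.fderiv_cutoff hβ1 (hD'D hζ) (hBts hx) with h3 | h3
        · left
          rw [fderiv_fun_sub (hβ.differentiable two_ne_zero x) (hχ.differentiable two_ne_zero x),
            h3, hK0 x hxK, sub_zero]
        · exact Or.inr ((min_le_right _ _).trans h3)
  set η := r' / 2
  have hη0 : 0 < η := half_pos hr'0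
  have hη1 : η < r' := half_lt_self hr'0
  have hη2 : η < r := hη1.trans_le (min_le_right _ _)
  have hn0 : ∀ {t : ℝ}, η < t → ‖(0 : Vec m)‖ + η < t := fun ht => by simpa using ht
  have hΩ : ∀ {ζ : ℂ}, ζ ∈ D → {x : Vec m | (ζ, x) ∈ D ×ˢ ball (0 : Vec m) R} =
      ball 0 R := fun hζ => by ext x; simp [hζ]
  have hEs : ∀ ζ ∈ D, ContDiffOn ℂ ω (fun x => E (ζ, x))
      {x : Vec m | (ζ, x) ∈ D ×ˢ ball (0 : Vec m) R} := fun ζ hζ =>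
    hE.comp (contDiff_prodMk_right ζ).contDiffOn fun x hx => hx
  have hin : ∀ ζ ∈ D', ∀ x, pgrad f (ζ, x) = 0 → x ∈ closedBall a d →
      x ∈ ball a (d / 2) := fun ζ hζ x hx0 hx => by
    by_contra hx2
    exact (hδs ζ hζ).1.1.1 x ⟨hx, hx2⟩ hx0
  have hE1 : ∀ ζ ∈ D', ∀ x, pgrad f (ζ, x) = 0 → x ∈ closedBall a d → E (ζ, x) = 1 :=
    fun ζ hζ x hx0 hx => ((hδs ζ hζ).1.1.2 x (hRR₁ (hdsub hx).1) hx0).1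
      (hχin x (hin ζ hζ x hx0 hx))
  have hE0 : ∀ ζ ∈ D', ∀ x ∈ ball 0 R, pgrad f (ζ, x) = 0 → x ∉ closedBall a d →
      E (ζ, x) = 0 := fun ζ hζ x hxR hx0 hx => ((hδs ζ hζ).1.1.2 x hxR hx0).2 (hχout x hx)
  set n : (Vec m → ℝ) → ℂ := fun χ => mass (fun x => pgrad f (1, x)) χ (kap η 0) 1 with hn
  have hnA : 1 ≤ (n χ).re := (hA.isoZ h1').one_le_mass_zero
    (hχin a (mem_ball_self (half_pos hd))) ha0 hη0 hη1
  have hbd : b ∉ closedBall a d := fun hbd => (hdsub hbd).2 ⟨⟨hb, hb0⟩, Ne.symm hab⟩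
  have hnB : 1 ≤ (n fun x => β x - χ x).re := (hB.isoZ h1').one_le_mass_zero (by
    filter_upwards [hχout b hbd, isOpen_ball.mem_nhds (hz h1 hb hb0)] with y hy1 hy2
    rw [hy1, hβ1 y hy2, sub_zero]) hb0 hη0 hη1
  have hsplit : ∀ ζ ∈ D', ∀ φ : Vec m → ℂ, ContDiffOn ℂ ω φ
      {x : Vec m | (ζ, x) ∈ D ×ˢ ball (0 : Vec m) R} →
      mass (fun x => pgrad f (ζ, x)) β (kap η 0) φ = mass (fun x => pgrad f (ζ, x)) χ (kap η 0) φ +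
        mass (fun x => pgrad f (ζ, x)) (fun x => β x - χ x) (kap η 0) φ := fun ζ hζ φ hφ => by
    rw [← (hA.isoZ hζ).mass_eq_add (hB.isoZ hζ) (continuous_kap η 0) hφ.continuousOn]
    simp only [add_sub_cancel]
  have hME : ∀ ζ ∈ D', mass (fun x => pgrad f (ζ, x)) β (kap η 0) (fun x => E (ζ, x)) = n χ := by
    intro ζ hζ
    rw [hsplit ζ hζ _ (hEs ζ (hD'D hζ)), (hA.isoZ hζ).mass_congr hη0 (hn0 hη1) (ψ := 1)
      (hEs ζ (hD'D hζ)) contDiffOn_const (fun x hx hx0 => hE1 ζ hζ x hx0 (hχts ▸ hx)),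
      (hB.isoZ hζ).mass_eq_zero hη0 (hn0 hη1) (hEs ζ (hD'D hζ)), add_zero]
    · exact hA.mass_eq isOpen_ball (convex_ball _ _).isPreconnected hζ h1' hη0 (hn0 hη1) hη0
        (hn0 hη1)
    · intro x hx hx0
      refine hE0 ζ hζ x (hBts hx) hx0 fun hxd => ?_
      refine notMem_tsupport_iff_eventuallyEq.2 ?_ hx
      filter_upwards [hχin x (hin ζ hζ x hx0 hxd), isOpen_ball.mem_nhds (hdsub hxd).1]
        with y hy1 hy2
      rw [hy1, hβ1 y hy2, sub_self, Pi.zero_apply]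
  have hMQ : ∀ ζ ∈ D', mass (fun x => pgrad f (ζ, x)) β (kap η 0)
      (fun x => E (ζ, x) * E (ζ, x) - E (ζ, x)) = 0 := by
    intro ζ hζ
    have hs := hEs ζ (hD'D hζ)
    refine (hH.isoZ (hD'D hζ)).mass_eq_zero hη0 (hn0 hη2) ((hs.mul hs).sub hs) fun x hx hx0 => ?_
    by_cases hxd : x ∈ closedBall a d
    · rw [hE1 ζ hζ x hx0 hxd]; ring
    · rw [hE0 ζ hζ x (hβR hx) hx0 hxd]; ring
  have hev1 : ∀ᶠ ζ in 𝓝 (1 : ℂ), ζ ∈ D' := ball_mem_nhds 1 hδ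
  have hME' := (hH.analyticOnNhd_mass h.isOpen hE hη0 hη2).eqOn_of_preconnected_of_eventuallyEq
    (g := fun _ => n χ) analyticOnNhd_const h.conn h1 (hev1.mono hME) h0
  have hMQ' := (hH.analyticOnNhd_mass h.isOpen ((hE.mul hE).sub hE) hη0
    hη2).eqOn_of_preconnected_of_eventuallyEq (g := fun _ => 0) analyticOnNhd_const h.conn h1
      (hev1.mono hMQ) h0
  have hu0 : ∀ x ∈ tsupport β, pgrad f (0, x) = 0 → x = w₀ := fun x hx => huniq x (hβR hx)
  have hs := hEs 0 h0
  simp only [] at hME' hMQ'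
  rw [(hH.isoZ h0).mass_of_unique_zero hη0 (hn0 hη2) hs hu0] at hME'
  rw [(hH.isoZ h0).mass_of_unique_zero hη0 (hn0 hη2) ((hs.mul hs).sub hs) hu0] at hMQ'
  have hN : mass (fun x => pgrad f (0, x)) β (kap η 0) 1 = n χ + n fun x => β x - χ x := by
    rw [hH.mass_eq h.isOpen h.conn h0 h1 hη0 (hn0 hη2) hη0 (hn0 hη2),
      hsplit 1 h1' 1 contDiffOn_const]
  rw [hN] at hME' hMQ'
  have hE01 : E (0, w₀) = 0 ∨ E (0, w₀) = 1 := by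
    rcases mul_eq_zero.1 hMQ' with h3 | h3
    · have : E (0, w₀) * (E (0, w₀) - 1) = 0 := by linear_combination h3
      exact (mul_eq_zero.1 this).imp id sub_eq_zero.1
    · have := congrArg Complex.re h3
      rw [Complex.add_re, Complex.zero_re] at this
      linarith
  rcases hE01 with h3 | h3 <;> rw [h3] at hME' <;> have := congrArg Complex.re hME' <;>
    simp at this <;> linarith

end UniqueZero

section Setups

variable {m : ℕ} {E : Type*} [NormedAddCommGroup E] [NormedSpace ℂ E]

/-- The partial derivatives in the fibre variable. -/
noncomputable def xgrad (f : E × Vec m → ℂ) (p : E × Vec m) (k : Fin m) : ℂ :=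
  fderiv ℂ f p (0, Pi.single k 1)

/-- The restriction of a family to a line in the parameter space. -/
def lineFam (f : E × Vec m → ℂ) (t v : E) (p : ℂ × Vec m) : ℂ :=
  f (t + p.1 • v, p.2)

/-- A family over a ball whose fibrewise critical points are critical points, stay away from the
outer shell, and reduce to the origin over the origin. -/
structure Setup (f : E × Vec m → ℂ) (τ R₁ R r : ℝ) : Prop where
  pos : 0 < r
  posτ : 0 < τ
  pos₁ : 0 < R₁
  lt : R₁ < R
  holo : ContDiffOn ℂ ω f (ball 0 τ ×ˢ ball 0 R)
  shell : ∀ t ∈ ball (0 : E) τ, ∀ x : Vec m, R₁ ≤ ‖x‖ → ‖x‖ < R → r ≤ ‖xgrad f (t, x)‖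
  crit : ∀ t ∈ ball (0 : E) τ, ∀ x ∈ ball (0 : Vec m) R,
    xgrad f (t, x) = 0 → fderiv ℂ f (t, x) = 0
  uniq : ∀ x ∈ ball (0 : Vec m) R, xgrad f (0, x) = 0 → x = 0
  zero : xgrad f 0 = 0

variable {f : E × Vec m → ℂ} {τ R₁ R r : ℝ}

theorem fderiv_lineFam {t v : E} {ζ : ℂ} {x : Vec m}
    (hf : DifferentiableAt ℂ f (t + ζ • v, x)) (w : ℂ × Vec m) :
    fderiv ℂ (lineFam f t v) (ζ, x) w = fderiv ℂ f (t + ζ • v, x) (w.1 • v, w.2) := by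
  have h1 : HasFDerivAt (fun p : ℂ × Vec m => (t + p.1 • v, p.2))
      (((fst ℂ ℂ Vec m).smulRight v).prod
        (snd ℂ ℂ Vec m)) (ζ, x) :=
    (((fst ℂ ℂ Vec m).smulRight v).hasFDerivAt.const_add t).prodMk
      (snd ℂ ℂ Vec m).hasFDerivAt
  have h2 := HasFDerivAt.comp (g := f) (f := fun p : ℂ × Vec m => (t + p.1 • v, p.2))
    (ζ, x) hf.hasFDerivAt h1
  have h3 : lineFam f t v = f ∘ fun p : ℂ × Vec m => (t + p.1 • v, p.2) := rfl
  rw [h3, h2.fderiv]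
  simp

theorem pgrad_lineFam {t v : E} {ζ : ℂ} {x : Vec m}
    (hf : DifferentiableAt ℂ f (t + ζ • v, x)) :
    pgrad (lineFam f t v) (ζ, x) = xgrad f (t + ζ • v, x) := by
  ext k
  simp [pgrad, xgrad, fderiv_lineFam hf]

theorem Setup.isOpen_prod (_ : Setup f τ R₁ R r) :
    IsOpen (ball (0 : E) τ ×ˢ ball (0 : Vec m) R) :=
  isOpen_ball.prod isOpen_ball

theorem Setup.differentiableAt (h : Setup f τ R₁ R r) {t : E} (ht : t ∈ ball 0 τ)
    {x : Vec m} (hx : x ∈ ball 0 R) : DifferentiableAt ℂ f (t, x) :=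
  (h.holo.contDiffAt (h.isOpen_prod.mem_nhds ⟨ht, hx⟩)).differentiableAt (by simp)

theorem Setup.mono (h : Setup f τ R₁ R r) {τ' : ℝ} (h0 : 0 < τ') (h1 : τ' ≤ τ) :
    Setup f τ' R₁ R r where
  pos := h.pos
  posτ := h0
  pos₁ := h.pos₁
  lt := h.lt
  holo := h.holo.mono (prod_mono_left (ball_subset_ball h1))
  shell t ht := h.shell t (ball_subset_ball h1 ht)
  crit t ht := h.crit t (ball_subset_ball h1 ht)
  uniq := h.uniq
  zero := h.zero

/-- The parameters for which the line stays in the ball. -/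
def lineDom (τ : ℝ) (t v : E) : Set ℂ := {ζ | t + ζ • v ∈ ball (0 : E) τ}

theorem isOpen_lineDom (τ : ℝ) (t v : E) : IsOpen (lineDom τ t v) :=
  isOpen_ball.preimage (by fun_prop)

theorem convex_lineDom (τ : ℝ) (t v : E) : Convex ℝ (lineDom τ t v) := by
  let _ : NormedSpace ℝ E := NormedSpace.restrictScalars ℝ ℂ E
  intro a ha b hb c d hc hd hcd
  have := convex_ball (0 : E) τ ha hb hc hd hcd
  show t + (c • a + d • b) • v ∈ ball (0 : E) τ
  convert this using 1
  have e : t = c • t + d • t := by rw [← add_smul, hcd, one_smul]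
  conv_lhs => rw [e]
  have e1 : ∀ (u : ℝ) (z : ℂ), (u • z) • v = u • (z • v) := fun u z => by
    show _ = (u : ℂ) • (z • v)
    rw [smul_smul]; rfl
  rw [add_smul, e1, e1, smul_add, smul_add]
  abel

theorem Setup.shellFam (h : Setup f τ R₁ R r) (t v : E) :
    ShellFam (lineDom τ t v) R₁ R r (lineFam f t v) where
  isOpen := isOpen_lineDom τ t v
  conn := (convex_lineDom τ t v).isPreconnected
  pos := h.pos
  pos₁ := h.pos₁
  lt := h.lt
  holo := h.holo.comp (t := ball (0 : E) τ ×ˢ ball (0 : Vec m) R)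
    (f := fun p : ℂ × Vec m => (t + p.1 • v, p.2))
    (by fun_prop) fun p hp => ⟨hp.1, hp.2⟩
  shell ζ hζ x hx hx' := by
    rw [pgrad_lineFam (h.differentiableAt hζ (by simpa using hx'))]
    exact h.shell _ hζ x hx hx'

theorem Setup.zero_mem (h : Setup f τ R₁ R r) : (0 : E) ∈ ball (0 : E) τ := by
  simpa using h.posτ

theorem Setup.zero_mem_ball (h : Setup f τ R₁ R r) :
    (0 : Vec m) ∈ ball (0 : Vec m) R := by
  simpa using h.pos₁.trans h.lt

theorem Setup.norm_lt (h : Setup f τ R₁ R r) {t : E} (ht : t ∈ ball 0 τ)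
    {x : Vec m} (hx : x ∈ ball 0 R) (h0 : xgrad f (t, x) = 0) : ‖x‖ < R₁ := by
  by_contra! hc
  have := h.shell t ht x hc (by simpa using hx)
  rw [h0, norm_zero] at this
  linarith [h.pos]

theorem eventually_cutoff_eq_one {χ : Vec m → ℝ} (h1 : ∀ x ∈ ball 0 R₁, χ x = 1)
    {p : Vec m} (hp : ‖p‖ < R₁) : ∀ᶠ x in 𝓝 p, χ x = 1 := by
  filter_upwards [isOpen_ball.mem_nhds (show p ∈ ball 0 R₁ by simpa using hp)]
    using h1

/-- On a member of a one-parameter family, the gradient map has nonzero Jacobian at points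
arbitrarily near any given point, as soon as it has a zero. -/
theorem Setup.frequently_sdet_ne_zero (h : Setup f τ R₁ R r) {t v : E} {ζ : ℂ}
    (hζ : ζ ∈ lineDom τ t v) {w : Vec m} (hw : w ∈ ball 0 R)
    (h0 : xgrad f (t + ζ • v, w) = 0) {p : Vec m} (hp : p ∈ ball 0 R) :
    ∃ᶠ x in 𝓝 p, sdet (fun x => pgrad (lineFam f t v) (ζ, x)) x ≠ 0 := by
  obtain ⟨χ, hχ, hs, hn, h1, hR⟩ := exists_cutoff_ball (m := m) h.pos₁ h.lt
  have hH := (h.shellFam t v).hamFam (hχ.of_le (by norm_num)) hs hn h1 hR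
  have e : {x : Vec m | (ζ, x) ∈ lineDom τ t v ×ˢ ball (0 : Vec m) R} =
      ball 0 R := by
    ext x; simp [hζ]
  have hI := hH.isoZ hζ
  rw [e] at hI
  exact hI.frequently_sdet_ne_zero (convex_ball 0 R).isPreconnected
    (eventually_cutoff_eq_one h1 (h.norm_lt hζ hw h0))
    (by rw [pgrad_lineFam (h.differentiableAt hζ hw), h0]) hp

theorem Setup.value_eq (h : Setup f τ R₁ R r) {t : E} (ht : t ∈ ball 0 τ)
    {x : Vec m} (hx : x ∈ ball 0 R) (h0 : xgrad f (t, x) = 0) : f (t, x) = f 0 := by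
  obtain ⟨χ, hχ, hs, hn, h1, hR⟩ := exists_cutoff_ball (m := m) h.pos₁ h.lt
  have hH := (h.shellFam 0 t).hamFam (hχ.of_le (by norm_num)) hs hn h1 hR
  have hseg : ∀ s ∈ Icc (0 : ℝ) 1, s • (1 : ℂ) ∈ lineDom τ 0 t := by
    intro s hs
    show _ ∈ ball _ _
    rw [mem_ball_zero_iff] at ht ⊢
    rw [zero_add, norm_smul, real_smul, mul_one, norm_real, Real.norm_eq_abs,
      abs_of_nonneg hs.1]
    nlinarith [hs.1, hs.2, norm_nonneg t]
  have h1D : (1 : ℂ) ∈ lineDom τ 0 t := by simpa using hseg 1 (by simp)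
  have e1 : (0 : E) + (1 : ℂ) • t = t := by simp
  have hd : DifferentiableAt ℂ f (0 + (1 : ℂ) • t, x) := by
    rw [e1]; exact h.differentiableAt ht hx
  have key := hH.critical_value_eq (isOpen_lineDom _ _ _) (convex_lineDom _ _ _).isPreconnected
    hseg (fun s hs y hy hz => ?_) (a := f 0) (fun y hy hz => ?_) (p := x)
    (eventually_cutoff_eq_one h1 (h.norm_lt ht hx h0)) ?_ ?_
  · simpa [lineFam] using key
  · have hD := hseg s hs
    have hdy := h.differentiableAt hD (hR hy)
    rw [pgrad_lineFam hdy] at hz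
    rw [fderiv_lineFam hdy, h.crit _ hD y (hR hy) hz]
    rfl
  · have hdy : DifferentiableAt ℂ f (0 + (0 : ℂ) • t, y) := by
      simpa using h.differentiableAt h.zero_mem (hR hy)
    rw [pgrad_lineFam hdy] at hz
    have := h.uniq y (hR hy) (by simpa using hz)
    subst this
    simp only [lineFam, zero_smul, add_zero]
    rfl
  · rw [pgrad_lineFam hd, e1, h0]
  · exact h.frequently_sdet_ne_zero h1D hx (by rw [e1, h0]) hx

theorem xgrad_eq_comp (f : E × Vec m → ℂ) (p : E × Vec m) :
    xgrad f p = ContinuousLinearMap.pi (fun k : Fin m =>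
      ContinuousLinearMap.apply ℂ ℂ ((0, Pi.single k 1) : E × Vec m)) (fderiv ℂ f p) := by
  ext k; rfl

theorem continuousAt_xgrad {p : E × Vec m} (hf : AnalyticAt ℂ f p) :
    ContinuousAt (xgrad f) p := by
  have : xgrad f = fun p => _ := funext (xgrad_eq_comp f)
  rw [this]
  exact (ContinuousLinearMap.continuous _).continuousAt.comp hf.fderiv.continuousAt

theorem exists_setup (h1 : ∀ᶠ z in 𝓝 (0 : E × Vec m), AnalyticAt ℂ f z)
    (h2 : ∀ᶠ x in 𝓝 (0 : Vec m), xgrad f (0, x) = 0 → x = 0)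
    (h3 : ∀ᶠ z in 𝓝 (0 : E × Vec m), xgrad f z = 0 → fderiv ℂ f z = 0)
    (h4 : xgrad f 0 = 0) {ρ : ℝ} (hρ : 0 < ρ) :
    ∃ τ R₁ R r, τ < ρ ∧ R < ρ ∧ Setup f τ R₁ R r := by
  obtain ⟨ε, hε, H⟩ := Metric.eventually_nhds_iff.1 (h1.and h3)
  obtain ⟨δ, hδ, H2⟩ := Metric.eventually_nhds_iff.1 h2
  have H' : ∀ (t : E) (x : Vec m), ‖t‖ < ε → ‖x‖ < ε →
      AnalyticAt ℂ f (t, x) ∧ (xgrad f (t, x) = 0 → fderiv ℂ f (t, x) = 0) := by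
    intro t x ht hx
    refine H ?_
    rw [dist_zero_right]
    exact max_lt ht hx
  set R := min (min ε δ) ρ / 2 with hRdef
  have hm : 0 < min (min ε δ) ρ := lt_min (lt_min hε hδ) hρ
  have hR0 : 0 < R := by positivity
  have hRm : R < min (min ε δ) ρ := by rw [hRdef]; linarith
  have hRε : R < ε := hRm.trans_le ((min_le_left _ _).trans (min_le_left _ _))
  have hRδ : R < δ := hRm.trans_le ((min_le_left _ _).trans (min_le_right _ _))
  have hRρ : R < ρ := hRm.trans_le (min_le_right _ _)
  let K : Set Vec m := closedBall 0 R \ ball 0 (R / 2)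
  have hK : IsCompact K := (isCompact_closedBall 0 R).diff isOpen_ball
  have hKn : ∀ x ∈ K, R / 2 ≤ ‖x‖ ∧ ‖x‖ ≤ R := fun x hx => by
    simpa [K, and_comm] using hx
  obtain ⟨a, ha, hmin⟩ := hK.exists_forall_le' (f := fun x => ‖xgrad f (0, x)‖) (a := 0)
    (fun x hx => by
      have h0 : ContinuousAt (xgrad f) ((0 : E), x) :=
        continuousAt_xgrad (H' 0 x (by simpa using hε) ((hKn x hx).2.trans_lt hRε)).1
      exact (ContinuousAt.comp (f := fun x : Vec m => ((0 : E), x)) (g := xgrad f) h0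
        (by fun_prop)).norm.continuousWithinAt)
    (fun x hx => by
      have := hKn x hx
      refine norm_pos_iff.2 fun h0 => ?_
      have := H2 (by rw [dist_zero_right]; linarith) h0
      subst this
      rw [norm_zero] at this
      linarith)
  have hev : ∀ᶠ t in 𝓝 (0 : E), ∀ x ∈ K, a / 2 ≤ ‖xgrad f (t, x)‖ := by
    refine hK.eventually_forall_of_forall_eventually fun x hx => ?_
    have h0 : ContinuousAt (xgrad f) ((0 : E), x) :=
      continuousAt_xgrad (H' 0 x (by simpa using hε) ((hKn x hx).2.trans_lt hRε)).1
    have : ∀ᶠ p in 𝓝 ((0 : E), x), a / 2 < ‖xgrad f p‖ :=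
      h0.norm.eventually_const_lt (by have := hmin x hx; linarith)
    exact this.mono fun p hp => hp.le
  obtain ⟨τ₀, hτ₀, H3⟩ := Metric.eventually_nhds_iff.1 hev
  have hmτ : 0 < min (min ε τ₀) ρ := lt_min (lt_min hε hτ₀) hρ
  set τ := min (min ε τ₀) ρ / 2 with hτdef
  have hτm : τ < min (min ε τ₀) ρ := by rw [hτdef]; linarith
  have hτε : τ < ε := hτm.trans_le ((min_le_left _ _).trans (min_le_left _ _))
  have hττ : τ < τ₀ := hτm.trans_le ((min_le_left _ _).trans (min_le_right _ _))
  refine ⟨τ, R / 2, R, a / 2, hτm.trans_le (min_le_right _ _), hRρ, ⟨by positivity, by positivity,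
    by positivity, by linarith, fun p hp => ?_, fun t ht x hx hx' => ?_, fun t ht x hx => ?_,
    fun x hx => ?_, h4⟩⟩
  · have hp1 := mem_ball_zero_iff.1 hp.1
    have hp2 := mem_ball_zero_iff.1 hp.2
    exact (H' p.1 p.2 (by linarith) (by linarith)).1.contDiffAt.contDiffWithinAt
  · rw [mem_ball_zero_iff] at ht
    refine H3 (by rw [dist_zero_right]; linarith) x ?_
    simp only [K, Set.mem_sdiff, mem_closedBall_zero_iff, mem_ball_zero_iff, not_lt]
    exact ⟨hx'.le, hx⟩
  · rw [mem_ball_zero_iff] at ht hx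
    exact (H' t x (by linarith) (by linarith)).2
  · rw [mem_ball_zero_iff] at hx
    exact H2 (by rw [dist_zero_right]; linarith)

end Setups

section UniqueCritical

variable {m : ℕ} {E : Type*} [NormedAddCommGroup E] [NormedSpace ℂ E]
  {f : E × Vec m → ℂ} {τ R₁ R r : ℝ}

theorem Setup.zero_mem_lineDom (h : Setup f τ R₁ R r) (t : E) : (0 : ℂ) ∈ lineDom τ 0 t := by
  simpa [lineDom] using h.posτ

theorem one_mem_lineDom {t : E} (ht : t ∈ ball 0 τ) : (1 : ℂ) ∈ lineDom τ 0 t := by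
  simpa [lineDom] using ht

theorem Setup.pgrad_one (h : Setup f τ R₁ R r) {t : E} (ht : t ∈ ball 0 τ)
    {x : Vec m} (hx : x ∈ ball 0 R) :
    pgrad (lineFam f 0 t) (1, x) = xgrad f (t, x) := by
  have e1 : (0 : E) + (1 : ℂ) • t = t := by simp
  rw [pgrad_lineFam (by rw [e1]; exact h.differentiableAt ht hx), e1]

theorem Setup.pgrad_zero (h : Setup f τ R₁ R r) (t : E)
    {x : Vec m} (hx : x ∈ ball 0 R) :
    pgrad (lineFam f 0 t) (0, x) = xgrad f (0, x) := by
  have e1 : (0 : E) + (0 : ℂ) • t = 0 := by simp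
  rw [pgrad_lineFam (by rw [e1]; exact h.differentiableAt h.zero_mem hx), e1]

theorem Setup.exists_zero (h : Setup f τ R₁ R r) {t : E} (ht : t ∈ ball 0 τ) :
    ∃ x ∈ ball 0 R, xgrad f (t, x) = 0 := by
  by_contra! hc
  obtain ⟨χ, hχ, hs, hn, h1, hR⟩ := exists_cutoff_ball (m := m) h.pos₁ h.lt
  have hH := (h.shellFam 0 t).hamFam (hχ.of_le (by norm_num)) hs hn h1 hR
  have hD0 := h.zero_mem_lineDom t
  have hD1 := one_mem_lineDom ht
  have hr := h.pos
  have e := hH.mass_eq (isOpen_lineDom _ _ _) (convex_lineDom _ _ _).isPreconnected hD0 hD1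
    (η := r / 2) (η' := r / 2) (c := 0) (c' := 0) (by linarith) (by rw [norm_zero]; linarith)
    (by linarith) (by rw [norm_zero]; linarith)
  have e0 := (hH.isoZ hD0).one_le_mass_zero (w := 0)
    (eventually_cutoff_eq_one h1 (by simpa using h.pos₁))
    (by simp only [h.pgrad_zero t h.zero_mem_ball]; exact h.zero)
    (η := r / 2) (by linarith) (by linarith)
  have e1 := (hH.isoZ hD1).mass_eq_zero (c := 0) (η := r / 2) (by linarith)
    (by rw [norm_zero]; linarith) (φ := 1) contDiffOn_const
    (fun x hx hz => absurd hz (by rw [h.pgrad_one ht (hR hx)]; exact hc x (hR hx)))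
  rw [e, e1] at e0
  norm_num at e0

theorem Setup.exists_unique_zero (h : Setup f τ R₁ R r) (hm : 1 ≤ m) :
    ∃ τ', 0 < τ' ∧ τ' ≤ τ ∧ ∀ t ∈ ball (0 : E) τ',
      ∀ x ∈ ball (0 : Vec m) R, ∀ y ∈ ball (0 : Vec m) R,
        xgrad f (t, x) = 0 → xgrad f (t, y) = 0 → x = y := by
  have hr := h.pos
  have hlt := h.lt
  set R₂ := (R₁ + R) / 2 with hR₂
  set l := (R₂ - R₁) * r / 16 with hl
  have hl0 : 0 < l := by
    have : 0 < R₂ - R₁ := by rw [hR₂]; linarith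
    positivity
  have hR₂R : R₂ < R := by rw [hR₂]; linarith
  have hsmall : R₁ + 8 * l / r < R₂ := by
    have : 8 * l / r = (R₂ - R₁) / 2 := by rw [hl]; field_simp; ring
    rw [this, hR₂]; linarith
  have hball : ∀ x : Vec m, ‖x‖ ≤ R₂ → x ∈ ball 0 R := fun x hx => by
    rw [mem_ball_zero_iff]; linarith
  have hev : ∀ᶠ t in 𝓝 (0 : E), ∀ x ∈ closedBall (0 : Vec m) R₂,
      ‖f (t, x) - f (0, x)‖ < l / 8 := by
    refine (isCompact_closedBall _ _).eventually_forall_of_forall_eventually fun x hx => ?_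
    have hx' := hball x (by simpa using hx)
    have h1 : ContinuousAt f ((0 : E), x) := (h.differentiableAt h.zero_mem hx').continuousAt
    have h2 : ContinuousAt (fun p : E × Vec m => ‖f (p.1, p.2) - f (0, p.2)‖) ((0 : E), x) :=
      (ContinuousAt.sub h1 (ContinuousAt.comp (g := f)
        (f := fun p : E × Vec m => ((0 : E), p.2)) h1 (by fun_prop))).norm
    exact h2.eventually_lt_const (by simp; linarith)
  obtain ⟨δ, hδ, H⟩ := Metric.eventually_nhds_iff.1 hev
  have hδτ : 0 < min δ τ := lt_min hδ h.posτ
  refine ⟨min δ τ, hδτ, min_le_right _ _, fun t ht x hx y hy hx0 hy0 => ?_⟩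
  have h' := h.mono hδτ (min_le_right _ _)
  have H' : ∀ t ∈ ball (0 : E) (min δ τ), ∀ x : Vec m, ‖x‖ ≤ R₂ →
      ‖f (t, x) - f (0, x)‖ < l / 8 := fun t ht x hx =>
    H (by rw [dist_zero_right]; exact (mem_ball_zero_iff.1 ht).trans_le (min_le_left _ _)) x
      (by simpa using hx)
  refine (h'.shellFam 0 t).unique_zero hm (h'.zero_mem_lineDom t) (one_mem_lineDom ht) (w₀ := 0)
    (fun x hx hz => h.uniq x hx (by rwa [h'.pgrad_zero t hx] at hz)) hR₂R hl0 hsmall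
    (fun x y hx hy hx0 hy0 => ?_) (fun ζ hζ x hx => ?_) hx
    (by rw [h'.pgrad_one ht hx, hx0]) hy (by rw [h'.pgrad_one ht hy, hy0])
  · rw [h'.pgrad_one ht (hball x hx)] at hx0
    rw [h'.pgrad_one ht (hball y hy)] at hy0
    have := (h'.value_eq ht (hball x hx) hx0).trans (h'.value_eq ht (hball y hy) hy0).symm
    simpa [lineFam] using this
  · have a1 := H' _ hζ x hx
    have a2 := H' t ht x hx
    have e : lineFam f 0 t (ζ, x) - lineFam f 0 t (1, x) =
        (f (0 + ζ • t, x) - f (0, x)) - (f (t, x) - f (0, x)) := by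
      simp [lineFam]
    rw [e]
    exact (norm_sub_le _ _).trans (by linarith)

end UniqueCritical

section CriticalSection

variable {m : ℕ} {E : Type} [NormedAddCommGroup E] [NormedSpace ℂ E]
  {f : E × Vec m → ℂ} {τ R₁ R r : ℝ} {χ : Vec m → ℝ}

theorem contDiffOn_xgrad {O : Set (E × Vec m)} (hO : IsOpen O) (hf : ContDiffOn ℂ ω f O) :
    ContDiffOn ℂ ω (xgrad f) O :=
  contDiffOn_pi.2 fun _ => contDiffOn_fderiv_apply hO hf _

/-- The fibrewise Hessian determinant. -/
noncomputable def xhess (f : E × Vec m → ℂ) (p : E × Vec m) : ℂ :=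
  (Matrix.of fun i k => fderiv ℂ (xgrad f) p (0, Pi.single k 1) i).det

theorem contDiffOn_xhess {O : Set (E × Vec m)} (hO : IsOpen O) (hf : ContDiffOn ℂ ω f O) :
    ContDiffOn ℂ ω (xhess f) O :=
  contDiffOn_det_of_entries fun i k => contDiffOn_pi.1
    (contDiffOn_fderiv_apply hO (contDiffOn_xgrad hO hf) (0, Pi.single k 1)) i

theorem Setup.sdet_xgrad (h : Setup f τ R₁ R r) {t : E} (ht : t ∈ ball 0 τ)
    {x : Vec m} (hx : x ∈ ball 0 R) :
    sdet (fun x => xgrad f (t, x)) x = xhess f (t, x) := by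
  have hd : DifferentiableAt ℂ (xgrad f) (t, x) :=
    ((contDiffOn_xgrad h.isOpen_prod h.holo).contDiffAt
      (h.isOpen_prod.mem_nhds ⟨ht, hx⟩)).differentiableAt (by simp)
  have := (HasFDerivAt.comp (g := xgrad f) (f := fun y : Vec m => (t, y)) x
    hd.hasFDerivAt (hasFDerivAt_prodMk_right t x)).fderiv
  simp only [Function.comp_def] at this
  unfold sdet xhess
  rw [this]
  simp

theorem mass_congr_map {G G' : Vec m → Vec m} {Ω : Set Vec m} (hΩ : IsOpen Ω)
    (hχ : tsupport χ ⊆ Ω) (h : ∀ x ∈ Ω, G x = G' x) (B : Vec m → ℝ)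
    (φ : Vec m → ℂ) : mass G χ B φ = mass G' χ B φ := by
  unfold mass
  congr 1
  ext x
  by_cases hx : x ∈ tsupport χ
  · have e : G =ᶠ[𝓝 x] G' := by
      filter_upwards [hΩ.mem_nhds (hχ hx)] with y hy using h y hy
    have : sdet G x = sdet G' x := by unfold sdet; rw [e.fderiv_eq]
    rw [this, h x (hχ hx)]
  · rw [image_eq_zero_of_notMem_tsupport hx]; simp

theorem Setup.mass_line (h : Setup f τ R₁ R r) (hR : tsupport χ ⊆ ball 0 R)
    {t v : E} {ζ : ℂ} (hζ : ζ ∈ lineDom τ t v) (B : Vec m → ℝ) (φ : Vec m → ℂ) :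
    mass (fun x => pgrad (lineFam f t v) (ζ, x)) χ B φ =
      mass (fun x => xgrad f (t + ζ • v, x)) χ B φ :=
  mass_congr_map isOpen_ball hR
    (fun _ hx => pgrad_lineFam (h.differentiableAt hζ hx)) B φ

/-- The integrand of the mass of a coordinate function. -/
noncomputable def massDens (f : E × Vec m → ℂ) (χ : Vec m → ℝ) (B : Vec m → ℝ)
    (φ : Vec m → ℂ) (p : E × Vec m) : ℂ :=
  φ p.2 * ((‖xhess f p‖ ^ 2 * (χ p.2 * B (xgrad f p)) : ℝ) : ℂ)

theorem Setup.contDiffOn_massDens (h : Setup f τ R₁ R r) (hχ : ContDiff ℝ 1 χ)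
    {B : Vec m → ℝ} (hB : ContDiff ℝ 1 B) {φ : Vec m → ℂ} (hφ : ContDiff ℝ 1 φ) :
    ContDiffOn ℝ 1 (massDens f χ B φ) (ball 0 τ ×ˢ ball 0 R) := by
  have h1 : ContDiffOn ℝ 1 (xhess f) (ball 0 τ ×ˢ ball 0 R) :=
    ((contDiffOn_xhess h.isOpen_prod h.holo).of_le (by simp)).restrict_scalars ℝ
  have h2 : ContDiffOn ℝ 1 (xgrad f) (ball 0 τ ×ˢ ball 0 R) :=
    ((contDiffOn_xgrad h.isOpen_prod h.holo).of_le (by simp)).restrict_scalars ℝ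
  refine ((hφ.comp contDiff_snd).contDiffOn).mul (ofRealCLM.contDiff.comp_contDiffOn ?_)
  exact (((contDiff_norm_sq ℝ).comp_contDiffOn h1).mul
    (((hχ.comp contDiff_snd).contDiffOn).mul (hB.comp_contDiffOn h2)))

theorem Setup.mass_eq_setIntegral (h : Setup f τ R₁ R r) (hR : tsupport χ ⊆ ball 0 R)
    {t : E} (ht : t ∈ ball 0 τ) (B : Vec m → ℝ) (φ : Vec m → ℂ) :
    mass (fun x => xgrad f (t, x)) χ B φ = ∫ x in tsupport χ, massDens f χ B φ (t, x) := by
  have : ∀ x ∉ tsupport χ, massDens f χ B φ (t, x) = 0 := fun x hx => by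
    simp [massDens, image_eq_zero_of_notMem_tsupport hx]
  rw [setIntegral_eq_integral_of_forall_compl_eq_zero this]
  unfold mass
  congr 1
  ext x
  by_cases hx : x ∈ tsupport χ
  · rw [h.sdet_xgrad ht (hR hx)]; rfl
  · rw [this x hx]
    simp [image_eq_zero_of_notMem_tsupport hx]

theorem hasFDerivAt_of_lines {g : E → ℂ} {t : E} {L : E →L[ℝ] ℂ} (hg : HasFDerivAt g L t)
    (hl : ∀ v : E, DifferentiableAt ℂ (fun ζ : ℂ => g (t + ζ • v)) 0) :
    DifferentiableAt ℂ g t := by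
  have key : ∀ (ζ : ℂ) (v : E), L (ζ • v) = ζ * L v := by
    intro ζ v
    have h1 := (hl v).hasFDerivAt.restrictScalars ℝ
    have h2 : HasFDerivAt (fun ζ : ℂ => t + ζ • v)
        ((((ContinuousLinearMap.id ℂ ℂ).smulRight v).restrictScalars ℝ)) (0 : ℂ) :=
      ((((ContinuousLinearMap.id ℂ ℂ).smulRight v).hasFDerivAt).restrictScalars ℝ).const_add t
    have h3 : HasFDerivAt g L (t + (0 : ℂ) • v) := by simpa using hg
    have h4 := HasFDerivAt.comp (g := g) (f := fun ζ : ℂ => t + ζ • v) (0 : ℂ) h3 h2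
    have h5 := h1.unique h4
    set c := fderiv ℂ (fun ζ : ℂ => g (t + ζ • v)) 0
    have h6 : ∀ z : ℂ, L (z • v) = c z := fun z => by
      have := congrArg (fun A : ℂ →L[ℝ] ℂ => A z) h5
      simpa using this.symm
    have h7 : L v = c 1 := by simpa using h6 1
    rw [h6, h7]
    have := c.map_smul ζ 1
    simpa using this
  have := hasFDerivAt_of_restrictScalars ℝ hg
    (f' := { toFun := L, map_add' := L.map_add, map_smul' := key, cont := L.cont }) (by ext; rfl)
  exact this.differentiableAt

theorem Setup.contDiffOn_mass (h : Setup f τ R₁ R r) (hχ : ContDiff ℝ 1 χ)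
    (hs : HasCompactSupport χ) (hn : ∀ x, 0 ≤ χ x) (h1 : ∀ x ∈ ball 0 R₁, χ x = 1)
    (hR : tsupport χ ⊆ ball 0 R) {φ : Vec m → ℂ} (hφ : ContDiff ℂ ω φ) {η : ℝ}
    (h0 : 0 < η) (hη : η < r) :
    ContDiffOn ℂ 1 (fun t => mass (fun x => xgrad f (t, x)) χ (kap η 0) φ)
      (ball 0 τ) := by
  have h3 : ∀ t ∈ ball (0 : E) τ, ContDiffAt ℝ 1
      (fun t => mass (fun x => xgrad f (t, x)) χ (kap η 0) φ) t := fun t ht =>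
    (setIntegral_param_of_contDiffOn (μ := (volume : Measure Vec m))
      (u := fun s x => massDens f χ (kap η 0) φ (s, x)) h.isOpen_prod hs (s₀ := t)
      (fun x hx => ⟨ht, hR hx⟩) (h.contDiffOn_massDens hχ (contDiff_kap η 0)
        ((hφ.of_le (by simp)).restrict_scalars ℝ))).2.congr_of_eventuallyEq (by
      filter_upwards [isOpen_ball.mem_nhds ht] with s hs using h.mass_eq_setIntegral hR hs _ _)
  refine ContDiffOn.complex_one_of_real isOpen_ball (fun t ht => (h3 t ht).contDiffWithinAt)
    fun t ht => DifferentiableAt.differentiableWithinAt ?_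
  refine hasFDerivAt_of_lines ((h3 t ht).differentiableAt one_ne_zero).hasFDerivAt fun v => ?_
  have hH := (h.shellFam t v).hamFam hχ hs hn h1 hR
  have h0D : (0 : ℂ) ∈ lineDom τ t v := by simpa [lineDom] using ht
  have h5 := hH.analyticOnNhd_mass (isOpen_lineDom _ _ _) (φ := fun p => φ p.2)
    (hφ.comp contDiff_snd).contDiffOn h0 hη 0 h0D
  refine h5.differentiableAt.congr_of_eventuallyEq ?_
  filter_upwards [(isOpen_lineDom τ t v).mem_nhds h0D] with ζ hζ
  exact (h.mass_line hR hζ _ _).symm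

theorem Setup.isoZ (h : Setup f τ R₁ R r) (hχ : ContDiff ℝ 1 χ)
    (hs : HasCompactSupport χ) (hn : ∀ x, 0 ≤ χ x) (h1 : ∀ x ∈ ball 0 R₁, χ x = 1)
    (hR : tsupport χ ⊆ ball 0 R) {t : E} (ht : t ∈ ball 0 τ) :
    IsoZ (ball 0 R) (fun x => xgrad f (t, x)) χ r := by
  have hH := (h.shellFam 0 t).hamFam hχ hs hn h1 hR
  refine ⟨isOpen_ball, ?_, hχ, hs, hn, hR, h.pos, fun x hx => ?_⟩
  · exact (contDiffOn_xgrad h.isOpen_prod h.holo).comp (contDiff_prodMk_right t).contDiffOn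
      fun x hx => ⟨ht, hx⟩
  · have := hH.sep 1 (one_mem_lineDom ht) x hx
    rwa [h.pgrad_one ht (hR hx)] at this

/-- The fibrewise critical point is unique and depends analytically on the parameter. -/
theorem Setup.exists_section [FiniteDimensional ℂ E] (h : Setup f τ R₁ R r) (hm : 1 ≤ m) :
    ∃ τ', 0 < τ' ∧ τ' ≤ τ ∧ ∃ φ : E → Vec m,
      AnalyticOnNhd ℂ φ (ball 0 τ') ∧ φ 0 = 0 ∧
      ∀ t ∈ ball (0 : E) τ', φ t ∈ ball 0 R ∧
        ∀ x ∈ ball (0 : Vec m) R, xgrad f (t, x) = 0 ↔ x = φ t := by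
  obtain ⟨τ', h0, hle, hu⟩ := h.exists_unique_zero hm
  have h' := h.mono h0 hle
  have hex : ∀ t : E, ∃ x : Vec m, t ∈ ball 0 τ' →
      x ∈ ball 0 R ∧ xgrad f (t, x) = 0 := by
    intro t
    by_cases ht : t ∈ ball 0 τ'
    · obtain ⟨x, hx, hx0⟩ := h'.exists_zero ht
      exact ⟨x, fun _ => ⟨hx, hx0⟩⟩
    · exact ⟨0, fun h => absurd h ht⟩
  choose φ hφ using hex
  refine ⟨τ', h0, hle, φ, ?_, ?_, fun t ht => ⟨(hφ t ht).1, fun x hx => ⟨fun hx0 =>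
    hu t ht x hx _ (hφ t ht).1 hx0 (hφ t ht).2, fun e => e ▸ (hφ t ht).2⟩⟩⟩
  swap
  · exact h.uniq _ (hφ 0 h'.zero_mem).1 (hφ 0 h'.zero_mem).2
  obtain ⟨χ, hχ, hs, hn, h1, hR⟩ := exists_cutoff_ball (m := m) h.pos₁ h.lt
  have hχ1 : ContDiff ℝ 1 χ := hχ.of_le (by norm_num)
  have hr := h.pos
  have hr2 : 0 < r / 2 := by linarith
  have hrr : ‖(0 : Vec m)‖ + r / 2 < r := by rw [norm_zero]; linarith
  set N := mass (fun x => xgrad f (0, x)) χ (kap (r / 2) 0) 1 with hN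
  have hI0 := h'.isoZ hχ1 hs hn h1 hR h'.zero_mem
  have hN0 : N ≠ 0 := by
    have := hI0.one_le_mass_zero (w := 0) (eventually_cutoff_eq_one h1 (by simpa using h.pos₁))
      h.zero hr2 (by linarith)
    intro hc
    rw [← hN, hc] at this
    norm_num at this
  have hform : ∀ t ∈ ball (0 : E) τ', ∀ j,
      φ t j = N⁻¹ * mass (fun x => xgrad f (t, x)) χ (kap (r / 2) 0) (fun x => x j) := by
    intro t ht j
    have hI := h'.isoZ hχ1 hs hn h1 hR ht
    have e1 := hI.mass_of_unique_zero (c := 0) hr2 hrr (φ := fun x => x j)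
      (contDiff_apply ℂ ℂ j).contDiffOn (p := φ t)
      (fun x hx hx0 => hu t ht x (hR hx) _ (hφ t ht).1 hx0 (hφ t ht).2)
    have hH := (h'.shellFam 0 t).hamFam hχ1 hs hn h1 hR
    have e2 := hH.mass_eq (isOpen_lineDom _ _ _) (convex_lineDom _ _ _).isPreconnected
      (one_mem_lineDom ht) (h'.zero_mem_lineDom t) (c := 0) (c' := 0) hr2 hrr hr2 hrr
    rw [h'.mass_line hR (one_mem_lineDom ht), h'.mass_line hR (h'.zero_mem_lineDom t)] at e2
    simp only [one_smul, zero_smul, zero_add] at e2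
    rw [e1, e2]
    field_simp
    rw [hN]
  refine ContDiffOn.analyticOnNhd_complex isOpen_ball (contDiffOn_pi.2 fun j => ?_)
  refine (contDiffOn_const (c := N⁻¹).mul (h'.contDiffOn_mass hχ1 hs hn h1 hR (φ := fun x => x j)
    (contDiff_apply ℂ ℂ j) hr2 (by linarith))).congr fun t ht => hform t ht j

end CriticalSection

section Tilt

variable {m : ℕ} {D : Set ℂ} {R₁ R r : ℝ} {g : ℂ × Vec m → ℂ} {χ : Vec m → ℝ}

/-- The linear form `x ↦ ∑ c k * x k`. -/
noncomputable def pairing (c : Vec m) : Vec m →L[ℂ] ℂ :=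
  ∑ k, c k • ContinuousLinearMap.proj k

theorem pairing_apply (c x : Vec m) : pairing c x = ∑ k, c k * x k := by
  simp [pairing]

theorem pairing_single (c : Vec m) (k : Fin m) : pairing c (Pi.single k 1) = c k := by
  simp [pairing_apply, Pi.single_apply]

theorem norm_pairing_le (c x : Vec m) : ‖pairing c x‖ ≤ m * (‖c‖ * ‖x‖) := by
  rw [pairing_apply]
  refine (norm_sum_le _ _).trans ?_
  have : ∀ k ∈ Finset.univ, ‖c k * x k‖ ≤ ‖c‖ * ‖x‖ := fun k _ => by
    rw [norm_mul]
    exact mul_le_mul (norm_le_pi_norm c k) (norm_le_pi_norm x k) (norm_nonneg _) (norm_nonneg _)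
  simpa using Finset.sum_le_sum this

/-- A function of the fibre variable tilted by a linear form. -/
noncomputable def tilt (g : ℂ × Vec m → ℂ) (ζ : ℂ) (c : Vec m)
    (p : ℂ × Vec m) : ℂ :=
  g (ζ, p.2) - p.1 * pairing c p.2

theorem fderiv_tilt {ζ : ℂ} {c : Vec m} {s : ℂ} {x : Vec m}
    (hg : DifferentiableAt ℂ g (ζ, x)) (w : ℂ × Vec m) :
    fderiv ℂ (tilt g ζ c) (s, x) w =
      fderiv ℂ g (ζ, x) (0, w.2) - (s * pairing c w.2 + w.1 * pairing c x) := by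
  have h1 : HasFDerivAt (fun p : ℂ × Vec m => (ζ, p.2))
      ((0 : ℂ × Vec m →L[ℂ] ℂ).prod (snd ℂ ℂ Vec m)) (s, x) :=
    (hasFDerivAt_const ζ _).prodMk (snd ℂ ℂ Vec m).hasFDerivAt
  have h2 := HasFDerivAt.comp (g := g) (f := fun p : ℂ × Vec m => (ζ, p.2))
    (s, x) hg.hasFDerivAt h1
  have h3 : HasFDerivAt (fun p : ℂ × Vec m => p.1 * pairing c p.2) _ (s, x) :=
    (fst ℂ ℂ Vec m).hasFDerivAt.mul
      (((pairing c).comp (snd ℂ ℂ Vec m)).hasFDerivAt)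
  have h4 := (h2.sub h3).fderiv
  have e : tilt g ζ c = (g ∘ fun p : ℂ × Vec m => (ζ, p.2)) -
      fun p : ℂ × Vec m => p.1 * pairing c p.2 := rfl
  rw [e, h4]
  simp [mul_comm]

theorem pgrad_tilt {ζ : ℂ} {c : Vec m} {s : ℂ} {x : Vec m}
    (hg : DifferentiableAt ℂ g (ζ, x)) :
    pgrad (tilt g ζ c) (s, x) = pgrad g (ζ, x) - s • c := by
  ext k
  simp [pgrad, fderiv_tilt hg, pairing_single]

theorem ham_tilt {ζ : ℂ} {c : Vec m} {s a : ℂ} {x : Vec m}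
    (hg : DifferentiableAt ℂ g (ζ, x)) : ham (tilt g ζ c) a (s, x) = ham g a (ζ, x) := by
  have : ∑ k, pgrad (tilt g ζ c) (s, x) k * x k =
      (∑ k, pgrad g (ζ, x) k * x k) - s * pairing c x := by
    rw [pairing_apply, Finset.mul_sum, ← Finset.sum_sub_distrib, pgrad_tilt hg]
    refine Finset.sum_congr rfl fun k _ => ?_
    simp only [Pi.sub_apply, Pi.smul_apply, smul_eq_mul]
    ring
  simp only [ham, this, tilt]
  ring

theorem ShellFam.tilt (h : ShellFam D R₁ R r g) {ζ : ℂ} (hζ : ζ ∈ D) {c : Vec m}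
    (hc : ‖c‖ ≤ r / 4) : ShellFam (ball 0 2) R₁ R (r / 2) (tilt g ζ c) where
  isOpen := isOpen_ball
  conn := (convex_ball 0 2).isPreconnected
  pos := by have := h.pos; linarith
  pos₁ := h.pos₁
  lt := h.lt
  holo := by
    refine ContDiffOn.sub ?_ ?_
    · exact (h.slice hζ).comp (f := Prod.snd) contDiff_snd.contDiffOn fun p hp => hp.2
    · exact (contDiff_fst.mul ((pairing c).contDiff.comp contDiff_snd)).contDiffOn
  shell s hs x hx hx' := by
    rw [pgrad_tilt (h.differentiableAt hζ hx')]
    have h1 := h.shell ζ hζ x hx hx'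
    have h2 : ‖s • c‖ ≤ 2 * (r / 4) := by
      rw [norm_smul]
      exact mul_le_mul (mem_ball_zero_iff.1 hs).le hc (norm_nonneg _) (by norm_num)
    have := norm_sub_norm_le (pgrad g (ζ, x)) (s • c)
    linarith

theorem ShellFam.sdet_tilt (h : ShellFam D R₁ R r g) {ζ : ℂ} (hζ : ζ ∈ D) (c : Vec m)
    (s : ℂ) {x : Vec m} (hx : x ∈ ball 0 R) :
    sdet (fun x => pgrad (_root_.tilt g ζ c) (s, x)) x = sdet (fun x => pgrad g (ζ, x)) x := by
  have e : (fun x => pgrad (_root_.tilt g ζ c) (s, x)) =ᶠ[𝓝 x]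
      fun x => pgrad g (ζ, x) - s • c := by
    filter_upwards [isOpen_ball.mem_nhds hx] with y hy
    exact pgrad_tilt (h.differentiableAt hζ (by simpa using hy))
  unfold sdet
  rw [e.fderiv_eq, fderiv_sub_const]

theorem kap_zero_sub (η : ℝ) (c y : Vec m) : kap η 0 (y - c) = kap η c y := by
  simp [kap]

theorem ShellFam.sqrt_wsq_ham_le (h : ShellFam D R₁ R r g) (hχ : ContDiff ℝ 1 χ)
    (hs : HasCompactSupport χ) (hn : ∀ x, 0 ≤ χ x) (h1 : ∀ x ∈ ball 0 R₁, χ x = 1)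
    (hR : tsupport χ ⊆ ball 0 R) {ζ : ℂ} (hζ : ζ ∈ D) {c : Vec m}
    (hc : ‖c‖ ≤ r / 4) {η : ℝ} (h0 : 0 < η) (hη : η < r / 2) {δ e N : ℝ} {a : ℂ}
    (hδ : 0 ≤ δ) (he : 0 ≤ e)
    (hx : ∀ x ∈ ball 0 R, ‖pgrad g (ζ, x)‖ < ‖c‖ + η → ‖x‖ ≤ δ)
    (hh : ∀ x ∈ ball 0 R, ‖pgrad g (ζ, x)‖ < η → ‖ham g a (ζ, x)‖ ≤ e)
    (hN : (mass (fun x => pgrad g (ζ, x)) χ (kap η 0) 1).re ≤ N) :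
    √(wsq (pgrad g) χ (kap η c) (fun q => ham g a q * pdet (pgrad g) q) ζ) ≤
      e * √N + m * (‖c‖ * δ) * √N := by
  have hT := h.tilt hζ hc
  have hH := hT.hamFam hχ hs hn h1 hR
  have hHg := h.hamFam hχ hs hn h1 hR
  have hd : ∀ x ∈ tsupport χ, DifferentiableAt ℂ g (ζ, x) := fun x hx =>
    h.differentiableAt hζ (by simpa using hR hx)
  have hmem : ∀ s ∈ Icc (0 : ℝ) 1, s • (1 : ℂ) ∈ ball (0 : ℂ) 2 := fun s hs => by
    rw [mem_ball_zero_iff, real_smul, mul_one, norm_real, Real.norm_eq_abs,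
      abs_of_nonneg hs.1]
    linarith [hs.2]
  have hz : ‖(0 : Vec m)‖ + η < r / 2 := by rwa [norm_zero, zero_add]
  have hm0 : (0 : ℂ) ∈ ball (0 : ℂ) 2 := by simp
  have hmass : ∀ s ∈ ball (0 : ℂ) 2,
      wsq (pgrad (_root_.tilt g ζ c)) χ (kap η 0) (pdet (pgrad (_root_.tilt g ζ c))) s ≤ N := by
    intro s hs
    rw [hH.wsq_pdet _ hs, hH.mass_eq hT.isOpen hT.conn hs hm0 h0 hz h0 hz,
      mass_congr_map isOpen_ball hR (G' := fun x => pgrad g (ζ, x)) (fun x hx => ?_)]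
    · exact hN
    · rw [pgrad_tilt (h.differentiableAt hζ (by simpa using hx)), zero_smul, sub_zero]
  have key := (hH.fam η 0).sqrt_wsq_le (contDiffOn_ham hT.isOpen_prod hT.holo a)
    (ψ := fun p => fderiv ℂ (_root_.tilt g ζ c) p (1, 0))
    (contDiffOn_fderiv_apply hT.isOpen_prod hT.holo _)
    (fun p hp => flow_ham hT.isOpen_prod hT.holo a hp) (ζ := 1) (M := m * (‖c‖ * δ)) (N := N)
    (by positivity) (fun s hs => hH.adm h0 hz (hmem s hs))
    (fun s hs x hxs hB => ?_) (fun s hs => hmass _ (hmem s hs))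
  · rw [norm_one, one_mul] at key
    have e1 : wsq (pgrad (_root_.tilt g ζ c)) χ (kap η 0)
        (fun q => ham (_root_.tilt g ζ c) a q * pdet (pgrad (_root_.tilt g ζ c)) q) 1 =
        wsq (pgrad g) χ (kap η c) (fun q => ham g a q * pdet (pgrad g) q) ζ := by
      rw [hH.wsq_eq_integral _ _ (by simp), hHg.wsq_eq_integral _ _ hζ]
      congr 1
      ext x
      by_cases hxs : x ∈ tsupport χ
      · rw [ham_tilt (hd x hxs), h.sdet_tilt hζ c 1 (hR hxs), pgrad_tilt (hd x hxs), one_smul,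
          kap_zero_sub]
      · rw [image_eq_zero_of_notMem_tsupport hxs]; simp
    rw [e1] at key
    refine key.trans (add_le_add_left ?_ _)
    have e2 := (hH.fam η 0).wsq_mul_le (b := ham (_root_.tilt g ζ c) a)
      (A := pdet (pgrad (_root_.tilt g ζ c)))
      (contDiffOn_ham hT.isOpen_prod hT.holo a).continuousOn
      (contDiffOn_pdet hT.isOpen_prod (contDiffOn_pgrad hT.isOpen_prod hT.holo)).continuousOn
      (ζ := 0) (fun x hx => ⟨hm0, hR hx⟩) (M := e) (fun x hxs hB => by
        have hlt := norm_sub_lt_of_kap_ne_zero h0 hB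
        rw [sub_zero, pgrad_tilt (hd x hxs), zero_smul, sub_zero] at hlt
        rw [ham_tilt (hd x hxs)]
        exact hh x (hR hxs) hlt)
    calc _ ≤ √(e ^ 2 * N) := Real.sqrt_le_sqrt (e2.trans
            (mul_le_mul_of_nonneg_left (hmass 0 hm0) (sq_nonneg e)))
      _ = e * √N := by rw [Real.sqrt_mul (sq_nonneg e), Real.sqrt_sq he]
  · have hlt := norm_sub_lt_of_kap_ne_zero h0 hB
    rw [sub_zero, pgrad_tilt (hd x hxs)] at hlt
    have hsc : ‖(s • (1 : ℂ)) • c‖ ≤ ‖c‖ := by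
      rw [norm_smul, real_smul, mul_one, norm_real, Real.norm_eq_abs,
        abs_of_nonneg hs.1]
      exact mul_le_of_le_one_left (norm_nonneg _) hs.2
    have hxδ := hx x (hR hxs) (by
      have := norm_sub_norm_le (pgrad g (ζ, x)) ((s • (1 : ℂ)) • c)
      linarith)
    rw [fderiv_tilt (hd x hxs)]
    have e3 : fderiv ℂ g (ζ, x) (0, ((1 : ℂ), (0 : Vec m)).2) = 0 := by
      show fderiv ℂ g (ζ, x) 0 = 0
      simp
    rw [e3]
    simp only [map_zero, mul_zero, zero_add, one_mul, zero_sub, norm_neg]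
    exact (norm_pairing_le c x).trans (by gcongr)

end Tilt

section SlowVariation

variable {m : ℕ}

theorem ShellFam.sq_mul_norm_sq_le {D : Set ℂ} {R₁ R r : ℝ} {g : ℂ × Vec m → ℂ}
    (h : ShellFam D R₁ R r g) {ρ : ℝ} (hρ : 0 < ρ) (hD : closedBall 0 ρ ⊆ D)
    {w : Vec m} (hw : ‖w‖ < R₁) (hc0 : pgrad g (0, w) ≠ 0) (hc : ‖pgrad g (0, w)‖ < r / 4)
    (hdet : sdet (fun x => pgrad g (0, x)) w ≠ 0) {δ N : ℝ} {a : ℂ} (hδ : 0 < δ)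
    (hx : ∀ ζ ∈ closedBall (0 : ℂ) ρ, ∀ x ∈ ball (0 : Vec m) R,
      ‖pgrad g (ζ, x)‖ < 2 * ‖pgrad g (0, w)‖ → ‖x‖ ≤ δ)
    (hh : ∀ e : ℝ, 0 < e → ∃ η₀ : ℝ, 0 < η₀ ∧ ∀ ζ ∈ closedBall (0 : ℂ) ρ,
      ∀ x ∈ ball (0 : Vec m) R, ‖pgrad g (ζ, x)‖ < η₀ → ‖ham g a (ζ, x)‖ ≤ e)
    {χ : Vec m → ℝ} (hχ : ContDiff ℝ 1 χ)
    (hs : HasCompactSupport χ) (hn : ∀ x, 0 ≤ χ x) (h1 : ∀ x ∈ ball 0 R₁, χ x = 1)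
    (hR : tsupport χ ⊆ ball 0 R) (hN0 : 0 ≤ N)
    (hN : ∀ ζ ∈ closedBall (0 : ℂ) ρ, ∀ η, 0 < η → η < r →
      (mass (fun x => pgrad g (ζ, x)) χ (kap η 0) 1).re ≤ N) :
    ρ ^ 2 * ‖fderiv ℂ g (0, w) (1, 0)‖ ^ 2 ≤
      2 * (((m + 1) * (‖pgrad g (0, w)‖ * δ)) ^ 2 * N) := by
  set c := pgrad g (0, w) with hcdef
  have hcpos : 0 < ‖c‖ := norm_pos_iff.2 hc0
  have hH := h.hamFam hχ hs hn h1 hR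
  have h0D : (0 : ℂ) ∈ D := hD (mem_closedBall_self hρ.le)
  obtain ⟨η₀, hη₀, H⟩ := hh (‖c‖ * δ) (by positivity)
  have hr := h.pos
  have hle := hH.norm_sq_le (g := fun p => fderiv ℂ g p (1, 0))
    (contDiffOn_fderiv_apply h.isOpen_prod h.holo _).continuousOn h0D
    (eventually_cutoff_eq_one h1 hw) hdet
    (M := 2 * (((m + 1) * (‖c‖ * δ)) ^ 2 * N) / ρ ^ 2) ?_
  · rwa [le_div_iff₀ (by positivity), mul_comm] at hle
  have hsmall : ∀ᶠ η : ℝ in 𝓝[>] 0, η < min η₀ ‖c‖ :=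
    mem_nhdsWithin_of_mem_nhds (Iio_mem_nhds (lt_min hη₀ hcpos))
  filter_upwards [hsmall, self_mem_nhdsWithin] with η hη h0
  have h0 : 0 < η := h0
  have hη1 : η < η₀ := hη.trans_le (min_le_left _ _)
  have hη2 : η < ‖c‖ := hη.trans_le (min_le_right _ _)
  rw [le_div_iff₀ (by positivity), mul_comm]
  refine (hH.fam η c).sq_mul_wsq_le (contDiffOn_ham h.isOpen_prod h.holo a)
    (contDiffOn_fderiv_apply h.isOpen_prod h.holo _)
    (fun p hp => flow_ham h.isOpen_prod h.holo a hp) hρ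
    (fun ζ hζ => hH.adm h0 (by linarith) (hD hζ)) fun ζ hζ => ?_
  have key := h.sqrt_wsq_ham_le hχ hs hn h1 hR (hD hζ) hc.le h0 (by linarith) hδ.le
    (e := ‖c‖ * δ) (N := N) (a := a) (by positivity)
    (fun x hxR hlt => hx ζ hζ x hxR (by linarith))
    (fun x hxR hlt => H ζ hζ x hxR (hlt.trans hη1)) (hN ζ hζ η h0 (by linarith))
  have e : ‖c‖ * δ * √N + m * (‖c‖ * δ) * √N = (m + 1) * (‖c‖ * δ) * √N := by ring
  rw [e] at key
  have := Real.sqrt_le_iff.1 key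
  rw [mul_pow _ (√N), Real.sq_sqrt hN0] at this
  exact this.2

variable {E : Type} [NormedAddCommGroup E] [NormedSpace ℂ E]
  {f : E × Vec m → ℂ} {τ R₁ R r : ℝ}

theorem Setup.norm_lt_of_small (h : Setup f τ R₁ R r)
    (hz : ∀ t ∈ ball (0 : E) τ, ∀ x ∈ ball (0 : Vec m) R,
      xgrad f (t, x) = 0 → x = 0)
    {K : Set E} (hK : IsCompact K) (hKτ : K ⊆ ball 0 τ) {ε : ℝ} (hε : 0 < ε) :
    ∃ η, 0 < η ∧ ∀ t ∈ K, ∀ x ∈ ball (0 : Vec m) R, ‖xgrad f (t, x)‖ < η → ‖x‖ < ε := by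
  have hlt := h.lt
  let L : Set Vec m := closedBall 0 R₁ \ ball 0 ε
  have hL : IsCompact L := (isCompact_closedBall 0 R₁).diff isOpen_ball
  have hLR : L ⊆ ball 0 R := fun x hx => closedBall_subset_ball hlt hx.1
  obtain ⟨η, hη, H⟩ := (hK.prod hL).exists_forall_le' (f := fun p => ‖xgrad f p‖) (a := 0)
    (((contDiffOn_xgrad h.isOpen_prod h.holo).continuousOn.mono
      (prod_mono hKτ hLR)).norm)
    (fun p hp => norm_pos_iff.2 fun h0 => by
      have := hz p.1 (hKτ hp.1) p.2 (hLR hp.2) h0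
      have h2 := hp.2.2
      rw [this] at h2
      exact h2 (mem_ball_self hε))
  refine ⟨min η r, lt_min hη h.pos, fun t ht x hx hlt => ?_⟩
  by_contra! hc
  rcases le_or_gt ‖x‖ R₁ with h1 | h1
  · have := H (t, x) ⟨ht, by simpa using h1, by simpa using hc⟩
    exact absurd (hlt.trans_le (min_le_left _ _)) (not_lt.2 this)
  · have := h.shell t (hKτ ht) x h1.le (by simpa using hx)
    exact absurd (hlt.trans_le (min_le_right _ _)) (not_lt.2 this)

/-- The Legendre-type correction of a family. -/
noncomputable def xham (f : E × Vec m → ℂ) (a : ℂ) (p : E × Vec m) : ℂ :=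
  f p - a - ∑ k, xgrad f p k * p.2 k

theorem ham_lineFam {t v : E} {ζ : ℂ} {x : Vec m}
    (hf : DifferentiableAt ℂ f (t + ζ • v, x)) (a : ℂ) :
    ham (lineFam f t v) a (ζ, x) = xham f a (t + ζ • v, x) := by
  simp only [ham, pgrad_lineFam hf, xham, lineFam]

theorem Setup.norm_xham_le (h : Setup f τ R₁ R r)
    (hz : ∀ t ∈ ball (0 : E) τ, ∀ x ∈ ball (0 : Vec m) R,
      xgrad f (t, x) = 0 → x = 0)
    (hz' : ∀ t ∈ ball (0 : E) τ, xgrad f (t, 0) = 0)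
    {K : Set E} (hK : IsCompact K) (hKτ : K ⊆ ball 0 τ) {ε : ℝ} (hε : 0 < ε) :
    ∃ η, 0 < η ∧ ∀ t ∈ K, ∀ x ∈ ball (0 : Vec m) R, ‖xgrad f (t, x)‖ < η →
      ‖xham f (f 0) (t, x)‖ ≤ ε := by
  have hev : ∀ᶠ x in 𝓝 (0 : Vec m), ∀ t ∈ K, ‖xham f (f 0) (t, x)‖ < ε := by
    refine hK.eventually_forall_of_forall_eventually fun t ht => ?_
    have ht' := hKτ ht
    have hmem := h.isOpen_prod.mem_nhds (show (t, (0 : Vec m)) ∈ _ from ⟨ht', h.zero_mem_ball⟩)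
    have h1 : ContinuousAt f (t, (0 : Vec m)) := (h.holo.contDiffAt hmem).continuousAt
    have h2 : ContinuousAt (xgrad f) (t, (0 : Vec m)) :=
      ((contDiffOn_xgrad h.isOpen_prod h.holo).contDiffAt hmem).continuousAt
    have h3 : ContinuousAt (xham f (f 0)) (t, (0 : Vec m)) := by
      unfold xham
      refine (h1.sub continuousAt_const).sub (tendsto_finsetSum _ fun k _ => ?_)
      exact ((continuous_apply k).continuousAt.comp h2).mul
        ((continuous_apply k).comp continuous_snd).continuousAt
    have h4 : xham f (f 0) (t, 0) = 0 := by
      simp [xham, h.value_eq ht' h.zero_mem_ball (hz' t ht')]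
    have h5 : ContinuousAt (fun p : Vec m × E => ‖xham f (f 0) (p.2, p.1)‖)
        ((0 : Vec m), t) :=
      (ContinuousAt.comp (g := xham f (f 0)) (f := fun p : Vec m × E => (p.2, p.1))
        (x := ((0 : Vec m), t)) h3 (by fun_prop)).norm
    exact h5.eventually_lt_const (by simpa [h4] using hε)
  obtain ⟨δ, hδ, H⟩ := Metric.eventually_nhds_iff.1 hev
  obtain ⟨η, hη, H2⟩ := h.norm_lt_of_small hz hK hKτ hδ
  exact ⟨η, hη, fun t ht x hx hlt => (H (by
    rw [dist_zero_right]; exact H2 t ht x hx hlt) t ht).le⟩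

/-- Along the parameter directions the derivative is negligible compared to the fibrewise
gradient near the critical locus. -/
theorem Setup.norm_fderiv_le [ProperSpace E] (h : Setup f τ R₁ R r)
    (hz : ∀ t ∈ ball (0 : E) τ, ∀ x ∈ ball (0 : Vec m) R,
      xgrad f (t, x) = 0 → x = 0)
    (hz' : ∀ t ∈ ball (0 : E) τ, xgrad f (t, 0) = 0)
    {t₀ : E} (ht₀ : t₀ ∈ ball 0 τ) (v : E) {ε : ℝ} (hε : 0 < ε) :
    ∃ δ, 0 < δ ∧ ∀ t, dist t t₀ < δ → t ∈ ball 0 τ ∧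
      ∀ x ∈ ball (0 : Vec m) R,
      ‖xgrad f (t, x)‖ < δ → ‖fderiv ℂ f (t, x) (v, 0)‖ ≤ ε * ‖xgrad f (t, x)‖ := by
  obtain ⟨κ₀, hκ₀, hκ₀τ⟩ := isOpen_iff.1 isOpen_ball t₀ ht₀
  set κ := κ₀ / 4 with hκ
  have hκ0 : 0 < κ := by positivity
  let K : Set E := closedBall t₀ (2 * κ)
  have hK : IsCompact K := isCompact_closedBall _ _
  have hKτ : K ⊆ ball 0 τ :=
    (closedBall_subset_ball (by rw [hκ]; linarith)).trans hκ₀τ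
  set ρ := κ / (‖v‖ + 1) with hρdef
  have hv1 : 0 < ‖v‖ + 1 := by positivity
  have hρ : 0 < ρ := by positivity
  have hρv : ρ * ‖v‖ ≤ κ := by
    rw [hρdef, div_mul_eq_mul_div, div_le_iff₀ hv1]
    nlinarith [norm_nonneg v]
  obtain ⟨χ, hχ, hs, hn, h1, hR⟩ := exists_cutoff_ball (m := m) h.pos₁ h.lt
  have hχ1 : ContDiff ℝ 1 χ := hχ.of_le (by norm_num)
  have hr := h.pos
  set N := (mass (fun x => xgrad f (0, x)) χ (kap (r / 2) 0) 1).re with hNdef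
  have hN0 : 0 ≤ N := le_trans zero_le_one
    ((h.isoZ hχ1 hs hn h1 hR h.zero_mem).one_le_mass_zero (w := 0)
      (eventually_cutoff_eq_one h1 (by simpa using h.pos₁)) h.zero (by linarith) (by linarith))
  have hNt : ∀ t ∈ ball (0 : E) τ, ∀ η, 0 < η → η < r →
      (mass (fun x => xgrad f (t, x)) χ (kap η 0) 1).re ≤ N := by
    intro t ht η h0 hη
    have hH := (h.shellFam 0 t).hamFam hχ1 hs hn h1 hR
    have e2 := hH.mass_eq (isOpen_lineDom _ _ _) (convex_lineDom _ _ _).isPreconnected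
      (one_mem_lineDom ht) (h.zero_mem_lineDom t) (c := 0) (c' := 0) (η := η) (η' := r / 2) h0
      (by rwa [norm_zero, zero_add]) (by linarith) (by rw [norm_zero]; linarith)
    rw [h.mass_line hR (one_mem_lineDom ht), h.mass_line hR (h.zero_mem_lineDom t)] at e2
    simp only [one_smul, zero_smul, zero_add] at e2
    rw [e2]
  set δ' := ε * ρ / ((m + 1) * √(2 * N + 1)) with hδ'def
  have hδ' : 0 < δ' := by positivity
  obtain ⟨η₁, hη₁, H1⟩ := h.norm_lt_of_small hz hK hKτ hδ'
  refine ⟨min κ (min (η₁ / 2) (r / 4)), by positivity, fun t ht => ?_⟩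
  have htκ : dist t t₀ < κ := ht.trans_le (min_le_left _ _)
  have htK : ∀ ζ ∈ closedBall (0 : ℂ) ρ, t + ζ • v ∈ K := by
    intro ζ hζ
    rw [mem_closedBall, dist_eq_norm]
    have e : t + ζ • v - t₀ = (t - t₀) + ζ • v := by abel
    have h2 : ‖ζ • v‖ ≤ κ := by
      rw [norm_smul]
      exact (mul_le_mul_of_nonneg_right (mem_closedBall_zero_iff.1 hζ) (norm_nonneg _)).trans hρv
    rw [dist_eq_norm] at htκ
    rw [e]
    exact (norm_add_le _ _).trans (by linarith)
  have htτ : t ∈ ball 0 τ := by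
    have := hKτ (htK 0 (mem_closedBall_self hρ.le))
    simpa using this
  refine ⟨htτ, fun x hx hlt => ?_⟩
  have h0D : (0 : ℂ) ∈ lineDom τ t v := by simpa [lineDom] using htτ
  have hS := h.shellFam t v
  have hdiff : ∀ ζ ∈ closedBall (0 : ℂ) ρ, ∀ x ∈ ball (0 : Vec m) R,
      DifferentiableAt ℂ f (t + ζ • v, x) := fun ζ hζ x hx =>
    h.differentiableAt (hKτ (htK ζ hζ)) hx
  have h0ρ : (0 : ℂ) ∈ closedBall (0 : ℂ) ρ := mem_closedBall_self hρ.le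
  have et : t + (0 : ℂ) • v = t := by simp
  have key : ∀ w ∈ ball (0 : Vec m) R, xgrad f (t, w) ≠ 0 →
      ‖xgrad f (t, w)‖ < min (η₁ / 2) (r / 4) →
      sdet (fun x => pgrad (lineFam f t v) (0, x)) w ≠ 0 →
      ‖fderiv ℂ f (t, w) (v, 0)‖ ≤ ε * ‖xgrad f (t, w)‖ := by
    intro w hw hne hlt hdet
    have ep : pgrad (lineFam f t v) (0, w) = xgrad f (t, w) := by
      rw [pgrad_lineFam (hdiff 0 h0ρ w hw), et]
    have hlt1 := hlt.trans_le (min_le_left _ _)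
    have hlt2 := hlt.trans_le (min_le_right _ _)
    have hwR : ‖w‖ < R₁ := by
      by_contra! hc
      have := h.shell t htτ w hc (by simpa using hw)
      linarith
    have := hS.sq_mul_norm_sq_le hρ (fun ζ hζ => hKτ (htK ζ hζ)) hwR (by rwa [ep])
      (by rwa [ep]) hdet hδ' (a := f 0)
      (fun ζ hζ x hx hlt => by
        rw [ep, pgrad_lineFam (hdiff ζ hζ x hx)] at hlt
        exact (H1 _ (htK ζ hζ) x hx (by linarith)).le)
      (fun e he => by
        obtain ⟨η, hη, H⟩ := h.norm_xham_le hz hz' hK hKτ he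
        refine ⟨η, hη, fun ζ hζ x hx hlt => ?_⟩
        rw [pgrad_lineFam (hdiff ζ hζ x hx)] at hlt
        rw [ham_lineFam (hdiff ζ hζ x hx)]
        exact H _ (htK ζ hζ) x hx hlt)
      hχ1 hs hn h1 hR hN0
      (fun ζ hζ η h0 hη => by
        rw [h.mass_line hR (hKτ (htK ζ hζ))]
        exact hNt _ (hKτ (htK ζ hζ)) η h0 hη)
    rw [ep, fderiv_lineFam (hdiff 0 h0ρ w hw), et, one_smul] at this
    set A := ‖fderiv ℂ f (t, w) (v, 0)‖ with hA
    set C := ‖xgrad f (t, w)‖ with hC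
    have hq : ((m + 1 : ℝ) * δ') ^ 2 * (2 * N + 1) = ε ^ 2 * ρ ^ 2 := by
      have hsq : √(2 * N + 1) ^ 2 = 2 * N + 1 := Real.sq_sqrt (by positivity)
      have hpos : 0 < √(2 * N + 1) := by positivity
      rw [hδ'def]
      have : (m + 1 : ℝ) * (ε * ρ / ((m + 1) * √(2 * N + 1))) = ε * ρ / √(2 * N + 1) := by
        field_simp
      rw [this, div_pow, hsq]
      field_simp
    have h6 : ρ ^ 2 * A ^ 2 ≤ ρ ^ 2 * (ε * C) ^ 2 := by
      have h7 : 2 * (((m + 1 : ℝ) * (C * δ')) ^ 2 * N) ≤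
          C ^ 2 * (((m + 1 : ℝ) * δ') ^ 2 * (2 * N + 1)) := by
        have : 0 ≤ C ^ 2 * ((m + 1 : ℝ) * δ') ^ 2 := by positivity
        nlinarith
      rw [hq] at h7
      calc _ ≤ _ := this
        _ ≤ _ := h7
        _ = _ := by ring
    have h8 : A ^ 2 ≤ (ε * C) ^ 2 := le_of_mul_le_mul_left h6 (by positivity)
    exact abs_le_of_sq_le_sq' h8 (by positivity) |>.2
  by_cases hne : xgrad f (t, x) = 0
  · rw [h.crit t htτ x hx hne]
    simp [hne]
  by_contra! hc
  have hmem := h.isOpen_prod.mem_nhds (show (t, x) ∈ _ from ⟨htτ, hx⟩)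
  have c1 : ContinuousAt (fun y => xgrad f (t, y)) x :=
    ContinuousAt.comp (g := xgrad f) (f := fun y : Vec m => (t, y))
      ((contDiffOn_xgrad h.isOpen_prod h.holo).contDiffAt hmem).continuousAt (by fun_prop)
  have c2 : ContinuousAt (fun y => fderiv ℂ f (t, y) (v, 0)) x :=
    ContinuousAt.comp (g := fun p => fderiv ℂ f p (v, 0)) (f := fun y : Vec m => (t, y))
      ((contDiffOn_fderiv_apply h.isOpen_prod h.holo _).contDiffAt hmem).continuousAt
      (by fun_prop)
  have hfreq := h.frequently_sdet_ne_zero h0D h.zero_mem_ball (by rw [et]; exact hz' t htτ) hx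
  obtain ⟨w, hdet, hw, hw1, hw2, hw3⟩ := (hfreq.and_eventually
    ((show ∀ᶠ w in 𝓝 x, w ∈ ball 0 R from isOpen_ball.mem_nhds hx).and
    ((c1.eventually_ne hne).and ((c1.norm.eventually_lt_const
      (hlt.trans_le (min_le_right _ _))).and
      ((c1.norm.const_mul ε).eventually_lt c2.norm hc))))).exists
  exact absurd (key w hw hw1 hw2 hdet) (not_le.2 hw3)

end SlowVariation

section Straightening

variable {m : ℕ} {E : Type} [NormedAddCommGroup E] [NormedSpace ℂ E]
  {f : E × Vec m → ℂ}

/-- The family in fibre coordinates centred at a section. -/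
def recenter (f : E × Vec m → ℂ) (φ : E → Vec m) (p : E × Vec m) : ℂ :=
  f (p.1, p.2 + φ p.1)

theorem fderiv_recenter {φ : E → Vec m} {t : E} {x : Vec m}
    (hf : DifferentiableAt ℂ f (t, x + φ t)) (hφ : DifferentiableAt ℂ φ t)
    (w : E × Vec m) :
    fderiv ℂ (recenter f φ) (t, x) w = fderiv ℂ f (t, x + φ t) (w.1, w.2 + fderiv ℂ φ t w.1) := by
  have h1 : HasFDerivAt (fun p : E × Vec m => φ p.1)
      ((fderiv ℂ φ t).comp (fst ℂ E Vec m)) (t, x) :=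
    HasFDerivAt.comp (g := φ) (f := fun p : E × Vec m => p.1) (t, x) hφ.hasFDerivAt
      (fst ℂ E Vec m).hasFDerivAt
  have h2 : HasFDerivAt (fun p : E × Vec m => (p.1, p.2 + φ p.1)) _ (t, x) :=
    (fst ℂ E Vec m).hasFDerivAt.prodMk
      ((snd ℂ E Vec m).hasFDerivAt.add h1)
  have h3 := HasFDerivAt.comp (g := f) (f := fun p : E × Vec m => (p.1, p.2 + φ p.1))
    (t, x) hf.hasFDerivAt h2
  have e : recenter f φ = f ∘ fun p : E × Vec m => (p.1, p.2 + φ p.1) := rfl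
  rw [e, h3.fderiv]
  simp

theorem xgrad_recenter {φ : E → Vec m} {t : E} {x : Vec m}
    (hf : DifferentiableAt ℂ f (t, x + φ t)) (hφ : DifferentiableAt ℂ φ t) :
    xgrad (recenter f φ) (t, x) = xgrad f (t, x + φ t) := by
  ext k
  simp [xgrad, fderiv_recenter hf hφ]

theorem exists_section_slow [FiniteDimensional ℂ E] (hm : 1 ≤ m)
    (h1 : ∀ᶠ z in 𝓝 (0 : E × Vec m), AnalyticAt ℂ f z)
    (h2 : ∀ᶠ x in 𝓝 (0 : Vec m), xgrad f (0, x) = 0 → x = 0)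
    (h3 : ∀ᶠ z in 𝓝 (0 : E × Vec m), xgrad f z = 0 → fderiv ℂ f z = 0)
    (h4 : xgrad f 0 = 0) {V : Set (E × Vec m)} (hV : V ∈ 𝓝 0) :
    ∃ τ R : ℝ, 0 < τ ∧ 0 < R ∧ ∃ φ : E → Vec m,
      AnalyticOnNhd ℂ φ (ball 0 τ) ∧ φ 0 = 0 ∧
      ball 0 τ ×ˢ ball 0 R ⊆ V ∧
      (∀ t ∈ ball (0 : E) τ, φ t ∈ ball 0 R ∧
        ∀ x ∈ ball (0 : Vec m) R, xgrad f (t, x) = 0 ↔ x = φ t) ∧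
      ∀ t ∈ ball (0 : E) τ, ∀ v : E, ∀ ε : ℝ, 0 < ε →
        ∀ᶠ z in 𝓝 (t, φ t), ‖fderiv ℂ f z (v, fderiv ℂ φ z.1 v)‖ ≤ ε * ‖xgrad f z‖ := by
  have : ProperSpace E := FiniteDimensional.proper ℂ E
  obtain ⟨ρ, hρ, hρV⟩ := Metric.mem_nhds_iff.1 hV
  obtain ⟨τ₀, R₁, R, r, hτρ, hRρ, hS⟩ := exists_setup h1 h2 h3 h4 hρ
  obtain ⟨τ₁, hτ₁, hle, φ, hφ, hφ0, hφz⟩ := hS.exists_section hm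
  have hS1 := hS.mono hτ₁ hle
  have hφd : ∀ t ∈ ball (0 : E) τ₁, DifferentiableAt ℂ φ t :=
    fun t ht => (hφ t ht).differentiableAt
  have hφc : ∀ t ∈ ball (0 : E) τ₁,
      ContinuousAt (fun z : E × Vec m => z.2 + φ z.1) (t, 0) := fun t ht =>
    continuousAt_snd.add (ContinuousAt.comp (g := φ) (f := Prod.fst) (hφ t ht).continuousAt
      continuousAt_fst)
  have hev : ∀ᶠ z in 𝓝 (0 : E × Vec m),
      z.1 ∈ ball (0 : E) τ₁ ∧ z.2 + φ z.1 ∈ ball (0 : Vec m) R := by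
    refine (continuousAt_fst.eventually_mem (isOpen_ball.mem_nhds hS1.zero_mem)).and
      ((hφc 0 hS1.zero_mem).eventually_mem (isOpen_ball.mem_nhds ?_))
    simpa [hφ0] using hS1.zero_mem_ball
  have hfd : ∀ (t : E) (x : Vec m), t ∈ ball (0 : E) τ₁ → x ∈ ball 0 R →
      DifferentiableAt ℂ f (t, x) := fun t x ht hx => hS1.differentiableAt ht hx
  have hxg : ∀ (t : E) (x : Vec m), t ∈ ball (0 : E) τ₁ → x + φ t ∈ ball 0 R →
      xgrad (recenter f φ) (t, x) = xgrad f (t, x + φ t) := fun t x ht hx =>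
    xgrad_recenter (hfd t _ ht hx) (hφd t ht)
  have hzero : ∀ (t : E) (x : Vec m), t ∈ ball (0 : E) τ₁ →
      x + φ t ∈ ball 0 R → xgrad (recenter f φ) (t, x) = 0 → x = 0 := by
    intro t x ht hx h0
    rw [hxg t x ht hx] at h0
    simpa using ((hφz t ht).2 _ hx).1 h0
  have hzero' : ∀ t : E, t ∈ ball (0 : E) τ₁ → xgrad (recenter f φ) (t, 0) = 0 := by
    intro t ht
    have := (hφz t ht).1
    rw [hxg t 0 ht (by rwa [zero_add]), zero_add]
    exact ((hφz t ht).2 _ this).2 rfl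
  obtain ⟨ρ₂, hρ₂, H⟩ := Metric.eventually_nhds_iff.1 hev
  obtain ⟨τ₂, R₂', R₂, r₂, hτ₂, hR₂, hT⟩ := exists_setup (f := recenter f φ) (ρ := min ρ₂ τ₁)
    (by
      filter_upwards [hev] with z hz
      have ha : AnalyticAt ℂ f (z.1, z.2 + φ z.1) :=
        (hS1.holo.contDiffAt (hS1.isOpen_prod.mem_nhds
          (show (z.1, z.2 + φ z.1) ∈ _ from ⟨hz.1, hz.2⟩))).analyticAt
      refine AnalyticAt.fun_comp (g := f) (f := fun z : E × Vec m => (z.1, z.2 + φ z.1)) ha (analyticAt_fst.prod (analyticAt_snd.add ?_))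
      exact AnalyticAt.fun_comp (g := φ) (f := Prod.fst) (hφ z.1 hz.1) analyticAt_fst)
    (by
      have hc : ContinuousAt (fun x : Vec m => ((0 : E), x)) 0 := by fun_prop
      filter_upwards [hc.eventually hev] with x hx hx0
      exact hzero 0 x hx.1 hx.2 hx0)
    (by
      filter_upwards [hev] with z hz hz0
      rw [hxg z.1 z.2 hz.1 hz.2] at hz0
      refine ContinuousLinearMap.ext fun w => ?_
      change fderiv ℂ (recenter f φ) (z.1, z.2) w = 0
      rw [fderiv_recenter (hfd _ _ hz.1 hz.2) (hφd _ hz.1), hS1.crit _ hz.1 _ hz.2 hz0]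
      rfl)
    (hzero' 0 hS1.zero_mem) (lt_min hρ₂ hτ₁)
  have hτ₂₁ : τ₂ ≤ τ₁ := hτ₂.le.trans (min_le_right _ _)
  have hin : ∀ t ∈ ball (0 : E) τ₂, ∀ x ∈ ball (0 : Vec m) R₂,
      t ∈ ball (0 : E) τ₁ ∧ x + φ t ∈ ball (0 : Vec m) R := by
    intro t ht x hx
    refine H (y := (t, x)) ?_
    rw [dist_zero_right]
    exact max_lt ((mem_ball_zero_iff.1 ht).trans (hτ₂.trans_le (min_le_left _ _)))
      ((mem_ball_zero_iff.1 hx).trans (hR₂.trans_le (min_le_left _ _)))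
  refine ⟨τ₂, R, hT.posτ, hS.pos₁.trans hS.lt, φ, hφ.mono (ball_subset_ball hτ₂₁), hφ0,
    fun z hz => hρV ?_, fun t ht => hφz t (ball_subset_ball hτ₂₁ ht), ?_⟩
  · rw [mem_ball_zero_iff]
    exact max_lt ((mem_ball_zero_iff.1 hz.1).trans (by linarith))
      ((mem_ball_zero_iff.1 hz.2).trans hRρ)
  intro t ht v ε hε
  have ht1 := ball_subset_ball hτ₂₁ ht
  obtain ⟨δ, hδ, hδH⟩ := hT.norm_fderiv_le
    (fun t ht x hx => hzero t x (hin t ht x hx).1 (hin t ht x hx).2)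
    (fun t ht => hzero' t (ball_subset_ball hτ₂₁ ht)) ht v hε
  have hc1 : ∀ᶠ z in 𝓝 (t, φ t), dist z.1 t < δ :=
    (continuousAt_fst (p := (t, φ t))).eventually (ball_mem_nhds t hδ)
  have hc2 : ∀ᶠ z in 𝓝 (t, φ t), z.2 - φ z.1 ∈ ball (0 : Vec m) R₂ := by
    have : ContinuousAt (fun z : E × Vec m => z.2 - φ z.1) (t, φ t) :=
      continuousAt_snd.sub (ContinuousAt.comp (g := φ) (f := Prod.fst) (hφ t ht1).continuousAt
        continuousAt_fst)
    refine this.eventually_mem (isOpen_ball.mem_nhds ?_)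
    simpa using hT.zero_mem_ball
  have hmem := (hφz t ht1).1
  have hc3 : ∀ᶠ z in 𝓝 (t, φ t), ‖xgrad f z‖ < δ := by
    have : ContinuousAt (xgrad f) (t, φ t) :=
      ((contDiffOn_xgrad hS1.isOpen_prod hS1.holo).contDiffAt
        (hS1.isOpen_prod.mem_nhds ⟨ht1, hmem⟩)).continuousAt
    refine this.norm.eventually_lt_const ?_
    change ‖xgrad f (t, φ t)‖ < δ
    rw [((hφz t ht1).2 _ hmem).2 rfl]
    simpa using hδ
  filter_upwards [hc1, hc2, hc3] with z hz1 hz2 hz3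
  obtain ⟨hzτ, hzH⟩ := hδH z.1 hz1
  obtain ⟨hz4, hz5⟩ := hin z.1 hzτ _ hz2
  have e1 := hxg z.1 _ hz4 hz5
  have e2 := fderiv_recenter (hfd _ _ hz4 hz5) (hφd _ hz4) (v, 0)
  simp only [sub_add_cancel, zero_add] at e1 e2
  have := hzH _ hz2 (by rw [e1]; exact hz3)
  rw [e1, e2] at this
  exact this

theorem norm_xgrad_le (f : E × Vec m → ℂ) (z : E × Vec m) :
    ‖xgrad f z‖ ≤ ‖fderiv ℂ f z‖ := by
  refine (pi_norm_le_iff_of_nonneg (norm_nonneg _)).2 fun k => ?_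
  refine (ContinuousLinearMap.le_opNorm _ _).trans (mul_le_of_le_one_right (norm_nonneg _) ?_)
  rw [Prod.norm_def, max_le_iff]
  refine ⟨by simp, (pi_norm_le_iff_of_nonneg zero_le_one).2 fun i => ?_⟩
  rcases eq_or_ne i k with rfl | h <;> simp [*]

theorem tendsto_clm_apply {F G : Type*} [NormedAddCommGroup F] [NormedSpace ℂ F]
    [NormedAddCommGroup G] [NormedSpace ℂ G] {L : ℕ → F →L[ℂ] G} {η : F →L[ℂ] G} {x : ℕ → F} {y : F}
    (hL : Tendsto L atTop (𝓝 η)) (hx : Tendsto x atTop (𝓝 y)) :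
    Tendsto (fun k => L k (x k)) atTop (𝓝 (η y)) :=
  (isBoundedBilinearMap_apply.continuous.tendsto (η, y)).comp (hL.prodMk_nhds hx)

theorem eq_zero_of_tendsto_normalized {φ : E → Vec m} {t v : E}
    (hφ : AnalyticAt ℂ φ t)
    (hs : ∀ ε : ℝ, 0 < ε →
      ∀ᶠ z in 𝓝 (t, φ t), ‖fderiv ℂ f z (v, fderiv ℂ φ z.1 v)‖ ≤ ε * ‖xgrad f z‖)
    {q : ℕ → E × Vec m} (hq : Tendsto q atTop (𝓝 (t, φ t)))
    {η : E × Vec m →L[ℂ] ℂ}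
    (hη : Tendsto (fun k => (‖fderiv ℂ f (q k)‖)⁻¹ • fderiv ℂ f (q k)) atTop (𝓝 η)) :
    η (v, fderiv ℂ φ t v) = 0 := by
  have hq1 : Tendsto (fun k => (q k).1) atTop (𝓝 t) := (continuous_fst.tendsto _).comp hq
  have hd : Tendsto (fun k => fderiv ℂ φ (q k).1 v) atTop (𝓝 (fderiv ℂ φ t v)) :=
    tendsto_clm_apply (hφ.fderiv.continuousAt.tendsto.comp hq1) tendsto_const_nhds
  have hlim := tendsto_clm_apply hη ((tendsto_const_nhds (x := v)).prodMk_nhds hd)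
  refine tendsto_nhds_unique hlim (Metric.tendsto_nhds.2 fun ε hε => ?_)
  filter_upwards [hq.eventually (hs (ε / 2) (half_pos hε))] with k hk
  have h1 := norm_xgrad_le f (q k)
  rw [dist_zero_right, FunLike.coe_smul, Pi.smul_apply, norm_smul, norm_inv, norm_norm]
  have h2 : ‖fderiv ℂ f (q k)‖⁻¹ * ‖fderiv ℂ f (q k) (v, fderiv ℂ φ (q k).1 v)‖ ≤
      ‖fderiv ℂ f (q k)‖⁻¹ * (ε / 2 * ‖fderiv ℂ f (q k)‖) := by
    gcongr
    exact hk.trans (by gcongr)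
  refine h2.trans_lt ?_
  rcases eq_or_ne ‖fderiv ℂ f (q k)‖ 0 with h | h
  · simpa [h] using hε
  · rw [mul_left_comm, inv_mul_cancel₀ h]
    linarith

end Straightening

section GraphTangent

variable {s m : ℕ} {S : Set ((Fin s → ℂ) × Vec m)}
  {φ : (Fin s → ℂ) → Vec m} {t : Fin s → ℂ}

theorem snd_eq_of_mem_tangentConeAt {W : Set ((Fin s → ℂ) × Vec m)}
    (hW : W ∈ 𝓝 (t, φ t)) (hS : ∀ z ∈ S ∩ W, z.2 = φ z.1) (hφ : DifferentiableAt ℂ φ t)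
    {v : (Fin s → ℂ) × Vec m} (hv : v ∈ tangentConeAt ℝ S (t, φ t)) :
    v.2 = fderiv ℂ φ t v.1 := by
  rw [← tangentConeAt_inter_nhds hW] at hv
  have h1 : HasFDerivAt (fun p : (Fin s → ℂ) × Vec m => φ p.1)
      ((fderiv ℂ φ t).comp (fst ℂ (Fin s → ℂ) Vec m)) (t, φ t) :=
    HasFDerivAt.comp (g := φ) (f := fun p : (Fin s → ℂ) × Vec m => p.1) (t, φ t)
      hφ.hasFDerivAt (fst ℂ (Fin s → ℂ) Vec m).hasFDerivAt
  have h2 := (((snd ℂ (Fin s → ℂ) Vec m).hasFDerivAt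
    (x := (t, φ t))).sub h1).restrictScalars ℝ
  have h3 := (h2.hasFDerivWithinAt (s := S ∩ W)).mapsTo_tangent_cone hv
  have h4 : tangentConeAt ℝ ({0} : Set Vec m) 0 ⊆ {0} :=
    tangentConeAt_subset_zero (by
      rw [accPt_iff_nhds]
      intro h
      obtain ⟨y, hy, hy0⟩ := h univ univ_mem
      exact hy0 hy.2)
  have h5 := tangentConeAt_mono (t := {0}) (by
    rintro _ ⟨z, hz, rfl⟩
    simp [hS z hz]) h3
  have e : (⇑(snd ℂ (Fin s → ℂ) Vec m) -
      fun p : (Fin s → ℂ) × Vec m => φ p.1) (t, φ t) = 0 := by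
    simp
  rw [e] at h5
  simpa [sub_eq_zero] using h4 h5

theorem mem_tangentConeAt_of_graph_subset {V : Set (Fin s → ℂ)} (hV : V ∈ 𝓝 t)
    (hS : ∀ a ∈ V, (a, φ a) ∈ S) (hφ : DifferentiableAt ℂ φ t) (u : Fin s → ℂ) :
    (u, fderiv ℂ φ t u) ∈ tangentConeAt ℝ S (t, φ t) := by
  have h2 := (((ContinuousLinearMap.id ℂ (Fin s → ℂ)).hasFDerivAt (x := t)).prodMk
    hφ.hasFDerivAt).restrictScalars ℝ
  have h3 := (h2.hasFDerivWithinAt (s := V)).mapsTo_tangent_cone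
    (show u ∈ tangentConeAt ℝ V t by rw [tangentConeAt_of_mem_nhds hV]; trivial)
  exact tangentConeAt_mono (by rintro _ ⟨a, ha, rfl⟩; exact hS a ha) h3

end GraphTangent

section CriticalLocus

variable {n s : ℕ} {U : Set (Csp n s)} {f : Csp n s → ℂ}

theorem partialsVanish_iff {z : Csp n s} : PartialsVanish n s f z ↔ xgrad f z = 0 :=
  funext_iff.symm

theorem eventually_fderiv_eq_zero_of_jacobianEq (h : JacobianEq n s f U) :
    ∀ᶠ z in 𝓝 (0 : Csp n s), xgrad f z = 0 → fderiv ℂ f z = 0 := by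
  obtain ⟨W, hWo, h0, -, hW⟩ := h
  filter_upwards [hWo.mem_nhds h0] with z hz hx
  have : z ∈ SigmaF n s f U ∩ W := hW ▸ ⟨hz, partialsVanish_iff.2 hx⟩
  exact this.1.2

theorem eventually_eq_zero_of_centralIsolation (hU : IsOpen U) (h0U : (0 : Csp n s) ∈ U)
    (h : CentralIsolation n s f U) :
    ∀ᶠ x in 𝓝 (0 : Fin (n + 1 - s) → ℂ), xgrad f ((0 : Fin s → ℂ), x) = 0 → x = 0 := by
  obtain ⟨W, hWo, h0, hW⟩ := h
  have hc : ContinuousAt (fun x : Fin (n + 1 - s) → ℂ => ((0 : Fin s → ℂ), x)) 0 := by fun_prop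
  filter_upwards [hc.eventually_mem ((hU.inter hWo).mem_nhds ⟨h0U, h0⟩)] with x hx h0x
  exact congrArg Prod.snd (hW _ hx rfl (partialsVanish_iff.2 h0x))

theorem graphForm_and_afCondition (hs : s ≤ n) (hU : IsOpen U) (h0U : (0 : Csp n s) ∈ U)
    (hf : ∀ z ∈ U, AnalyticAt ℂ f z) (h0 : (0 : Csp n s) ∈ SigmaF n s f U)
    (hC : CentralIsolation n s f U) (hJ : JacobianEq n s f U) :
    GraphForm n s f U ∧ AfCondition n s f U := by
  have h3 := eventually_fderiv_eq_zero_of_jacobianEq hJ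
  have hx0 : ∀ z, fderiv ℂ f z = 0 → xgrad f z = 0 := fun z hz => by
    ext k
    simp [xgrad, hz]
  obtain ⟨τ, R, hτ, hR, φ, hφ, hφ0, hV, hz, hslow⟩ := exists_section_slow (by omega)
    (Filter.eventually_of_mem (hU.mem_nhds h0U) hf)
    (eventually_eq_zero_of_centralIsolation hU h0U hC) h3 (hx0 _ h0.2)
    (Filter.inter_mem (hU.mem_nhds h0U) h3)
  have hWo : IsOpen (ball (0 : Fin s → ℂ) τ ×ˢ ball (0 : Fin (n + 1 - s) → ℂ) R) :=
    isOpen_ball.prod isOpen_ball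
  have h0W : (0 : Csp n s) ∈
      ball (0 : Fin s → ℂ) τ ×ˢ ball (0 : Fin (n + 1 - s) → ℂ) R :=
    ⟨mem_ball_self hτ, mem_ball_self hR⟩
  have hgraph : ∀ z ∈ SigmaF n s f U ∩
      ball (0 : Fin s → ℂ) τ ×ˢ ball (0 : Fin (n + 1 - s) → ℂ) R,
      z.2 = φ z.1 := fun z hzS => ((hz z.1 hzS.2.1).2 z.2 hzS.2.2).1 (hx0 _ hzS.1.2)
  refine ⟨⟨_, ball 0 τ, φ, hWo, h0W, fun z hz => (hV hz).1, isOpen_ball,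
    (convex_ball 0 τ).isConnected ⟨0, mem_ball_self hτ⟩, mem_ball_self hτ, hφ, hφ0,
    ?_⟩, ⟨_, hWo, h0W, fun z hz => (hV hz).1, ?_⟩⟩
  · ext z
    constructor
    · intro hzS
      exact ⟨z.1, hzS.2.1, Prod.ext rfl (hgraph z hzS).symm⟩
    · rintro ⟨a, ha, rfl⟩
      have hmem := (hz a ha).1
      obtain ⟨hzU, hcrit⟩ := hV (show (a, φ a) ∈ _ from ⟨ha, hmem⟩)
      exact ⟨⟨hzU, hcrit (((hz a ha).2 _ hmem).2 rfl)⟩, ha, hmem⟩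
  · rintro ⟨t, x⟩ hp q - hq η hη v hv
    obtain rfl : x = φ t := hgraph _ hp
    have ht := hp.2.1
    have hv2 := snd_eq_of_mem_tangentConeAt (hWo.mem_nhds hp.2) hgraph
      (hφ t ht).differentiableAt hv
    have := eq_zero_of_tendsto_normalized (hφ t ht) (hslow t ht v.1) hq hη
    rwa [← hv2] at this

theorem clm_eq_zero_of_graph {E : Type*} {m : ℕ} [NormedAddCommGroup E] [NormedSpace ℂ E]
    {η : E × Vec m →L[ℂ] ℂ} (h1 : ∀ j, η (0, Pi.single j 1) = 0) {g : E → Vec m}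
    (h2 : ∀ u, η (u, g u) = 0) : η = 0 := by
  have h3 : ∀ x, η (0, x) = 0 := by
    have : (η : E × Vec m →ₗ[ℂ] ℂ) ∘ₗ LinearMap.inr ℂ E Vec m = 0 := by
      ext j
      simpa using h1 j
    exact fun x => LinearMap.congr_fun this x
  refine ContinuousLinearMap.ext fun w => ?_
  have e : w = (w.1, g w.1) + (0, w.2 - g w.1) := by ext <;> simp
  rw [e, map_add, h2, h3]
  simp

theorem eventually_fderiv_eq_zero_of_afCondition (hU : IsOpen U) (h0U : (0 : Csp n s) ∈ U)
    (h0 : (0 : Csp n s) ∈ SigmaF n s f U)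
    (hG : GraphForm n s f U) (hA : AfCondition n s f U) :
    ∀ᶠ z in 𝓝 (0 : Csp n s), xgrad f z = 0 → fderiv ℂ f z = 0 := by
  obtain ⟨W, V, φ, -, -, -, hVo, -, h0V, hφ, hφ0, hS⟩ := hG
  obtain ⟨W₁, hW₁o, h0W₁, -, hW₁⟩ := hA
  by_contra hcon
  have hfr : ∃ᶠ z in 𝓝 (0 : Csp n s), z ∈ W₁ ∧ z ∈ U ∧ xgrad f z = 0 ∧ fderiv ℂ f z ≠ 0 := by
    refine ((Filter.not_eventually.1 hcon).and_eventually
      ((hW₁o.inter hU).mem_nhds ⟨h0W₁, h0U⟩)).mono fun z hz => ?_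
    exact ⟨hz.2.1, hz.2.2, Classical.not_imp.1 hz.1⟩
  obtain ⟨q, hq, hqH⟩ := Filter.exists_seq_forall_of_frequently hfr
  have : ProperSpace (Csp n s →L[ℂ] ℂ) := FiniteDimensional.proper ℂ _
  obtain ⟨η, hηs, ψ, hψ, hη⟩ := (isCompact_sphere (0 : Csp n s →L[ℂ] ℂ) 1).tendsto_subseq
    (x := fun k => (‖fderiv ℂ f (q k)‖)⁻¹ • fderiv ℂ f (q k)) (fun k => by
      rw [mem_sphere_zero_iff_norm, norm_smul, norm_inv, norm_norm,
        inv_mul_cancel₀ (norm_ne_zero_iff.2 (hqH k).2.2.2)])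
  have hη' : Tendsto (fun k => (‖fderiv ℂ f (q (ψ k))‖)⁻¹ • fderiv ℂ f (q (ψ k))) atTop (𝓝 η) := hη
  have h1 : ∀ j, η (0, Pi.single j 1) = 0 := by
    intro j
    refine tendsto_nhds_unique (tendsto_clm_apply hη'
      (x := fun _ => ((0 : Fin s → ℂ), Pi.single j (1 : ℂ))) tendsto_const_nhds)
      (tendsto_const_nhds.congr fun k => ?_)
    have := congrFun (hqH (ψ k)).2.2.1 j
    simp only [xgrad, Pi.zero_apply] at this
    simp [this]
  have h2 : ∀ u, η (u, fderiv ℂ φ 0 u) = 0 := by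
    intro u
    refine hW₁ 0 ⟨h0, h0W₁⟩ (fun k => q (ψ k)) (fun k => ⟨(hqH _).1, fun h => (hqH _).2.2.2 h.2⟩)
      (hq.comp hψ.tendsto_atTop) η hη' _ ?_
    have := mem_tangentConeAt_of_graph_subset (S := SigmaF n s f U) (hVo.mem_nhds h0V)
      (fun a ha => (hS ▸ mem_image_of_mem _ ha : (a, φ a) ∈ SigmaF n s f U ∩ W).1)
      (hφ 0 h0V).differentiableAt u
    rwa [hφ0] at this
  rw [clm_eq_zero_of_graph h1 h2] at hηs
  simp at hηs

theorem centralIsolation_and_jacobianEq (hU : IsOpen U) (h0U : (0 : Csp n s) ∈ U)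
    (h0 : (0 : Csp n s) ∈ SigmaF n s f U)
    (hG : GraphForm n s f U) (hA : AfCondition n s f U) :
    CentralIsolation n s f U ∧ JacobianEq n s f U := by
  have h3 := eventually_fderiv_eq_zero_of_afCondition hU h0U h0 hG hA
  obtain ⟨W, V, φ, hWo, h0W, -, -, -, -, -, hφ0, hS⟩ := hG
  obtain ⟨W', hW', hW'o, h0W'⟩ := mem_nhds_iff.1 (Filter.inter_mem (hU.mem_nhds h0U) h3)
  refine ⟨⟨W ∩ W', hWo.inter hW'o, ⟨h0W, h0W'⟩, fun z hz hz1 hz2 => ?_⟩,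
    W', hW'o, h0W', fun z hz => (hW' hz).1, ?_⟩
  · have : z ∈ SigmaF n s f U ∩ W :=
      ⟨⟨hz.1, (hW' hz.2.2).2 (partialsVanish_iff.1 hz2)⟩, hz.2.1⟩
    rw [hS] at this
    obtain ⟨a, -, rfl⟩ := this
    obtain rfl : a = 0 := hz1
    exact Prod.ext rfl hφ0
  · ext z
    refine ⟨fun hz => ⟨hz.2, fun j => by rw [hz.1.2]; rfl⟩, fun hz => ⟨⟨(hW' hz.1).1, ?_⟩, hz.1⟩⟩
    exact (hW' hz.1).2 (partialsVanish_iff.1 hz.2)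

end CriticalLocus

/- STATEMENT 5: (central isolation ∧ Jacobian set equality near 0) holds if and
only if (Σf is a graph over ℂ^s near 0 ∧ the a_f condition holds near 0). -/
theorem stmt_5 (n s : ℕ) (hn : 1 ≤ n) (hs : s ≤ n)
    (U : Set (Csp n s)) (hU : IsOpen U) (h0U : (0 : Csp n s) ∈ U)
    (f : Csp n s → ℂ) (hf : ∀ z ∈ U, AnalyticAt ℂ f z)
    (h0crit : (0 : Csp n s) ∈ SigmaF n s f U) :
    (CentralIsolation n s f U ∧ JacobianEq n s f U) ↔
      (GraphForm n s f U ∧ AfCondition n s f U) := by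
  exact ⟨fun h => graphForm_and_afCondition hs hU h0U hf h0crit h.1 h.2,
    fun h => centralIsolation_and_jacobianEq hU h0U h0crit h.1 h.2⟩
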